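/- Let m, n be non-negative integers. Every simple strong Harish-Chandra module over the Lie superalgebra W(m+1,n) is either (1) a quotient of a tensor module T(V,λ) corresponding to a simple finite-dimensional gl(m+1,n)-module V and λ ∈ ℂ^{m+1}, or (2) a module of highest weight type L(T)^θ, twisted by an automorphism θ ∈ GL_{m+1}(ℤ), where T is a simple quotient of a tensor module for W(m,n) ⋉ A d_0. -/

import Mathlib

open scoped BigOperators

namespace WSuper

noncomputable section

/-- Exponents of the Laurent (even) variables `t_1, …, t_m`. -/
abbrev LExp (m : ℕ) := Fin m → ℤ
/-- Exponents of the Grassmann (odd) variables `ξ_1, …, ξ_n`. -/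
abbrev GExp (n : ℕ) := Fin n → Bool

variable {m n : ℕ}

/-- Degree of a Grassmann monomial `ξ^s`. -/
def gdeg (s : GExp n) : ℕ := (Finset.univ.filter fun a => s a = true).card

/-- Number of inversions between `ξ^s` and `ξ^q`. -/
def invCount (s q : GExp n) : ℕ :=
  ((Finset.univ ×ˢ Finset.univ).filter
    fun p : Fin n × Fin n => s p.1 = true ∧ q p.2 = true ∧ p.2 < p.1).card

/-- The scalar `c` with `ξ^s · ξ^q = c · ξ^(s xor q)` in the exterior algebra. -/
def mulSgn (s q : GExp n) : ℂ :=
  if ∃ a, s a = true ∧ q a = true then 0 else (-1 : ℂ) ^ invCount s q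

/-- Exponent of the product of two (disjoint) Grassmann monomials. -/
def xorE (s q : GExp n) : GExp n := fun a => Bool.xor (s a) (q a)

/-- The scalar `c` with `∂_a (ξ^s) = c ξ^(s \ a)`. -/
def derC (a : Fin n) (s : GExp n) : ℂ :=
  if s a = true then (-1 : ℂ) ^ (Finset.univ.filter fun x => s x = true ∧ x < a).card else 0

/-- The exponent of `∂_a (ξ^s)`. -/
def derE (a : Fin n) (s : GExp n) : GExp n := Function.update s a false

/-- Directions: `d_i = t_i ∂/∂t_i`, `∂_α = ∂/∂ξ_α`, and (when `b = true`) the extra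
even direction `d_0` of `W(m,n) ⋉ A d_0`. -/
inductive Dir (m n : ℕ) : Bool → Type where
  | di {b : Bool} (i : Fin m) : Dir m n b
  | pa {b : Bool} (a : Fin n) : Dir m n b
  | d0 : Dir m n true

/-- The basis `t^r ξ^s D` of `W(m,n)` (for `b = false`) resp. of `W(m,n) ⋉ A d_0`
(for `b = true`). -/
abbrev WBasis (m n : ℕ) (b : Bool) := LExp m × GExp n × Dir m n b

/-- The Lie superalgebra `W(m,n)` (`b = false`) resp. `W(m,n) ⋉ A d_0` (`b = true`),
as the free complex vector space on its standard basis. -/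
abbrev W (m n : ℕ) (b : Bool) := WBasis m n b →₀ ℂ

def sng {b : Bool} (x : WBasis m n b) : W m n b := Finsupp.single x 1

/-- Parity (0 = even, 1 = odd) of a basis element. -/
def par {b : Bool} : WBasis m n b → ℕ
  | ⟨_, s, .di _⟩ => gdeg s % 2
  | ⟨_, s, .pa _⟩ => (gdeg s + 1) % 2
  | ⟨_, s, .d0⟩ => gdeg s % 2

/-- The super Lie bracket of `W(m,n)` (resp. `W(m,n) ⋉ A d_0`) on basis elements. -/
def brB {b : Bool} : WBasis m n b → WBasis m n b → W m n b
  | ⟨r, s, .di i⟩, ⟨p, q, .di j⟩ =>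
      ((p i : ℂ) * mulSgn s q) • sng ⟨r + p, xorE s q, .di j⟩
        - ((r j : ℂ) * mulSgn s q) • sng ⟨r + p, xorE s q, .di i⟩
  | ⟨r, s, .di i⟩, ⟨p, q, .pa β⟩ =>
      ((p i : ℂ) * mulSgn s q) • sng ⟨r + p, xorE s q, .pa β⟩
        - ((-1 : ℂ) ^ (gdeg s * (gdeg q + 1)) * derC β s * mulSgn q (derE β s)) •
            sng ⟨r + p, xorE q (derE β s), .di i⟩
  | ⟨r, s, .pa α⟩, ⟨p, q, .di j⟩ =>
      (derC α q * mulSgn s (derE α q)) • sng ⟨r + p, xorE s (derE α q), .di j⟩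
        - ((-1 : ℂ) ^ ((gdeg s + 1) * gdeg q) * (r j : ℂ) * mulSgn q s) •
            sng ⟨r + p, xorE q s, .pa α⟩
  | ⟨r, s, .pa α⟩, ⟨p, q, .pa β⟩ =>
      (derC α q * mulSgn s (derE α q)) • sng ⟨r + p, xorE s (derE α q), .pa β⟩
        - ((-1 : ℂ) ^ ((gdeg s + 1) * (gdeg q + 1)) * derC β s * mulSgn q (derE β s)) •
            sng ⟨r + p, xorE q (derE β s), .pa α⟩
  | ⟨r, s, .di i⟩, ⟨p, q, .d0⟩ =>
      ((p i : ℂ) * mulSgn s q) • sng ⟨r + p, xorE s q, .d0⟩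
  | ⟨r, s, .pa α⟩, ⟨p, q, .d0⟩ =>
      (derC α q * mulSgn s (derE α q)) • sng ⟨r + p, xorE s (derE α q), .d0⟩
  | ⟨r, s, .d0⟩, ⟨p, q, .di j⟩ =>
      (-(r j : ℂ) * mulSgn s q) • sng ⟨r + p, xorE s q, .d0⟩
  | ⟨r, s, .d0⟩, ⟨p, q, .pa β⟩ =>
      (-(-1 : ℂ) ^ (gdeg s * (gdeg q + 1)) * derC β s * mulSgn q (derE β s)) •
          sng ⟨r + p, xorE q (derE β s), .d0⟩
  | ⟨_, _, .d0⟩, ⟨_, _, .d0⟩ => 0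

/-- A module over the Lie superalgebra `W(m,n)` (resp. `W(m,n) ⋉ A d_0`):
a complex vector space with a linear action satisfying the super commutator rule. -/
structure WRep (m n : ℕ) (b : Bool) where
  M : Type
  [addgrp : AddCommGroup M]
  [mods : Module ℂ M]
  act : W m n b →ₗ[ℂ] M →ₗ[ℂ] M
  super : ∀ x y : WBasis m n b,
    act (brB x y)
      = act (sng x) ∘ₗ act (sng y)
        - ((-1 : ℂ) ^ (par x * par y)) • (act (sng y) ∘ₗ act (sng x))

attribute [instance] WRep.addgrp WRep.mods

/-- A raw action of (the basis of) `W(m,n)` resp. `W(m,n) ⋉ A d_0` on a vector space. -/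
abbrev GAct (m n : ℕ) (b : Bool) (M : Type) [AddCommGroup M] [Module ℂ M] :=
  WBasis m n b → M →ₗ[ℂ] M

/-- Index set for the Cartan subalgebra `h'`: the elements `d_1, …, d_m`,
together with `d_0` when `b = true`. -/
abbrev HIdx (m : ℕ) (b : Bool) := Fin m ⊕ Fin (cond b 1 0)

def hB (m n : ℕ) (b : Bool) : HIdx m b → WBasis m n b :=
  fun h => match b, h with
    | _, .inl i => ⟨0, fun _ => false, .di i⟩
    | true, .inr _ => ⟨0, fun _ => false, .d0⟩
    | false, .inr j => j.elim0

/-- The basis element `ξ_a ∂_a` of the odd Cartan subalgebra `h''`. -/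
def hppB (m n : ℕ) (b : Bool) (a : Fin n) : WBasis m n b :=
  ⟨0, fun x => decide (x = a), .pa a⟩

section Predicates

variable {M : Type} [AddCommGroup M] [Module ℂ M] {b : Bool}

/-- Weight space with respect to the even Cartan subalgebra `h'`. -/
def wtG (F : GAct m n b M) (lam : HIdx m b → ℂ) : Submodule ℂ M :=
  ⨅ h, LinearMap.ker (F (hB m n b h) - lam h • (LinearMap.id : M →ₗ[ℂ] M))

/-- Weight space with respect to the full Cartan subalgebra `h = h' ⊕ h''`. -/
def wtFullG (F : GAct m n b M) (lam : HIdx m b → ℂ) (mu : Fin n → ℂ) : Submodule ℂ M :=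
  wtG F lam ⊓
    ⨅ a, LinearMap.ker (F (hppB m n b a) - mu a • (LinearMap.id : M →ₗ[ℂ] M))

/-- Strong Harish-Chandra module: weight decomposition with respect to `h'`
with finite-dimensional weight spaces. -/
def IsStrongHCG (F : GAct m n b M) : Prop :=
  (⨆ lam, wtG F lam) = ⊤ ∧ ∀ lam, FiniteDimensional ℂ (wtG F lam)

/-- Harish-Chandra module: weight decomposition with respect to `h`
with finite-dimensional weight spaces. -/
def IsHCG (F : GAct m n b M) : Prop :=
  (⨆ lam, ⨆ mu, wtFullG F lam mu) = ⊤ ∧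
    ∀ lam mu, FiniteDimensional ℂ (wtFullG F lam mu)

/-- Strongly cuspidal: strong Harish-Chandra with uniformly bounded multiplicities. -/
def IsStronglyCuspidalG (F : GAct m n b M) : Prop :=
  IsStrongHCG F ∧ ∃ C : ℕ, ∀ lam, Module.finrank ℂ (wtG F lam) ≤ C

/-- Cuspidal: Harish-Chandra with uniformly bounded weight multiplicities. -/
def IsCuspidalG (F : GAct m n b M) : Prop :=
  IsHCG F ∧ ∃ C : ℕ, ∀ lam mu, Module.finrank ℂ (wtFullG F lam mu) ≤ C

/-- The action of the odd Cartan subalgebra `h''` is diagonalizable. -/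
def DiagHppG (F : GAct m n b M) : Prop :=
  (⨆ mu : Fin n → ℂ,
    ⨅ a, LinearMap.ker (F (hppB m n b a) - mu a • (LinearMap.id : M →ₗ[ℂ] M))) = ⊤

def InvariantG (F : GAct m n b M) (N : Submodule ℂ M) : Prop :=
  ∀ x : WBasis m n b, ∀ v ∈ N, F x v ∈ N

/-- Simplicity of a module, phrased via invariant subspaces. -/
def IsSimpleG (F : GAct m n b M) : Prop :=
  (∃ v : M, v ≠ 0) ∧ ∀ N : Submodule ℂ M, InvariantG F N → N = ⊥ ∨ N = ⊤

end Predicates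

/-- The action of basis elements attached to a representation. -/
def WRep.g {b : Bool} (ρ : WRep m n b) : GAct m n b ρ.M := fun x => ρ.act (sng x)

end

end WSuper

namespace WSuper

noncomputable section

variable {m n : ℕ}

/-- Basis monomials `t^r ξ^s` of the supercommutative superalgebra `A = R_m ⊗ Λ`. -/
abbrev ABasis (m n : ℕ) := LExp m × GExp n

/-- The supercommutative superalgebra `A = R_m ⊗ Λ` as the free complex vector
space on its monomial basis. -/
abbrev AAlg (m n : ℕ) := ABasis m n →₀ ℂ

def asng (x : ABasis m n) : AAlg m n := Finsupp.single x 1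

def aone (m n : ℕ) : AAlg m n := asng (0, fun _ => false)

/-- Product of two monomials of `A`. -/
def amulB (x y : ABasis m n) : AAlg m n :=
  mulSgn x.2 y.2 • asng (x.1 + y.1, xorE x.2 y.2)

/-- Parity of a monomial of `A`. -/
def apar (x : ABasis m n) : ℕ := gdeg x.2 % 2

/-- The action of a basis element of `W(m,n)` (resp. `W(m,n) ⋉ A d_0`) on a
monomial of `A` by superderivations (`d_0` acts by zero on `A`). -/
def wOnA {b : Bool} : WBasis m n b → ABasis m n → AAlg m n
  | ⟨r, s, .di i⟩, ⟨p, q⟩ => ((p i : ℂ) * mulSgn s q) • asng (r + p, xorE s q)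
  | ⟨r, s, .pa α⟩, ⟨p, q⟩ =>
      (derC α q * mulSgn s (derE α q)) • asng (r + p, xorE s (derE α q))
  | ⟨_, _, .d0⟩, _ => 0

/-- An `AV`-module: compatible actions of the superalgebra `A` and of the Lie
superalgebra `V = W(m,n)` (resp. `W(m,n) ⋉ A d_0`), satisfying the Leibniz rule. -/
structure AVRep (m n : ℕ) (b : Bool) extends WRep m n b where
  aact : AAlg m n →ₗ[ℂ] M →ₗ[ℂ] M
  aact_one : aact (aone m n) = LinearMap.id
  aact_mul : ∀ x y : ABasis m n, aact (amulB x y) = aact (asng x) ∘ₗ aact (asng y)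
  leibniz : ∀ (x : WBasis m n b) (f : ABasis m n),
    act (sng x) ∘ₗ aact (asng f)
      = aact (wOnA x f)
        + ((-1 : ℂ) ^ (par x * apar f)) • (aact (asng f) ∘ₗ act (sng x))

/-- `M` is finitely generated as an `A`-module. -/
def IsFiniteRank {b : Bool} (ρ : AVRep m n b) : Prop :=
  ∃ S : Finset ρ.M,
    Submodule.span ℂ {v : ρ.M | ∃ f : ABasis m n, ∃ s ∈ S, v = ρ.aact (asng f) s} = ⊤

/-- A subspace invariant under both the `A`-action and the `V`-action. -/
def AVInvariant {b : Bool} (ρ : AVRep m n b) (N : Submodule ℂ ρ.M) : Prop :=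
  InvariantG ρ.g N ∧ ∀ f : ABasis m n, ∀ v ∈ N, ρ.aact (asng f) v ∈ N

/-- Irreducibility as an `AV`-module. -/
def AVIsSimple {b : Bool} (ρ : AVRep m n b) : Prop :=
  (∃ v : ρ.M, v ≠ 0) ∧ ∀ N : Submodule ℂ ρ.M, AVInvariant ρ N → N = ⊥ ∨ N = ⊤

/-- A weight module: weight decomposition with respect to `h'`. -/
def IsWeightG {M : Type} [AddCommGroup M] [Module ℂ M] {b : Bool}
    (F : GAct m n b M) : Prop :=
  (⨆ lam, wtG F lam) = ⊤

end

end WSuper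

namespace WSuper

noncomputable section

variable {m n : ℕ}

/-- Index set for the standard basis `e_{xy}` of `gl(m,n)`. -/
abbrev GlIdx (m n : ℕ) := Fin m ⊕ Fin n

/-- Parity of an index of `gl(m,n)`. -/
def gpar : GlIdx m n → ℕ
  | .inl _ => 0
  | .inr _ => 1

/-- A module over the Lie superalgebra `gl(m,n)`, given by the action of the
standard basis elements `e_{xy}` subject to the super commutator relations. -/
structure GlRep (m n : ℕ) where
  V : Type
  [addgrp : AddCommGroup V]
  [mods : Module ℂ V]
  ρ : GlIdx m n → GlIdx m n → Module.End ℂ V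
  rel : ∀ x y z w : GlIdx m n,
    ρ x y * ρ z w
        - ((-1 : ℂ) ^ ((gpar x + gpar y) * (gpar z + gpar w))) • (ρ z w * ρ x y)
      = (if y = z then ρ x w else 0)
        - ((-1 : ℂ) ^ ((gpar x + gpar y) * (gpar z + gpar w))) •
            (if w = x then ρ z y else 0)

attribute [instance] GlRep.addgrp GlRep.mods

/-- Irreducibility of a `gl(m,n)`-module. -/
def GlRep.IsSimple (σ : GlRep m n) : Prop :=
  (∃ v : σ.V, v ≠ 0) ∧
    ∀ N : Submodule ℂ σ.V, (∀ x y, ∀ v ∈ N, σ.ρ x y v ∈ N) → N = ⊥ ∨ N = ⊤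

/-- The carrier `A ⊗ V` of a tensor module. -/
abbrev TModule (σ : GlRep m n) := ABasis m n →₀ σ.V

/-- The action of `W(m,n)` (resp. `W(m,n) ⋉ A d_0`, where `f d_0` acts as
multiplication by `λ_0 f`) on the tensor module `T(V, λ) = A ⊗ V`:
`(t^s f d_j)(t^r g ⊗ v) = (r_j + λ_j) t^{r+s} f g ⊗ v
  + Σ_i s_i t^{r+s} f ⊗ ρ(e_{ij}) g·v + Σ_α t^{r+s} (f)∂*_α ⊗ ρ(e_{αj}) g·v`,
`(t^s f ∂_β)(t^r g ⊗ v) = t^{r+s} f (∂g/∂ξ_β) ⊗ v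
  + Σ_i s_i t^{r+s} f ⊗ ρ(e_{iβ}) g·v + Σ_α t^{r+s} (f)∂*_α ⊗ ρ(e_{αβ}) g·v`,
with `(f)∂*_α = (−1)^{|f|+1} ∂_α(f)` and the usual Koszul signs for applying an
operator `a ⊗ ρ(e)` with `e` odd to `g ⊗ v`. -/
def tmAct (σ : GlRep m n) (lam : Fin m → ℂ) (lam0 : ℂ) {b : Bool} :
    WBasis m n b → TModule σ → TModule σ
  | ⟨s, f, .di j⟩, u => u.sum fun rc v =>
      ((((rc.1 j : ℂ) + lam j) * mulSgn f rc.2) •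
          Finsupp.single (rc.1 + s, xorE f rc.2) v)
      + (∑ i : Fin m, ((s i : ℂ) * mulSgn f rc.2) •
          Finsupp.single (rc.1 + s, xorE f rc.2) (σ.ρ (.inl i) (.inl j) v))
      + (∑ α : Fin n,
          ((-1 : ℂ) ^ gdeg rc.2 * ((-1 : ℂ) ^ (gdeg f + 1) * derC α f) *
              mulSgn (derE α f) rc.2) •
            Finsupp.single (rc.1 + s, xorE (derE α f) rc.2) (σ.ρ (.inr α) (.inl j) v))
  | ⟨s, f, .pa β⟩, u => u.sum fun rc v =>
      ((derC β rc.2 * mulSgn f (derE β rc.2)) •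
          Finsupp.single (rc.1 + s, xorE f (derE β rc.2)) v)
      + (∑ i : Fin m, ((-1 : ℂ) ^ gdeg rc.2 * (s i : ℂ) * mulSgn f rc.2) •
          Finsupp.single (rc.1 + s, xorE f rc.2) (σ.ρ (.inl i) (.inr β) v))
      + (∑ α : Fin n,
          (((-1 : ℂ) ^ (gdeg f + 1) * derC α f) * mulSgn (derE α f) rc.2) •
            Finsupp.single (rc.1 + s, xorE (derE α f) rc.2) (σ.ρ (.inr α) (.inr β) v))
  | ⟨s, f, .d0⟩, u => u.sum fun rc v =>
      (lam0 * mulSgn f rc.2) • Finsupp.single (rc.1 + s, xorE f rc.2) v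

/-- The action of `A` on the tensor module `A ⊗ V` by multiplication on the
left tensor factor. -/
def tmA {σ : GlRep m n} (x : ABasis m n) (u : TModule σ) : TModule σ :=
  u.sum fun rc v => mulSgn x.2 rc.2 • Finsupp.single (x.1 + rc.1, xorE x.2 rc.2) v

end

end WSuper

namespace WSuper

noncomputable section

variable {m n : ℕ}

/-- The automorphism of `W(m+1,n)` (here: of `W(m,n)` with `m` arbitrary) induced by
`θ ∈ GL_m(ℤ)` via `θ(t^s) = t^{θ s}`, on basis elements:
`θ(t^r ξ^s d_i) = Σ_j (θ⁻¹)_{ij} t^{θ r} ξ^s d_j`, `θ(t^r ξ^s ∂_a) = t^{θ r} ξ^s ∂_a`. -/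
def twB (θ : Matrix.GeneralLinearGroup (Fin m) ℤ) :
    WBasis m n false → W m n false
  | ⟨r, s, .di i⟩ =>
      ∑ j : Fin m, ((((θ⁻¹ : Matrix.GeneralLinearGroup (Fin m) ℤ) : Matrix (Fin m) (Fin m) ℤ) i j : ℂ)) •
        sng ⟨(θ : Matrix (Fin m) (Fin m) ℤ).mulVec r, s, .di j⟩
  | ⟨r, s, .pa a⟩ => sng ⟨(θ : Matrix (Fin m) (Fin m) ℤ).mulVec r, s, .pa a⟩

/-- Linear extension of the twist to all of `W`. -/
def twL (θ : Matrix.GeneralLinearGroup (Fin m) ℤ) (w : W m n false) : W m n false :=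
  w.sum fun x c => c • twB θ x

/-- The embedding of (the basis of) `V_0 = W(m,n) ⋉ A d_0` into `W(m+1,n)` as the
zero component of the `ℤ`-grading by `ad(d_0)`-eigenvalues (index `0` plays the
role of `t_0`). -/
def embB : WBasis m n true → WBasis (m + 1) n false
  | ⟨r, s, .di i⟩ => ⟨Fin.cons 0 r, s, .di i.succ⟩
  | ⟨r, s, .pa a⟩ => ⟨Fin.cons 0 r, s, .pa a⟩
  | ⟨r, s, .d0⟩ => ⟨Fin.cons 0 r, s, .di 0⟩

end

end WSuper

namespace WSuper

noncomputable section

/-- The subspace of singular vectors of the twisted module `M^θ`: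
the joint kernel of the twisted action of
`V_+ = {elements of W(m+1,n) of positive ad(d_0)-degree}`. -/
def singularSp {m n : ℕ} (ρ : WRep (m + 1) n false)
    (θ : Matrix.GeneralLinearGroup (Fin (m + 1)) ℤ) : Submodule ℂ ρ.M :=
  ⨅ x ∈ {x : WBasis (m + 1) n false | 0 < x.1 0},
    LinearMap.ker (ρ.act (twB θ x))

end

noncomputable section

section Shift
variable {G G' : Type} [AddCommGroup G] [AddCommGroup G']
variable {M M' : Type} [AddCommGroup M] [Module ℂ M] [AddCommGroup M'] [Module ℂ M']

/-- The group algebra acting on functions on the group by shifts. -/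
def sh (G M : Type) [AddCommGroup G] [AddCommGroup M] [Module ℂ M] :
    AddMonoidAlgebra ℂ G →ₐ[ℂ] Module.End ℂ (G → M) :=
  AddMonoidAlgebra.lift ℂ _ _
    { toFun := fun g => LinearMap.funLeft ℂ M (fun x => x + g.toAdd)
      map_one' := by ext; simp [LinearMap.funLeft]
      map_mul' := by
        intro a b; ext F x
        simp [LinearMap.funLeft]; congr 1; abel }

/-- The group element `g` in the group algebra. -/
def sg (g : G) : AddMonoidAlgebra ℂ G := AddMonoidAlgebra.single g 1

lemma sh_sg (g : G) (F : G → M) (x : G) : sh G M (sg g) F x = F (x + g) := by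
  simp [sh, sg, LinearMap.funLeft]

lemma sg_add (g h : G) : sg (g + h) = sg g * sg h := by
  simp [sg, AddMonoidAlgebra.single_mul_single]

lemma sg_zero : sg (0 : G) = 1 := rfl

/-- The map of group algebras induced by a homomorphism. -/
def mapG (φ : G →+ G') : AddMonoidAlgebra ℂ G →ₐ[ℂ] AddMonoidAlgebra ℂ G' :=
  AddMonoidAlgebra.mapDomainAlgHom ℂ ℂ φ

lemma mapG_sg (φ : G →+ G') (g : G) : mapG φ (sg g) = sg (φ g) := by
  simp [mapG, sg]

lemma ga_induction {P : AddMonoidAlgebra ℂ G → Prop} (p : AddMonoidAlgebra ℂ G)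
    (h1 : ∀ g, P (sg g)) (h2 : ∀ p q, P p → P q → P (p + q)) (h3 : ∀ (c : ℂ) p, P p → P (c • p)) :
    P p := by
  induction p using AddMonoidAlgebra.induction_on with
  | of g => exact h1 _
  | add f g hf hg => exact h2 _ _ hf hg
  | smul r f hf => exact h3 _ _ hf

lemma sh_slice (ι : G' →+ G) (p : AddMonoidAlgebra ℂ G') (F : G → M) (q : G' → M')
    (L : M' →ₗ[ℂ] M) (x : G) (z : G') (h : ∀ y, F (x + ι y) = L (q (z + y))) :
    sh G M (mapG ι p) F x = L (sh G' M' p q z) := by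
  induction p using ga_induction with
  | h1 g => rw [mapG_sg, sh_sg, sh_sg, h]
  | h2 p q hp hq => simp [hp, hq]
  | h3 c p hp => simp [hp]

lemma sh_comp (φ : G →+ G') (p : AddMonoidAlgebra ℂ G) (q : G' → M) :
    sh G M p (fun x => q (φ x)) = fun x => sh G' M (mapG φ p) q (φ x) := by
  induction p using ga_induction with
  | h1 g => ext x; simp [mapG_sg, sh_sg]
  | h2 p q hp hq => ext x; simp [hp, hq]
  | h3 c p hp => ext x; simp [hp]

lemma sh_mem (S : Submodule ℂ M) (p : AddMonoidAlgebra ℂ G) (F : G → M) (h : ∀ x, F x ∈ S) (x : G) :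
    sh G M p F x ∈ S := by
  induction p using ga_induction with
  | h1 g => rw [sh_sg]; exact h _
  | h2 p q hp hq => simpa using S.add_mem hp hq
  | h3 c p hp => simpa using S.smul_mem _ hp

lemma sh_lin (L : M →ₗ[ℂ] M') (p : AddMonoidAlgebra ℂ G) (F : G → M) (x : G) :
    sh G M' p (fun y => L (F y)) x = L (sh G M p F x) := by
  induction p using ga_induction with
  | h1 g => rw [sh_sg, sh_sg]
  | h2 p q hp hq => simp [hp, hq]
  | h3 c p hp => simp [hp]

lemma sh_mul_zero (p q : AddMonoidAlgebra ℂ G) (F : G → M) (h : sh G M q F = 0) :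
    sh G M (p * q) F = 0 := by
  rw [map_mul, Module.End.mul_apply, h, map_zero]

lemma sh_dvd_zero {p q : AddMonoidAlgebra ℂ G} {F : G → M} (h : sh G M q F = 0) (hd : q ∣ p) :
    sh G M p F = 0 := by
  obtain ⟨r, rfl⟩ := hd
  rw [mul_comm]; exact sh_mul_zero _ _ _ h

end Shift
end

noncomputable section

section Extension
variable {M : Type} [AddCommGroup M] [Module ℂ M]

/-- The quadratic function `(x, y) ↦ e_x e_y v`. -/
def quad (e : ℤ → Module.End ℂ M) (v : M) : ℤ × ℤ → M := fun p => e p.1 (e p.2 v)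

/-- The difference operator `σ₂ - σ₁`. -/
def dl : AddMonoidAlgebra ℂ (ℤ × ℤ) := sg (0, 1) - sg (1, 0)

variable {e : ℤ → Module.End ℂ M}

section four
abbrev Z4 := ℤ × ℤ × ℤ × ℤ
abbrev Z3 := ℤ × ℤ × ℤ
def i12 : ℤ × ℤ →+ Z4 := ⟨⟨fun p => (p.1, p.2, 0, 0), rfl⟩, by intros; simp⟩
def i34 : ℤ × ℤ →+ Z4 := ⟨⟨fun p => (0, 0, p.1, p.2), rfl⟩, by intros; ext <;> simp⟩
def sw : Z4 →+ Z4 := ⟨⟨fun p => (p.1, p.2.2.1, p.2.1, p.2.2.2), rfl⟩, by intros; simp⟩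
def c23 : Z4 →+ Z3 :=
  ⟨⟨fun p => (p.1, p.2.1 + p.2.2.1, p.2.2.2), rfl⟩, by intros; simp; ring⟩
def s13 : Z3 →+ Z3 := ⟨⟨fun p => (p.2.2, p.2.1, p.1), rfl⟩, by intros; simp⟩
def a12 : Z3 →+ ℤ × ℤ := ⟨⟨fun p => (p.1 + p.2.1, p.2.2), rfl⟩, by intros; simp; ring⟩
def a23 : Z3 →+ ℤ × ℤ := ⟨⟨fun p => (p.2.1 + p.2.2, p.1), rfl⟩, by intros; simp; ring⟩
def a13 : Z3 →+ ℤ × ℤ := ⟨⟨fun p => (p.2.1, p.1 + p.2.2), rfl⟩, by intros; simp; ring⟩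

lemma shift_sub_eq {G : Type} [AddCommGroup G] (g h : G) (F : G → M) :
    sh G M (sg g - sg h) F = fun x => F (x + g) - F (x + h) := by
  ext x; simp [sh_sg]

lemma ext_four {m : ℕ} {A B : ℤ → Submodule ℂ M}
    (hAB : ∀ k, ∀ v ∈ A k, ∀ x, sh _ M (dl ^ m) (quad e v) x ∈ B (k + x.1 + x.2 + m))
    (hB : ∀ k, ∀ v ∈ B k, sh _ M (dl ^ m) (quad e v) = 0) (k : ℤ) (v : M) (hv : v ∈ A k) :
    sh Z4 M (mapG i12 (dl ^ m) * mapG i34 (dl ^ m))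
      (fun x => e x.1 (e x.2.1 (e x.2.2.1 (e x.2.2.2 v)))) = 0 := by
  ext x
  rw [map_mul, Module.End.mul_apply]
  set F : Z4 → M := fun x => e x.1 (e x.2.1 (e x.2.2.1 (e x.2.2.2 v)))
  have h1 : ∀ y, sh Z4 M (mapG i34 (dl ^ m)) F y
      = (e y.1 * e y.2.1) (sh _ M (dl ^ m) (quad e v) (y.2.2.1, y.2.2.2)) := by
    intro y
    exact sh_slice i34 _ F (quad e v) (e y.1 * e y.2.1) y _ (by intro z; simp [F, quad, i34])
  have h2 := sh_slice i12 (dl ^ m) (sh Z4 M (mapG i34 (dl ^ m)) F)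
    (quad e (sh _ M (dl ^ m) (quad e v) (x.2.2.1, x.2.2.2))) LinearMap.id x (x.1, x.2.1)
    (by intro z; rw [h1]; simp [quad, i12])
  rw [h2, hB _ _ (hAB _ v hv _)]
  rfl

lemma extension {m : ℕ} (hm : 1 ≤ m)
    (comm : ∀ x y, e x * e y - e y * e x = ((y : ℂ) - x) • e (x + y))
    {A B : ℤ → Submodule ℂ M}
    (hAB : ∀ k, ∀ v ∈ A k, ∀ x, sh _ M (dl ^ m) (quad e v) x ∈ B (k + x.1 + x.2 + m))
    (hB : ∀ k, ∀ v ∈ B k, sh _ M (dl ^ m) (quad e v) = 0) (k : ℤ) (v : M) (hv : v ∈ A k) :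
    sh _ M (dl ^ (4 * m)) (quad e v) = 0 := by
  have hc : ∀ x y w, e x (e y w) = e y (e x w) + ((y : ℂ) - x) • e (x + y) w := by
    intro x y w
    have := LinearMap.congr_fun (comm x y) w
    simp only [LinearMap.sub_apply, Module.End.mul_apply, LinearMap.smul_apply] at this
    rw [← this]; abel
  set F : Z4 → M := fun x => e x.1 (e x.2.1 (e x.2.2.1 (e x.2.2.2 v))) with hF
  have hF0 := ext_four hAB hB k v hv
  rw [← hF] at hF0
  set s1 : AddMonoidAlgebra ℂ Z4 := sg (1, 0, 0, 0) with hs1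
  set s2 : AddMonoidAlgebra ℂ Z4 := sg (0, 1, 0, 0) with hs2
  set s3 : AddMonoidAlgebra ℂ Z4 := sg (0, 0, 1, 0) with hs3
  set s4 : AddMonoidAlgebra ℂ Z4 := sg (0, 0, 0, 1) with hs4
  have e12 : mapG i12 dl = s2 - s1 := by simp [dl, mapG_sg, i12, hs1, hs2]
  have e34 : mapG i34 dl = s4 - s3 := by simp [dl, mapG_sg, i34, hs3, hs4]
  rw [map_pow, map_pow, e12, e34] at hF0
  have hsw1 : mapG sw s1 = s1 := by simp [mapG_sg, sw, hs1]
  have hsw2 : mapG sw s2 = s3 := by simp [mapG_sg, sw, hs2, hs3]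
  have hsw3 : mapG sw s3 = s2 := by simp [mapG_sg, sw, hs2, hs3]
  have hsw4 : mapG sw s4 = s4 := by simp [mapG_sg, sw, hs4]
  have hF1 : sh Z4 M ((s3 - s1) ^ m * (s4 - s2) ^ m) (fun x => F (sw x)) = 0 := by
    rw [sh_comp]
    simp only [map_mul, map_pow, map_sub, hsw1, hsw2, hsw3, hsw4]
    simp only [map_mul, map_pow, map_sub] at hF0
    rw [hF0]; rfl
  set c : Z3 → M := fun y => e y.1 (e y.2.1 (e y.2.2 v)) with hcdef
  set D : AddMonoidAlgebra ℂ Z4 :=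
    (s2 - s1) ^ m * (s4 - s3) ^ m * ((s3 - s1) ^ m * (s4 - s2) ^ m) with hD
  have hD0 : sh Z4 M D (F - fun x => F (sw x)) = 0 := by
    rw [map_sub, sh_dvd_zero hF0 (Dvd.intro _ rfl), sh_dvd_zero hF1 (Dvd.intro_left _ rfl), sub_zero]
  have hD1 : sh Z4 M D (fun x => (2 : ℂ) • (fun y : Z3 => c (y + (0, 1, 0))) (c23 x)) = 0 := by
    have : (fun x => (2 : ℂ) • (fun y : Z3 => c (y + (0, 1, 0))) (c23 x))
        = sh Z4 M (s3 - s2) (F - fun x => F (sw x)) := by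
      rw [hs3, hs2, shift_sub_eq]
      ext x
      obtain ⟨x1, x2, x3, x4⟩ := x
      simp only [hF, hcdef, c23, sw, Pi.sub_apply, AddMonoidHom.coe_mk, ZeroHom.coe_mk,
        Prod.mk_add_mk, add_zero]
      rw [hc x2 (x3 + 1), hc (x2 + 1) x3, show x2 + (x3 + 1) = x2 + x3 + 1 by ring,
        show x2 + 1 + x3 = x2 + x3 + 1 by ring]
      simp only [map_add, map_smul]
      push_cast
      module
    rw [this, ← Module.End.mul_apply, ← map_mul, mul_comm]
    exact sh_mul_zero _ _ _ hD0
  set t1 : AddMonoidAlgebra ℂ Z3 := sg (1, 0, 0) with ht1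
  set t2 : AddMonoidAlgebra ℂ Z3 := sg (0, 1, 0) with ht2
  set t3 : AddMonoidAlgebra ℂ Z3 := sg (0, 0, 1) with ht3
  set E : AddMonoidAlgebra ℂ Z3 := (t2 - t1) ^ (2 * m) * (t3 - t2) ^ (2 * m) with hE
  have hED : mapG c23 D = E := by
    have q1 : mapG c23 s1 = t1 := by simp [mapG_sg, c23, hs1, ht1]
    have q2 : mapG c23 s2 = t2 := by simp [mapG_sg, c23, hs2, ht2]
    have q3 : mapG c23 s3 = t2 := by simp [mapG_sg, c23, hs3, ht2]
    have q4 : mapG c23 s4 = t3 := by simp [mapG_sg, c23, hs4, ht3]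
    simp only [hD, map_mul, map_pow, map_sub, q1, q2, q3, q4, hE]
    ring
  have hEc : sh Z3 M E c = 0 := by
    have h1 : sh Z4 M D (fun x => (sh Z3 M ((2 : ℂ) • t2) c) (c23 x)) = 0 := by
      rw [← hD1]; congr 1; ext x; simp [ht2, sh_sg]
    rw [sh_comp, hED] at h1
    have h2 : sh Z3 M (E * (2 : ℂ) • t2) c = 0 := by
      rw [map_mul, Module.End.mul_apply]
      ext y
      have := congrFun h1 (y.1, 0, y.2.1, y.2.2)
      simpa [c23] using this
    have h3 : E = ((1 / 2 : ℂ) • sg ((0, -1, 0) : Z3)) * (E * (2 : ℂ) • t2) := by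
      have : sg ((0, -1, 0) : Z3) * t2 = 1 := by
        rw [ht2, ← sg_add, ← sg_zero]; simp; rfl
      calc E = E * (sg ((0, -1, 0) : Z3) * t2) := by rw [this, mul_one]
        _ = _ := by
          rw [smul_mul_assoc, mul_smul_comm, mul_smul_comm, smul_smul]
          norm_num; ring
    rw [h3]; exact sh_mul_zero _ _ _ h2
  have hEc' : sh Z3 M E (fun x => c (s13 x)) = 0 := by
    have q1 : mapG s13 t1 = t3 := by simp [mapG_sg, s13, ht1, ht3]
    have q2 : mapG s13 t2 = t2 := by simp [mapG_sg, s13, ht2]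
    have q3 : mapG s13 t3 = t1 := by simp [mapG_sg, s13, ht1, ht3]
    have : mapG s13 E = E := by
      simp only [hE, map_mul, map_pow, map_sub, q1, q2, q3, pow_mul]
      ring
    rw [sh_comp, this, hEc]; rfl
  set q := quad e v with hq
  -- the three terms of the expansion of `c - c ∘ s13`
  set f1 : Z3 → M := fun x => ((x.2.1 : ℂ) - x.1) • q (a12 x) with hf1
  set f2 : Z3 → M := fun x => ((x.2.2 : ℂ) - x.1) • q (a13 x) with hf2
  set f3 : Z3 → M := fun x => ((x.2.2 : ℂ) - x.2.1) • q (a23 x) with hf3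
  have hsum : f2 = c - (fun x => c (s13 x)) - f1 - f3 := by
    ext ⟨x, w, b⟩
    simp only [hf1, hf2, hf3, hq, hcdef, quad, a12, a13, a23, s13, Pi.sub_apply,
      AddMonoidHom.coe_mk, ZeroHom.coe_mk]
    rw [hc x w, hc x b v, map_add, hc w b (e x v)]
    simp only [map_smul]
    abel
  have hE1 : sh Z3 M E f1 = 0 := by
    have : sh Z3 M ((t2 - t1) ^ 2) f1 = 0 := by
      rw [pow_two, map_mul, Module.End.mul_apply, ht1, ht2, shift_sub_eq, shift_sub_eq]
      ext ⟨x, w, b⟩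
      simp only [hf1, a12, AddMonoidHom.coe_mk, ZeroHom.coe_mk, Prod.mk_add_mk, add_zero]
      rw [show x + (w + 1 + 1) = x + w + 2 by ring, show x + 1 + (w + 1) = x + w + 2 by ring,
        show x + 1 + 1 + w = x + w + 2 by ring]
      push_cast
      simp only [Pi.zero_apply]
      module
    exact sh_dvd_zero this (Dvd.dvd.mul_right (pow_dvd_pow _ (by omega)) _)
  have hE3 : sh Z3 M E f3 = 0 := by
    have : sh Z3 M ((t3 - t2) ^ 2) f3 = 0 := by
      rw [pow_two, map_mul, Module.End.mul_apply, ht3, ht2, shift_sub_eq, shift_sub_eq]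
      ext ⟨x, w, b⟩
      simp only [hf3, a23, AddMonoidHom.coe_mk, ZeroHom.coe_mk, Prod.mk_add_mk, add_zero]
      rw [show w + (b + 1 + 1) = w + b + 2 by ring, show w + 1 + (b + 1) = w + b + 2 by ring,
        show w + 1 + 1 + b = w + b + 2 by ring]
      push_cast
      simp only [Pi.zero_apply]
      module
    exact sh_dvd_zero this (Dvd.dvd.mul_left (pow_dvd_pow _ (by omega)) _)
  have hE2 : sh Z3 M E f2 = 0 := by
    rw [hsum, map_sub, map_sub, map_sub, hEc, hEc', hE1, hE3]; simp
  have hE2' : sh Z3 M E (fun x => (sh _ M ((2 : ℂ) • sg ((0, 1) : ℤ × ℤ)) q) (a13 x)) = 0 := by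
    have : (fun x => (sh _ M ((2 : ℂ) • sg ((0, 1) : ℤ × ℤ)) q) (a13 x)) = sh Z3 M (t3 - t1) f2 := by
      rw [ht3, ht1, shift_sub_eq]
      ext ⟨x, w, b⟩
      simp only [map_smul, LinearMap.smul_apply, Pi.smul_apply, sh_sg, hf2, a13, AddMonoidHom.coe_mk,
        ZeroHom.coe_mk, Prod.mk_add_mk, add_zero]
      rw [show x + (b + 1) = x + b + 1 by ring, show x + 1 + b = x + b + 1 by ring]
      push_cast
      module
    rw [this, ← Module.End.mul_apply, ← map_mul, mul_comm]
    exact sh_mul_zero _ _ _ hE2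
  rw [sh_comp] at hE2'
  have hEd : mapG a13 E = dl ^ (4 * m) := by
    have q1 : mapG a13 t1 = sg (0, 1) := by simp [mapG_sg, a13, ht1]
    have q2 : mapG a13 t2 = sg (1, 0) := by simp [mapG_sg, a13, ht2]
    have q3 : mapG a13 t3 = sg (0, 1) := by simp [mapG_sg, a13, ht3]
    simp only [hE, map_mul, map_pow, map_sub, q1, q2, q3, dl]
    rw [show 4 * m = 2 * m + 2 * m by ring, pow_add, ← neg_sub, (even_two_mul m).neg_pow]
  rw [hEd] at hE2'
  have h2 : sh _ M (dl ^ (4 * m) * (2 : ℂ) • sg ((0, 1) : ℤ × ℤ)) q = 0 := by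
    rw [map_mul, Module.End.mul_apply]
    ext y
    have := congrFun hE2' (y.2, y.1, 0)
    simpa [a13] using this
  have h3 : dl ^ (4 * m) = ((1 / 2 : ℂ) • sg ((0, -1) : ℤ × ℤ)) *
      (dl ^ (4 * m) * (2 : ℂ) • sg ((0, 1) : ℤ × ℤ)) := by
    have : sg ((0, -1) : ℤ × ℤ) * sg (0, 1) = 1 := by
      rw [← sg_add, ← sg_zero]; simp; rfl
    calc dl ^ (4 * m) = dl ^ (4 * m) * (sg ((0, -1) : ℤ × ℤ) * sg (0, 1)) := by rw [this, mul_one]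
      _ = _ := by
        rw [smul_mul_assoc, mul_smul_comm, mul_smul_comm, smul_smul]
        norm_num; ring
  rw [h3]; exact sh_mul_zero _ _ _ h2

end four
end Extension
end

noncomputable section

section PolyMat
set_option linter.unusedSectionVars false
open Polynomial

lemma exists_adj {V : Type} [AddCommGroup V] [Module ℂ[X] V] [Module.Free ℂ[X] V]
    [Module.Finite ℂ[X] V] (P : V →ₗ[ℂ[X]] V) (hP : ∀ v, P v = 0 → v = 0) :
    ∃ D : ℂ[X], D ≠ 0 ∧ ∃ Q : V →ₗ[ℂ[X]] V, ∀ v, Q (P v) = D • v := by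
  classical
  let b := Module.Free.chooseBasis ℂ[X] V
  set A := LinearMap.toMatrix b b P with hA
  refine ⟨A.det, ?_, Matrix.toLin b b A.adjugate, ?_⟩
  · intro h0
    obtain ⟨w, hw, hw0⟩ := Matrix.exists_mulVec_eq_zero_iff.2 h0
    apply hw
    have h1 : P (b.equivFun.symm w) = 0 := by
      apply b.equivFun.injective
      have := LinearMap.toMatrix_mulVec_repr b b P (b.equivFun.symm w)
      rw [← hA] at this
      ext1 i
      have hi := congrFun this i
      have hr : (⇑(b.repr (b.equivFun.symm w)) : _ → ℂ[X]) = w := by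
        ext1 j; exact congrFun (b.equivFun.apply_symm_apply w) j
      rw [hr, hw0] at hi
      rw [map_zero]; exact hi.symm
    exact (LinearEquiv.map_eq_zero_iff _).1 (hP _ h1)
  · intro v
    have hP' : P = Matrix.toLin b b A := by rw [hA, Matrix.toLin_toMatrix]
    rw [hP', ← LinearMap.comp_apply, ← Matrix.toLin_mul, Matrix.adjugate_mul]
    simp

variable {ι : Type} [Fintype ι] [DecidableEq ι]

/-- Evaluation of a matrix of polynomials. -/
def ev (z : ℂ) : Matrix ι ι ℂ[X] →+* Matrix ι ι ℂ := (evalRingHom z).mapMatrix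

lemma ev_smul (z : ℂ) (p : ℂ[X]) (N : Matrix ι ι ℂ[X]) : ev z (p • N) = p.eval z • ev z N := by
  ext i j; simp [ev]

/-- Constant matrices. -/
def cm : Matrix ι ι ℂ →+* Matrix ι ι ℂ[X] := (C : ℂ →+* ℂ[X]).mapMatrix

lemma ev_cm (z : ℂ) (A : Matrix ι ι ℂ) : ev z (cm A) = A := by
  ext i j; simp [ev, cm]

/-- The substitution `z ↦ z - 1`. -/
def shm : Matrix ι ι ℂ[X] →+* Matrix ι ι ℂ[X] := (compRingHom (X - 1)).mapMatrix

lemma ev_shm (z : ℂ) (N : Matrix ι ι ℂ[X]) : ev z (shm N) = ev (z - 1) N := by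
  ext i j; simp [ev, shm]

lemma ev_dvd (z : ℂ) (N : Matrix ι ι ℂ[X]) (h : ev z N = 0) : ∃ N', N = (X - C z) • N' := by
  have : ∀ i j, ∃ q, N i j = (X - C z) * q := by
    intro i j
    have := congrFun (congrFun h i) j
    exact dvd_iff_isRoot.2 (by simpa [ev] using this)
  choose q hq using this
  exact ⟨Matrix.of q, by ext1 i j; simp [hq i j]⟩

lemma ev_zero_of_eventually (κ : ℂ) (N : Matrix ι ι ℂ[X])
    (h : ∀ᶠ n : ℕ in Filter.atTop, ev (κ - n) N = 0) : N = 0 := by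
  obtain ⟨n0, hn0⟩ := Filter.eventually_atTop.1 h
  ext1 i j
  apply eq_zero_of_infinite_isRoot
  refine Set.infinite_of_injective_forall_mem (f := fun n : ℕ => κ - ((n0 + n : ℕ) : ℂ)) ?_ ?_
  · intro a b hab
    simpa using hab
  · intro n
    have := congrFun (congrFun (hn0 (n0 + n) (by omega)) i) j
    simpa [ev] using this

/-- The polynomial matrices describing `e_{-1}` and `e_{-2}`, with shifted argument. -/
def p1 (A : Matrix ι ι ℂ) (j : ℂ) : Matrix ι ι ℂ[X] :=
  (X ^ 2 - C (2 * j + 1) * X + C (j ^ 2 + j)) • 1 + cm A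

def p2 (A B : Matrix ι ι ℂ) (j : ℂ) : Matrix ι ι ℂ[X] :=
  (X ^ 3 - C (3 * j + 3) * X ^ 2 + C (3 * j ^ 2 + 6 * j + 2) * X - C (j * (j + 1) * (j + 2))) • 1
    + ((3 : ℂ[X]) * (X - C j)) • cm A + cm B

lemma ev_p1 (A : Matrix ι ι ℂ) (j z : ℂ) :
    ev z (p1 A j) = ((z - j) ^ 2 - (z - j)) • (1 : Matrix ι ι ℂ) + A := by
  rw [p1, map_add, ev_smul, ev_cm, map_one]
  congr 2
  simp; ring

lemma ev_p2 (A B : Matrix ι ι ℂ) (j z : ℂ) :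
    ev z (p2 A B j) = ((z - j) * (z - j - 1) * (z - j - 2)) • (1 : Matrix ι ι ℂ)
      + (3 * (z - j)) • A + B := by
  rw [p2, map_add, map_add, ev_smul, ev_smul, ev_cm, ev_cm, map_one]
  congr 3
  · simp; ring
  · simp

/-- Coefficients of a polynomial matrix. -/
def cf (q : ℕ) : Matrix ι ι ℂ[X] →ₗ[ℂ] Matrix ι ι ℂ := (lcoeff ℂ q).mapMatrix

lemma cf_apply (q : ℕ) (P : Matrix ι ι ℂ[X]) (i j : ι) : cf q P i j = (P i j).coeff q := rfl

lemma cf_cm_mul (q : ℕ) (A : Matrix ι ι ℂ) (P : Matrix ι ι ℂ[X]) :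
    cf q (cm A * P) = A * cf q P := by
  ext i j
  simp [cf_apply, Matrix.mul_apply, cm]

lemma cf_mul_cm (q : ℕ) (A : Matrix ι ι ℂ) (P : Matrix ι ι ℂ[X]) :
    cf q (P * cm A) = cf q P * A := by
  ext i j
  simp [cf_apply, Matrix.mul_apply, cm]

lemma cf_X_smul (q : ℕ) (P : Matrix ι ι ℂ[X]) : cf (q + 1) ((X : ℂ[X]) • P) = cf q P := by
  ext i j; simp [cf_apply]

lemma cf_X_smul_zero (P : Matrix ι ι ℂ[X]) : cf 0 ((X : ℂ[X]) • P) = 0 := by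
  ext i j; simp [cf_apply]

lemma cf_quad_smul (c d : ℂ) (r : ℕ) (P : Matrix ι ι ℂ[X]) (hP : cf (r + 2) P = 0) :
    cf (r + 2) ((X ^ 2 - C c * X + C d) • P) = cf r P - c • cf (r + 1) P := by
  ext i j
  have := congrFun (congrFun hP i) j
  rw [cf_apply] at this
  simp only [Matrix.zero_apply] at this
  simp [cf_apply, add_mul, sub_mul, mul_assoc, coeff_X_pow_mul, this, coeff_X_mul]

lemma cf_cubic_smul (c d f : ℂ) (r : ℕ) (P : Matrix ι ι ℂ[X]) (hP : ∀ j, r + 2 ≤ j → cf j P = 0) :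
    cf (r + 3) ((X ^ 3 - C c * X ^ 2 + C d * X - C f) • P) = cf r P - c • cf (r + 1) P := by
  ext i j
  have h1 := congrFun (congrFun (hP (r + 2) le_rfl) i) j
  have h2 := congrFun (congrFun (hP (r + 3) (by omega)) i) j
  rw [cf_apply] at h1 h2
  simp only [Matrix.zero_apply] at h1 h2
  have h3 : (X ^ 2 * P i j).coeff (r + 3) = (P i j).coeff (r + 1) := coeff_X_pow_mul _ 2 (r + 1)
  simp [cf_apply, add_mul, sub_mul, mul_assoc, coeff_X_pow_mul, h1, h2, h3, coeff_X_mul]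

lemma cf_p1_mul (A : Matrix ι ι ℂ) (j : ℂ) (r : ℕ) (P : Matrix ι ι ℂ[X]) (hP : cf (r + 2) P = 0) :
    cf (r + 2) (p1 A j * P) = cf r P - (2 * j + 1) • cf (r + 1) P := by
  rw [p1, add_mul, map_add, cf_cm_mul, hP, smul_mul_assoc, one_mul, cf_quad_smul _ _ _ _ hP]
  simp

lemma cf_mul_p1 (A : Matrix ι ι ℂ) (j : ℂ) (r : ℕ) (P : Matrix ι ι ℂ[X]) (hP : cf (r + 2) P = 0) :
    cf (r + 2) (P * p1 A j) = cf r P - (2 * j + 1) • cf (r + 1) P := by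
  rw [p1, mul_add, map_add, cf_mul_cm, hP, mul_smul_comm, mul_one, cf_quad_smul _ _ _ _ hP]
  simp

lemma cf_lin_smul (c : ℂ) (r : ℕ) (P : Matrix ι ι ℂ[X]) (hP : ∀ j, r + 2 ≤ j → cf j P = 0) :
    cf (r + 3) (((3 : ℂ[X]) * (X - C c)) • P) = 0 := by
  have : ((3 : ℂ[X]) * (X - C c)) • P = (3 : ℂ) • ((X : ℂ[X]) • P) - (3 * c) • P := by
    ext1 i j; simp [sub_mul, mul_assoc, smul_eq_C_mul, mul_sub, show (C 3 : ℂ[X]) = 3 from rfl]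
  rw [this, map_sub, (cf _).map_smul (3 : ℂ), (cf _).map_smul (3 * c : ℂ), cf_X_smul, hP _ le_rfl, hP _ (by omega)]
  simp

lemma cf_p2_mul (A B : Matrix ι ι ℂ) (j : ℂ) (r : ℕ) (P : Matrix ι ι ℂ[X])
    (hP : ∀ j, r + 2 ≤ j → cf j P = 0) :
    cf (r + 3) (p2 A B j * P) = cf r P - (3 * j + 3) • cf (r + 1) P := by
  rw [p2, add_mul, add_mul, map_add, map_add, cf_cm_mul, hP (r + 3) (by omega), smul_mul_assoc,
    one_mul, cf_cubic_smul _ _ _ _ _ hP, smul_mul_assoc, cf_lin_smul]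
  · simp
  · intro j hj; rw [cf_cm_mul, hP j hj, mul_zero]

lemma cf_mul_p2 (A B : Matrix ι ι ℂ) (j : ℂ) (r : ℕ) (P : Matrix ι ι ℂ[X])
    (hP : ∀ j, r + 2 ≤ j → cf j P = 0) :
    cf (r + 3) (P * p2 A B j) = cf r P - (3 * j + 3) • cf (r + 1) P := by
  rw [p2, mul_add, mul_add, map_add, map_add, cf_mul_cm, hP (r + 3) (by omega), mul_smul_comm,
    mul_one, cf_cubic_smul _ _ _ _ _ hP, mul_smul_comm, cf_lin_smul]
  · simp
  · intro j hj; rw [cf_mul_cm, hP j hj, zero_mul]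

lemma exists_cf_bound (P : Matrix ι ι ℂ[X]) : ∃ N, ∀ j, N ≤ j → cf j P = 0 := by
  refine ⟨(Finset.univ.sup fun x : ι × ι => (P x.1 x.2).natDegree) + 1, fun j hj => ?_⟩
  ext a b
  rw [cf_apply]
  apply coeff_eq_zero_of_natDegree_lt
  have := Finset.le_sup (f := fun x : ι × ι => (P x.1 x.2).natDegree) (Finset.mem_univ (a, b))
  simp only at this
  omega

lemma eq_zero_of_cf (P : Matrix ι ι ℂ[X]) (h : ∀ j, cf j P = 0) : P = 0 := by
  ext i j q
  exact congrFun (congrFun (h q) i) j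

lemma sys_core (A B : Matrix ι ι ℂ) (P0 P1 P2 : Matrix ι ι ℂ[X])
    (h0 : cf 0 P0 = 0 ∧ cf 0 P1 = 0 ∧ cf 0 P2 = 0)
    (h1 : ∀ q, cf (q + 2) (p1 A 0 * P0 - P1 * p1 A 2) = 0)
    (h2 : ∀ q, cf (q + 2) (p1 A 1 * P1 - P2 * p1 A 3) = 0)
    (h3 : ∀ q, cf (q + 3) (p2 A B 0 * P0 - P2 * p2 A B 2) = 0) :
    P0 = 0 ∧ P1 = 0 ∧ P2 = 0 := by
  obtain ⟨N0, hN0⟩ := exists_cf_bound P0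
  obtain ⟨N1, hN1⟩ := exists_cf_bound P1
  obtain ⟨N2, hN2⟩ := exists_cf_bound P2
  have key : ∀ k q, q + k = N0 + N1 + N2 →
      ∀ j, q ≤ j → cf j P0 = 0 ∧ cf j P1 = 0 ∧ cf j P2 = 0 := by
    intro k
    induction k with
    | zero => exact fun q hq j hj => ⟨hN0 _ (by omega), hN1 _ (by omega), hN2 _ (by omega)⟩
    | succ k ih =>
      intro q hq j hj
      have ih' := ih (q + 1) (by omega)
      rcases hj.lt_or_eq with hj | rfl
      · exact ih' j hj
      rcases q with _ | r
      · exact h0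
      have z0 : ∀ j, r + 1 + 1 ≤ j → cf j P0 = 0 := fun j hj => (ih' j hj).1
      have z1 : ∀ j, r + 1 + 1 ≤ j → cf j P1 = 0 := fun j hj => (ih' j hj).2.1
      have z2 : ∀ j, r + 1 + 1 ≤ j → cf j P2 = 0 := fun j hj => (ih' j hj).2.2
      have a1 := h1 (r + 1)
      have a2 := h2 (r + 1)
      have b1 := h1 r
      have b2 := h2 r
      have b3 := h3 r
      rw [map_sub, cf_p1_mul _ _ _ _ (z0 _ (by omega)), cf_mul_p1 _ _ _ _ (z1 _ (by omega))] at a1 b1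
      rw [map_sub, cf_p1_mul _ _ _ _ (z1 _ (by omega)), cf_mul_p1 _ _ _ _ (z2 _ (by omega))] at a2 b2
      rw [map_sub, cf_p2_mul _ _ _ _ _ z0, cf_mul_p2 _ _ _ _ _ z2] at b3
      rw [z0 _ le_rfl, z1 _ le_rfl, smul_zero, smul_zero, sub_zero, sub_zero, sub_eq_zero] at a1
      rw [z1 _ le_rfl, z2 _ le_rfl, smul_zero, smul_zero, sub_zero, sub_zero, sub_eq_zero] at a2
      rw [a1] at b1 b3 ⊢
      rw [a2] at b1 b2 b3 ⊢
      have : (2 : ℂ) • cf (r + 1) P2 = 0 := by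
        linear_combination (norm := module) b1 + b2 - b3
      have : cf (r + 1) P2 = 0 := by simpa using this
      exact ⟨this, this, this⟩
  exact ⟨eq_zero_of_cf _ fun j => (key _ 0 (Nat.zero_add _) j (Nat.zero_le _)).1,
    eq_zero_of_cf _ fun j => (key _ 0 (Nat.zero_add _) j (Nat.zero_le _)).2.1,
    eq_zero_of_cf _ fun j => (key _ 0 (Nat.zero_add _) j (Nat.zero_le _)).2.2⟩

lemma sys_inj (A B : Matrix ι ι ℂ) (P0 P1 P2 : Matrix ι ι ℂ[X])
    (h1 : ∀ q, cf (q + 1) (p1 A 0 * P0 - P1 * p1 A 2) = 0)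
    (h2 : ∀ q, cf (q + 1) (p1 A 1 * P1 - P2 * p1 A 3) = 0)
    (h3 : ∀ q, cf (q + 2) (p2 A B 0 * P0 - P2 * p2 A B 2) = 0) :
    P0 = 0 ∧ P1 = 0 ∧ P2 = 0 := by
  have hX : ∀ P : Matrix ι ι ℂ[X], (X : ℂ[X]) • P = 0 → P = 0 := fun P h =>
    (smul_eq_zero.1 h).resolve_left X_ne_zero
  have := sys_core A B ((X : ℂ[X]) • P0) ((X : ℂ[X]) • P1) ((X : ℂ[X]) • P2)
    ⟨cf_X_smul_zero _, cf_X_smul_zero _, cf_X_smul_zero _⟩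
    (fun q => by rw [mul_smul_comm, smul_mul_assoc, ← smul_sub, cf_X_smul]; exact h1 q)
    (fun q => by rw [mul_smul_comm, smul_mul_assoc, ← smul_sub, cf_X_smul]; exact h2 q)
    (fun q => by rw [mul_smul_comm, smul_mul_assoc, ← smul_sub, cf_X_smul]; exact h3 q)
  exact ⟨hX _ this.1, hX _ this.2.1, hX _ this.2.2⟩
end PolyMat
end

noncomputable section

section CommonVec
open Polynomial Filter
set_option linter.unusedSectionVars false
variable {ι : Type} [Fintype ι] [DecidableEq ι]

/-- The linear system satisfied by three consecutive matrices of `e_2`. -/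
def sysP (A B : Matrix ι ι ℂ) : (Matrix ι ι ℂ[X] × Matrix ι ι ℂ[X] × Matrix ι ι ℂ[X]) →ₗ[ℂ[X]]
    (Matrix ι ι ℂ[X] × Matrix ι ι ℂ[X] × Matrix ι ι ℂ[X]) :=
  let f0 := LinearMap.fst ℂ[X] (Matrix ι ι ℂ[X]) (Matrix ι ι ℂ[X] × Matrix ι ι ℂ[X])
  let g := LinearMap.snd ℂ[X] (Matrix ι ι ℂ[X]) (Matrix ι ι ℂ[X] × Matrix ι ι ℂ[X])
  let f1 := LinearMap.fst ℂ[X] (Matrix ι ι ℂ[X]) (Matrix ι ι ℂ[X]) ∘ₗ g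
  let f2 := LinearMap.snd ℂ[X] (Matrix ι ι ℂ[X]) (Matrix ι ι ℂ[X]) ∘ₗ g
  (LinearMap.mulLeft ℂ[X] (p1 A 0) ∘ₗ f0 - LinearMap.mulRight ℂ[X] (p1 A 2) ∘ₗ f1).prod
    ((LinearMap.mulLeft ℂ[X] (p1 A 1) ∘ₗ f1 - LinearMap.mulRight ℂ[X] (p1 A 3) ∘ₗ f2).prod
      (LinearMap.mulLeft ℂ[X] (p2 A B 0) ∘ₗ f0 - LinearMap.mulRight ℂ[X] (p2 A B 2) ∘ₗ f2))

lemma sysP_apply (A B : Matrix ι ι ℂ) (P0 P1 P2 : Matrix ι ι ℂ[X]) :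
    sysP A B (P0, P1, P2) = (p1 A 0 * P0 - P1 * p1 A 2, p1 A 1 * P1 - P2 * p1 A 3,
      p2 A B 0 * P0 - P2 * p2 A B 2) := rfl

def c3 : Matrix ι ι ℂ[X] := C (3 : ℂ) • 1
def l4 : Matrix ι ι ℂ[X] := (C (4 : ℂ) * (X - C 2)) • 1

lemma ev_c3 (z : ℂ) : ev z (c3 : Matrix ι ι ℂ[X]) = (3 : ℂ) • 1 := by
  rw [c3, ev_smul, map_one]; simp

lemma ev_l4 (z : ℂ) : ev z (l4 : Matrix ι ι ℂ[X]) = (4 * (z - 2)) • 1 := by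
  rw [l4, ev_smul, map_one]; simp

lemma cf_c3 (q : ℕ) : cf (q + 1) (c3 : Matrix ι ι ℂ[X]) = 0 := by
  ext i j
  by_cases h : i = j <;> simp [cf_apply, c3, h]

lemma cf_l4 (q : ℕ) : cf (q + 2) (l4 : Matrix ι ι ℂ[X]) = 0 := by
  ext i j
  by_cases h : i = j <;> simp [cf_apply, l4, h, coeff_X]

structure Sys (A B : Matrix ι ι ℂ) (X : ℕ → Matrix ι ι ℂ) (κ : ℂ) : Prop where
  r1 : ∀ n : ℕ, ev (κ - n) (p1 A 0) * X n - X (n + 1) * ev (κ - n) (p1 A 2) = (3 : ℂ) • 1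
  r2 : ∀ n : ℕ, ev (κ - n) (p2 A B 0) * X n - X (n + 2) * ev (κ - n) (p2 A B 2)
    = (4 * (κ - n - 2)) • 1

lemma Sys.r1' {A B : Matrix ι ι ℂ} {X : ℕ → Matrix ι ι ℂ} {κ : ℂ} (h : Sys A B X κ) (n : ℕ) :
    ev (κ - n) (p1 A 1) * X (n + 1) - X (n + 2) * ev (κ - n) (p1 A 3) = (3 : ℂ) • 1 := by
  have := h.r1 (n + 1)
  rw [← this]
  simp only [ev_p1]
  push_cast
  ring_nf

/-- `D` is a common denominator for the sequence `X`, with numerator `N`. -/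
def IsDenom (X : ℕ → Matrix ι ι ℂ) (κ : ℂ) (D : ℂ[X]) (N : Matrix ι ι ℂ[X]) : Prop :=
  ∀ᶠ n : ℕ in atTop, D.eval (κ - n) • X n = ev (κ - n) N

lemma exists_denom {A B : Matrix ι ι ℂ} {X : ℕ → Matrix ι ι ℂ} {κ : ℂ} (h : Sys A B X κ) :
    ∃ D : ℂ[X], D ≠ 0 ∧ ∃ N, IsDenom X κ D N := by
  obtain ⟨D, hD, Q, hQ⟩ := exists_adj (sysP A B) (by
    rintro ⟨P0, P1, P2⟩ hv
    rw [sysP_apply, Prod.mk_eq_zero, Prod.mk_eq_zero] at hv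
    obtain ⟨h1, h2, h3⟩ := hv
    obtain ⟨a, b, c⟩ := sys_inj A B P0 P1 P2 (by simp [h1]) (by simp [h2]) (by simp [h3])
    simp [a, b, c])
  refine ⟨D, hD, (Q (c3, c3, l4)).1, Eventually.of_forall fun n => ?_⟩
  set z := κ - (n : ℂ) with hz
  obtain ⟨a, ha⟩ := ev_dvd z (p1 A 0 * cm (X n) - cm (X (n + 1)) * p1 A 2 - c3) (by
    rw [map_sub, map_sub, map_mul, map_mul, ev_cm, ev_cm, ev_c3, h.r1, sub_self])
  obtain ⟨b, hb⟩ := ev_dvd z (p1 A 1 * cm (X (n + 1)) - cm (X (n + 2)) * p1 A 3 - c3) (by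
    rw [map_sub, map_sub, map_mul, map_mul, ev_cm, ev_cm, ev_c3, h.r1', sub_self])
  obtain ⟨c, hc⟩ := ev_dvd z (p2 A B 0 * cm (X n) - cm (X (n + 2)) * p2 A B 2 - l4) (by
    rw [map_sub, map_sub, map_mul, map_mul, ev_cm, ev_cm, ev_l4, h.r2, sub_self])
  have h1 : sysP A B (cm (X n), cm (X (n + 1)), cm (X (n + 2)))
      = (c3, c3, l4) + (Polynomial.X - C z) • (a, b, c) := by
    rw [sysP_apply, Prod.smul_mk, Prod.smul_mk, ← ha, ← hb, ← hc]
    simp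
  have h2 := congrArg (fun v => ev z v.1) (hQ (cm (X n), cm (X (n + 1)), cm (X (n + 2))))
  simp only [h1, map_add, map_smul, Prod.fst_add, Prod.smul_fst, ev_smul, ev_cm] at h2
  rw [← h2]
  simp

lemma exists_pole [Nonempty ι] {A B : Matrix ι ι ℂ} {X : ℕ → Matrix ι ι ℂ} {κ : ℂ}
    (h : Sys A B X κ) : ∃ (D : ℂ[X]) (N : Matrix ι ι ℂ[X]) (z : ℂ), IsDenom X κ D N ∧
      D.eval z = 0 ∧ D.eval (z - 1) ≠ 0 ∧ D.eval (z - 2) ≠ 0 ∧ ev z N ≠ 0 := by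
  classical
  have hex : ∃ d : ℕ, ∃ D : ℂ[X], D ≠ 0 ∧ D.natDegree = d ∧ ∃ N, IsDenom X κ D N := by
    obtain ⟨D, hD, N, hN⟩ := exists_denom h
    exact ⟨_, D, hD, rfl, N, hN⟩
  obtain ⟨D, hD, hd, N, hN⟩ := Nat.find_spec hex
  have hmin := fun k => @Nat.find_min _ _ hex k
  have hroots : D.roots.toFinset.Nonempty := by
    by_contra hne
    have hdeg : D.natDegree = 0 := by
      by_contra hpos
      obtain ⟨z, hz⟩ := Complex.exists_root (f := D) (natDegree_pos_iff_degree_pos.1 (by omega))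
      exact hne ⟨z, by simpa [hD] using hz⟩
    obtain ⟨c, rfl⟩ := natDegree_eq_zero.1 hdeg
    have hc : c ≠ 0 := by rintro rfl; simp at hD
    have hX : ∀ᶠ n : ℕ in atTop, X n = ev (κ - n) (C c⁻¹ • N) := by
      filter_upwards [hN] with n hn
      rw [ev_smul, ← hn]; simp [hc]
    set N' := C c⁻¹ • N
    have hX1 := (tendsto_add_atTop_nat 1).eventually hX
    have hX2 := (tendsto_add_atTop_nat 2).eventually hX
    have e1 : p1 A 0 * N' - shm N' * p1 A 2 - c3 = 0 := by
      apply ev_zero_of_eventually κ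
      filter_upwards [hX, hX1] with n h0 h1
      rw [map_sub, map_sub, map_mul, map_mul, ev_shm, ev_c3, ← h0, ← h.r1 n, h1]
      push_cast; simp [sub_sub]
    have e2 : p1 A 1 * shm N' - shm (shm N') * p1 A 3 - c3 = 0 := by
      apply ev_zero_of_eventually κ
      filter_upwards [hX1, hX2] with n h0 h1
      rw [map_sub, map_sub, map_mul, map_mul, ev_shm, ev_shm, ev_shm, ev_c3, ← h.r1' n, h0, h1]
      push_cast; simp only [← sub_sub, show κ - (n : ℂ) - 1 - 1 = κ - n - 2 by ring]; abel
    have e3 : p2 A B 0 * N' - shm (shm N') * p2 A B 2 - l4 = 0 := by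
      apply ev_zero_of_eventually κ
      filter_upwards [hX, hX2] with n h0 h1
      rw [map_sub, map_sub, map_mul, map_mul, ev_shm, ev_shm, ev_l4, ← h0, ← h.r2 n, h1]
      push_cast; simp only [← sub_sub, show κ - (n : ℂ) - 1 - 1 = κ - n - 2 by ring]; abel
    rw [sub_eq_zero] at e1 e2 e3
    obtain ⟨a, b, -⟩ := sys_inj A B N' (shm N') (shm (shm N')) (by intro q; rw [e1, cf_c3])
      (by intro q; rw [e2, cf_c3]) (by intro q; rw [e3, cf_l4])
    rw [a, map_zero] at e1
    simp only [mul_zero, zero_mul, sub_zero] at e1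
    obtain ⟨i⟩ := ‹Nonempty ι›
    have := congrFun (congrFun e1 i) i
    simp [c3] at this
    exact (by norm_num : (3 : ℂ) ≠ 0) (C_eq_zero.1 this.symm)
  obtain ⟨z, hz, hzmin⟩ := Finset.exists_min_image _ Complex.re hroots
  have hz0 : D.eval z = 0 := by simpa [hD] using hz
  have hne : ∀ w : ℂ, w.re < z.re → D.eval w ≠ 0 := by
    intro w hw h0
    have := hzmin w (by simp [hD, h0])
    linarith
  refine ⟨D, N, z, hN, hz0, hne _ (by simp), hne _ (by simp), fun hNz => ?_⟩
  obtain ⟨N', rfl⟩ := ev_dvd z N hNz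
  obtain ⟨D', rfl⟩ := dvd_iff_isRoot.2 hz0
  have hD' : D' ≠ 0 := right_ne_zero_of_mul hD
  refine hmin D'.natDegree ?_ ⟨D', hD', rfl, N', ?_⟩
  · rw [← hd, natDegree_mul (X_sub_C_ne_zero z) hD', natDegree_X_sub_C]; omega
  · have hz' : ∀ᶠ n : ℕ in atTop, κ - (n : ℂ) ≠ z := by
      have : Set.Finite {n : ℕ | κ - (n : ℂ) = z} := by
        apply Set.Subsingleton.finite
        intro a ha b hb
        have : (a : ℂ) = b := by
          rw [Set.mem_ofPred_eq] at ha hb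
          linear_combination hb - ha
        exact_mod_cast this
      rw [← Nat.cofinite_eq_atTop]
      exact this.compl_mem_cofinite
    filter_upwards [hN, hz'] with n hn hnz
    rw [ev_smul, eval_mul, mul_smul] at hn
    simp only [eval_sub, eval_X, eval_C] at hn
    exact smul_right_injective _ (sub_ne_zero.2 hnz) hn

lemma common_vec [Nonempty ι] {A B : Matrix ι ι ℂ} {X : ℕ → Matrix ι ι ℂ} {κ : ℂ}
    (h : Sys A B X κ) : ∃ (z : ℂ) (u : ι → ℂ), u ≠ 0 ∧
      (ev z (p1 A 0)).mulVec u = 0 ∧ (ev z (p2 A B 0)).mulVec u = 0 := by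
  obtain ⟨D, N, z, hN, h0, h1, h2, hz⟩ := exists_pole h
  have hN1 := (tendsto_add_atTop_nat 1).eventually hN
  have hN2 := (tendsto_add_atTop_nat 2).eventually hN
  have e1 : (D.comp (Polynomial.X - C 1)) • (p1 A 0 * N)
      - D • (shm N * p1 A 2) - (D * D.comp (Polynomial.X - C 1)) • c3 = 0 := by
    apply ev_zero_of_eventually κ
    filter_upwards [hN, hN1] with n a b
    push_cast at b
    rw [← sub_sub] at b
    simp only [map_sub, ev_smul, map_mul, ev_shm, ev_c3, eval_comp, eval_sub, eval_X, eval_C,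
      eval_mul]
    rw [← a, ← b, ← h.r1 n]
    simp only [mul_smul_comm, smul_mul_assoc, smul_sub, smul_smul]
    rw [mul_comm (eval (κ - n - 1) D)]
    abel
  have e2 : (D.comp (Polynomial.X - C 2)) • (p2 A B 0 * N)
      - D • (shm (shm N) * p2 A B 2) - (D * D.comp (Polynomial.X - C 2)) • l4 = 0 := by
    apply ev_zero_of_eventually κ
    filter_upwards [hN, hN2] with n a b
    push_cast at b
    rw [← sub_sub] at b
    simp only [map_sub, ev_smul, map_mul, ev_shm, ev_l4, eval_comp, eval_sub, eval_X, eval_C,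
      eval_mul]
    rw [← a, sub_sub (κ - n) 1 1, one_add_one_eq_two, ← b, ← h.r2 n]
    simp only [mul_smul_comm, smul_mul_assoc, smul_sub, smul_smul]
    rw [mul_comm (eval (κ - n - 2) D)]
    abel
  have f1 : ev z (p1 A 0) * ev z N = 0 := by
    have := congrArg (ev z) e1
    simp only [map_sub, ev_smul, map_mul, eval_comp, eval_sub, eval_X, eval_C, eval_mul, h0,
      zero_smul, zero_mul, sub_zero, map_zero] at this
    exact (smul_eq_zero.1 this).resolve_left h1
  have f2 : ev z (p2 A B 0) * ev z N = 0 := by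
    have := congrArg (ev z) e2
    simp only [map_sub, ev_smul, map_mul, eval_comp, eval_sub, eval_X, eval_C, eval_mul, h0,
      zero_smul, zero_mul, sub_zero, map_zero] at this
    exact (smul_eq_zero.1 this).resolve_left h2
  obtain ⟨j, hj⟩ : ∃ j, (ev z N).col j ≠ 0 := by
    by_contra! hcon
    exact hz (by ext i j; exact congrFun (hcon j) i)
  refine ⟨z, (ev z N).col j, hj, ?_, ?_⟩
  · ext i; exact congrFun (congrFun f1 i) j
  · ext i; exact congrFun (congrFun f2 i) j
end CommonVec
end

noncomputable section

section WittFamily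
open Filter
variable {M : Type} [AddCommGroup M] [Module ℂ M]

/-- A graded representation of the Witt algebra with finite-dimensional components. -/
structure WittFam (e : ℤ → Module.End ℂ M) (a : ℂ) (G : ℤ → Submodule ℂ M) : Prop where
  comm : ∀ x y, e x * e y - e y * e x = ((y : ℂ) - x) • e (x + y)
  maps : ∀ x k, ∀ v ∈ G k, e x v ∈ G (k + x)
  zero : ∀ k, ∀ v ∈ G k, e 0 v = (a + k) • v
  fd : ∀ k, FiniteDimensional ℂ (G k)

namespace WittFam
variable {e : ℤ → Module.End ℂ M} {a : ℂ} {G : ℤ → Submodule ℂ M}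

lemma swap (h : WittFam e a G) (x y : ℤ) (v : M) :
    e x (e y v) = e y (e x v) + ((y : ℂ) - x) • e (x + y) v := by
  have := LinearMap.congr_fun (h.comm x y) v
  simp only [LinearMap.sub_apply, Module.End.mul_apply, LinearMap.smul_apply] at this
  rw [← this]; abel

lemma chain (h : WittFam e a G) {k : ℤ} {v : M} (hv : v ∈ G k) (h0 : v ≠ 0) (h1 : e 1 v = 0)
    (hre : (a + k).re < 0) (j : ℕ) : ∃ w ∈ G (k - j), w ≠ 0 ∧
      e (-1) (e 1 w) = ((a + k - j) ^ 2 + (a + k - j) - (a + k) ^ 2 - (a + k)) • w := by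
  induction j with
  | zero => exact ⟨v, by simpa using hv, h0, by simp [h1]⟩
  | succ j ih =>
    obtain ⟨w, hw, hw0, hT⟩ := ih
    have e1 : e 1 (e (-1) w) = (((j : ℂ) + 1) * (j - 2 * (a + k))) • w := by
      rw [h.swap, hT]
      have := h.zero _ _ hw
      norm_num at this ⊢
      rw [this]
      module
    have hne : ((j : ℂ) + 1) * (j - 2 * (a + k)) ≠ 0 := by
      refine mul_ne_zero (by exact_mod_cast Nat.succ_ne_zero j) fun hc => ?_
      have := congrArg Complex.re hc
      simp at this hre
      have hj : (0 : ℝ) ≤ j := Nat.cast_nonneg j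
      linarith
    refine ⟨e (-1) w, ?_, ?_, ?_⟩
    · have := h.maps (-1) _ _ hw
      convert this using 2
      push_cast; ring
    · intro hc
      rw [hc, map_zero] at e1
      exact (smul_ne_zero hne hw0) e1.symm
    · rw [e1, map_smul]
      congr 1
      push_cast; ring

lemma inj_one (h : WittFam e a G) {l : ℕ} (hd : ∀ᶠ k in atBot, Module.finrank ℂ (G k) ≤ l) :
    ∀ᶠ k in atBot, ∀ v ∈ G k, e 1 v = 0 → v = 0 := by
  by_contra hcon
  obtain ⟨L, hL⟩ := eventually_atBot.1 hd
  obtain ⟨R, hR⟩ : ∃ R : ℤ, ∀ k ≤ R, (a + k).re < -1 := by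
    refine ⟨⌊-2 - a.re⌋, fun k hk => ?_⟩
    have : (k : ℝ) ≤ -2 - a.re := Int.le_floor.1 hk
    simp; linarith
  let bad : Set ℤ := {k | k ≤ R ∧ ∃ v ∈ G k, e 1 v = 0 ∧ v ≠ 0}
  have hinf : bad.Infinite := by
    intro hfin
    apply hcon
    obtain ⟨B, hB⟩ := hfin.bddBelow
    filter_upwards [eventually_lt_atBot B, eventually_le_atBot R] with k hk hkR v hv hv1
    by_contra hv0
    exact absurd (hB ⟨hkR, v, hv, hv1, hv0⟩) (not_le.2 hk)
  obtain ⟨s, hs, hcard⟩ := hinf.exists_subset_card_eq (l + 1)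
  obtain ⟨m0, hm0⟩ := s.finite_toSet.bddBelow
  set k' := min L m0
  have hex : ∀ k : s, ∃ w ∈ G k', w ≠ 0 ∧ e (-1) (e 1 w)
      = ((a + k') ^ 2 + (a + k') - (a + (k : ℤ)) ^ 2 - (a + (k : ℤ))) • w := by
    rintro ⟨k, hk⟩
    obtain ⟨hkR, v, hv, hv1, hv0⟩ := hs hk
    have hle : k' ≤ k := (min_le_right _ _).trans (hm0 hk)
    obtain ⟨w, hw, hw0, hT⟩ := h.chain hv hv0 hv1 (by linarith [hR k hkR]) (k - k').toNat
    have hc : (((k - k').toNat : ℕ) : ℤ) = k - k' := Int.toNat_of_nonneg (by omega)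
    have hc' : (((k - k').toNat : ℕ) : ℂ) = k - k' := by exact_mod_cast congrArg (Int.cast (R := ℂ)) hc
    refine ⟨w, by rwa [hc, sub_sub_cancel] at hw, hw0, ?_⟩
    rw [hT, hc']
    congr 1; ring
  choose w hw hw0 hT using hex
  have hli : LinearIndependent ℂ w := by
    refine Module.End.eigenvectors_linearIndependent' (e (-1) * e 1)
      (fun k : s => (a + k') ^ 2 + (a + k') - (a + (k : ℤ)) ^ 2 - (a + (k : ℤ))) ?_ w ?_
    · rintro ⟨k, hk⟩ ⟨q, hq⟩ hkq
      have : ((k : ℂ) - q) * (2 * a + k + q + 1) = 0 := by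
        simp only at hkq
        linear_combination -hkq
      rcases mul_eq_zero.1 this with h0 | h0
      · have h1 : k = q := by exact_mod_cast sub_eq_zero.1 h0
        exact Subtype.ext h1
      · have h1 := hR k (hs hk).1
        have h2 := hR q (hs hq).1
        have := congrArg Complex.re h0
        simp at this h1 h2
        linarith
    · intro k
      exact ⟨Module.End.mem_eigenspace_iff.2 (hT k), hw0 k⟩
  have hli' : LinearIndependent ℂ (fun k : s => (⟨w k, hw k⟩ : G k')) := by
    apply LinearIndependent.of_comp (G k').subtype
    exact hli
  have := h.fd k'
  have h1 := hli'.fintype_card_le_finrank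
  have h2 := hL k' (min_le_left _ _)
  rw [Fintype.card_coe] at h1
  omega

/-- Eventual trivialisation of the components by means of `e_1`. -/
lemma exists_triv (h : WittFam e a G) {l : ℕ} (hd : ∀ᶠ k in atBot, Module.finrank ℂ (G k) ≤ l) :
    ∃ (D : ℕ) (K : ℤ) (τ : ℕ → (Fin D → ℂ) →ₗ[ℂ] M), ∀ n, Function.Injective (τ n) ∧
      LinearMap.range (τ n) = G (K - n) ∧ ∀ u, e 1 (τ (n + 1) u) = τ n u := by
  obtain ⟨K0, hK0⟩ := eventually_atBot.1 (h.inj_one hd)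
  have fdi := h.fd
  let f : ∀ k, G k →ₗ[ℂ] G (k + 1) := fun k => (e 1).restrict (h.maps 1 k)
  have hf : ∀ k ≤ K0, Function.Injective (f k) := by
    intro k hk
    rw [← LinearMap.ker_eq_bot, LinearMap.ker_eq_bot']
    rintro ⟨v, hv⟩ hv0
    exact Subtype.ext (hK0 k hk v hv (congrArg Subtype.val hv0))
  have hex : ∃ d : ℕ, ∃ k ≤ K0, Module.finrank ℂ (G k) = d := ⟨_, K0, le_rfl, rfl⟩
  classical
  obtain ⟨K, hK, hKd⟩ := Nat.find_spec hex
  set D := Nat.find hex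
  have hconst : ∀ n : ℕ, Module.finrank ℂ (G (K - n)) = D := by
    intro n
    induction n with
    | zero => rw [Nat.cast_zero, sub_zero]; exact hKd
    | succ n ih =>
      apply le_antisymm
      · have := LinearMap.finrank_le_finrank_of_injective (hf (K - (n + 1 : ℕ)) (by omega))
        rwa [show K - ((n + 1 : ℕ) : ℤ) + 1 = K - n by push_cast; ring, ih] at this
      · exact Nat.find_min' hex ⟨_, by omega, rfl⟩
  let P : ℕ → ((Fin D → ℂ) →ₗ[ℂ] M) → Prop := fun n t =>
    Function.Injective t ∧ LinearMap.range t = G (K - n)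
  have h0 : ∃ t, P 0 t := by
    have eq : (Fin D → ℂ) ≃ₗ[ℂ] G (K - (0 : ℕ)) :=
      LinearEquiv.ofFinrankEq _ _ (by rw [hconst]; simp)
    refine ⟨(G (K - (0 : ℕ))).subtype ∘ₗ eq.toLinearMap, ?_, ?_⟩
    · exact Subtype.val_injective.comp eq.injective
    · rw [LinearMap.range_comp, LinearEquiv.range, Submodule.map_top, Submodule.range_subtype]
  have hs : ∀ n t, P n t → ∃ t', P (n + 1) t' ∧ ∀ u, e 1 (t' u) = t u := by
    intro n t ht
    have hk : K - ((n + 1 : ℕ) : ℤ) + 1 = K - n := by push_cast; ring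
    have hb : Function.Bijective (f (K - (n + 1 : ℕ))) := by
      refine ⟨hf _ (by omega), ?_⟩
      refine (LinearMap.injective_iff_surjective_of_finrank_eq_finrank ?_).1 (hf _ (by omega))
      rw [hk, hconst, hconst]
    let g := LinearEquiv.ofBijective _ hb
    have htm : ∀ u, t u ∈ G (K - ((n + 1 : ℕ) : ℤ) + 1) := fun u => by
      rw [hk, ← ht.2]; exact ⟨u, rfl⟩
    have hg : ∀ u, e 1 (g.symm ⟨t u, htm u⟩ : M) = t u := fun u =>
      congrArg Subtype.val (g.apply_symm_apply ⟨t u, htm u⟩)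
    refine ⟨(G _).subtype ∘ₗ g.symm.toLinearMap ∘ₗ t.codRestrict _ htm, ⟨?_, ?_⟩, hg⟩
    · intro u v huv
      apply ht.1
      rw [← hg u, ← hg v]
      exact congrArg (e 1) huv
    · apply le_antisymm
      · rintro _ ⟨u, rfl⟩
        exact Subtype.mem _
      · intro v hv
        have h1 : e 1 v ∈ G (K - n) := by rw [← hk]; exact h.maps _ _ _ hv
        rw [← ht.2] at h1
        obtain ⟨u, hu⟩ := h1
        refine ⟨u, ?_⟩
        have : g.symm ⟨t u, htm u⟩ = ⟨v, hv⟩ := by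
          rw [LinearEquiv.symm_apply_eq]
          exact Subtype.ext hu
        exact congrArg Subtype.val this
  obtain ⟨t0, ht0⟩ := h0
  choose! nx hnx using hs
  let τ : ℕ → ((Fin D → ℂ) →ₗ[ℂ] M) := fun n => Nat.rec t0 (fun n t => nx n t) n
  have hτ : ∀ n, P n (τ n) := by
    intro n
    induction n with
    | zero => exact ht0
    | succ n ih => exact (hnx n _ ih).1
  exact ⟨D, K, τ, fun n => ⟨(hτ n).1, (hτ n).2, (hnx n _ (hτ n)).2⟩⟩
end WittFam
end WittFamily
end

noncomputable section

section WittLine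
open Filter Matrix
variable {M : Type} [AddCommGroup M] [Module ℂ M]

lemma exists_lift_mat {D : ℕ} (f : Module.End ℂ M) (t t' : (Fin D → ℂ) →ₗ[ℂ] M)
    (ht' : Function.Injective t') (hm : ∀ u, f (t u) ∈ LinearMap.range t') :
    ∃ E : Matrix (Fin D) (Fin D) ℂ, ∀ u, f (t u) = t' (E *ᵥ u) := by
  let g := (LinearEquiv.ofInjective t' ht').symm.toLinearMap ∘ₗ (f ∘ₗ t).codRestrict _ hm
  refine ⟨LinearMap.toMatrix' g, fun u => ?_⟩
  rw [LinearMap.toMatrix'_mulVec]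
  exact (congrArg Subtype.val ((LinearEquiv.ofInjective t' ht').apply_symm_apply ⟨_, hm u⟩)).symm

lemma mat_ext {D : ℕ} {A B : Matrix (Fin D) (Fin D) ℂ} (h : ∀ u, A *ᵥ u = B *ᵥ u) : A = B :=
  Matrix.toLin'.injective (LinearMap.ext fun u => by simpa using h u)

lemma norm_dominance {D : ℕ} (T : Fin 4 → Matrix (Fin D) (Fin D) ℂ) :
    ∃ R : ℝ, ∀ s : ℂ, R < ‖s‖ → ∀ w : Fin D → ℂ,
      (2 * s ^ 4) • w = ∑ i : Fin 4, s ^ (i : ℕ) • (T i *ᵥ w) → w = 0 := by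
  let c : Fin 4 → ℝ := fun i => ‖LinearMap.toContinuousLinearMap (Matrix.toLin' (T i))‖
  have hc : ∀ i w, ‖T i *ᵥ w‖ ≤ c i * ‖w‖ := fun i w =>
    (LinearMap.toContinuousLinearMap (Matrix.toLin' (T i))).le_opNorm w
  have hc0 : ∀ i, 0 ≤ c i := fun i => norm_nonneg _
  refine ⟨1 + ∑ i, c i, fun s hs w hw => ?_⟩
  by_contra hne
  have hw0 : 0 < ‖w‖ := norm_pos_iff.2 hne
  have hC : 0 ≤ ∑ i, c i := Finset.sum_nonneg fun i _ => hc0 i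
  set r := ‖s‖
  have hr : 1 ≤ r := by linarith
  have h1 : 2 * r ^ 4 * ‖w‖ ≤ ∑ i : Fin 4, r ^ 3 * (c i * ‖w‖) := by
    calc 2 * r ^ 4 * ‖w‖ = ‖(2 * s ^ 4) • w‖ := by rw [norm_smul]; simp [r]
      _ = ‖∑ i : Fin 4, s ^ (i : ℕ) • (T i *ᵥ w)‖ := by rw [hw]
      _ ≤ ∑ i : Fin 4, ‖s ^ (i : ℕ) • (T i *ᵥ w)‖ := norm_sum_le _ _
      _ ≤ _ := Finset.sum_le_sum fun i _ => by
        rw [norm_smul, norm_pow]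
        apply mul_le_mul _ (hc i w) (norm_nonneg _) (by positivity)
        exact pow_le_pow_right₀ hr (by omega)
  rw [← Finset.mul_sum, ← Finset.sum_mul] at h1
  have h2 : 0 < r ^ 3 * ‖w‖ := by positivity
  have h3 : r ^ 3 * ‖w‖ * (2 * r) ≤ r ^ 3 * ‖w‖ * (∑ i, c i) := by
    calc _ = 2 * r ^ 4 * ‖w‖ := by ring
      _ ≤ _ := h1
      _ = _ := by ring
  have := le_of_mul_le_mul_left h3 h2
  linarith

namespace WittFam
variable {e : ℤ → Module.End ℂ M} {a : ℂ} {G : ℤ → Submodule ℂ M}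

/-- A vector line on which the operators `e_1, e_{-1}, e_{-2}` act as in a tensor density module,
together with a trivialisation of the ambient components. -/
lemma exists_line_neg (h : WittFam e a G) {D : ℕ} {K : ℤ} (hD : 0 < D)
    {τ : ℕ → (Fin D → ℂ) →ₗ[ℂ] M} (hτ : ∀ n, Function.Injective (τ n) ∧
      LinearMap.range (τ n) = G (K - n) ∧ ∀ u, e 1 (τ (n + 1) u) = τ n u) :
    ∃ (A B : Matrix (Fin D) (Fin D) ℂ) (n0 : ℕ) (b : ℂ) (V : ℕ → M),
      (∀ n u, e (-1) (τ n u) = τ (n + 1) (((a + K - n) ^ 2 - (a + K - n)) • u + A *ᵥ u)) ∧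
      (∀ n u, e (-2) (τ n u) = τ (n + 2)
        (((a + K - n) * (a + K - n - 1) * (a + K - n - 2)) • u
          + (3 * (a + K - n)) • A *ᵥ u + B *ᵥ u)) ∧
      (∀ n, V n ≠ 0 ∧ V n ∈ G (K - n0 - n) ∧ e 1 (V (n + 1)) = (a + K - n0 - n - 1 + b) • V n ∧
        e (-1) (V n) = (a + K - n0 - n - b) • V (n + 1) ∧
        e (-2) (V n) = (a + K - n0 - n - 2 * b) • V (n + 2)) := by
  have mem : ∀ (n : ℕ) u, τ n u ∈ G (K - n) := fun n u => by rw [← (hτ n).2.1]; exact ⟨u, rfl⟩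
  have inj := fun n => (hτ n).1
  have z0 : ∀ n u, e 0 (τ n u) = (a + K - n) • τ n u := fun n u => by
    rw [h.zero _ _ (mem n u)]; push_cast; rw [add_sub_assoc]
  have ht : ∀ n u, e 1 (τ (n + 1) u) = τ n u := fun n => (hτ n).2.2
  have hE1 : ∀ n, ∃ E : Matrix (Fin D) (Fin D) ℂ, ∀ u, e (-1) (τ n u) = τ (n + 1) (E *ᵥ u) :=
    fun n => exists_lift_mat _ _ _ (inj _) fun u => by
      rw [(hτ _).2.1]
      have := h.maps (-1) _ _ (mem n u)
      rwa [show K - (n : ℤ) + -1 = K - (n + 1 : ℕ) by push_cast; ring] at this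
  have hE2 : ∀ n, ∃ E : Matrix (Fin D) (Fin D) ℂ, ∀ u, e (-2) (τ n u) = τ (n + 2) (E *ᵥ u) :=
    fun n => exists_lift_mat _ _ _ (inj _) fun u => by
      rw [(hτ _).2.1]
      have := h.maps (-2) _ _ (mem n u)
      rwa [show K - (n : ℤ) + -2 = K - (n + 2 : ℕ) by push_cast; ring] at this
  have hX : ∀ n, ∃ E : Matrix (Fin D) (Fin D) ℂ, ∀ u, e 2 (τ (n + 2) u) = τ n (E *ᵥ u) :=
    fun n => exists_lift_mat _ _ _ (inj _) fun u => by
      rw [(hτ _).2.1]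
      have := h.maps 2 _ _ (mem (n + 2) u)
      rwa [show K - ((n + 2 : ℕ) : ℤ) + 2 = K - n by push_cast; ring] at this
  choose E1 hE1 using hE1
  choose E2 hE2 using hE2
  choose X hX using hX
  have r1 : ∀ n, E1 (n + 1) = E1 n - (2 * (a + K - n - 1)) • 1 := fun n => mat_ext fun u => by
    apply inj (n + 1)
    have := h.swap 1 (-1) (τ (n + 1) u)
    rw [hE1, ht, ht, hE1] at this
    norm_num [z0] at this
    rw [this, sub_mulVec, smul_mulVec, one_mulVec, map_sub, map_smul]
    module
  have r2 : ∀ n, E2 (n + 1) = E2 n - (3 : ℂ) • E1 (n + 1) := fun n => mat_ext fun u => by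
    apply inj (n + 2)
    have := h.swap 1 (-2) (τ (n + 1) u)
    rw [hE2, ht, ht, hE2] at this
    norm_num [hE1] at this
    rw [this, sub_mulVec, smul_mulVec, map_sub, map_smul]
    module
  set κ : ℂ := a + K with hκ
  set A := E1 0 - (κ ^ 2 - κ) • 1 with hA
  set B := E2 0 - (κ * (κ - 1) * (κ - 2)) • 1 - (3 * κ) • A with hB
  have f1 : ∀ n : ℕ, E1 n = ((κ - n) ^ 2 - (κ - n)) • 1 + A := by
    intro n
    induction n with
    | zero => simp [hA]
    | succ n ih => rw [r1, ih]; push_cast; module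
  have f2 : ∀ n : ℕ, E2 n = ((κ - n) * (κ - n - 1) * (κ - n - 2)) • 1 + (3 * (κ - n)) • A + B := by
    intro n
    induction n with
    | zero => simp [hB]
    | succ n ih => rw [r2, ih, f1]; push_cast; module
  have g1 : ∀ (n : ℕ) u, E1 n *ᵥ u = ((κ - n) ^ 2 - (κ - n)) • u + A *ᵥ u := fun n u => by
    rw [f1, add_mulVec, smul_mulVec, one_mulVec]
  have g2 : ∀ (n : ℕ) u, E2 n *ᵥ u = ((κ - n) * (κ - n - 1) * (κ - n - 2)) • u
      + (3 * (κ - n)) • A *ᵥ u + B *ᵥ u := fun n u => by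
    rw [f2, add_mulVec, add_mulVec, smul_mulVec, smul_mulVec, one_mulVec]
  have sys : Sys A B X κ := by
    constructor
    · intro n
      have h1 : ev (κ - n) (p1 A 0) = E1 n := by rw [ev_p1, f1]; simp
      have h2 : ev (κ - n) (p1 A 2) = E1 (n + 2) := by rw [ev_p1, f1]; push_cast; module
      rw [h1, h2]
      refine mat_ext fun u => inj (n + 1) ?_
      have := h.swap (-1) 2 (τ (n + 2) u)
      rw [hX, hE1, hE1, hX] at this
      norm_num [ht] at this
      rw [sub_mulVec, map_sub, this, smul_mulVec, one_mulVec,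
        map_smul]
      module
    · intro n
      have h1 : ev (κ - n) (p2 A B 0) = E2 n := by rw [ev_p2, f2]; simp
      have h2 : ev (κ - n) (p2 A B 2) = E2 (n + 2) := by rw [ev_p2, f2]; push_cast; module
      rw [h1, h2]
      refine mat_ext fun u => inj (n + 2) ?_
      have := h.swap (-2) 2 (τ (n + 2) u)
      rw [hX, hE2, hE2, hX] at this
      norm_num [z0] at this
      rw [sub_mulVec, map_sub, this, smul_mulVec, one_mulVec,
        map_smul]
      module
  have : Nonempty (Fin D) := ⟨⟨0, hD⟩⟩
  obtain ⟨z, u, hu, hz1, hz2⟩ := common_vec sys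
  rw [ev_p1, sub_zero, add_mulVec, smul_mulVec, one_mulVec] at hz1
  rw [ev_p2, sub_zero, add_mulVec, add_mulVec, smul_mulVec, one_mulVec, smul_mulVec] at hz2
  have hAu : A *ᵥ u = -(z ^ 2 - z) • u := by
    linear_combination (norm := module) hz1
  have hBu : B *ᵥ u = (3 * z * (z ^ 2 - z) - z * (z - 1) * (z - 2)) • u := by
    rw [hAu] at hz2
    linear_combination (norm := module) hz2
  obtain ⟨n0, hn0⟩ : ∃ n0 : ℕ, ∀ n : ℕ, κ - n0 - n - z ≠ 0 := by
    refine ⟨⌈(κ - z).re⌉₊ + 1, fun n hc => ?_⟩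
    have h1 := Nat.le_ceil (κ - z).re
    have h2 := congrArg Complex.re hc
    have h3 : (0 : ℝ) ≤ n := Nat.cast_nonneg n
    simp only [Complex.sub_re, Complex.natCast_re, Complex.zero_re] at h1 h2
    push_cast at h2
    simp at h1 h2
    linarith
  refine ⟨A, B, n0, 1 - z, fun n => (∏ i ∈ Finset.range n, (κ - n0 - i - z)) • τ (n0 + n) u,
    fun n u => by rw [hE1, g1], fun n u => by rw [hE2, g2], fun n => ⟨?_, ?_, ?_, ?_, ?_⟩⟩
  · refine smul_ne_zero (Finset.prod_ne_zero_iff.2 fun i _ => hn0 i) fun h0 => hu ?_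
    exact inj _ (by rw [h0, map_zero])
  · have := mem (n0 + n) u
    rw [show K - ((n0 + n : ℕ) : ℤ) = K - n0 - n by push_cast; ring] at this
    exact Submodule.smul_mem _ _ this
  · rw [map_smul, ← add_assoc, ht, Finset.prod_range_succ, smul_smul]
    congr 1; ring
  · rw [map_smul, hE1, g1, hAu, map_add, map_smul, map_smul, ← add_smul, smul_smul, smul_smul,
      Finset.prod_range_succ, add_assoc n0 n 1]
    congr 1; push_cast; ring
  · rw [map_smul, hE2, g2, hBu, hAu, map_add, map_add, smul_smul, map_smul, map_smul, map_smul,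
      ← add_smul, ← add_smul, smul_smul, smul_smul,
      Finset.prod_range_succ, Finset.prod_range_succ, add_assoc n0 n 2]
    congr 1; push_cast; ring

/-- A nonzero line on which the whole Witt algebra acts as in a tensor density module. -/
lemma exists_line (h : WittFam e a G) {D : ℕ} {K : ℤ} (hD : 0 < D)
    {τ : ℕ → (Fin D → ℂ) →ₗ[ℂ] M} (hτ : ∀ n, Function.Injective (τ n) ∧
      LinearMap.range (τ n) = G (K - n) ∧ ∀ u, e 1 (τ (n + 1) u) = τ n u) :
    ∃ (L : ℤ) (b : ℂ) (v : ℤ → M), ∀ k ≤ L, v k ≠ 0 ∧ v k ∈ G k ∧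
      ∀ x, k + x ≤ L → e x (v k) = (a + k + b * x) • v (k + x) := by
  obtain ⟨A, B, n0, b, V, g1, g2, hV⟩ := h.exists_line_neg hD hτ
  set s : ℕ → ℂ := fun n => a + K - n0 - n with hs
  have hs1 : ∀ n, s (n + 1) = s n - 1 := fun n => by simp only [hs]; push_cast; ring
  have hs2 : ∀ n, s (n + 2) = s n - 2 := fun n => by simp only [hs]; push_cast; ring
  have k1 : ∀ n, e 1 (V (n + 1)) = (s n - 1 + b) • V n := fun n => (hV n).2.2.1
  have k2 : ∀ n, e (-1) (V n) = (s n - b) • V (n + 1) := fun n => (hV n).2.2.2.1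
  have k3 : ∀ n, e (-2) (V n) = (s n - 2 * b) • V (n + 2) := fun n => (hV n).2.2.2.2
  have k0 : ∀ n, e 0 (V n) = s n • V n := fun n => by
    rw [h.zero _ _ (hV n).2.1]; simp only [hs]; push_cast; congr 1; ring
  set w : ℕ → M := fun n => e 2 (V (n + 2)) - (s n - 2 + 2 * b) • V n with hw
  have hw1 : ∀ n, e (-1) (w n) = (s n - 2 - b) • w (n + 1) := fun n => by
    have h1 := h.swap (-1) 2 (V (n + 2))
    rw [k2] at h1
    norm_num [k1, hs2, hs1] at h1
    simp only [hw, map_sub, map_smul, h1, k2, hs1]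
    module
  have hw2 : ∀ n, e (-2) (w n) = (s n - 2 - 2 * b) • w (n + 2) := fun n => by
    have h1 := h.swap (-2) 2 (V (n + 2))
    rw [k3] at h1
    norm_num [k0, hs2, hs1] at h1
    simp only [hw, map_sub, map_smul, h1, k3, hs2]
    module
  have hwm : ∀ n, ∃ o, w n = τ (n0 + n) o := fun n => by
    have h1 := (hV n).2.1
    have h2 := h.maps 2 _ _ (hV (n + 2)).2.1
    rw [show K - n0 - ((n + 2 : ℕ) : ℤ) + 2 = K - n0 - n by push_cast; ring] at h2
    have : w n ∈ G (K - n0 - n) := Submodule.sub_mem _ h2 (Submodule.smul_mem _ _ h1)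
    rw [show K - n0 - (n : ℤ) = K - (n0 + n : ℕ) by push_cast; ring, ← (hτ _).2.1] at this
    obtain ⟨o, ho⟩ := this
    exact ⟨o, ho.symm⟩
  choose o ho using hwm
  have ho1 : ∀ n, (s n ^ 2 - s n) • o n + A *ᵥ o n = (s n - 2 - b) • o (n + 1) := fun n => by
    have := hw1 n
    rw [ho, ho, g1, ← map_smul, add_assoc] at this
    rw [← (hτ _).1 this]
    simp only [hs]; push_cast; simp only [sub_sub]
  have ho2 : ∀ n, (s n * (s n - 1) * (s n - 2)) • o n + (3 * s n) • A *ᵥ o n + B *ᵥ o n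
      = (s n - 2 - 2 * b) • o (n + 2) := fun n => by
    have := hw2 n
    rw [ho, ho, g2, ← map_smul, add_assoc] at this
    rw [← (hτ _).1 this]
    simp only [hs]; push_cast; simp only [← sub_sub]
  obtain ⟨R, hR⟩ := norm_dominance ![(4 + 4 * b) • A + (2 + 2 * b) • (A * A) + ((2 + b) * (3 + b)) • B,
    (-2 * (2 + 2 * b - (2 + b) * (3 + b))) • (1 : Matrix (Fin D) (Fin D) ℂ)
      - (2 + 4 * (2 + 2 * b) - 3 * (2 + b) * (3 + b)) • A - A * A - (5 + 2 * b) • B,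
    (-(4 - 3 * (2 + 2 * b - (2 + b) * (3 + b)))) • (1 : Matrix (Fin D) (Fin D) ℂ)
      - (-4 - 2 * (2 + 2 * b) + 3 * (5 + 2 * b)) • A + B,
    (-((2 + 2 * b - (2 + b) * (3 + b)) - 6)) • (1 : Matrix (Fin D) (Fin D) ℂ) + A]
  have hwz : ∀ᶠ n in atTop, w n = 0 := by
    have hlim : ∀ᶠ n : ℕ in atTop, R < ‖s n‖ := by
      filter_upwards [(tendsto_natCast_atTop_atTop (R := ℝ)).eventually_gt_atTop
        (R + ‖a + K - n0‖)] with n hn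
      have := norm_sub_norm_le (n : ℂ) (a + K - n0)
      rw [Complex.norm_natCast] at this
      have hsn : s n = -((n : ℂ) - (a + K - n0)) := by simp only [hs]; ring
      rw [hsn, norm_neg]; linarith
    filter_upwards [hlim] with n hn
    rw [ho, hR _ hn (o n) ?_, map_zero]
    have q1 := ho1 n
    have q2 := congrArg (fun u => A *ᵥ u) q1
    have q3 := ho1 (n + 1)
    have q4 := ho2 n
    simp only [mulVec_add, mulVec_smul, mulVec_mulVec] at q2
    rw [hs1] at q3
    simp only [Fin.sum_univ_four]
    simp [add_mulVec, sub_mulVec, smul_mulVec, neg_mulVec]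
    linear_combination (norm := (ring_nf; module))
      ((s n - 2 - 2 * b) * ((s n - 1) ^ 2 - (s n - 1))) • q1 + (s n - 2 - 2 * b) • q2
       + ((s n - 2 - 2 * b) * (s n - 2 - b)) • q3 - ((s n - 2 - b) * (s n - 3 - b)) • q4
  obtain ⟨n1, hn1⟩ := eventually_atTop.1 hwz
  set v : ℤ → M := fun k => V (K - n0 - k).toNat with hv
  have hvn : ∀ k ≤ K - n0, ∃ n : ℕ, k = K - n0 - n ∧ v k = V n ∧ s n = a + k := fun k hk => by
    refine ⟨(K - n0 - k).toNat, by omega, rfl, ?_⟩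
    have : (((K - n0 - k).toNat : ℤ) : ℂ) = ((K - n0 - k : ℤ) : ℂ) := by
      rw [Int.toNat_of_nonneg (by omega)]
    simp only [hs]; push_cast at this; rw [this]; ring
  have hvk : ∀ n : ℕ, ∀ k : ℤ, k = K - n0 - n → v k = V n := fun n k hk => by
    simp only [hv]; congr 1; omega
  have t1 : ∀ k ≤ K - n0 - 1, e 1 (v k) = (a + k + b) • v (k + 1) := fun k hk => by
    obtain ⟨n, hn, hn', hsn⟩ := hvn k (by omega)
    obtain ⟨m, rfl⟩ : ∃ m, n = m + 1 := ⟨n - 1, by omega⟩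
    rw [hn', k1, hvk m (k + 1) (by push_cast at hn; omega), ← hsn, hs1]
  have tm1 : ∀ k ≤ K - n0, e (-1) (v k) = (a + k - b) • v (k + -1) := fun k hk => by
    obtain ⟨n, hn, hn', hsn⟩ := hvn k (by omega)
    rw [hn', k2, hvk (n + 1) (k + -1) (by push_cast; omega), ← hsn]
  have tm2 : ∀ k ≤ K - n0, e (-2) (v k) = (a + k - 2 * b) • v (k + -2) := fun k hk => by
    obtain ⟨n, hn, hn', hsn⟩ := hvn k (by omega)
    rw [hn', k3, hvk (n + 2) (k + -2) (by push_cast; omega), ← hsn]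
  have t2 : ∀ k ≤ K - n0 - n1 - 2, e 2 (v k) = (a + k + 2 * b) • v (k + 2) := fun k hk => by
    obtain ⟨n, hn, hn', hsn⟩ := hvn k (by omega)
    obtain ⟨m, rfl⟩ : ∃ m, n = m + 2 := ⟨n - 2, by omega⟩
    have := sub_eq_zero.1 (hn1 m (by omega))
    rw [hn', this, hvk m (k + 2) (by push_cast at hn; omega), ← hsn, hs2]
  refine ⟨K - n0 - n1, b, v, fun k hk => ?_⟩
  obtain ⟨n, hn, hn', hsn⟩ := hvn k (by omega)
  refine ⟨by rw [hn']; exact (hV n).1, by rw [hn', hn]; exact (hV n).2.1, ?_⟩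
  have hpos : ∀ x : ℕ, 2 ≤ x → ∀ k : ℤ, k + x ≤ K - n0 - n1 →
      e x (v k) = (a + k + b * x) • v (k + x) := by
    intro x hx
    induction x, hx using Nat.le_induction with
    | base => intro k hk; push_cast at hk ⊢; rw [t2 k (by omega), mul_comm b]
    | succ x hx ih =>
      intro k hk
      push_cast at hk
      have h1 := h.swap 1 x (v k)
      rw [ih k (by omega), t1 k (by omega), map_smul, map_smul, ih (k + 1) (by omega),
        t1 (k + x) (by omega)] at h1
      have hx1 : (x : ℂ) - 1 ≠ 0 := sub_ne_zero.2 (by exact_mod_cast (by omega : x ≠ 1))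
      apply smul_right_injective M hx1
      simp only
      rw [show k + 1 + (x : ℤ) = k + (x + 1) by ring, show k + (x : ℤ) + 1 = k + (x + 1) by ring,
        show (1 : ℤ) + x = x + 1 by ring] at h1
      push_cast at h1 ⊢
      linear_combination (norm := module) -h1
  have hneg : ∀ x : ℕ, 2 ≤ x → ∀ k : ℤ, k ≤ K - n0 →
      e (-x) (v k) = (a + k - b * x) • v (k + -x) := by
    intro x hx
    induction x, hx using Nat.le_induction with
    | base => intro k hk; push_cast at hk ⊢; rw [tm2 k (by omega), mul_comm b]
    | succ x hx ih =>
      intro k hk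
      have h1 := h.swap (-1) (-x) (v k)
      rw [ih k (by omega), tm1 k (by omega), map_smul, map_smul, ih (k + -1) (by omega),
        tm1 (k + -x) (by omega)] at h1
      have hx1 : (x : ℂ) - 1 ≠ 0 := sub_ne_zero.2 (by exact_mod_cast (by omega : x ≠ 1))
      apply smul_right_injective M hx1
      simp only
      rw [show k + -1 + -(x : ℤ) = k + -(x + 1) by ring, show k + -(x : ℤ) + -1 = k + -(x + 1) by ring,
        show (-1 : ℤ) + -x = -(x + 1) by ring] at h1
      push_cast at h1 ⊢
      linear_combination (norm := module) h1
  intro x hx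
  obtain ⟨y, rfl | rfl⟩ := Int.eq_nat_or_neg x
  · rcases y with _ | _ | y
    · simp [hn', k0, hsn]
    · simpa using t1 k (by simpa using (by push_cast at hx; omega))
    · exact_mod_cast hpos (y + 2) (by omega) k hx
  · rcases y with _ | _ | y
    · simp [hn', k0, hsn]
    · simpa [sub_eq_add_neg] using tm1 k (by omega)
    · have := hneg (y + 2) (by omega) k (by omega)
      rw [this]; push_cast; congr 1; ring
end WittFam
end WittLine
end

noncomputable section

open Filter

section Omega
variable {M : Type} [AddCommGroup M] [Module ℂ M]

lemma diag_sub_mem {H : ℤ × ℤ → M} {S : Submodule ℂ M} {t : ℤ}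
    (h : ∀ y : ℤ × ℤ, y.1 + y.2 = t → H (y + (0, 1)) - H (y + (1, 0)) ∈ S) (z z' : ℤ × ℤ)
    (hz : z.1 + z.2 = t + 1) (hz' : z'.1 + z'.2 = t + 1) : H z - H z' ∈ S := by
  have key : ∀ j : ℤ, H (0, t + 1) - H (j, t + 1 - j) ∈ S := by
    intro j
    induction j using Int.induction_on with
    | zero => simp
    | succ i ih =>
      have := h (i, t - i) (by simp)
      simp only [Prod.mk_add_mk, add_zero] at this
      have h2 := S.add_mem ih this
      rw [show t - (i : ℤ) + 1 = t + 1 - i by ring, sub_add_sub_cancel] at h2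
      rwa [show t + 1 - ((i : ℤ) + 1) = t - i by ring]
    | pred i ih =>
      have := h (-(i : ℤ) - 1, t - (-(i : ℤ) - 1)) (by simp)
      simp only [Prod.mk_add_mk, add_zero] at this
      have h2 := S.sub_mem ih this
      rw [show -(i : ℤ) - 1 + 1 = -i by ring, show t - (-(i : ℤ) - 1) = t + 1 - (-(i : ℤ)) by ring,
        show t + 1 - -(i : ℤ) + 1 = t + 1 - (-(i : ℤ) - 1) by ring] at h2
      convert h2 using 1; abel
  obtain ⟨p, q⟩ := z
  obtain ⟨p', q'⟩ := z'
  simp only at hz hz'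
  obtain rfl : q = t + 1 - p := by omega
  obtain rfl : q' = t + 1 - p' := by omega
  have := S.sub_mem (key p') (key p)
  convert this using 1; abel

lemma sh_dl (F : ℤ × ℤ → M) (x : ℤ × ℤ) : sh _ M dl F x = F (x + (0, 1)) - F (x + (1, 0)) := by
  simp [dl, sh_sg]

lemma sh_dl_succ (m : ℕ) (F : ℤ × ℤ → M) (x : ℤ × ℤ) : sh _ M (dl ^ (m + 1)) F x
    = sh _ M (dl ^ m) F (x + (0, 1)) - sh _ M (dl ^ m) F (x + (1, 0)) := by
  rw [pow_succ', map_mul, Module.End.mul_apply, sh_dl]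

lemma sh_trans (p : AddMonoidAlgebra ℂ (ℤ × ℤ)) (F : ℤ × ℤ → M) (g x : ℤ × ℤ) :
    sh _ M p (fun y => F (y + g)) x = sh _ M p F (x + g) := by
  have : (fun y => F (y + g)) = sh _ M (sg g) F := by ext y; rw [sh_sg]
  rw [this, ← Module.End.mul_apply, ← map_mul, mul_comm, map_mul, Module.End.mul_apply, sh_sg]

lemma sh_dl_fst (m : ℕ) (c : ℂ) (F : ℤ × ℤ → M) (x : ℤ × ℤ) :
    sh _ M (dl ^ (m + 1)) (fun y => ((y.1 : ℂ) - c) • F y) x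
      = ((x.1 : ℂ) - c) • sh _ M (dl ^ (m + 1)) F x
        - ((m : ℂ) + 1) • sh _ M (dl ^ m) F (x + (1, 0)) := by
  induction m generalizing x with
  | zero => simp [sh_dl]; module
  | succ m ih =>
    rw [sh_dl_succ (m + 1), ih, ih, sh_dl_succ (m + 1), sh_dl_succ m _ (x + (1, 0)),
      add_right_comm x (0, 1) (1, 0)]
    simp only [Prod.fst_add]; push_cast
    module

lemma sh_dl_snd (m : ℕ) (c : ℂ) (F : ℤ × ℤ → M) (x : ℤ × ℤ) :
    sh _ M (dl ^ (m + 1)) (fun y => ((y.2 : ℂ) - c) • F y) x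
      = ((x.2 : ℂ) - c) • sh _ M (dl ^ (m + 1)) F x
        + ((m : ℂ) + 1) • sh _ M (dl ^ m) F (x + (0, 1)) := by
  induction m generalizing x with
  | zero => simp [sh_dl]; module
  | succ m ih =>
    rw [sh_dl_succ (m + 1), ih, ih, sh_dl_succ (m + 1), sh_dl_succ m _ (x + (0, 1)),
      add_right_comm x (0, 1) (1, 0)]
    simp only [Prod.snd_add]; push_cast
    module

lemma sh_dl_three (F : ℤ × ℤ → M) (x : ℤ × ℤ) : sh _ M (dl ^ 3) F x
    = F (x + (0, 3)) - (3 : ℂ) • F (x + (1, 2)) + (3 : ℂ) • F (x + (2, 1)) - F (x + (3, 0)) := by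
  have h : ∀ g : ℤ × ℤ, sh _ M (dl ^ 0) F g = F g := by intro g; simp
  simp only [sh_dl_succ 2, sh_dl_succ 1, sh_dl_succ 0, h, add_assoc, Prod.mk_add_mk]
  norm_num
  module

variable {e : ℤ → Module.End ℂ M} {a : ℂ} {G : ℤ → Submodule ℂ M}

lemma WittFam.comm_sh (h : WittFam e a G) (m : ℕ) (p : ℤ) (w : M) (x : ℤ × ℤ) :
    e p (sh _ M (dl ^ (m + 1)) (quad e w) x) = sh _ M (dl ^ (m + 1)) (quad e (e p w)) x
      + (x.1 - p : ℂ) • sh _ M (dl ^ (m + 1)) (quad e w) (x + (p, 0))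
      + (x.2 - p : ℂ) • sh _ M (dl ^ (m + 1)) (quad e w) (x + (0, p))
      + ((m : ℂ) + 1) • (sh _ M (dl ^ m) (quad e w) (x + (0, p + 1))
          - sh _ M (dl ^ m) (quad e w) (x + (p + 1, 0))) := by
  have hF : (fun y => e p (quad e w y)) = quad e (e p w)
      + (fun y : ℤ × ℤ => ((y.1 : ℂ) - p) • (fun z => quad e w (z + (p, 0))) y)
      + (fun y : ℤ × ℤ => ((y.2 : ℂ) - p) • (fun z => quad e w (z + (0, p))) y) := by
    ext y
    simp only [quad, Pi.add_apply, Prod.fst_add, Prod.snd_add, add_zero]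
    rw [h.swap p y.1, h.swap p y.2, map_add, map_smul, add_comm p y.1, add_comm p y.2]
    abel
  rw [← sh_lin, hF, map_add, map_add, Pi.add_apply, Pi.add_apply, sh_dl_fst, sh_dl_snd]
  simp only [sh_trans, add_assoc, Prod.mk_add_mk, add_zero]
  rw [add_comm 1 p]
  module

end Omega

section LineMod
variable {M : Type} [AddCommGroup M] [Module ℂ M]

/-- The vectors `e_{p₁} ⋯ e_{p_r} v_k` with all `p_i > 0`, together with their degree. -/
inductive InLine (e : ℤ → Module.End ℂ M) (v : ℤ → M) (L : ℤ) : ℤ → M → Prop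
  | base (k : ℤ) : k ≤ L → InLine e v L k (v k)
  | step (k : ℤ) (w : M) (p : ℤ) : 0 < p → InLine e v L k w → InLine e v L (k + p) (e p w)

/-- The graded pieces of the submodule generated by the line `v`. -/
def lineSp (e : ℤ → Module.End ℂ M) (v : ℤ → M) (L k : ℤ) : Submodule ℂ M :=
  Submodule.span ℂ {w | InLine e v L k w}

/-- The graded pieces of the span of the values of third differences on `lineSp`. -/
def diffSp (e : ℤ → Module.End ℂ M) (v : ℤ → M) (L k : ℤ) : Submodule ℂ M :=
  Submodule.span ℂ {u | ∃ j, ∃ w ∈ lineSp e v L j, ∃ x : ℤ × ℤ, j + x.1 + x.2 + 3 = k ∧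
    sh _ M (dl ^ 3) (quad e w) x = u}

variable {e : ℤ → Module.End ℂ M} {a b : ℂ} {G : ℤ → Submodule ℂ M} {v : ℤ → M} {L : ℤ}

lemma sh_mem_diffSp {k j : ℤ} {w : M} (hw : w ∈ lineSp e v L j) (x : ℤ × ℤ)
    (hk : j + x.1 + x.2 + 3 = k) : sh _ M (dl ^ 3) (quad e w) x ∈ diffSp e v L k :=
  Submodule.subset_span ⟨j, w, hw, x, hk, rfl⟩

lemma WittFam.lineSp_le (h : WittFam e a G) (hv : ∀ k ≤ L, v k ∈ G k) (k : ℤ) :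
    lineSp e v L k ≤ G k := by
  refine Submodule.span_le.2 fun w hw => ?_
  induction hw with
  | base k hk => exact hv k hk
  | step k w p hp _ ih => exact h.maps _ _ _ ih

lemma lineSp_step {k p : ℤ} (hp : 0 < p) {w : M} (hw : w ∈ lineSp e v L k) :
    e p w ∈ lineSp e v L (k + p) := by
  have : lineSp e v L k ≤ (lineSp e v L (k + p)).comap (e p) :=
    Submodule.span_le.2 fun w hw => Submodule.subset_span (InLine.step _ _ _ hp hw)
  exact this hw

lemma WittFam.lineSp_maps (h : WittFam e a G)
    (hl : ∀ k ≤ L, ∀ x, k + x ≤ L → e x (v k) = (a + k + b * x) • v (k + x)) (x k : ℤ) (w : M)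
    (hw : w ∈ lineSp e v L k) : e x w ∈ lineSp e v L (k + x) := by
  have : lineSp e v L k ≤ (lineSp e v L (k + x)).comap (e x) := by
    refine Submodule.span_le.2 fun w hw => ?_
    rw [SetLike.mem_coe, Submodule.mem_comap]
    clear * - hw hl h
    induction hw generalizing x with
    | base k hk =>
      by_cases hx : 0 < x
      · exact lineSp_step hx (Submodule.subset_span (.base k hk))
      · rw [hl k hk x (by omega)]
        exact Submodule.smul_mem _ _ (Submodule.subset_span (.base _ (by omega)))
    | step k w p hp hw ih =>
      rw [h.swap]
      refine Submodule.add_mem _ ?_ (Submodule.smul_mem _ _ ?_)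
      · have := lineSp_step hp (ih x)
        rwa [add_right_comm] at this
      · have := ih (x + p)
        rwa [← add_assoc, add_right_comm] at this
  exact this hw

lemma WittFam.diffSp_le (h : WittFam e a G) (hv : ∀ k ≤ L, v k ∈ G k) (k : ℤ) :
    diffSp e v L k ≤ G k := by
  refine Submodule.span_le.2 ?_
  rintro _ ⟨j, w, hw, x, rfl, rfl⟩
  have hq : ∀ g : ℤ × ℤ, g.1 + g.2 = 3 → quad e w (x + g) ∈ G (j + x.1 + x.2 + 3) := by
    intro g hg
    have := h.maps (x + g).1 _ _ (h.maps (x + g).2 _ _ (h.lineSp_le hv _ hw))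
    change e _ (e _ w) ∈ _
    convert this using 2
    simp only [Prod.fst_add, Prod.snd_add]; omega
  rw [SetLike.mem_coe, sh_dl_three]
  exact sub_mem (add_mem (sub_mem (hq _ (by simp)) (Submodule.smul_mem _ _ (hq _ (by simp))))
    (Submodule.smul_mem _ _ (hq _ (by simp)))) (hq _ (by simp))

lemma WittFam.diffSp_maps (h : WittFam e a G)
    (hl : ∀ k ≤ L, ∀ x, k + x ≤ L → e x (v k) = (a + k + b * x) • v (k + x)) (p k : ℤ) (u : M)
    (hu : u ∈ diffSp e v L k) : e p u ∈ diffSp e v L (k + p) := by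
  have : diffSp e v L k ≤ (diffSp e v L (k + p)).comap (e p) := by
    refine Submodule.span_le.2 ?_
    rintro _ ⟨j, w, hw, x, rfl, rfl⟩
    rw [SetLike.mem_coe, Submodule.mem_comap, h.comm_sh 2]
    refine add_mem (add_mem (add_mem (sh_mem_diffSp (h.lineSp_maps hl p _ _ hw) x (by ring))
      (Submodule.smul_mem _ _ (sh_mem_diffSp hw _ (by simp; ring))))
      (Submodule.smul_mem _ _ (sh_mem_diffSp hw _ (by simp; ring)))) (Submodule.smul_mem _ _ ?_)
    refine diag_sub_mem (t := x.1 + x.2 + p) (fun y hy => ?_) _ _ (by simp; ring) (by simp; ring)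
    rw [← sh_dl_succ]
    exact sh_mem_diffSp hw _ (by omega)
  exact this hu

lemma WittFam.quad_line (h : WittFam e a G)
    (hl : ∀ k ≤ L, ∀ x, k + x ≤ L → e x (v k) = (a + k + b * x) • v (k + x)) {k : ℤ} (hk : k ≤ L)
    (x y : ℤ) (hxy : k + x + y ≤ L) :
    e x (e y (v k)) = ((a + k + b * y) * (a + k + y + b * x)) • v (k + x + y) := by
  by_cases hy : k + y ≤ L
  · rw [hl k hk y hy, map_smul, hl _ hy x (by omega), smul_smul, add_right_comm k y x]
    congr 2; push_cast; ring
  · have hx : k + x ≤ L := by omega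
    rw [h.swap, hl k hk x hx, map_smul, hl _ hx y (by omega), hl k hk (x + y) (by omega), ← add_assoc]
    push_cast
    module

lemma WittFam.diffSp_eq_bot (h : WittFam e a G)
    (hl : ∀ k ≤ L, ∀ x, k + x ≤ L → e x (v k) = (a + k + b * x) • v (k + x)) {k : ℤ} (hk : k ≤ L) :
    diffSp e v L k = ⊥ := by
  have key : ∀ j w, InLine e v L j w → ∀ x : ℤ × ℤ, j + x.1 + x.2 + 3 ≤ L →
      sh _ M (dl ^ 3) (quad e w) x = 0 := by
    intro j w hw
    induction hw with
    | base j hj =>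
      rintro ⟨x, y⟩ hx
      simp only at hx
      rw [sh_dl_three]
      simp only [quad, Prod.mk_add_mk]
      rw [h.quad_line hl hj _ _ (by omega), h.quad_line hl hj _ _ (by omega),
        h.quad_line hl hj _ _ (by omega), h.quad_line hl hj _ _ (by omega)]
      rw [show j + (x + 0) + (y + 3) = j + x + y + 3 by ring,
        show j + (x + 1) + (y + 2) = j + x + y + 3 by ring,
        show j + (x + 2) + (y + 1) = j + x + y + 3 by ring,
        show j + (x + 3) + (y + 0) = j + x + y + 3 by ring]
      push_cast
      module
    | step j w p hp hw ih =>
      intro x hx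
      have h1 := h.comm_sh 2 p w x
      rw [ih x (by omega), ih (x + (p, 0)) (by simp; omega), ih (x + (0, p)) (by simp; omega)] at h1
      have h2 : sh _ M (dl ^ 2) (quad e w) (x + (0, p + 1))
          - sh _ M (dl ^ 2) (quad e w) (x + (p + 1, 0)) ∈ (⊥ : Submodule ℂ M) := by
        refine diag_sub_mem (t := x.1 + x.2 + p) (fun y hy => ?_) _ _ (by simp; ring) (by simp; ring)
        rw [← sh_dl_succ, Submodule.mem_bot]
        exact ih _ (by omega)
      rw [Submodule.mem_bot] at h2
      rw [h2] at h1
      simpa using h1.symm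
  rw [diffSp, Submodule.span_eq_bot]
  rintro _ ⟨j, w, hw, x, rfl, rfl⟩
  have : lineSp e v L j ≤ LinearMap.ker (LinearMap.proj x ∘ₗ sh _ M (dl ^ 3) ∘ₗ
      (LinearMap.pi fun p => e p.1 ∘ₗ e p.2)) :=
    Submodule.span_le.2 fun w hw => key j w hw x hk
  exact this hw

end LineMod

section Induction
open Module

/-- Every graded Witt module whose dimensions are eventually at most `d` (resp. `d'`) in degrees
tending to `-∞` (resp. `+∞`) is killed by a fixed power of the difference operator. -/
def DiffBound (d d' : ℕ) : Prop :=
  ∃ m ≥ 1, ∀ (M : Type) [AddCommGroup M] [Module ℂ M] (e : ℤ → Module.End ℂ M) (a : ℂ)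
    (G : ℤ → Submodule ℂ M), WittFam e a G → (∀ᶠ k in atBot, finrank ℂ (G k) ≤ d) →
    (∀ᶠ k in atTop, finrank ℂ (G k) ≤ d') → ∀ k, ∀ v ∈ G k, sh _ M (dl ^ m) (quad e v) = 0

lemma sh_pow_mono {M : Type} [AddCommGroup M] [Module ℂ M] {m m' : ℕ} (hm : m ≤ m')
    {F : ℤ × ℤ → M} (h : sh _ M (dl ^ m) F = 0) : sh _ M (dl ^ m') F = 0 :=
  sh_dvd_zero h (pow_dvd_pow _ hm)

lemma quad_ker_iSup {M : Type} [AddCommGroup M] [Module ℂ M] {e : ℤ → Module.End ℂ M}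
    {p : AddMonoidAlgebra ℂ (ℤ × ℤ)} {A : ℤ → Submodule ℂ M}
    (h : ∀ k, ∀ v ∈ A k, sh _ M p (quad e v) = 0) (v : M) (hv : v ∈ ⨆ k, A k) :
    sh _ M p (quad e v) = 0 := by
  have : ⨆ k, A k ≤ LinearMap.ker (sh _ M p ∘ₗ (LinearMap.pi fun p => e p.1 ∘ₗ e p.2)) :=
    iSup_le fun k v hv => h k v hv
  exact this hv

lemma diffBound_zero : DiffBound 0 0 := by
  refine ⟨1, le_rfl, fun M _ _ e a G h h1 h2 k v hv => ?_⟩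
  obtain ⟨K1, hK1⟩ := eventually_atBot.1 h1
  obtain ⟨K2, hK2⟩ := eventually_atTop.1 h2
  have fdi := h.fd
  have z1 : ∀ k ≤ K1, ∀ v ∈ G k, v = 0 := fun k hk v hv => by
    have := Submodule.finrank_eq_zero.1 (Nat.le_zero.1 (hK1 k hk))
    rw [this] at hv; simpa using hv
  have z2 : ∀ k ≥ K2, ∀ v ∈ G k, v = 0 := fun k hk v hv => by
    have := Submodule.finrank_eq_zero.1 (Nat.le_zero.1 (hK2 k hk))
    rw [this] at hv; simpa using hv
  have hz : ∀ y, e y v = 0 := by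
    intro y
    obtain ⟨x, hx⟩ : ∃ x : ℤ, K2 ≤ k + x ∧ k + (y - x) ≤ K1 ∧ y < 2 * x :=
      ⟨|K2 - k| + |k + y - K1| + |y| + 1, by
        have := le_abs_self (K2 - k); have := le_abs_self (k + y - K1); have := le_abs_self y
        have := abs_nonneg (K2 - k); have := abs_nonneg (k + y - K1); have := abs_nonneg y
        omega⟩
    have := h.swap x (y - x) v
    rw [z1 _ hx.2.1 _ (h.maps (y - x) k v hv), z2 _ hx.1 _ (h.maps x k v hv), map_zero, map_zero,
      zero_add, add_sub_cancel] at this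
    refine (smul_eq_zero.1 this.symm).resolve_left ?_
    intro h0
    have : (y - x - x : ℤ) = 0 := by exact_mod_cast h0
    omega
  have : quad e v = 0 := by ext x; simp [quad, hz]
  rw [this, map_zero]

lemma diffBound_step {d d' : ℕ} (h1 : DiffBound d d') (h0 : DiffBound 0 d') :
    DiffBound (d + 1) d' := by
  obtain ⟨m, hm, H⟩ := h1
  obtain ⟨m0, hm0, H0⟩ := h0
  set m1 := max 3 m0 with hm1
  set m2 := max m (4 * m1) with hm2
  refine ⟨4 * m2, by omega, fun M _ _ e a G h hbot htop k v hv => ?_⟩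
  obtain ⟨D, K, τ, hτ⟩ := h.exists_triv hbot
  have fdi := h.fd
  rcases Nat.eq_zero_or_pos D with rfl | hD
  · refine sh_pow_mono (show m ≤ 4 * m2 by omega) (H M e a G h ?_ htop k v hv)
    refine eventually_atBot.2 ⟨K, fun k hk => ?_⟩
    have := (hτ (K - k).toNat).2.1
    rw [show K - ((K - k).toNat : ℤ) = k by omega] at this
    have hr := LinearMap.finrank_range_le (τ (K - k).toNat)
    rw [this] at hr
    simp at hr
    rw [Submodule.finrank_eq_zero.2 hr]
    exact Nat.zero_le _
  obtain ⟨L, b, w, hw⟩ := h.exists_line hD hτ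
  have hl : ∀ k ≤ L, ∀ x, k + x ≤ L → e x (w k) = (a + k + b * x) • w (k + x) :=
    fun k hk => (hw k hk).2.2
  have hwG : ∀ k ≤ L, w k ∈ G k := fun k hk => (hw k hk).2.1
  have hS : WittFam e a (diffSp e w L) :=
    ⟨h.comm, fun x k v hv => h.diffSp_maps hl x k v hv, fun k v hv => h.zero k v (h.diffSp_le hwG k hv),
      fun k => Submodule.finiteDimensional_of_le (h.diffSp_le hwG k)⟩
  have hS0 : ∀ k, ∀ v ∈ diffSp e w L k, sh _ M (dl ^ m1) (quad e v) = 0 := by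
    intro k v hv
    refine sh_pow_mono (show m0 ≤ m1 by omega) (H0 M e a _ hS ?_ ?_ k v hv)
    · refine eventually_atBot.2 ⟨L, fun k hk => ?_⟩
      rw [h.diffSp_eq_bot hl hk]; simp
    · filter_upwards [htop] with k hk
      exact (Submodule.finrank_mono (h.diffSp_le hwG k)).trans hk
  have hM1 : ∀ k, ∀ v ∈ lineSp e w L k, sh _ M (dl ^ (4 * m1)) (quad e v) = 0 := by
    intro k v hv
    refine extension (by omega) h.comm (A := lineSp e w L) (B := fun _ => ⨆ k, diffSp e w L k)
      ?_ (fun _ => quad_ker_iSup hS0) k v hv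
    intro k v hv x
    rw [show m1 = m1 - 3 + 3 by omega, pow_add, map_mul, Module.End.mul_apply]
    exact sh_mem _ _ _ (fun y => Submodule.mem_iSup_of_mem _ (sh_mem_diffSp hv y rfl)) x
  set N := ⨆ k, lineSp e w L k with hN
  have hNe : ∀ x, N ≤ N.comap (e x) := fun x => iSup_le fun k v hv =>
    Submodule.mem_iSup_of_mem _ (h.lineSp_maps hl x k v hv)
  let e' : ℤ → Module.End ℂ (M ⧸ N) := fun x => N.mapQ N (e x) (hNe x)
  have he' : ∀ x v, e' x (N.mkQ v) = N.mkQ (e x v) := fun x v => rfl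
  have hQ : WittFam e' a (fun k => (G k).map N.mkQ) := by
    refine ⟨fun x y => ?_, ?_, ?_, fun k => inferInstance⟩
    · refine Submodule.linearMap_qext _ (LinearMap.ext fun v => ?_)
      have := congrArg N.mkQ (LinearMap.congr_fun (h.comm x y) v)
      simp only [LinearMap.sub_apply, Module.End.mul_apply, map_sub, LinearMap.smul_apply, map_smul,
        ← he'] at this
      exact this
    · rintro x k _ ⟨v, hv, rfl⟩
      exact ⟨e x v, h.maps x k v hv, rfl⟩
    · rintro k _ ⟨v, hv, rfl⟩
      rw [he', h.zero k v hv, map_smul]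
  have hQd : ∀ k, ∀ v ∈ G k, ∀ x, sh _ M (dl ^ m) (quad e v) x ∈ N := by
    intro k v hv x
    have := H _ e' a _ hQ ?_ ?_ k _ ⟨v, hv, rfl⟩
    · have h3 := sh_lin N.mkQ (dl ^ m) (quad e v) x
      have h4 : (fun y => N.mkQ (quad e v y)) = quad e' (N.mkQ v) := by
        ext y; simp only [quad, he']
      rw [h4, this] at h3
      exact (Submodule.Quotient.mk_eq_zero _).1 h3.symm
    · filter_upwards [hbot, eventually_le_atBot L] with k hk hkL
      have hlt : finrank ℂ ((G k).map N.mkQ) < finrank ℂ (G k) := by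
        have h5 := LinearMap.finrank_range_add_finrank_ker (N.mkQ.domRestrict (G k))
        rw [LinearMap.range_domRestrict] at h5
        have h6 : 0 < finrank ℂ (LinearMap.ker (N.mkQ.domRestrict (G k))) := by
          rw [Module.finrank_pos_iff]
          refine ⟨⟨⟨w k, hwG k hkL⟩, ?_⟩, 0, fun h0 => (hw k hkL).1 ?_⟩
          · rw [LinearMap.mem_ker, LinearMap.domRestrict_apply]
            exact (Submodule.Quotient.mk_eq_zero _).2
              (Submodule.mem_iSup_of_mem k (Submodule.subset_span (.base k hkL)))
          · simpa using congrArg (fun z => ((z : G k) : M)) (congrArg Subtype.val h0)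
        omega
      omega
    · filter_upwards [htop] with k hk
      exact (Submodule.finrank_map_le _ _).trans hk
  refine extension (by omega) h.comm (A := G) (B := fun _ => N) ?_ ?_ k v hv
  · intro k v hv x
    rw [show m2 = m2 - m + m by omega, pow_add, map_mul, Module.End.mul_apply]
    exact sh_mem _ _ _ (hQd k v hv) x
  · exact fun _ => quad_ker_iSup fun k v hv => sh_pow_mono (show 4 * m1 ≤ m2 by omega) (hM1 k v hv)

lemma diffBound_mirror {d d' : ℕ} (h : DiffBound d d') : DiffBound d' d := by
  obtain ⟨m, hm, H⟩ := h
  refine ⟨m, hm, fun M _ _ e a G h hbot htop k v hv => ?_⟩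
  have h' : WittFam (fun x => -e (-x)) (-a) (fun k => G (-k)) := by
    refine ⟨fun x y => ?_, fun x k v hv => ?_, fun k v hv => ?_, fun k => h.fd _⟩
    · have := h.comm (-x) (-y)
      rw [neg_mul_neg, neg_mul_neg, this, show -x + -y = -(x + y) by ring]
      push_cast; module
    · have := h.maps (-x) _ _ hv
      rw [show -k + -x = -(k + x) by ring] at this
      simpa using this
    · have := h.zero _ _ hv
      simp only [neg_zero, LinearMap.neg_apply, this]
      push_cast; module
  have := H M _ _ _ h' ?_ ?_ (-k) v (by simpa using hv)
  · have hq : quad (fun x => -e (-x)) v = fun x => quad e v ((-AddMonoidHom.id (ℤ × ℤ)) x) := by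
      ext x; simp [quad]
    rw [hq, sh_comp] at this
    have h2 : sh _ M (mapG (-AddMonoidHom.id (ℤ × ℤ)) (dl ^ m)) (quad e v) = 0 := by
      ext x
      simpa using congrFun this (-x)
    refine sh_dvd_zero h2 ?_
    rw [map_pow]
    refine pow_dvd_pow_of_dvd ⟨-sg (1, 1), ?_⟩ m
    simp only [dl, map_sub, mapG_sg]
    rw [sub_mul, mul_neg, mul_neg, ← sg_add, ← sg_add]
    simp only [AddMonoidHom.neg_apply, AddMonoidHom.id_apply, Prod.neg_mk, Prod.mk_add_mk]
    norm_num
    abel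
  · exact (tendsto_neg_atBot_atTop (G := ℤ)).eventually htop
  · exact (tendsto_neg_atTop_atBot (G := ℤ)).eventually hbot

theorem diffBound (d d' : ℕ) : DiffBound d d' := by
  have h1 : ∀ d, DiffBound d 0 := fun d => by
    induction d with
    | zero => exact diffBound_zero
    | succ d ih => exact diffBound_step ih diffBound_zero
  induction d with
  | zero => exact diffBound_mirror (h1 d')
  | succ d ih => exact diffBound_step ih (diffBound_mirror (h1 d'))

end Induction
end

noncomputable section

open Filter

section Grassmann
variable {n : ℕ}

/-- The exponent of the monomial `1`. -/
abbrev gz (n : ℕ) : GExp n := fun _ => false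

@[simp] lemma gdeg_gz : gdeg (gz n) = 0 := by simp [gdeg]
@[simp] lemma derC_gz (a : Fin n) : derC a (gz n) = 0 := by simp [derC]
@[simp] lemma mulSgn_gz_left (q : GExp n) : mulSgn (gz n) q = 1 := by simp [mulSgn, invCount]
@[simp] lemma mulSgn_gz_right (q : GExp n) : mulSgn q (gz n) = 1 := by simp [mulSgn, invCount]
@[simp] lemma xorE_gz_left (q : GExp n) : xorE (gz n) q = q := by ext; simp [xorE]
@[simp] lemma xorE_gz_right (q : GExp n) : xorE q (gz n) = q := by ext; simp [xorE]

end Grassmann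

section Basics
variable {m n : ℕ} {b : Bool}

lemma WRep.comm (ρ : WRep m n b) (x y : WBasis m n b) (v : ρ.M) :
    ρ.act (brB x y) v = ρ.g x (ρ.g y v) - ((-1 : ℂ) ^ (par x * par y)) • ρ.g y (ρ.g x v) := by
  rw [ρ.super]; rfl

lemma WRep.act_sng (ρ : WRep m n b) (x : WBasis m n b) : ρ.act (sng x) = ρ.g x := rfl

/-- The coefficient of `d_i` acting on the direction `D`: `[t^x d_i, D] = - x_i …`. -/
def dirK (i : Fin m) : Dir m n b → ℂ
  | .di j => if j = i then 1 else 0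
  | _ => 0

/-- The vector `x ε_i`. -/
abbrev ep (i : Fin m) (x : ℤ) : LExp m := Pi.single i x

lemma brB_di (i : Fin m) (x : ℤ) (p : LExp m) (q : GExp n) (D : Dir m n b) :
    brB ⟨ep i x, gz n, .di i⟩ ⟨p, q, D⟩ = ((p i : ℂ) - dirK i D * x) • sng ⟨ep i x + p, q, D⟩ := by
  cases D with
  | di j =>
    by_cases h : j = i
    · subst h
      simp [brB, dirK, sub_smul]
    · simp [brB, dirK, h]
  | pa a => simp [brB, dirK]
  | d0 => simp [brB, dirK]

lemma brB_zero_di (i : Fin m) (x : WBasis m n b) :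
    brB ⟨0, gz n, .di i⟩ x = (x.1 i : ℂ) • sng x := by
  obtain ⟨p, q, D⟩ := x
  have := brB_di i 0 p q D
  simpa [ep] using this

lemma par_di_gz (r : LExp m) (i : Fin m) : par (⟨r, gz n, .di i⟩ : WBasis m n b) = 0 := by
  simp [par]

lemma brB_zero_d0 (x : WBasis m n true) : brB ⟨0, gz n, .d0⟩ x = 0 := by
  obtain ⟨p, q, D⟩ := x
  cases D <;> simp [brB]

/-- The weight `λ + r`. -/
def wsh (lam : HIdx m b → ℂ) (r : LExp m) : HIdx m b → ℂ :=
  fun h => Sum.elim (fun i => lam (.inl i) + r i) (fun j => lam (.inr j)) h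

/-- The weight space of weight `λ + r`. -/
def WRep.Gr (ρ : WRep m n b) (lam : HIdx m b → ℂ) (r : LExp m) : Submodule ℂ ρ.M :=
  wtG ρ.g (wsh lam r)

lemma WRep.mem_wt (ρ : WRep m n b) {mu : HIdx m b → ℂ} {v : ρ.M} :
    v ∈ wtG ρ.g mu ↔ ∀ h, ρ.g (hB m n b h) v = mu h • v := by
  simp [wtG, Submodule.mem_iInf, sub_eq_zero]

lemma WRep.Gr_di (ρ : WRep m n b) {lam : HIdx m b → ℂ} {r : LExp m} {v : ρ.M}
    (hv : v ∈ ρ.Gr lam r) (i : Fin m) :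
    ρ.g ⟨0, gz n, .di i⟩ v = (lam (.inl i) + r i) • v := by
  have := ρ.mem_wt.1 hv (.inl i)
  simpa [hB, wsh] using this

lemma WRep.wt_comm (ρ : WRep m n b) (h : HIdx m b) (x : WBasis m n b) (v : ρ.M) :
    ρ.g (hB m n b h) (ρ.g x v)
      = ρ.g x (ρ.g (hB m n b h) v) + (wsh 0 x.1 h) • ρ.g x v := by
  have key : brB (hB m n b h) x = wsh 0 x.1 h • sng x ∧ par (hB m n b h) = 0 := by
    cases b with
    | false =>
      rcases h with i | j
      · exact ⟨by simpa [hB, wsh] using brB_zero_di i x, by simp [hB, par]⟩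
      · exact j.elim0
    | true =>
      rcases h with i | j
      · exact ⟨by simpa [hB, wsh] using brB_zero_di i x, by simp [hB, par]⟩
      · exact ⟨by simpa [hB, wsh] using brB_zero_d0 x, by simp [hB, par]⟩
  have := ρ.comm (hB m n b h) x v
  rw [key.1, key.2, zero_mul, pow_zero, one_smul, map_smul, LinearMap.smul_apply, ρ.act_sng] at this
  rw [this]; abel

lemma WRep.wt_maps (ρ : WRep m n b) {lam : HIdx m b → ℂ} {mu : HIdx m b → ℂ} (x : WBasis m n b)
    (hmu : ∀ h, mu h = lam h + wsh 0 x.1 h) (v : ρ.M) (hv : v ∈ wtG ρ.g lam) :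
    ρ.g x v ∈ wtG ρ.g mu := by
  rw [ρ.mem_wt] at hv ⊢
  intro h
  rw [ρ.wt_comm, hv, map_smul, hmu, add_smul]

lemma WRep.Gr_maps (ρ : WRep m n b) {lam : HIdx m b → ℂ} {r : LExp m} (x : WBasis m n b)
    (v : ρ.M) (hv : v ∈ ρ.Gr lam r) : ρ.g x v ∈ ρ.Gr lam (r + x.1) := by
  refine ρ.wt_maps x (fun h => ?_) v hv
  rcases h with i | j
  · simp [wsh]; ring
  · simp [wsh]

lemma exists_wt_ne {ρ : WRep m n b} (hs : IsSimpleG ρ.g) (hw : IsStrongHCG ρ.g) :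
    ∃ lam, wtG ρ.g lam ≠ ⊥ := by
  by_contra! h
  obtain ⟨v, hv⟩ := hs.1
  have := hw.1
  simp only [h, iSup_bot] at this
  have : v ∈ (⊥ : Submodule ℂ ρ.M) := this ▸ Submodule.mem_top
  exact hv (by simpa using this)

lemma iSup_Gr_eq_top {ρ : WRep m n b} (hs : IsSimpleG ρ.g) {lam : HIdx m b → ℂ} {r : LExp m}
    (hl : ρ.Gr lam r ≠ ⊥) : ⨆ r, ρ.Gr lam r = ⊤ := by
  refine (hs.2 _ fun x v hv => ?_).resolve_left fun h => hl (le_bot_iff.1 (h ▸ le_iSup _ r))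
  have : ⨆ r, ρ.Gr lam r ≤ (⨆ r, ρ.Gr lam r).comap (ρ.g x) :=
    iSup_le fun r v hv => Submodule.mem_iSup_of_mem _ (ρ.Gr_maps x v hv)
  exact this hv

lemma wsh_zero (lam : HIdx m b → ℂ) : wsh lam 0 = lam := by
  ext h; rcases h with i | j <;> simp [wsh]

end Basics

section Peel
variable {E : Type} [AddCommGroup E] [Module ℂ E]

lemma sh_swap {k : ℕ} {F : ℤ × ℤ → E} (h : sh _ E (dl ^ k) F = 0) :
    sh _ E (dl ^ k) (fun p => F p.swap) = 0 := by
  have h1 := sh_comp (AddEquiv.prodComm (M := ℤ) (N := ℤ) : ℤ × ℤ →+ ℤ × ℤ) (dl ^ k) F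
  have h2 : mapG (AddEquiv.prodComm (M := ℤ) (N := ℤ) : ℤ × ℤ →+ ℤ × ℤ) dl = - dl := by
    simp [dl, mapG_sg]
  have h4 : mapG (AddEquiv.prodComm (M := ℤ) (N := ℤ) : ℤ × ℤ →+ ℤ × ℤ) (dl ^ k) = (-1) ^ k * dl ^ k := by
    rw [map_pow, h2, neg_pow]
  rw [h4] at h1
  have h3 : sh _ E ((-1) ^ k * dl ^ k) F = 0 := sh_mul_zero _ _ _ h
  rw [h3] at h1
  exact h1

lemma sh_dl_two (F : ℤ × ℤ → E) (x : ℤ × ℤ) : sh _ E (dl ^ 2) F x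
    = F (x + (0, 2)) - (2 : ℂ) • F (x + (1, 1)) + F (x + (2, 0)) := by
  have h : ∀ g : ℤ × ℤ, sh _ E (dl ^ 0) F g = F g := by intro g; simp
  simp only [sh_dl_succ 1, sh_dl_succ 0, h, add_assoc, Prod.mk_add_mk]
  norm_num
  module

lemma peel {k : ℕ} {κ r : ℂ} (hκ : 1 + κ ≠ 0) {g : ℤ × ℤ → E} {V : ℤ → ℤ × ℤ → E}
    (hF : ∀ z : ℤ, sh _ E (dl ^ k)
      (fun p => ((z : ℂ) + r - κ * p.2) • g (p.1, p.2 + z) + V z p) = 0)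
    (hV : ∀ (z : ℤ) (p : ℤ × ℤ),
      V (z + 2) p - (2 : ℂ) • V (z + 1) (p + (1, 0)) + V z (p + (2, 0)) = 0) :
    sh _ E (dl ^ (k + 2)) g = 0 := by
  set F : ℤ → ℤ × ℤ → E := fun z p => ((z : ℂ) + r - κ * p.2) • g (p.1, p.2 + z) + V z p with hFd
  set H : ℤ × ℤ → E := F 3 - (fun p => F 2 (p + (0, 1))) - (2 : ℂ) • (fun p => F 2 (p + (1, 0)))
    + (2 : ℂ) • (fun p => F 1 (p + (1, 1))) + (fun p => F 1 (p + (2, 0)))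
    - (fun p => F 0 (p + (2, 1))) with hH
  have hz : ∀ (z : ℤ) (c : ℤ × ℤ), sh _ E (dl ^ k) (fun p => F z (p + c)) = 0 := by
    intro z c; ext x; rw [sh_trans, hF]; rfl
  have h0 : sh _ E (dl ^ k) H = 0 := by
    rw [hH]
    have hF' : ∀ z, sh _ E (dl ^ k) (F z) = 0 := hF
    simp only [map_add, map_sub, map_smul, hz, hF']
    simp
  have h1 : H = (1 + κ) • (fun p => sh _ E (dl ^ 2) g (p + (0, 1))) := by
    ext ⟨x, y⟩
    have v1 := hV 1 (x, y)
    have v2 := hV 0 (x, y + 1)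
    simp only [hH, hFd, Pi.add_apply, Pi.sub_apply, Pi.smul_apply, sh_dl_two, Prod.mk_add_mk,
      add_zero, zero_add] at v1 v2 ⊢
    norm_num at v1 v2
    rw [show y + 1 + 2 = y + 3 by ring, show y + 1 + 1 = y + 2 by ring] at *
    push_cast
    rw [← sub_eq_zero, ← sub_eq_zero.2 (v1.trans v2.symm)]
    module
  rw [h1, map_smul] at h0
  have h2 := (smul_eq_zero.1 h0).resolve_left hκ
  rw [pow_add, map_mul, Module.End.mul_apply]
  ext x
  have := congrFun h2 (x - (0, 1))
  rw [sh_trans] at this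
  simpa using this

end Peel

section Difference
variable {m n : ℕ} {b : Bool}

lemma ep_same (i : Fin m) (x : ℤ) : ep i x i = x := Pi.single_eq_same ..

lemma ep_add (i : Fin m) (x y : ℤ) : ep i (x + y) = ep i x + ep i y := Pi.single_add ..

lemma WRep.line_witt (ρ : WRep m n b) {lam : HIdx m b → ℂ}
    (hfd : ∀ r, FiniteDimensional ℂ (ρ.Gr lam r)) (i : Fin m) (r : LExp m) :
    WittFam (fun x => ρ.g ⟨ep i x, gz n, .di i⟩) (lam (.inl i) + r i)
      (fun k => ρ.Gr lam (r + ep i k)) := by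
  refine ⟨fun x y => ?_, fun x k v hv => ?_, fun k v hv => ?_, fun k => hfd _⟩
  · refine LinearMap.ext fun v => ?_
    have := ρ.comm ⟨ep i x, gz n, .di i⟩ ⟨ep i y, gz n, .di i⟩ v
    rw [brB_di, par_di_gz, zero_mul, pow_zero, one_smul, map_smul, LinearMap.smul_apply,
      ρ.act_sng, ← ep_add, ep_same, dirK, if_pos rfl, one_mul] at this
    exact this.symm
  · have h := ρ.Gr_maps (lam := lam) (r := r + ep i k) ⟨ep i x, gz n, .di i⟩ v hv
    dsimp only at h
    rw [add_assoc, ← ep_add] at h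
    exact h
  · have := ρ.Gr_di hv i
    simp only [ep, Pi.single_zero]
    rw [this]
    simp [add_assoc]

lemma sh_end (p : AddMonoidAlgebra ℂ (ℤ × ℤ)) {M : Type} [AddCommGroup M] [Module ℂ M]
    (F : ℤ × ℤ → Module.End ℂ M) (x : ℤ × ℤ) (v : M) :
    sh _ (Module.End ℂ M) p F x v = sh _ M p (fun y => F y v) x :=
  (sh_lin (LinearMap.applyₗ v) p F x).symm

lemma brB_affine (i : Fin m) (r s : LExp m) (q q' : GExp n) (D D' : Dir m n b) (z : ℤ) (p : ℤ) :
    brB (⟨r + ep i p, q, D⟩ : WBasis m n b) ⟨s + ep i (z + 2), q', D'⟩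
      - (2 : ℂ) • brB (⟨r + ep i (p + 1), q, D⟩ : WBasis m n b) ⟨s + ep i (z + 1), q', D'⟩
      + brB (⟨r + ep i (p + 2), q, D⟩ : WBasis m n b) ⟨s + ep i z, q', D'⟩ = 0 := by
  have h1 : r + ep i (p + 1) + (s + ep i (z + 1)) = r + ep i p + (s + ep i (z + 2)) := by
    simp only [ep_add]
    rw [show ep i 2 = ep i 1 + ep i 1 from ep_add i 1 1]; abel
  have h2 : r + ep i (p + 2) + (s + ep i z) = r + ep i p + (s + ep i (z + 2)) := by
    simp only [ep_add]; abel
  have h3 : ∀ (t : LExp m) (j : Fin m) (x y : ℤ),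
      (((t + ep i (x + y)) j : ℤ) : ℂ) = ((t + ep i x) j : ℤ) + ((ep i y j : ℤ) : ℂ) := by
    intro t j x y; rw [ep_add]; simp [add_assoc]
  have h4 : ∀ j, ((ep i 2 j : ℤ) : ℂ) = 2 * ((ep i 1 j : ℤ) : ℂ) := by
    intro j; by_cases h : j = i <;> simp [ep, h]
  cases D <;> cases D' <;> simp only [brB, h1, h2, h3, h4] <;> module

theorem WRep.diff_zero (ρ : WRep m n b) {lam : HIdx m b → ℂ} (htop : ⨆ r, ρ.Gr lam r = ⊤)
    (hfd : ∀ r, FiniteDimensional ℂ (ρ.Gr lam r)) {C : ℕ}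
    (hC : ∀ r, Module.finrank ℂ (ρ.Gr lam r) ≤ C) :
    ∃ K, ∀ (i : Fin m) (r s : LExp m) (q q' : GExp n) (D D' : Dir m n b),
      sh _ (Module.End ℂ ρ.M) (dl ^ K)
        (fun p => ρ.g ⟨r + ep i p.1, q, D⟩ * ρ.g ⟨s + ep i p.2, q', D'⟩) = 0 := by
  obtain ⟨k, -, hk⟩ := diffBound C C
  refine ⟨k + 2 + 2, fun i s r q' q D' D => ?_⟩
  set e : ℤ → Module.End ℂ ρ.M := fun x => ρ.g ⟨ep i x, gz n, .di i⟩ with he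
  have hee : sh _ (Module.End ℂ ρ.M) (dl ^ k) (fun p => e p.1 * e p.2) = 0 := by
    ext x v
    rw [sh_end]
    have hv : v ∈ ⨆ r, ρ.Gr lam r := htop ▸ Submodule.mem_top
    have : ⨆ r, ρ.Gr lam r ≤ LinearMap.ker (sh _ ρ.M (dl ^ k) ∘ₗ
        (LinearMap.pi fun p => e p.1 ∘ₗ e p.2)) := by
      refine iSup_le fun r v hv => ?_
      refine hk ρ.M e _ _ (ρ.line_witt hfd i r) (.of_forall fun _ => hC _)
        (.of_forall fun _ => hC _) 0 v (by simpa [ep] using hv)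
    exact congrFun (this hv) x
  have hec : ∀ (t : LExp m) (q : GExp n) (D : Dir m n b) (x y : ℤ),
      e x * ρ.g ⟨t + ep i y, q, D⟩ - ρ.g ⟨t + ep i y, q, D⟩ * e x
        = ((y : ℂ) + t i - dirK i D * x) • ρ.g ⟨t + ep i (x + y), q, D⟩ := by
    intro t q D x y
    refine LinearMap.ext fun v => ?_
    have := ρ.comm ⟨ep i x, gz n, .di i⟩ ⟨t + ep i y, q, D⟩ v
    rw [brB_di, par_di_gz, zero_mul, pow_zero, one_smul, map_smul, LinearMap.smul_apply,
      ρ.act_sng, add_left_comm, ← ep_add, Pi.add_apply, ep_same, Int.cast_add,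
      add_comm (t i : ℂ)] at this
    exact this.symm
  have hκ : ∀ D : Dir m n b, 1 + dirK i D ≠ 0 := by
    intro D
    cases D with
    | di j => by_cases h : j = i <;> simp [dirK, h]
    | pa a => simp [dirK]
    | d0 => simp [dirK]
  have heb : sh _ (Module.End ℂ ρ.M) (dl ^ (k + 2))
      (fun p => e p.1 * ρ.g ⟨r + ep i p.2, q, D⟩) = 0 := by
    refine peel (κ := dirK i D) (r := r i) (hκ D)
      (V := fun z p => ((z : ℂ) + r i - dirK i D * p.1) • (ρ.g ⟨r + ep i (p.1 + z), q, D⟩ * e p.2))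
      (fun z => ?_) (fun z p => ?_)
    · have h1 := sh_lin (M' := Module.End ℂ ρ.M) (LinearMap.mulRight ℂ (ρ.g ⟨r + ep i z, q, D⟩)
        - LinearMap.mulLeft ℂ (ρ.g ⟨r + ep i z, q, D⟩)) (dl ^ k) (fun p => e p.1 * e p.2)
      funext x
      have h2 := h1 x
      rw [hee, Pi.zero_apply, map_zero] at h2
      rw [Pi.zero_apply, ← h2]
      refine congrFun (congrArg _ (funext fun p => ?_)) x
      simp only [LinearMap.sub_apply, LinearMap.mulRight_apply, LinearMap.mulLeft_apply]
      rw [← mul_smul_comm, ← smul_mul_assoc, ← hec, ← hec]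
      noncomm_ring
    · simp only [Prod.fst_add, Prod.snd_add, add_zero]
      rw [show p.1 + 1 + (z + 1) = p.1 + (z + 2) by ring, show p.1 + 2 + z = p.1 + (z + 2) by ring]
      push_cast
      module
  have hbe := sh_swap heb
  set ε : ℂ := (-1 : ℂ) ^ (par (⟨r, q, D⟩ : WBasis m n b) * par (⟨s, q', D'⟩ : WBasis m n b)) with hε
  have hε2 : ε * ε = 1 := by rw [hε, ← pow_add, ← two_mul, pow_mul]; norm_num
  have hpar : ∀ (t t' : LExp m) (q : GExp n) (D : Dir m n b), par (⟨t, q, D⟩ : WBasis m n b) = par (⟨t', q, D⟩ : WBasis m n b) := by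
    intro t t' q D; cases D <;> rfl
  have hbc : sh _ (Module.End ℂ ρ.M) (dl ^ (k + 2 + 2))
      (fun p => ρ.g ⟨s + ep i p.2, q', D'⟩ * ρ.g ⟨r + ep i p.1, q, D⟩) = 0 := by
    refine peel (κ := dirK i D') (r := s i) (hκ D')
      (g := fun p => ρ.g ⟨s + ep i p.2, q', D'⟩ * ρ.g ⟨r + ep i p.1, q, D⟩)
      (V := fun z p => ε • (e p.2 * ρ.act (brB ⟨r + ep i p.1, q, D⟩ ⟨s + ep i z, q', D'⟩)))
      (fun z => ?_) (fun z p => ?_)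
    · have h1 := sh_lin (M' := Module.End ℂ ρ.M)
        (ε • LinearMap.mulRight ℂ (ρ.g ⟨s + ep i z, q', D'⟩)
        - LinearMap.mulLeft ℂ (ρ.g ⟨s + ep i z, q', D'⟩)) (dl ^ (k + 2))
        (fun p => e p.2 * ρ.g ⟨r + ep i p.1, q, D⟩)
      funext x
      have h2 := h1 x
      have h3 := congrFun hbe x
      simp only [Prod.fst_swap, Prod.snd_swap] at h3
      rw [h3, Pi.zero_apply, map_zero] at h2
      rw [Pi.zero_apply, ← h2]
      refine congrFun (congrArg _ (funext fun p => ?_)) x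
      have h4 : ρ.act (brB ⟨r + ep i p.1, q, D⟩ ⟨s + ep i z, q', D'⟩)
          = ρ.g ⟨r + ep i p.1, q, D⟩ * ρ.g ⟨s + ep i z, q', D'⟩
            - ε • (ρ.g ⟨s + ep i z, q', D'⟩ * ρ.g ⟨r + ep i p.1, q, D⟩) := by
        rw [ρ.super, hpar (r + ep i p.1) r, hpar (s + ep i z) s]; rfl
      rw [h4, ← smul_mul_assoc, ← hec, LinearMap.sub_apply, LinearMap.smul_apply,
        LinearMap.mulRight_apply, LinearMap.mulLeft_apply, mul_sub, mul_smul_comm, smul_sub,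
        smul_smul, hε2, one_smul]
      noncomm_ring
    · have h := congrArg ρ.act (brB_affine i r s q q' D D' z p.1)
      rw [map_zero, map_add, map_sub, map_smul] at h
      have h5 := congrArg (fun T => ε • (e p.2 * T)) h
      simp only [mul_zero, smul_zero, mul_add, mul_sub, smul_add, smul_sub, mul_smul_comm] at h5
      rw [← h5, smul_comm ε (2 : ℂ)]
      simp
  have := sh_swap hbc
  exact this

end Difference
end

noncomputable section

variable {m n : ℕ} {b : Bool}

section Laurent

/-- The Laurent polynomial algebra. -/
abbrev LR (m : ℕ) := AddMonoidAlgebra ℂ (LExp m)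

/-- Linear maps out of a group algebra, given on group elements. -/
def gaLift {G E : Type} [AddCommGroup E] [Module ℂ E] (f : G → E) :
    AddMonoidAlgebra ℂ G →ₗ[ℂ] E :=
  Finsupp.linearCombination ℂ f ∘ₗ (AddMonoidAlgebra.coeffLinearEquiv ℂ).toLinearMap

lemma gaLift_sg {G E : Type} [AddCommGroup G] [AddCommGroup E] [Module ℂ E] (f : G → E) (g : G) :
    gaLift f (sg g) = f g := by
  simp [gaLift, sg, AddMonoidAlgebra.coeffLinearEquiv, Finsupp.linearCombination_apply]

/-- The degree derivation `t_i ∂/∂t_i`. -/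
def dR (i : Fin m) : LR m →ₗ[ℂ] LR m := gaLift fun x => (x i : ℂ) • sg x

lemma dR_sg (i : Fin m) (x : LExp m) : dR i (sg x) = (x i : ℂ) • sg x := gaLift_sg _ _

lemma dR_one (i : Fin m) : dR i (1 : LR m) = 0 := by
  rw [← sg_zero, dR_sg]; simp

lemma dR_mul (i : Fin m) (p q : LR m) : dR i (p * q) = p * dR i q + dR i p * q := by
  induction p using ga_induction with
  | h1 x =>
    induction q using ga_induction with
    | h1 y =>
      rw [← sg_add, dR_sg, dR_sg, dR_sg, mul_smul_comm, smul_mul_assoc, ← sg_add, ← add_smul]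
      simp [add_comm]
    | h2 p q hp hq => rw [mul_add, map_add, hp, hq, map_add]; ring
    | h3 c p hp => rw [mul_smul_comm, map_smul, hp, map_smul]; simp [smul_add]
  | h2 p q hp hq => rw [add_mul, map_add, hp, hq, map_add]; ring
  | h3 c p hp => rw [smul_mul_assoc, map_smul, hp, map_smul]; simp [smul_add]

/-- The augmentation ideal. -/
def augI (m : ℕ) : Ideal (LR m) := Ideal.span (Set.range fun x : LExp m => sg x - 1)

/-- The generator `t_i - 1` of the augmentation ideal. -/
def tm1 (i : Fin m) : LR m := sg (ep i 1) - 1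

lemma sg_sub_mem (x : LExp m) : sg x - 1 ∈ augI m := Ideal.subset_span ⟨x, rfl⟩

lemma tm1_mem (i : Fin m) : tm1 i ∈ augI m := sg_sub_mem _

lemma dR_tm1 (i j : Fin m) : dR i (tm1 j) = if i = j then sg (ep j 1) else 0 := by
  rw [tm1, map_sub, dR_sg, dR_one]
  by_cases h : i = j
  · subst h; simp [ep]
  · simp [ep, h]

/-- The first-order part of `t^x - 1`. -/
lemma sg_first_order (x : LExp m) :
    sg x - 1 - ∑ i, (x i : ℂ) • tm1 i ∈ augI m ^ 2 := by
  let S : AddSubgroup (LExp m) :=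
    { carrier := {x | sg x - 1 - ∑ i, (x i : ℂ) • tm1 i ∈ augI m ^ 2}
      zero_mem' := by simp [sg_zero]
      add_mem' := by
        intro x y hx hy
        have h := Ideal.mul_mem_mul (sg_sub_mem x) (sg_sub_mem y)
        rw [← pow_two] at h
        have := (augI m ^ 2).add_mem ((augI m ^ 2).add_mem hx hy) h
        simp only [Set.mem_ofPred_eq]
        convert this using 1
        rw [sg_add]
        simp only [Pi.add_apply, Int.cast_add, add_smul, Finset.sum_add_distrib]
        ring
      neg_mem' := by
        intro x hx
        simp only [Set.mem_ofPred_eq] at hx ⊢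
        have h := Ideal.mul_mem_mul (sg_sub_mem x) (sg_sub_mem (-x))
        rw [← pow_two] at h
        have := (augI m ^ 2).sub_mem ((augI m ^ 2).neg_mem hx) h
        convert this using 1
        have e : sg x * sg (-x) = (1 : LR m) := by rw [← sg_add, add_neg_cancel, sg_zero]
        simp only [Pi.neg_apply, Int.cast_neg, neg_smul, Finset.sum_neg_distrib]
        linear_combination e }
  have hS : S = ⊤ := by
    rw [eq_top_iff]
    intro x _
    have : x = ∑ i, x i • (ep i 1 : LExp m) := by
      ext j; simp [ep, Finset.sum_apply, Pi.single_apply]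
    rw [this]
    refine S.sum_mem fun i _ => S.zsmul_mem ?_ _
    change sg (ep i 1) - 1 - ∑ j, ((ep i 1 : LExp m) j : ℂ) • tm1 j ∈ augI m ^ 2
    have : ∑ j, ((ep i 1 : LExp m) j : ℂ) • tm1 j = tm1 i := by
      simp [ep, Pi.single_apply]
    rw [this, tm1, sub_self]; exact zero_mem _
  exact (hS ▸ AddSubgroup.mem_top x : x ∈ S)

lemma augI_eq_span : augI m = Ideal.span (Set.range (tm1 (m := m))) := by
  apply le_antisymm
  · rw [augI, Ideal.span_le]
    rintro _ ⟨x, rfl⟩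
    let J := Ideal.span (Set.range (tm1 (m := m)))
    let S : AddSubgroup (LExp m) :=
      { carrier := {x | sg x - 1 ∈ J}
        zero_mem' := by simp [sg_zero]
        add_mem' := by
          intro x y hx hy
          have := J.add_mem (J.mul_mem_left (sg x) hy) hx
          simp only [Set.mem_ofPred_eq]
          convert this using 1
          rw [sg_add]; ring
        neg_mem' := by
          intro x hx
          simp only [Set.mem_ofPred_eq] at hx ⊢
          have := J.neg_mem (J.mul_mem_left (sg (-x)) hx)
          convert this using 1
          have e : sg x * sg (-x) = (1 : LR m) := by rw [← sg_add, add_neg_cancel, sg_zero]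
          linear_combination e }
    have : x = ∑ i, x i • (ep i 1 : LExp m) := by
      ext j; simp [ep, Finset.sum_apply, Pi.single_apply]
    have h : x ∈ S := by
      rw [this]
      exact S.sum_mem fun i _ => S.zsmul_mem (Ideal.subset_span ⟨i, rfl⟩) _
    exact h
  · rw [Ideal.span_le]
    rintro _ ⟨i, rfl⟩
    exact tm1_mem i

lemma augI_add_const (P : LR m) : ∃ c : ℂ, P - c • 1 ∈ augI m := by
  induction P using ga_induction with
  | h1 x => exact ⟨1, by simpa using sg_sub_mem x⟩
  | h2 p q hp hq =>
    obtain ⟨c, hc⟩ := hp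
    obtain ⟨d, hd⟩ := hq
    refine ⟨c + d, ?_⟩
    convert (augI m).add_mem hc hd using 1
    rw [add_smul]; ring
  | h3 c p hp =>
    obtain ⟨d, hd⟩ := hp
    refine ⟨c * d, ?_⟩
    convert Submodule.smul_of_tower_mem (augI m) c hd using 1
    rw [smul_sub, smul_smul]

lemma augI_first_order {P : LR m} (hP : P ∈ augI m) :
    ∃ c : Fin m → ℂ, P - ∑ i, c i • tm1 i ∈ augI m ^ 2 := by
  rw [augI_eq_span, ← Set.image_univ] at hP
  have := hP
  rw [Set.image_univ, Ideal.mem_span_range_iff_exists_fun] at this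
  obtain ⟨f, rfl⟩ := this
  choose c hc using fun i => augI_add_const (f i)
  refine ⟨c, ?_⟩
  rw [← Finset.sum_sub_distrib]
  refine Ideal.sum_mem _ fun i _ => ?_
  have := Ideal.mul_mem_mul (hc i) (tm1_mem i)
  rw [← pow_two] at this
  convert this using 1
  rw [sub_mul, smul_mul_assoc, one_mul]

lemma dR_pow_mem (i : Fin m) (k : ℕ) {P : LR m} (hP : P ∈ augI m ^ k) :
    dR i P ∈ augI m ^ (k - 1) := by
  induction k generalizing P with
  | zero => simp
  | succ k ih =>
    rw [pow_succ] at hP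
    refine Submodule.mul_induction_on hP ?_ ?_
    · intro p hp q hq
      rw [dR_mul]
      refine Ideal.add_mem _ (Ideal.mul_mem_right _ _ (by simpa using hp)) ?_
      have := Ideal.mul_mem_mul (ih hp) hq
      rw [← pow_succ] at this
      exact Ideal.pow_le_pow_right (by omega) this
    · intro p q hp hq
      rw [map_add]; exact Ideal.add_mem _ hp hq

/-- The Euler operator of the augmentation filtration. -/
def euler (P : LR m) : LR m := ∑ i, tm1 i * dR i P

lemma euler_mul (P Q : LR m) : euler (P * Q) = P * euler Q + euler P * Q := by
  simp only [euler, dR_mul, Finset.mul_sum, Finset.sum_mul, ← Finset.sum_add_distrib]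
  exact Finset.sum_congr rfl fun i _ => by ring

lemma euler_add (P Q : LR m) : euler (P + Q) = euler P + euler Q := by
  simp [euler, mul_add, Finset.sum_add_distrib]

lemma euler_mem (k : ℕ) {P : LR m} (hP : P ∈ augI m ^ k) :
    euler P - (k : ℂ) • P ∈ augI m ^ (k + 1) := by
  induction k generalizing P with
  | zero =>
    simp only [Nat.cast_zero, zero_smul, sub_zero, zero_add, pow_one]
    exact Ideal.sum_mem _ fun i _ => Ideal.mul_mem_right _ _ (tm1_mem i)
  | succ k ih =>
    rw [pow_succ] at hP
    refine Submodule.mul_induction_on hP ?_ ?_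
    · intro p hp q hq
      have hq1 : euler q - q ∈ augI m ^ 2 := by
        rw [augI_eq_span] at hq
        induction hq using Submodule.span_induction with
        | mem x hx =>
          obtain ⟨j, rfl⟩ := hx
          have : euler (tm1 j) - tm1 j = tm1 j * tm1 j := by
            simp only [euler, dR_tm1, mul_ite, mul_zero, Finset.sum_ite_eq', Finset.mem_univ,
              if_true]
            rw [tm1]; ring
          rw [this, pow_two]
          exact Ideal.mul_mem_mul (tm1_mem j) (tm1_mem j)
        | zero => simp [euler]
        | add x y _ _ hx hy =>
          rw [euler_add]; convert Ideal.add_mem _ hx hy using 1; ring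
        | smul a x hx' hx =>
          rw [smul_eq_mul, euler_mul]
          have h1 : x ∈ augI m := by rw [augI_eq_span]; exact hx'
          have h2 : euler a ∈ augI m :=
            Ideal.sum_mem _ fun i _ => Ideal.mul_mem_right _ _ (tm1_mem i)
          have h3 := Ideal.mul_mem_mul h2 h1
          rw [← pow_two] at h3
          convert Ideal.add_mem _ (Ideal.mul_mem_left _ a hx) h3 using 1; ring
      have h1 := Ideal.mul_mem_mul hp hq1
      have h2 := Ideal.mul_mem_mul (ih hp) hq
      rw [← pow_add] at h1
      rw [← pow_succ] at h2
      rw [euler_mul]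
      convert Ideal.add_mem _ h1 h2 using 1
      push_cast
      rw [add_smul, one_smul, sub_mul, smul_mul_assoc]; ring
    · intro p q hp hq
      rw [euler_add]
      convert Ideal.add_mem _ hp hq using 1
      rw [smul_add]; ring

/-- High powers of the augmentation ideal lie in the ideal of `N`-th powers. -/
lemma augI_pow_le (N : ℕ) : ∃ k, augI m ^ k ≤ Ideal.span (Set.range fun i : Fin m => tm1 i ^ N) := by
  apply Ideal.exists_pow_le_of_le_radical_of_fg
  · rw [augI_eq_span, Ideal.span_le]
    rintro _ ⟨i, rfl⟩
    exact ⟨N, Ideal.subset_span ⟨i, rfl⟩⟩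
  · rw [augI_eq_span]
    exact ⟨Finset.univ.image tm1, by simp⟩

end Laurent
end

noncomputable section

variable {m n : ℕ} {b : Bool}

section Bracket

lemma derE_same (a : Fin n) (s : GExp n) : derE a s a = false := by simp [derE]

lemma derE_ne {a x : Fin n} (h : x ≠ a) (s : GExp n) : derE a s x = s x := by simp [derE, h]

lemma gdeg_derE {a : Fin n} {s : GExp n} (h : derC a s ≠ 0) : gdeg (derE a s) + 1 = gdeg s := by
  have hs : s a = true := by
    by_contra h'; exact h (by simp [derC, h'])
  have : (Finset.univ.filter fun x => s x = true) =
      insert a (Finset.univ.filter fun x => derE a s x = true) := by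
    ext x
    by_cases hx : x = a
    · subst hx; simp [hs]
    · simp [derE_ne hx, hx]
  rw [gdeg, gdeg, this, Finset.card_insert_of_notMem
    (by simp [derE_same])]

lemma mulSgn_disj {s q : GExp n} (h : mulSgn s q ≠ 0) (a : Fin n) : ¬(s a = true ∧ q a = true) :=
  fun h' => h (by rw [mulSgn, if_pos ⟨a, h'⟩])

lemma gdeg_xorE {s q : GExp n} (h : mulSgn s q ≠ 0) : gdeg (xorE s q) = gdeg s + gdeg q := by
  have hd := mulSgn_disj h
  rw [gdeg, gdeg, gdeg, ← Finset.card_union_of_disjoint]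
  · congr 1
    ext a
    have := hd a
    simp only [xorE, Finset.mem_filter, Finset.mem_univ, true_and, Finset.mem_union]
    cases h1 : s a <;> cases h2 : q a <;> simp_all
  · rw [Finset.disjoint_left]
    intro a h1 h2
    exact hd a ⟨by simpa using h1, by simpa using h2⟩

lemma xorE_comm (s q : GExp n) : xorE s q = xorE q s := by
  ext a; simp only [xorE]; rw [Bool.xor_comm]

lemma invCount_add {s q : GExp n} (hd : ∀ a, ¬(s a = true ∧ q a = true)) :
    invCount s q + invCount q s = gdeg s * gdeg q := by
  have h2 : invCount q s = ((Finset.univ ×ˢ Finset.univ).filter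
      fun p : Fin n × Fin n => s p.1 = true ∧ q p.2 = true ∧ p.1 < p.2).card := by
    rw [invCount]
    refine Finset.card_bij (fun p _ => p.swap) ?_ ?_ ?_
    · rintro ⟨x, y⟩ h; simp at h ⊢; tauto
    · rintro ⟨x, y⟩ _ ⟨x', y'⟩ _ h; simpa [and_comm] using h
    · rintro ⟨x, y⟩ h; exact ⟨(y, x), by simp at h ⊢; tauto, rfl⟩
  rw [h2, invCount, ← Finset.card_union_of_disjoint, gdeg, gdeg, ← Finset.card_product]
  · congr 1
    ext ⟨x, y⟩
    simp only [Finset.mem_union, Finset.mem_filter, Finset.mem_product, Finset.mem_univ, true_and]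
    constructor
    · tauto
    · rintro ⟨h1, h2⟩
      rcases lt_trichotomy x y with h | h | h
      · exact Or.inr ⟨h1, h2, h⟩
      · subst h; exact absurd ⟨h1, h2⟩ (hd x)
      · exact Or.inl ⟨h1, h2, h⟩
  · rw [Finset.disjoint_left]
    rintro ⟨x, y⟩ h1 h2
    simp only [Finset.mem_filter] at h1 h2
    exact absurd h1.2.2.2 (not_lt.mpr h2.2.2.2.le)

lemma mulSgn_comm (s q : GExp n) : mulSgn s q = (-1) ^ (gdeg s * gdeg q) * mulSgn q s := by
  by_cases h : ∃ a, s a = true ∧ q a = true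
  · have h' : ∃ a, q a = true ∧ s a = true := by simpa only [and_comm] using h
    simp [mulSgn, h, h']
  · have h' : ¬∃ a, q a = true ∧ s a = true := by simpa only [and_comm] using h
    rw [mulSgn, mulSgn, if_neg h, if_neg h', ← pow_add, ← invCount_add (by simpa using h),
      add_assoc, ← two_mul, pow_add, pow_mul]
    simp

lemma neg_one_pow_mod_mul (x y : ℕ) : (-1 : ℂ) ^ (x % 2 * (y % 2)) = (-1) ^ (x * y) := by
  rw [neg_one_pow_eq_pow_mod_two, neg_one_pow_eq_pow_mod_two (n := x * y), Nat.mul_mod x y]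

/-- The scalar by which a direction acts on the Laurent monomial `t^y`. -/
def dD : Dir m n b → LExp m → ℂ
  | .di i, y => y i
  | .pa _, _ => 1
  | .d0, _ => 0

/-- The scalar by which a direction acts on a Grassmann monomial. -/
def DC : Dir m n b → GExp n → ℂ
  | .di _, _ => 1
  | .pa a, q => derC a q
  | .d0, _ => 0

/-- The exponent resulting from a direction acting on a Grassmann monomial. -/
def DE : Dir m n b → GExp n → GExp n
  | .di _, q => q
  | .pa a, q => derE a q
  | .d0, q => q

/-- The linear map on Laurent polynomials attached to a direction. -/
def DR : Dir m n b → LR m →ₗ[ℂ] LR m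
  | .di i => dR i
  | .pa _ => LinearMap.id
  | .d0 => 0

/-- Filtration weight of a direction. -/
def wD : Dir m n b → ℕ
  | .di _ => 1
  | .pa _ => 1
  | .d0 => 0

lemma DR_sg (D : Dir m n b) (y : LExp m) : DR D (sg y) = dD D y • sg y := by
  cases D with
  | di i => exact dR_sg i y
  | pa a => simp [DR, dD]
  | d0 => simp [DR, dD]

/-- Parity of `ξ^s D`. -/
def pd (a : GExp n × Dir m n b) : ℕ := par (⟨0, a.1, a.2⟩ : WBasis m n b)

lemma par_eq_pd (x : LExp m) (a : GExp n × Dir m n b) : par (⟨x, a⟩ : WBasis m n b) = pd a := by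
  obtain ⟨s, D⟩ := a
  cases D <;> rfl

/-- The first structure constant of the bracket. -/
def bC (a a' : GExp n × Dir m n b) : ℂ := DC a.2 a'.1 * mulSgn a.1 (DE a.2 a'.1)

/-- The first exponent of the bracket. -/
def bE (a a' : GExp n × Dir m n b) : GExp n × Dir m n b := (xorE a.1 (DE a.2 a'.1), a'.2)

lemma brB_eq (x y : LExp m) (a a' : GExp n × Dir m n b) :
    brB ⟨x, a⟩ ⟨y, a'⟩ = (dD a.2 y * bC a a') • sng ⟨x + y, bE a a'⟩ -
      ((-1) ^ (pd a * pd a') * (dD a'.2 x * bC a' a)) • sng ⟨x + y, bE a' a⟩ := by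
  obtain ⟨s, D⟩ := a
  obtain ⟨q, D'⟩ := a'
  cases D <;> cases D' <;>
    simp only [brB, bC, bE, DC, DE, dD, pd, par, neg_one_pow_mod_mul, one_mul, zero_mul, mul_zero,
      zero_smul, sub_zero, zero_sub]
  case di.di i j =>
    rw [xorE_comm q s, mulSgn_comm s q]; congr 2; ring
  case di.pa i a => congr 2; ring
  case pa.di a j => congr 2; ring
  case pa.pa a a' => congr 2; ring
  case d0.di j =>
    rw [xorE_comm q s, mulSgn_comm s q, ← neg_smul]; congr 1; ring
  case d0.pa a => rw [← neg_smul]; congr 1; ring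

end Bracket

section Operators

variable (ρ : WRep m n b)

/-- The translated action of `t^x ξ^s D` on families of vectors. -/
def Tx (x : LExp m) (a : GExp n × Dir m n b) : Module.End ℂ (LExp m → ρ.M) :=
  LinearMap.pi fun r => ρ.g ⟨x, a⟩ ∘ₗ LinearMap.proj (r - x)

lemma Tx_apply (x : LExp m) (a : GExp n × Dir m n b) (v : LExp m → ρ.M) (r : LExp m) :
    Tx ρ x a v r = ρ.g ⟨x, a⟩ (v (r - x)) := rfl

/-- The operator on families of vectors attached to `P ξ^s D`, for a Laurent polynomial `P`. -/
def Op (a : GExp n × Dir m n b) : LR m →ₗ[ℂ] Module.End ℂ (LExp m → ρ.M) :=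
  gaLift fun x => Tx ρ x a

lemma Op_sg (a : GExp n × Dir m n b) (x : LExp m) : Op ρ a (sg x) = Tx ρ x a := gaLift_sg _ _

lemma Op_sh (a : GExp n × Dir m n b) (P : LR m) (v : LExp m → ρ.M) (r : LExp m) :
    Op ρ a P v r = sh (LExp m) ρ.M P (fun x => ρ.g ⟨x, a⟩ (v (r - x))) 0 := by
  induction P using ga_induction with
  | h1 x => rw [Op_sg, Tx_apply, sh_sg, zero_add]
  | h2 p q hp hq => simp [hp, hq]
  | h3 c p hp => simp [hp]

lemma Tx_comm (x y : LExp m) (a a' : GExp n × Dir m n b) :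
    Tx ρ x a * Tx ρ y a' = ((-1 : ℂ) ^ (pd a * pd a')) • (Tx ρ y a' * Tx ρ x a) +
      (dD a.2 y * bC a a') • Tx ρ (x + y) (bE a a') -
      ((-1) ^ (pd a * pd a') * (dD a'.2 x * bC a' a)) • Tx ρ (x + y) (bE a' a) := by
  ext v r
  have h := ρ.comm ⟨x, a⟩ ⟨y, a'⟩ (v (r - x - y))
  rw [brB_eq, map_sub, map_smul, map_smul, ρ.act_sng, ρ.act_sng, par_eq_pd, par_eq_pd] at h
  have h3 : r - (x + y) = r - x - y := by abel
  have h4 : r - y - x = r - x - y := by abel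
  simp only [Module.End.mul_apply, LinearMap.add_apply, LinearMap.sub_apply, LinearMap.smul_apply,
    Pi.add_apply, Pi.sub_apply, Pi.smul_apply, Tx_apply, h3, h4] at h ⊢
  rw [add_sub_assoc, h]; abel

lemma Op_comm (a a' : GExp n × Dir m n b) (P Q : LR m) :
    Op ρ a P * Op ρ a' Q = ((-1 : ℂ) ^ (pd a * pd a')) • (Op ρ a' Q * Op ρ a P) +
      bC a a' • Op ρ (bE a a') (P * DR a.2 Q) -
      ((-1) ^ (pd a * pd a') * bC a' a) • Op ρ (bE a' a) (DR a'.2 P * Q) := by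
  induction P using ga_induction with
  | h1 x =>
    induction Q using ga_induction with
    | h1 y =>
      rw [Op_sg, Op_sg, Tx_comm, DR_sg, DR_sg, mul_smul_comm, smul_mul_assoc, ← sg_add, map_smul,
        map_smul, Op_sg, Op_sg, smul_smul, smul_smul]
      congr 2
      · congr 1; ring
      · ring
    | h2 p q hp hq =>
      simp only [map_add, mul_add, add_mul, hp, hq, smul_add]; abel
    | h3 c p hp =>
      simp only [map_smul, mul_smul_comm, smul_mul_assoc, hp, smul_add, smul_sub]
      simp only [smul_comm c]
  | h2 p q hp hq =>
    simp only [map_add, mul_add, add_mul, hp, hq, smul_add]; abel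
  | h3 c p hp =>
    simp only [map_smul, mul_smul_comm, smul_mul_assoc, hp, smul_add, smul_sub]
    simp only [smul_comm c]

/-- The power of the augmentation ideal attached to `ξ^s D` at filtration level `k`. -/
def Jx (k : ℕ) (a : GExp n × Dir m n b) : Ideal (LR m) := augI m ^ (k + wD a.2 - gdeg a.1)

lemma Jx_anti {k l : ℕ} (h : k ≤ l) (a : GExp n × Dir m n b) : Jx l a ≤ Jx k a :=
  Ideal.pow_le_pow_right (by omega)

lemma Jx_bracket {k l : ℕ} {a a' : GExp n × Dir m n b} {P Q : LR m} (hP : P ∈ Jx k a)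
    (hQ : Q ∈ Jx l a') (h : bC a a' ≠ 0) : P * DR a.2 Q ∈ Jx (k + l) (bE a a') := by
  obtain ⟨s, D⟩ := a
  obtain ⟨q, D'⟩ := a'
  have h1 := gdeg_xorE (right_ne_zero_of_mul h)
  cases D with
  | di i =>
    have := Ideal.mul_mem_mul hP (dR_pow_mem i _ hQ)
    rw [Jx, ← pow_add] at this
    refine Ideal.pow_le_pow_right ?_ this
    simp only [DE, wD, bE] at h1 ⊢
    omega
  | pa c =>
    have h2 := gdeg_derE (left_ne_zero_of_mul h)
    have := Ideal.mul_mem_mul hP hQ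
    rw [Jx, Jx, ← pow_add] at this
    refine Ideal.pow_le_pow_right ?_ this
    simp only [DE, wD, bE] at h1 h2 ⊢
    omega
  | d0 => simp [DR]

/-- Families killed by level `k` of the filtration. -/
def JM (k : ℕ) : Submodule ℂ (LExp m → ρ.M) :=
  ⨅ a : GExp n × Dir m n b, ⨅ P ∈ Jx k a, LinearMap.ker (Op ρ a P)

variable {ρ}

lemma mem_JM {k : ℕ} {v : LExp m → ρ.M} :
    v ∈ JM ρ k ↔ ∀ a, ∀ P ∈ Jx k a, Op ρ a P v = 0 := by
  simp [JM, Submodule.mem_iInf]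

lemma JM_mono {k l : ℕ} (h : k ≤ l) : JM ρ k ≤ JM ρ l := fun _ hv =>
  mem_JM.mpr fun a P hP => mem_JM.mp hv a P (Jx_anti h a hP)

/-- The commutator of two operators acts on families killed by the appropriate level by zero. -/
lemma Op_comm_apply {k l : ℕ} {a a' : GExp n × Dir m n b} {P Q : LR m} (hP : P ∈ Jx k a)
    (hQ : Q ∈ Jx l a') {v : LExp m → ρ.M} (hv : v ∈ JM ρ (k + l)) :
    Op ρ a P (Op ρ a' Q v) = ((-1 : ℂ) ^ (pd a * pd a')) • Op ρ a' Q (Op ρ a P v) := by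
  have h := LinearMap.congr_fun (Op_comm ρ a a' P Q) v
  have h1 : bC a a' • Op ρ (bE a a') (P * DR a.2 Q) v = 0 := by
    by_cases hc : bC a a' = 0
    · rw [hc, zero_smul]
    · rw [mem_JM.mp hv _ _ (Jx_bracket hP hQ hc), smul_zero]
  have h2 : ((-1) ^ (pd a * pd a') * bC a' a) • Op ρ (bE a' a) (DR a'.2 P * Q) v = 0 := by
    by_cases hc : bC a' a = 0
    · rw [hc, mul_zero, zero_smul]
    · rw [mul_comm (DR _ _), mem_JM.mp hv _ _ (add_comm k l ▸ Jx_bracket hQ hP hc), smul_zero]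
  simp only [Module.End.mul_apply, LinearMap.add_apply, LinearMap.sub_apply,
    LinearMap.smul_apply] at h
  rw [h, h1, h2, add_zero, sub_zero]

/-- Level-zero operators preserve the families killed by level `k`. -/
lemma Op_mem_JM {k : ℕ} {a : GExp n × Dir m n b} {P : LR m} (hP : P ∈ Jx 0 a)
    {v : LExp m → ρ.M} (hv : v ∈ JM ρ k) : Op ρ a P v ∈ JM ρ k := by
  rw [mem_JM]
  intro a' Q hQ
  rw [Op_comm_apply hQ hP (by simpa using hv), mem_JM.mp hv _ _ hQ, map_zero, smul_zero]

end Operators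
end

noncomputable section

variable {m n : ℕ} {b : Bool}

section Families

/-- Homogeneous families of vectors. -/
def GF (ρ : WRep m n b) (lam : HIdx m b → ℂ) : Submodule ℂ (LExp m → ρ.M) :=
  Submodule.pi Set.univ fun r => ρ.Gr lam r

variable {ρ : WRep m n b} {lam : HIdx m b → ℂ}

lemma mem_GF {v : LExp m → ρ.M} : v ∈ GF ρ lam ↔ ∀ r, v r ∈ ρ.Gr lam r := by
  simp [GF, Submodule.mem_pi]

lemma Op_mem_GF (a : GExp n × Dir m n b) (P : LR m) {v : LExp m → ρ.M} (hv : v ∈ GF ρ lam) :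
    Op ρ a P v ∈ GF ρ lam := by
  induction P using ga_induction with
  | h1 x =>
    rw [mem_GF] at hv ⊢
    intro r
    rw [Op_sg, Tx_apply]
    have := ρ.Gr_maps ⟨x, a⟩ _ (hv (r - x))
    simpa using this
  | h2 p q hp hq => rw [map_add]; exact Submodule.add_mem _ hp hq
  | h3 c p hp => rw [map_smul]; exact Submodule.smul_mem _ _ hp

/-- Homogeneous families killed by level `K`. -/
def VK (ρ : WRep m n b) (lam : HIdx m b → ℂ) (K : ℕ) : Submodule ℂ (LExp m → ρ.M) :=
  GF ρ lam ⊓ JM ρ K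

lemma Op_mem_VK {K : ℕ} {a : GExp n × Dir m n b} {P : LR m} (hP : P ∈ Jx 0 a)
    {v : LExp m → ρ.M} (hv : v ∈ VK ρ lam K) : Op ρ a P v ∈ VK ρ lam K :=
  ⟨Op_mem_GF a P hv.1, Op_mem_JM hP hv.2⟩

lemma tm1_eq_mapG (i : Fin m) :
    tm1 i = mapG (AddMonoidHom.single (fun _ : Fin m => ℤ) i) (sg (1 : ℤ) - 1) := by
  rw [map_sub, map_one, mapG_sg]; rfl

lemma sg_diag_sub_one :
    mapG ((AddMonoidHom.id ℤ).prod (-AddMonoidHom.id ℤ)) (sg (1 : ℤ) - 1) = -sg (0, -1) * dl := by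
  rw [map_sub, map_one, mapG_sg, dl, mul_sub, neg_mul, neg_mul, ← sg_add, ← sg_add, ← sg_zero]
  simp [Prod.zero_eq_mk]; ring

/-- Bounded families exist: a nonzero homogeneous family killed by a level of the filtration. -/
theorem exists_VK_ne_bot (htop : ⨆ r, ρ.Gr lam r = ⊤)
    (hfd : ∀ r, FiniteDimensional ℂ (ρ.Gr lam r)) {C : ℕ}
    (hC : ∀ r, Module.finrank ℂ (ρ.Gr lam r) ≤ C) (hne : ∃ r, ρ.Gr lam r ≠ ⊥) :
    ∃ K, VK ρ lam K ≠ ⊥ := by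
  by_cases h0 : ∀ x, ρ.g x = 0
  · obtain ⟨r, hr⟩ := hne
    obtain ⟨u, hu, hu0⟩ := Submodule.exists_mem_ne_zero_of_ne_bot hr
    refine ⟨0, fun h => hu0 ?_⟩
    have : (Pi.single r u : LExp m → ρ.M) ∈ VK ρ lam 0 := by
      refine ⟨mem_GF.mpr fun s => ?_, mem_JM.mpr fun a P _ => ?_⟩
      · by_cases hs : s = r
        · subst hs; simpa using hu
        · simp [hs]
      · ext s
        rw [Op_sh]
        simp only [h0, LinearMap.zero_apply]
        exact congrFun (map_zero (sh (LExp m) ρ.M P)) 0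
    rw [h, Submodule.mem_bot] at this
    simpa using congrFun this r
  · push Not at h0
    obtain ⟨⟨x0, a'⟩, hx⟩ := h0
    obtain ⟨r0, u, hu, hgu⟩ : ∃ r, ∃ u ∈ ρ.Gr lam r, ρ.g ⟨x0, a'⟩ u ≠ 0 := by
      by_contra! h
      apply hx
      rw [← LinearMap.ker_eq_top, eq_top_iff, ← htop, iSup_le_iff]
      exact fun r u hu => h r u hu
    obtain ⟨K0, hK0⟩ := ρ.diff_zero htop hfd hC
    obtain ⟨k, hk⟩ := augI_pow_le (m := m) K0
    let v : LExp m → ρ.M := fun r => ρ.g ⟨r - r0, a'⟩ u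
    have hv : v ∈ VK ρ lam (k + n) := by
      refine ⟨mem_GF.mpr fun r => ?_, mem_JM.mpr fun a P hP => ?_⟩
      · have := ρ.Gr_maps ⟨r - r0, a'⟩ _ hu
        simpa using this
      · have hP' : P ∈ Ideal.span (Set.range fun i : Fin m => tm1 i ^ K0) := by
          refine hk (Ideal.pow_le_pow_right ?_ hP)
          have : gdeg a.1 ≤ n := by
            have := Finset.card_filter_le (Finset.univ : Finset (Fin n)) fun x => a.1 x = true
            rwa [Finset.card_univ, Fintype.card_fin] at this
          omega
        ext r
        rw [Op_sh]
        suffices h : sh (LExp m) ρ.M P (fun x => ρ.g ⟨x, a⟩ (v (r - x))) = 0 by rw [h]; rfl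
        clear hP
        induction hP' using Submodule.span_induction with
        | mem _ hx =>
          obtain ⟨i, rfl⟩ := hx
          ext x
          have hd := hK0 i x (r - x - r0) a.1 a'.1 a.2 a'.2
          set F : ℤ × ℤ → Module.End ℂ ρ.M := fun p =>
            ρ.g ⟨x + ep i p.1, a.1, a.2⟩ * ρ.g ⟨r - x - r0 + ep i p.2, a'.1, a'.2⟩ with hF
          have h1 : sh _ _ ((mapG ((AddMonoidHom.id ℤ).prod (-AddMonoidHom.id ℤ))
              (sg (1 : ℤ) - 1)) ^ K0) F = 0 := by
            rw [sg_diag_sub_one, mul_pow]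
            exact sh_mul_zero _ _ _ hd
          rw [← map_pow] at h1
          have h2 := sh_slice (M := Module.End ℂ ρ.M) (M' := Module.End ℂ ρ.M)
            ((AddMonoidHom.id ℤ).prod (-AddMonoidHom.id ℤ))
            ((sg (1 : ℤ) - 1) ^ K0) F (fun y => F (y, -y)) LinearMap.id 0 0 (fun y => by simp)
          rw [h1] at h2
          simp only [tm1_eq_mapG, ← map_pow]
          rw [sh_slice (M' := Module.End ℂ ρ.M) _ _ _ (fun y => F (y, -y))
            (LinearMap.applyₗ u) x 0 (fun y => ?_)]
          · rw [← LinearMap.id_apply (R := ℂ) (sh ℤ (Module.End ℂ ρ.M) _ _ 0), ← h2]; simp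
          · have e : r - (x + ep i y) - r0 = r - x - r0 + ep i (-y) := by
              rw [show ep i (-y) = -ep i y from Pi.single_neg ..]; abel
            simp only [hF, v, zero_add, LinearMap.applyₗ_apply_apply, Module.End.mul_apply,
              AddMonoidHom.single_apply]
            change ρ.g (x + ep i y, a) (ρ.g (r - (x + ep i y) - r0, a') u) = _
            rw [e]
        | zero => rw [map_zero]; rfl
        | add p q _ _ hp hq => rw [map_add, LinearMap.add_apply, hp, hq, add_zero]
        | smul c p _ hp => exact sh_mul_zero _ _ _ hp
    refine ⟨k + n, fun h => hgu ?_⟩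
    rw [h, Submodule.mem_bot] at hv
    simpa [v] using congrFun hv (x0 + r0)

lemma sh_pow_of_zero {G M : Type} [AddCommGroup G] [AddCommGroup M] [Module ℂ M] (y x : G) (N : ℕ)
    (F : G → M) (h : ∀ j : ℕ, 1 ≤ j → j ≤ N → F (x + j • y) = 0) :
    sh G M ((sg y - 1) ^ N) F x = (-1 : ℂ) ^ N • F x := by
  induction N generalizing F with
  | zero => simp
  | succ N ih =>
    have hG (z : G) : sh G M (sg y - 1) F z = F (z + y) - F z := by
      rw [map_sub, map_one]; simp [sh_sg]
    rw [pow_succ, map_mul, Module.End.mul_apply, ih, hG, pow_succ]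
    · have := h 1 le_rfl (by omega)
      rw [one_smul] at this
      rw [this]; simp
    · intro j hj hj'
      have h1 := h (j + 1) (by omega) (by omega)
      have h2 := h j hj (by omega)
      rw [hG, h2, add_assoc, ← succ_nsmul, h1, sub_zero]

/-- Values of families propagate along lines. -/
lemma VK_line {K : ℕ} {v : LExp m → ρ.M} (hv : v ∈ VK ρ lam K) (i : Fin m) (p : LExp m)
    (h0 : (∀ l, lam (.inl l) + p l = 0) → v p = 0) (c : ℤ)
    (hp : ∀ j : ℕ, 1 ≤ j → j ≤ K + 1 → v (p + ep i (c * j)) = 0) : v p = 0 := by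
  by_contra hvp
  refine hvp (h0 fun l => ?_)
  have hP : (sg (ep i (-c)) - 1) ^ (K + 1) ∈ Jx K ((gz n, .di l) : GExp n × Dir m n b) := by
    have := Ideal.pow_mem_pow (sg_sub_mem (ep i (-c))) (K + 1)
    simpa [Jx, wD] using this
  have h := congrFun (mem_JM.mp hv.2 _ _ hP) p
  rw [Op_sh, sh_pow_of_zero] at h
  · have h1 := ρ.Gr_di (mem_GF.mp hv.1 p) l
    simp only [sub_zero, Pi.zero_apply] at h
    rw [h1, smul_smul, smul_eq_zero] at h
    simpa [hvp] using h
  · intro j hj hj'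
    have : p - (0 + j • ep i (-c)) = p + ep i (c * j) := by
      ext l
      by_cases hl : l = i
      · subst hl; simp [ep]; ring
      · simp [ep, hl]
    rw [this, hp j hj hj', map_zero]

lemma VK_line_all {K : ℕ} {v : LExp m → ρ.M} (hv : v ∈ VK ρ lam K) (i : Fin m) (p : LExp m)
    (h0 : ∀ p, (∀ l, lam (.inl l) + p l = 0) → v p = 0)
    (hp : ∀ j : ℤ, 0 ≤ j → j ≤ K → v (p + ep i j) = 0) (j : ℤ) : v (p + ep i j) = 0 := by
  have key (c : ℤ) (N : ℕ) (z : LExp m) (h : ∀ j : ℕ, j ≤ K → v (z + ep i (c * j)) = 0) :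
      v (z + ep i (-(c * N))) = 0 := by
    induction N using Nat.strong_induction_on with
    | _ N ih =>
      rcases Nat.eq_zero_or_pos N with rfl | hN
      · simpa using h 0 (by omega)
      · refine VK_line hv i _ (h0 _) c fun j hj hj' => ?_
        rw [add_assoc, ← ep_add]
        rcases le_or_gt j N with h1 | h1
        · have := ih (N - j) (by omega)
          convert this using 4
          push_cast [h1]; ring
        · have := h (j - N) (by omega)
          convert this using 4
          push_cast [h1.le]; ring
  rcases le_total 0 j with hj | hj
  · rcases le_or_gt j K with h | h
    · exact hp j hj h
    · have := key (-1) (j - K).toNat (p + ep i K) (fun l hl => by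
        rw [add_assoc, ← ep_add]; exact hp _ (by omega) (by omega))
      rw [add_assoc, ← ep_add] at this
      convert this using 4
      omega
  · have := key 1 (-j).toNat p (fun l hl => hp _ (by omega) (by omega))
    convert this using 4
    omega

/-- Families are determined by their values on a finite set. -/
theorem VK_finite (hfd : ∀ r, FiniteDimensional ℂ (ρ.Gr lam r)) (K : ℕ) :
    FiniteDimensional ℂ (VK ρ lam K) := by
  classical
  obtain ⟨p0, hp0⟩ : ∃ p0 : LExp m, ∀ p : LExp m, (∀ l, lam (.inl l) + p l = 0) → p = p0 := by
    by_cases h : ∃ p0 : LExp m, ∀ l, lam (.inl l) + p0 l = 0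
    · obtain ⟨p0, h0⟩ := h
      refine ⟨p0, fun p hp => funext fun l => ?_⟩
      have := add_left_cancel ((hp l).trans (h0 l).symm)
      exact_mod_cast this
    · push Not at h
      exact ⟨0, fun p hp => by obtain ⟨l, hl⟩ := h p; exact absurd (hp l) hl⟩
  let B : Finset (LExp m) := insert p0 (Fintype.piFinset fun _ => Finset.Icc (0 : ℤ) K)
  let f : VK ρ lam K →ₗ[ℂ] (p : B) → ρ.Gr lam p :=
    LinearMap.pi fun p => LinearMap.codRestrict (ρ.Gr lam p)
      (LinearMap.proj (p : LExp m) ∘ₗ (VK ρ lam K).subtype) fun v => mem_GF.mp v.2.1 p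
  have := fun r => hfd r
  refine FiniteDimensional.of_injective f ?_
  rw [← LinearMap.ker_eq_bot, LinearMap.ker_eq_bot']
  rintro ⟨v, hv⟩ hf
  have hB : ∀ p ∈ B, v p = 0 := fun p hp => congrArg Subtype.val (congrFun hf ⟨p, hp⟩)
  have h0 : ∀ p : LExp m, (∀ l, lam (.inl l) + p l = 0) → v p = 0 := fun p hp => by
    rw [hp0 p hp]; exact hB _ (Finset.mem_insert_self _ _)
  have key (S : Finset (Fin m)) : ∀ p : LExp m, (∀ i, i ∉ S → 0 ≤ p i ∧ p i ≤ K) → v p = 0 := by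
    induction S using Finset.induction_on with
    | empty =>
      exact fun p hp => hB p (Finset.mem_insert_of_mem (by
        rw [Fintype.mem_piFinset]; exact fun i => Finset.mem_Icc.mpr (hp i (by simp))))
    | insert i S hi ih =>
      intro p hp
      have := VK_line_all hv i (p + ep i (-p i)) h0 (fun j hj hj' => ih _ fun l hl => ?_) (p i)
      · rw [add_assoc, ← ep_add] at this
        simpa [ep] using this
      · by_cases hli : l = i
        · subst hli; simp [ep]; exact ⟨hj, hj'⟩
        · have := hp l (by simp [hl, hli])
          simpa [ep, hli] using this
  ext p
  simpa using key Finset.univ p (by simp)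

end Families
end

noncomputable section

variable {m n : ℕ} {b : Bool}

section Single

/-- The exponent of the Grassmann monomial `ξ_a`. -/
def gx (a : Fin n) : GExp n := fun x => decide (x = a)

lemma gx_same (a : Fin n) : gx a a = true := by simp [gx]

lemma gx_eq_true {a x : Fin n} : gx a x = true ↔ x = a := by simp [gx]

lemma gdeg_gx (a : Fin n) : gdeg (gx a) = 1 := by
  simp only [gdeg, gx_eq_true]
  rw [Finset.filter_eq' Finset.univ a]; simp

lemma derC_gx (a c : Fin n) : derC a (gx c) = if a = c then 1 else 0 := by
  rw [derC]
  by_cases h : a = c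
  · subst h
    rw [if_pos (gx_same a), if_pos rfl, Finset.card_eq_zero.mpr, pow_zero]
    rw [Finset.filter_eq_empty_iff]
    rintro x _ ⟨h1, h2⟩
    rw [gx_eq_true.mp h1] at h2
    exact lt_irrefl _ h2
  · rw [if_neg (by simpa [gx_eq_true] using h), if_neg h]

lemma derE_gx (a : Fin n) : derE a (gx a) = gz n := by
  ext x
  by_cases h : x = a
  · subst h; simp [derE_same, gz]
  · simp [derE_ne h, gx, h, gz]

lemma mulSgn_gx_left {a : Fin n} {q : GExp n} (h : q a = false) :
    mulSgn (gx a) q = (-1) ^ (Finset.univ.filter fun x => q x = true ∧ x < a).card := by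
  rw [mulSgn, if_neg]
  · congr 1
    rw [invCount]
    refine Finset.card_bij (fun p _ => p.2) ?_ ?_ ?_
    · rintro ⟨x, y⟩ h
      simp only [Finset.mem_filter, gx_eq_true] at h
      obtain ⟨_, rfl, h2⟩ := h
      simpa using h2
    · rintro ⟨x, y⟩ h ⟨x', y'⟩ h' e
      simp only [Finset.mem_filter, gx_eq_true] at h h'
      exact Prod.ext (h.2.1.trans h'.2.1.symm) e
    · intro y hy
      refine ⟨(a, y), ?_, rfl⟩
      simpa [gx_same] using hy
  · rintro ⟨x, h1, h2⟩
    rw [gx_eq_true.mp h1, h] at h2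
    exact Bool.false_ne_true h2

lemma mulSgn_gx_eq_zero {a : Fin n} {q : GExp n} (h : q a = true) : mulSgn (gx a) q = 0 := by
  rw [mulSgn, if_pos ⟨a, gx_same a, h⟩]

lemma derC_false {a : Fin n} {s : GExp n} (h : s a = false) : derC a s = 0 := by simp [derC, h]

lemma derC_mulSgn_gx (a : Fin n) (s : GExp n) :
    derC a s * mulSgn (gx a) (derE a s) = if s a = true then 1 else 0 := by
  by_cases h : s a = true
  · rw [mulSgn_gx_left (derE_same a s), derC, if_pos h, if_pos h, ← pow_add]
    have : (Finset.univ.filter fun x => derE a s x = true ∧ x < a) =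
        Finset.univ.filter fun x => s x = true ∧ x < a := by
      refine Finset.filter_congr fun x _ => and_congr_left fun hx => ?_
      rw [derE_ne hx.ne]
    rw [this, ← two_mul, pow_mul]; simp
  · rw [derC, if_neg h, if_neg h, zero_mul]

lemma xorE_gx_derE {a : Fin n} {s : GExp n} (h : s a = true) : xorE (gx a) (derE a s) = s := by
  ext x
  rw [xorE]
  by_cases hx : x = a
  · subst hx; rw [derE_same, gx_same, h]; rfl
  · rw [derE_ne hx]; simp [gx, hx]

end Single

section Minimal

variable {ρ : WRep m n b} {lam : HIdx m b → ℂ}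

/-- Stability under the level-zero operators. -/
def JStable (ρ : WRep m n b) (N : Submodule ℂ (LExp m → ρ.M)) : Prop :=
  ∀ a, ∀ P ∈ Jx 0 a, ∀ v ∈ N, Op ρ a P v ∈ N

lemma exists_minimal_JStable (hfd : ∀ r, FiniteDimensional ℂ (ρ.Gr lam r)) {K : ℕ}
    (hK : VK ρ lam K ≠ ⊥) : ∃ V ≤ VK ρ lam K, V ≠ ⊥ ∧ JStable ρ V ∧
      ∀ N ≤ V, N ≠ ⊥ → JStable ρ N → N = V := by
  classical
  have := VK_finite hfd K
  have hex : ∃ d, ∃ V ≤ VK ρ lam K, V ≠ ⊥ ∧ JStable ρ V ∧ Module.finrank ℂ V = d :=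
    ⟨_, VK ρ lam K, le_rfl, hK, fun a P hP v hv => Op_mem_VK hP hv, rfl⟩
  obtain ⟨V, hV, hV0, hVs, hVd⟩ := Nat.find_spec hex
  refine ⟨V, hV, hV0, hVs, fun N hN hN0 hNs => ?_⟩
  have : FiniteDimensional ℂ V := Submodule.finiteDimensional_of_le hV
  refine Submodule.eq_of_le_of_finrank_le hN ?_
  rw [hVd]
  exact Nat.find_min' hex ⟨N, hN.trans hV, hN0, hNs, rfl⟩

/-- The Euler operator on families. -/
def eps (ρ : WRep m n b) : Module.End ℂ (LExp m → ρ.M) :=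
  ∑ i, Op ρ (gz n, .di i) (tm1 i) + ∑ α, Op ρ (gx α, .pa α) 1

lemma tm1_mem_Jx (i : Fin m) (D : Dir m n b) : tm1 i ∈ Jx 0 (gz n, D) := by
  rw [Jx]
  have : augI m ^ 1 ≤ augI m ^ (0 + wD D - gdeg (gz n)) :=
    Ideal.pow_le_pow_right (by cases D <;> simp [wD])
  exact this (by simpa using tm1_mem i)

lemma one_mem_Jx_gx (α : Fin n) (D : Dir m n b) : (1 : LR m) ∈ Jx 0 (gx α, D) := by
  have : 0 + wD D - gdeg (gx α) = 0 := by rw [gdeg_gx]; cases D <;> simp [wD]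
  rw [Jx, this]; simp

lemma eps_mem {N : Submodule ℂ (LExp m → ρ.M)} (hN : JStable ρ N) {v : LExp m → ρ.M}
    (hv : v ∈ N) : eps ρ v ∈ N := by
  rw [eps, LinearMap.add_apply, LinearMap.sum_apply, LinearMap.sum_apply]
  exact N.add_mem (N.sum_mem fun i _ => hN _ _ (tm1_mem_Jx i _) _ hv)
    (N.sum_mem fun α _ => hN _ _ (one_mem_Jx_gx α _) _ hv)

lemma JM_stable (k : ℕ) : JStable ρ (JM ρ k) := fun _ _ hP _ hv => Op_mem_JM hP hv

lemma DC_pa (a : Fin n) (q : GExp n) : DC (.pa a : Dir m n b) q = derC a q := rfl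

lemma DE_pa (a : Fin n) (q : GExp n) : DE (.pa a : Dir m n b) q = derE a q := rfl

lemma pd_gz_di (i : Fin m) : pd ((gz n, .di i) : GExp n × Dir m n b) = 0 := by simp [pd, par]

lemma pd_gx_pa (α c : Fin n) : pd ((gx α, .pa c) : GExp n × Dir m n b) = 0 := by
  simp [pd, par, gdeg_gx]

lemma Op_congr_JM {k : ℕ} {a : GExp n × Dir m n b} {P Q : LR m} (h : P - Q ∈ Jx k a)
    {v : LExp m → ρ.M} (hv : v ∈ JM ρ k) : Op ρ a P v = Op ρ a Q v := by
  have := mem_JM.mp hv a _ h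
  rwa [map_sub, LinearMap.sub_apply, sub_eq_zero] at this

lemma eps_comm {k : ℕ} {a : GExp n × Dir m n b} {P : LR m} (hP : P ∈ Jx k a)
    {v : LExp m → ρ.M} (hv : v ∈ JM ρ (k + 1)) :
    eps ρ (Op ρ a P v) = Op ρ a P (eps ρ v) + (k : ℂ) • Op ρ a P v := by
  obtain ⟨s, D⟩ := a
  by_cases hk : k + wD D < gdeg s
  · have hP' : P ∈ Jx (k + 1) (s, D) := by
      rw [Jx] at hP ⊢
      rwa [show k + 1 + wD D - gdeg s = k + wD D - gdeg s by omega]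
    rw [mem_JM.mp hv _ _ hP', mem_JM.mp (eps_mem (JM_stable _) hv) _ _ hP']
    simp
  · have h1 (i : Fin m) : Op ρ (gz n, .di i) (tm1 i) (Op ρ (s, D) P v) =
        Op ρ (s, D) P (Op ρ (gz n, .di i) (tm1 i) v) + Op ρ (s, D) (tm1 i * dR i P) v -
          (DC D (gz n) * mulSgn s (DE D (gz n))) •
            Op ρ (xorE s (DE D (gz n)), .di i) (DR D (tm1 i) * P) v := by
      have := LinearMap.congr_fun (Op_comm ρ (gz n, .di i) (s, D) (tm1 i) P) v
      simpa [pd_gz_di, bC, bE, DC, DE, DR] using this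
    have h2 (α : Fin n) : Op ρ (gx α, .pa α) 1 (Op ρ (s, D) P v) =
        Op ρ (s, D) P (Op ρ (gx α, .pa α) 1 v) +
          (if s α = true then (1 : ℂ) else 0) • Op ρ (s, D) P v -
          (DC D (gx α) * mulSgn s (DE D (gx α))) •
            Op ρ (xorE s (DE D (gx α)), .pa α) (DR D 1 * P) v := by
      have := LinearMap.congr_fun (Op_comm ρ (gx α, .pa α) (s, D) 1 P) v
      simp only [pd_gx_pa, zero_mul, pow_zero, one_smul, one_mul, bC, bE, DC_pa, DE_pa,
        derC_mulSgn_gx, LinearMap.sub_apply, LinearMap.add_apply, LinearMap.smul_apply,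
        Module.End.mul_apply] at this
      rw [this]
      by_cases hs : s α = true
      · rw [xorE_gx_derE hs]; rfl
      · simp only [if_neg hs, zero_smul]
    have hw : (∑ i, (DC D (gz n) * mulSgn s (DE D (gz n))) •
          Op ρ (xorE s (DE D (gz n)), .di i) (DR D (tm1 i) * P) v) +
        (∑ α, (DC D (gx α) * mulSgn s (DE D (gx α))) •
          Op ρ (xorE s (DE D (gx α)), .pa α) (DR D 1 * P) v) =
        (wD D : ℂ) • Op ρ (s, D) P v := by
      cases D with
      | di j =>
        simp only [DC, DE, DR, mulSgn_gz_right, xorE_gz_right, dR_tm1, dR_one, ite_mul, zero_mul,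
          map_zero, LinearMap.zero_apply, smul_zero, Finset.sum_const_zero, add_zero, one_mul,
          one_smul, wD, Nat.cast_one]
        rw [Finset.sum_eq_single j (fun i _ hi => by rw [if_neg hi.symm]; simp) (by simp),
          if_pos rfl]
        refine Op_congr_JM ?_ hv
        have := Ideal.mul_mem_mul hP (tm1_mem j)
        rw [Jx, ← pow_succ] at this
        have e : sg (ep j 1) * P - P = P * tm1 j := by rw [tm1]; ring
        rw [e]
        refine Ideal.pow_le_pow_right ?_ this
        simp only [wD]; omega
      | pa β =>
        simp only [DC, DE, DR, derC_gz, zero_mul, zero_smul, Finset.sum_const_zero, zero_add,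
          derC_gx, LinearMap.id_apply, one_mul, wD, Nat.cast_one, one_smul, ite_mul]
        rw [Finset.sum_eq_single β (fun i _ hi => by rw [if_neg hi.symm]; simp) (by simp),
          if_pos rfl, derE_gx]
        simp
      | d0 => simp [DC, wD]
    have hdeg : (∑ α, (if s α = true then (1 : ℂ) else 0)) = gdeg s := by
      rw [gdeg, Finset.sum_boole]
    have he : Op ρ (s, D) (euler P) v = ((k : ℂ) + wD D - gdeg s) • Op ρ (s, D) P v := by
      have := euler_mem _ hP
      have e : ((k + wD D - gdeg s : ℕ) : ℂ) = (k : ℂ) + wD D - gdeg s := by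
        push_cast [not_lt.mp hk]; ring
      rw [e] at this
      rw [← LinearMap.smul_apply, ← map_smul]
      refine Op_congr_JM ?_ hv
      refine Ideal.pow_le_pow_right ?_ this
      omega
    rw [euler, map_sum, LinearMap.sum_apply] at he
    simp only [eps, LinearMap.add_apply, LinearMap.sum_apply, h1, h2, Finset.sum_sub_distrib,
      Finset.sum_add_distrib, he, ← Finset.sum_smul, hdeg, map_add, map_sum]
    have h3 := hw
    rw [← eq_sub_iff_add_eq] at h3
    rw [h3]
    module

/-- A minimal stable space of families is killed by level one. -/
theorem minimal_le_JM_one (hfd : ∀ r, FiniteDimensional ℂ (ρ.Gr lam r)) {K : ℕ}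
    {V : Submodule ℂ (LExp m → ρ.M)} (hV : V ≤ VK ρ lam K) (hV0 : V ≠ ⊥) (hVs : JStable ρ V)
    (hmin : ∀ N ≤ V, N ≠ ⊥ → JStable ρ N → N = V) : V ≤ JM ρ 1 := by
  have := VK_finite hfd K
  have : FiniteDimensional ℂ V := Submodule.finiteDimensional_of_le hV
  have : Nontrivial V := Submodule.nontrivial_iff_ne_bot.mpr hV0
  let e : Module.End ℂ V := (eps ρ).restrict fun v hv => eps_mem hVs hv
  have hfin : {μ | Module.End.HasEigenvalue e μ}.Finite := Module.End.finite_hasEigenvalue e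
  obtain ⟨μ0, hμ0⟩ := Module.End.exists_eigenvalue e
  obtain ⟨μ, hμ, hmax⟩ := hfin.exists_maximalFor Complex.re _ ⟨μ0, hμ0⟩
  obtain ⟨u, hu⟩ := Module.End.HasEigenvalue.exists_hasEigenvector hμ
  have hu1 : eps ρ (u : LExp m → ρ.M) = μ • (u : LExp m → ρ.M) :=
    congrArg Subtype.val hu.apply_eq_smul
  have hk (j : ℕ) : (u : LExp m → ρ.M) ∈ JM ρ (K - j + 1) := by
    induction j with
    | zero => exact JM_mono (by omega) (hV u.2).2
    | succ j ih =>
      rcases le_or_gt K j with h | h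
      · rwa [show K - (j + 1) = K - j by omega]
      · obtain ⟨k, hk1, hk2⟩ : ∃ k, K - j = k ∧ K - (j + 1) + 1 = k := ⟨K - j, rfl, by omega⟩
        rw [hk1] at ih
        rw [hk2, mem_JM]
        intro a P hP
        have h1 := eps_comm hP ih
        rw [hu1, map_smul, ← add_smul] at h1
        have hmem : Op ρ a P (u : LExp m → ρ.M) ∈ V :=
          hVs a P (Jx_anti (Nat.zero_le k) a hP) _ u.2
        by_contra hne
        have hev : Module.End.HasEigenvalue e (μ + k) :=
          Module.End.hasEigenvalue_of_hasEigenvector (x := ⟨_, hmem⟩)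
            ⟨Module.End.mem_eigenspace_iff.mpr (Subtype.ext h1), fun h' =>
              hne (congrArg Subtype.val h')⟩
        have h2 := hmax hev (by simp)
        have h3 : (1 : ℝ) ≤ k := by exact_mod_cast (by omega : 1 ≤ k)
        simp at h2
        linarith
  have hu' : (u : LExp m → ρ.M) ∈ JM ρ 1 := by simpa using hk K
  have := hmin (V ⊓ JM ρ 1) inf_le_left
    (fun h => hu.2 (Subtype.ext (by
      have : (u : LExp m → ρ.M) ∈ V ⊓ JM ρ 1 := ⟨u.2, hu'⟩
      rwa [h, Submodule.mem_bot] at this)))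
    (fun a P hP v hv => ⟨hVs a P hP v hv.1, Op_mem_JM hP hv.2⟩)
  exact inf_eq_left.mp this

end Minimal
end

noncomputable section

variable {m n : ℕ} {b : Bool}

section GlAction

/-- The Laurent part of the operator attached to `e_{xy}`. -/
def gP : GlIdx m n → LR m
  | .inl i => tm1 i
  | .inr _ => 1

/-- The Grassmann part of the operator attached to `e_{xy}`. -/
def gS : GlIdx m n → GExp n
  | .inl _ => gz n
  | .inr α => gx α

/-- The direction of the operator attached to `e_{xy}`. -/
def gD : GlIdx m n → Dir m n b
  | .inl j => .di j
  | .inr β => .pa β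

lemma gP_l (i : Fin m) : gP (.inl i : GlIdx m n) = tm1 i := rfl
lemma gP_r (α : Fin n) : gP (.inr α : GlIdx m n) = 1 := rfl
lemma gS_l (i : Fin m) : gS (.inl i : GlIdx m n) = gz n := rfl
lemma gS_r (α : Fin n) : gS (.inr α : GlIdx m n) = gx α := rfl
lemma gD_l (i : Fin m) : (gD (.inl i : GlIdx m n) : Dir m n b) = .di i := rfl
lemma gD_r (α : Fin n) : (gD (.inr α : GlIdx m n) : Dir m n b) = .pa α := rfl

/-- The operator on families attached to `e_{xy}`. -/
def EO (ρ : WRep m n b) (x y : GlIdx m n) : Module.End ℂ (LExp m → ρ.M) :=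
  Op ρ (gS x, gD y) (gP x)

lemma wD_gD (y : GlIdx m n) : wD (gD y : Dir m n b) = 1 := by cases y <;> rfl

lemma gdeg_gS (x : GlIdx m n) : gdeg (gS x) = gpar x := by
  cases x
  · exact gdeg_gz
  · exact gdeg_gx _

lemma gpar_le (x : GlIdx m n) : gpar x ≤ 1 := by cases x <;> simp [gpar]

lemma gP_mem_pow (x : GlIdx m n) : gP x ∈ augI m ^ (1 - gpar x) := by
  cases x with
  | inl i => simpa [gP, gpar] using tm1_mem i
  | inr α => simp [gpar]

lemma gP_mem (x : GlIdx m n) (y : GlIdx m n) : gP x ∈ Jx 0 ((gS x, gD y) : GExp n × Dir m n b) := by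
  rw [Jx]
  simp only [wD_gD, gdeg_gS, zero_add]
  exact gP_mem_pow x

lemma pd_gS_gD (x y : GlIdx m n) :
    pd ((gS x, gD y) : GExp n × Dir m n b) = (gpar x + gpar y) % 2 := by
  cases y <;> simp [gD, pd, par, gdeg_gS, gpar]

variable {ρ : WRep m n b}

lemma gl_bracket (x y z w : GlIdx m n) {v : LExp m → ρ.M} (hv : v ∈ JM ρ 1) :
    bC (gS x, gD y) ((gS z, gD w) : GExp n × Dir m n b) •
      Op ρ (bE (gS x, gD y) (gS z, gD w)) (gP x * DR (gD y : Dir m n b) (gP z)) v =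
    if y = z then EO ρ x w v else 0 := by
  rcases y with j | β <;> rcases z with k | α
  · simp only [gD_l, gS_l, gP_l, bC, bE, DC, DE, DR, mulSgn_gz_right, xorE_gz_right, dR_tm1, mul_one,
      one_smul, Sum.inl.injEq]
    split_ifs with h
    · refine Op_congr_JM ?_ hv
      have := Ideal.mul_mem_mul (gP_mem_pow x) (tm1_mem k)
      rw [← pow_succ] at this
      have e : gP x * sg (ep k 1) - gP x = gP x * tm1 k := by rw [tm1]; ring
      rw [e, Jx]
      simp only [wD_gD, gdeg_gS]
      exact Ideal.pow_le_pow_right (by omega) this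
    · simp
  · simp [gD, gP, DR, dR_one]
  · simp [gD, gS, bC, DC]
  · simp only [gD_r, gS_r, gP_r, bC, bE, DC, DE, DR, derC_gx, LinearMap.id_apply, mul_one,
      Sum.inr.injEq]
    split_ifs with h
    · subst h; rw [derE_gx]; simp [EO]
    · simp

lemma EO_rel (x y z w : GlIdx m n) {v : LExp m → ρ.M} (hv : v ∈ JM ρ 1) :
    EO ρ x y (EO ρ z w v) -
      ((-1 : ℂ) ^ ((gpar x + gpar y) * (gpar z + gpar w))) • EO ρ z w (EO ρ x y v) =
    (if y = z then EO ρ x w v else 0) -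
      ((-1 : ℂ) ^ ((gpar x + gpar y) * (gpar z + gpar w))) • (if w = x then EO ρ z y v else 0) := by
  have h := LinearMap.congr_fun (Op_comm ρ (gS x, gD y) (gS z, gD w) (gP x) (gP z)) v
  have h1 := gl_bracket x y z w hv
  have h2 := gl_bracket z w x y hv
  simp only [LinearMap.add_apply, LinearMap.sub_apply, LinearMap.smul_apply,
    Module.End.mul_apply, pd_gS_gD, neg_one_pow_mod_mul] at h
  rw [h1, mul_smul, mul_comm (DR _ _), h2] at h
  rw [EO, EO, h]; abel

variable {lam : HIdx m b → ℂ}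

/-- A minimal stable space of families killed by level one. -/
structure MinFam (ρ : WRep m n b) (lam : HIdx m b → ℂ) (V : Submodule ℂ (LExp m → ρ.M)) : Prop where
  le_GF : V ≤ GF ρ lam
  le_JM : V ≤ JM ρ 1
  ne_bot : V ≠ ⊥
  stable : JStable ρ V
  min : ∀ N ≤ V, N ≠ ⊥ → JStable ρ N → N = V

theorem exists_MinFam (htop : ⨆ r, ρ.Gr lam r = ⊤)
    (hfd : ∀ r, FiniteDimensional ℂ (ρ.Gr lam r)) {C : ℕ}
    (hC : ∀ r, Module.finrank ℂ (ρ.Gr lam r) ≤ C) (hne : ∃ r, ρ.Gr lam r ≠ ⊥) :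
    ∃ V, MinFam ρ lam V ∧ FiniteDimensional ℂ V := by
  obtain ⟨K, hK⟩ := exists_VK_ne_bot htop hfd hC hne
  obtain ⟨V, hV, hV0, hVs, hmin⟩ := exists_minimal_JStable hfd hK
  have := VK_finite hfd K
  exact ⟨V, ⟨hV.trans inf_le_left, minimal_le_JM_one hfd hV hV0 hVs hmin, hV0, hVs, hmin⟩,
    Submodule.finiteDimensional_of_le hV⟩

lemma MinFam.EO_mem {V : Submodule ℂ (LExp m → ρ.M)} (h : MinFam ρ lam V) (x y : GlIdx m n)
    (v : LExp m → ρ.M) (hv : v ∈ V) : EO ρ x y v ∈ V :=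
  h.stable _ _ (gP_mem x y) _ hv

/-- Sign twist of `e_{xy}`. -/
def gc (x y : GlIdx m n) : ℂ := (-1) ^ (n * (gpar x + gpar y))

/-- The supertrace character. -/
def gstr (x y : GlIdx m n) : ℂ := if x = y then (-1) ^ gpar x else 0

/-- The restricted operator attached to `e_{xy}`. -/
def MinFam.er {V : Submodule ℂ (LExp m → ρ.M)} (h : MinFam ρ lam V) (x y : GlIdx m n) :
    Module.End ℂ V := (EO ρ x y).restrict (h.EO_mem x y)

lemma MinFam.er_rel {V : Submodule ℂ (LExp m → ρ.M)} (h : MinFam ρ lam V) (x y z w : GlIdx m n) :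
    h.er x y * h.er z w -
      ((-1 : ℂ) ^ ((gpar x + gpar y) * (gpar z + gpar w))) • (h.er z w * h.er x y) =
    (if y = z then h.er x w else 0) -
      ((-1 : ℂ) ^ ((gpar x + gpar y) * (gpar z + gpar w))) • (if w = x then h.er z y else 0) := by
  ext v : 2
  have := EO_rel x y z w (h.le_JM v.2)
  refine Eq.trans ?_ (this.trans ?_)
  · rfl
  · split_ifs <;> simp [MinFam.er]

/-- The operator by which `e_{xy}` acts on a minimal stable space of families. -/
def MinFam.glOp {V : Submodule ℂ (LExp m → ρ.M)} (h : MinFam ρ lam V) (x y : GlIdx m n) :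
    Module.End ℂ V := gc x y • h.er x y + gstr x y • 1

lemma MinFam.glOp_rel {V : Submodule ℂ (LExp m → ρ.M)} (h : MinFam ρ lam V)
    (x y z w : GlIdx m n) :
    h.glOp x y * h.glOp z w -
      ((-1 : ℂ) ^ ((gpar x + gpar y) * (gpar z + gpar w))) • (h.glOp z w * h.glOp x y) =
    (if y = z then h.glOp x w else 0) -
      ((-1 : ℂ) ^ ((gpar x + gpar y) * (gpar z + gpar w))) • (if w = x then h.glOp z y else 0) := by
  simp only [MinFam.glOp]
  have hr := h.er_rel x y z w
  set s : ℂ := (-1 : ℂ) ^ ((gpar x + gpar y) * (gpar z + gpar w)) with hs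
  have h1 : gstr x y = s * gstr x y := by
    by_cases hxy : x = y
    · subst hxy; rw [hs, ← two_mul, mul_assoc, pow_mul]; simp
    · simp [gstr, hxy]
  have h2 : gstr z w = s * gstr z w := by
    by_cases hxy : z = w
    · subst hxy
      rw [hs, show (gpar x + gpar y) * (gpar z + gpar z) = 2 * ((gpar x + gpar y) * gpar z) by ring,
        pow_mul]
      simp
    · simp [gstr, hxy]
  have e1 : (gc x y • h.er x y + gstr x y • 1) * (gc z w • h.er z w + gstr z w • 1) -
      s • ((gc z w • h.er z w + gstr z w • 1) * (gc x y • h.er x y + gstr x y • 1)) =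
      (gc x y * gc z w) • (h.er x y * h.er z w - s • (h.er z w * h.er x y)) +
      ((gstr x y - s * gstr x y) * gc z w) • h.er z w +
      ((gstr z w - s * gstr z w) * gc x y) • h.er x y +
      ((gstr x y - s * gstr x y) * gstr z w) • (1 : Module.End ℂ V) := by
    simp only [mul_add, add_mul, smul_mul_assoc, mul_smul_comm, mul_one, one_mul]
    module
  rw [e1, hr, sub_eq_zero.mpr h1, sub_eq_zero.mpr h2]
  simp only [zero_mul, zero_smul, add_zero]
  have hc1 : y = z → gc x y * gc z w = gc x w := by
    rintro rfl
    rw [gc, gc, gc, ← pow_add, show n * (gpar x + gpar y) + n * (gpar y + gpar w) =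
      n * (gpar x + gpar w) + 2 * (n * gpar y) by ring, pow_add, pow_mul]
    simp
  have hc2 : w = x → gc x y * gc z w = gc z y := by
    rintro rfl
    rw [gc, gc, gc, ← pow_add, show n * (gpar w + gpar y) + n * (gpar z + gpar w) =
      n * (gpar z + gpar y) + 2 * (n * gpar w) by ring, pow_add, pow_mul]
    simp
  have hd : y = z → w = x → gstr x x = s * gstr y y := by
    rintro rfl rfl
    have hy := gpar_le y
    have hw := gpar_le w
    simp only [gstr, if_true, hs]
    interval_cases gpar y <;> interval_cases gpar w <;> norm_num
  by_cases hyz : y = z <;> by_cases hwx : w = x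
  · have a1 := hc1 hyz
    have a2 := hc2 hwx
    have a3 := hd hyz hwx
    simp only [if_pos hyz, if_pos hwx]
    subst hyz hwx
    have a4 : gc w w = gc y y := a1.symm.trans a2
    rw [a1, a3, a4]; module
  · have h3 : gstr x w = 0 := by simp [gstr, Ne.symm hwx]
    simp only [if_pos hyz, if_neg hwx, hc1 hyz, h3]; module
  · have h3 : gstr z y = 0 := by simp [gstr, Ne.symm hyz]
    simp only [if_neg hyz, if_pos hwx, ← hc2 hwx, h3]; module
  · simp only [if_neg hyz, if_neg hwx]; module

/-- The representation of `gl(m,n)` on a minimal stable space of families. -/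
def MinFam.gl {V : Submodule ℂ (LExp m → ρ.M)} (h : MinFam ρ lam V) : GlRep m n where
  V := V
  ρ := h.glOp
  rel := h.glOp_rel

lemma eq_gz {s : GExp n} (h : gdeg s = 0) : s = gz n := by
  ext a
  rw [gdeg, Finset.card_eq_zero, Finset.filter_eq_empty_iff] at h
  simpa [gz] using h (Finset.mem_univ a)

lemma eq_gx {s : GExp n} (h : gdeg s = 1) : ∃ α, s = gx α := by
  rw [gdeg, Finset.card_eq_one] at h
  obtain ⟨α, h⟩ := h
  refine ⟨α, funext fun a => ?_⟩
  have : s a = true ↔ a = α := by simpa using Finset.ext_iff.mp h a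
  rw [Bool.eq_iff_iff, this, gx_eq_true]

lemma Op_eq_zero_of_gdeg {a : GExp n × Dir m n b} (ha : 1 + wD a.2 ≤ gdeg a.1) (P : LR m)
    {v : LExp m → ρ.M} (hv : v ∈ JM ρ 1) : Op ρ a P v = 0 := by
  refine mem_JM.mp hv _ _ ?_
  rw [Jx, Nat.sub_eq_zero_of_le ha]; simp

lemma dir_cases (D : Dir m n b) : wD D = 0 ∨ ∃ y, D = gD y := by
  cases D with
  | di i => exact Or.inr ⟨.inl i, rfl⟩
  | pa a => exact Or.inr ⟨.inr a, rfl⟩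
  | d0 => exact Or.inl rfl

lemma Op_one_d0 {ρ : WRep m n true} {lam : HIdx m true → ℂ} (j : Fin (cond true 1 0)) {v : LExp m → ρ.M}
    (hv : v ∈ GF ρ lam) : Op ρ (gz n, .d0) 1 v = lam (.inr j) • v := by
  ext r
  rw [← sg_zero, Op_sg, Tx_apply, sub_zero]
  exact ρ.mem_wt.1 (mem_GF.mp hv r) (.inr j)

lemma MinFam.isSimple {V : Submodule ℂ (LExp m → ρ.M)} (h : MinFam ρ lam V) : h.gl.IsSimple := by
  constructor
  · obtain ⟨v, hv, hv0⟩ := Submodule.exists_mem_ne_zero_of_ne_bot h.ne_bot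
    exact ⟨⟨v, hv⟩, fun h' => hv0 (congrArg Subtype.val h')⟩
  · intro (N : Submodule ℂ V) hN
    by_cases hN0 : N = ⊥
    · exact Or.inl hN0
    right
    have hE (x y : GlIdx m n) (v : V) (hv : v ∈ N) : h.er x y v ∈ N := by
      have h1 : (gc x y • h.er x y + gstr x y • 1) v ∈ N := hN x y v hv
      have h2 := N.sub_mem h1 (N.smul_mem (gstr x y) hv)
      have hc : gc x y ≠ 0 := by rw [gc]; exact pow_ne_zero _ (by norm_num)
      have h3 := N.smul_mem (gc x y)⁻¹ h2
      simpa [hc] using h3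
    have hstab : JStable ρ (N.map V.subtype) := by
      rintro ⟨s, D⟩ P hP _ ⟨v, hv, rfl⟩
      rw [Submodule.subtype_apply]
      have hvJ := h.le_JM v.2
      have hE' (x y : GlIdx m n) : EO ρ x y v ∈ N.map V.subtype := ⟨_, hE x y v hv, rfl⟩
      by_cases hs : 1 + wD D ≤ gdeg s
      · rw [Op_eq_zero_of_gdeg hs P hvJ]; exact zero_mem _
      obtain ⟨c, hc⟩ := augI_add_const P
      rcases dir_cases D with hD | ⟨y, rfl⟩
      · obtain rfl := eq_gz (s := s) (by omega)
        cases D with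
        | d0 =>
          rw [Op_congr_JM (Q := c • 1) (by simpa [Jx, wD] using hc) hvJ, map_smul,
            LinearMap.smul_apply, Op_one_d0 (0 : Fin 1) (h.le_GF v.2)]
          exact Submodule.smul_mem _ _ (Submodule.smul_mem _ _ ⟨v, hv, rfl⟩)
        | _ => simp [wD] at hD
      · rw [wD_gD] at hs
        rcases (show gdeg s = 0 ∨ gdeg s = 1 by omega) with hs | hs
        · obtain rfl := eq_gz hs
          rw [Jx] at hP
          simp only [wD_gD, gdeg_gz] at hP
          obtain ⟨c, hc⟩ := augI_first_order (by simpa using hP)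
          rw [Op_congr_JM (Q := ∑ i, c i • tm1 i) (by simpa [Jx, wD_gD] using hc) hvJ, map_sum,
            LinearMap.sum_apply]
          refine Submodule.sum_mem _ fun i _ => ?_
          rw [map_smul, LinearMap.smul_apply]
          exact Submodule.smul_mem _ _ (hE' (.inl i) y)
        · obtain ⟨α, rfl⟩ := eq_gx hs
          rw [Op_congr_JM (Q := c • 1) (by simpa [Jx, wD_gD, gdeg_gx] using hc) hvJ, map_smul,
            LinearMap.smul_apply]
          exact Submodule.smul_mem _ _ (hE' (.inr α) y)
    have hNV := h.min (N.map V.subtype) (Submodule.map_subtype_le _ _)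
      (fun h' => hN0 (Submodule.map_injective_of_injective V.injective_subtype
        (h'.trans (Submodule.map_bot _).symm))) hstab
    refine Submodule.eq_top_iff'.mpr fun (v : V) => ?_
    have hv : (v : LExp m → ρ.M) ∈ N.map V.subtype := by rw [hNV]; exact v.2
    obtain ⟨w, hw, e⟩ := hv
    rwa [← Subtype.ext e]

end GlAction
end

noncomputable section

variable {m n : ℕ} {b : Bool}

section Leibniz

/-- The number of odd variables of `ξ^g` before `a`. -/
def ltC (a : Fin n) (g : GExp n) : ℕ := (Finset.univ.filter fun x => g x = true ∧ x < a).card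

/-- The number of odd variables of `ξ^g` after `a`. -/
def gtC (a : Fin n) (g : GExp n) : ℕ := (Finset.univ.filter fun x => g x = true ∧ a < x).card

lemma derC_true {a : Fin n} {g : GExp n} (h : g a = true) : derC a g = (-1) ^ ltC a g := by
  rw [derC, if_pos h, ltC]

lemma invCount_eq_left (f g : GExp n) :
    invCount f g = ∑ p, if f p = true then ltC p g else 0 := by
  rw [invCount, Finset.card_filter, Finset.sum_product]
  refine Finset.sum_congr rfl fun p _ => ?_
  split_ifs with h
  · rw [ltC, Finset.card_filter]; simp only [h, true_and]
  · simp [h]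

lemma invCount_eq_right (f g : GExp n) :
    invCount f g = ∑ q, if g q = true then gtC q f else 0 := by
  rw [invCount, Finset.card_filter, Finset.sum_product_right]
  refine Finset.sum_congr rfl fun p _ => ?_
  split_ifs with h
  · rw [gtC, Finset.card_filter]
    exact Finset.sum_congr rfl fun x _ => by simp only [h, true_and]
  · simp [h]

lemma invCount_derE_left {a : Fin n} {f : GExp n} (h : f a = true) (g : GExp n) :
    invCount f g = ltC a g + invCount (derE a f) g := by
  rw [invCount_eq_left, invCount_eq_left, ← Finset.add_sum_erase _ _ (Finset.mem_univ a),
    ← Finset.add_sum_erase (f := fun p => if derE a f p = true then ltC p g else 0) _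
      (Finset.mem_univ a), if_pos h, derE_same, if_neg (by simp), zero_add]
  congr 1
  exact Finset.sum_congr rfl fun p hp => by rw [derE_ne (Finset.ne_of_mem_erase hp)]

lemma invCount_derE_right {a : Fin n} {g : GExp n} (h : g a = true) (f : GExp n) :
    invCount f g = gtC a f + invCount f (derE a g) := by
  rw [invCount_eq_right, invCount_eq_right, ← Finset.add_sum_erase _ _ (Finset.mem_univ a),
    ← Finset.add_sum_erase (f := fun p => if derE a g p = true then gtC p f else 0) _
      (Finset.mem_univ a), if_pos h, derE_same, if_neg (by simp), zero_add]
  congr 1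
  exact Finset.sum_congr rfl fun p hp => by rw [derE_ne (Finset.ne_of_mem_erase hp)]

lemma gdeg_split (a : Fin n) (f : GExp n) :
    gdeg f = ltC a f + (if f a = true then 1 else 0) + gtC a f := by
  rw [gdeg, ltC, gtC, Finset.card_filter, Finset.card_filter, Finset.card_filter]
  have : (if f a = true then 1 else 0) =
      ∑ x, if x = a then (if f x = true then 1 else 0) else 0 := by simp
  rw [this, ← Finset.sum_add_distrib, ← Finset.sum_add_distrib]
  refine Finset.sum_congr rfl fun x _ => ?_
  rcases lt_trichotomy x a with hx | hx | hx
  · simp [hx, hx.ne, hx.not_gt]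
  · simp [hx]
  · simp [hx, hx.ne', hx.not_gt]

lemma mulSgn_pos {f g : GExp n} (h : ∀ a, f a = true → g a = false) :
    mulSgn f g = (-1) ^ invCount f g := by
  rw [mulSgn, if_neg]
  rintro ⟨a, h1, h2⟩
  simp [h a h1] at h2

lemma mulSgn_zero {f g : GExp n} {a : Fin n} (h : f a = true) (h' : g a = true) :
    mulSgn f g = 0 := by rw [mulSgn, if_pos ⟨a, h, h'⟩]

lemma ltC_xorE {f g : GExp n} (h : ∀ a, f a = true → g a = false) (a : Fin n) :
    ltC a (xorE f g) = ltC a f + ltC a g := by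
  rw [ltC, ltC, ltC, Finset.card_filter, Finset.card_filter, Finset.card_filter,
    ← Finset.sum_add_distrib]
  refine Finset.sum_congr rfl fun x _ => ?_
  have := h x
  rw [xorE]
  revert this
  cases f x <;> cases g x <;> simp

lemma derE_xorE_left {a : Fin n} {f g : GExp n} (h : g a = false) :
    derE a (xorE f g) = xorE (derE a f) g := by
  ext x
  by_cases hx : x = a
  · subst hx; simp [derE_same, xorE, h]
  · simp [derE_ne hx, xorE]

lemma derE_xorE_right {a : Fin n} {f g : GExp n} (h : f a = false) :
    derE a (xorE f g) = xorE f (derE a g) := by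
  rw [xorE_comm, derE_xorE_left h, xorE_comm]

lemma xorE_derE_swap {a : Fin n} {f g : GExp n} (h : f a = true) (h' : g a = true) :
    xorE (derE a f) g = xorE f (derE a g) := by
  ext x
  by_cases hx : x = a
  · subst hx; simp [derE_same, xorE, h, h']
  · simp [derE_ne hx, xorE]

lemma derE_eq_true {a x : Fin n} {f : GExp n} : derE a f x = true ↔ x ≠ a ∧ f x = true := by
  by_cases hx : x = a
  · subst hx; simp [derE_same]
  · simp [derE_ne hx, hx]

lemma neg_one_pow_eq_of_even {k l : ℕ} (h : Even (k + l)) : (-1 : ℂ) ^ k = (-1) ^ l := by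
  rcases Nat.even_or_odd k with hk | hk
  · rw [hk.neg_one_pow, ((Nat.even_add.mp h).mp hk).neg_one_pow]
  · have : Odd l := by
      rw [← Nat.not_even_iff_odd] at hk ⊢
      exact fun hl => hk ((Nat.even_add.mp h).mpr hl)
    rw [hk.neg_one_pow, this.neg_one_pow]

/-- The graded Leibniz rule for `∂_a` on monomials, with values in a module. -/
lemma leibniz_mono {E : Type} [AddCommGroup E] [Module ℂ E] (a : Fin n) (f g : GExp n)
    (F : GExp n → E) :
    (mulSgn f g * derC a (xorE f g)) • F (derE a (xorE f g)) =
      (derC a f * mulSgn (derE a f) g) • F (xorE (derE a f) g) +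
      ((-1) ^ gdeg f * derC a g * mulSgn f (derE a g)) • F (xorE f (derE a g)) := by
  cases hf : f a <;> cases hg : g a
  · simp [derC_false hf, derC_false hg, derC_false (show xorE f g a = false by simp [xorE, hf, hg])]
  · rw [derC_false hf, derE_xorE_right hf]
    simp only [zero_mul, zero_smul, zero_add]
    congr 1
    by_cases hd : ∀ x, f x = true → g x = false
    · have hd' : ∀ x, f x = true → derE a g x = false := fun x hx => by
        have := hd x hx
        by_cases hxa : x = a
        · subst hxa; exact derE_same _ _
        · rwa [derE_ne hxa]
      rw [mulSgn_pos hd, mulSgn_pos hd', derC_true hg,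
        derC_true (show xorE f g a = true by simp [xorE, hf, hg]), ltC_xorE hd, ← pow_add,
        ← pow_add, ← pow_add, invCount_derE_right hg, gdeg_split a f, hf]
      refine neg_one_pow_eq_of_even ?_
      simp only [Bool.false_eq_true, if_false]
      exact ⟨gtC a f + invCount f (derE a g) + ltC a f + ltC a g, by ring⟩
    · push Not at hd
      obtain ⟨x, hx, hx'⟩ := hd
      have hx' : g x = true := by simpa using hx'
      have hxa : x ≠ a := by rintro rfl; simp [hf] at hx
      rw [mulSgn_zero hx hx', mulSgn_zero hx (derE_eq_true.mpr ⟨hxa, hx'⟩)]; simp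
  · rw [derC_false hg, derE_xorE_left hg]
    simp only [mul_zero, zero_mul, zero_smul, add_zero]
    congr 1
    by_cases hd : ∀ x, f x = true → g x = false
    · have hd' : ∀ x, derE a f x = true → g x = false := fun x hx => hd x (derE_eq_true.mp hx).2
      rw [mulSgn_pos hd, mulSgn_pos hd', derC_true hf,
        derC_true (show xorE f g a = true by simp [xorE, hf, hg]), ltC_xorE hd, ← pow_add,
        ← pow_add, invCount_derE_left hf]
      refine neg_one_pow_eq_of_even ?_
      exact ⟨invCount (derE a f) g + ltC a f + ltC a g, by ring⟩
    · push Not at hd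
      obtain ⟨x, hx, hx'⟩ := hd
      have hx' : g x = true := by simpa using hx'
      have hxa : x ≠ a := by rintro rfl; simp [hg] at hx'
      rw [mulSgn_zero hx hx', mulSgn_zero (derE_eq_true.mpr ⟨hxa, hx⟩) hx']; simp
  · rw [mulSgn_zero hf hg, xorE_derE_swap hf hg, ← add_smul, zero_mul, zero_smul]
    refine (smul_eq_zero_of_left ?_ _).symm
    by_cases hd : ∀ x, x ≠ a → f x = true → g x = false
    · have h1 : ∀ x, derE a f x = true → g x = false := fun x hx =>
        hd x (derE_eq_true.mp hx).1 (derE_eq_true.mp hx).2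
      have h2 : ∀ x, f x = true → derE a g x = false := fun x hx => by
        by_cases hxa : x = a
        · subst hxa; exact derE_same _ _
        · rw [derE_ne hxa]; exact hd x hxa hx
      rw [mulSgn_pos h1, mulSgn_pos h2, derC_true hf, derC_true hg, ← pow_add, ← pow_add,
        ← pow_add, ← neg_eq_iff_add_eq_zero, ← neg_one_mul, ← pow_succ']
      refine neg_one_pow_eq_of_even ?_
      have e1 := invCount_derE_left hf g
      have e2 := invCount_derE_right hg f
      rw [gdeg_split a f, if_pos hf]
      refine ⟨ltC a f + 1 + gtC a f + invCount f (derE a g), ?_⟩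
      omega
    · push Not at hd
      obtain ⟨x, hxa, hx, hx'⟩ := hd
      have hx' : g x = true := by simpa using hx'
      rw [mulSgn_zero hx (derE_eq_true.mpr ⟨hxa, hx'⟩),
        mulSgn_zero (derE_eq_true.mpr ⟨hxa, hx⟩) hx']; simp

lemma derE_comm (a c : Fin n) (g : GExp n) : derE a (derE c g) = derE c (derE a g) := by
  ext x
  by_cases ha : x = a <;> by_cases hc : x = c <;> simp [derE, ha, hc, Function.update]

lemma ltC_derE {a c : Fin n} {g : GExp n} (hc : g c = true) :
    ltC a g = ltC a (derE c g) + if c < a then 1 else 0 := by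
  rw [ltC, ltC, Finset.card_filter, Finset.card_filter,
    ← Finset.add_sum_erase _ _ (Finset.mem_univ c),
    ← Finset.add_sum_erase (f := fun x => if derE c g x = true ∧ x < a then 1 else 0) _
      (Finset.mem_univ c), derE_same, hc]
  simp only [true_and, Bool.false_eq_true, false_and, if_false, zero_add]
  rw [add_comm]
  congr 1
  exact Finset.sum_congr rfl fun p hp => by rw [derE_ne (Finset.ne_of_mem_erase hp)]

lemma derC_derE_anti (a c : Fin n) (g : GExp n) :
    derC a g * derC c (derE a g) = -(derC c g * derC a (derE c g)) := by
  by_cases hac : a = c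
  · subst hac; simp [derC_false (derE_same a g)]
  by_cases ha : g a = true
  swap
  · rw [derC_false (by simpa using ha), derC_false (show derE c g a = false by
      rw [derE_ne hac]; simpa using ha)]; simp
  by_cases hc : g c = true
  swap
  · rw [derC_false (a := c) (s := g) (by simpa using hc),
      derC_false (show derE a g c = false by rw [derE_ne (Ne.symm hac)]; simpa using hc)]; simp
  rw [derC_true ha, derC_true hc, derC_true (derE_eq_true.mpr ⟨Ne.symm hac, hc⟩),
    derC_true (derE_eq_true.mpr ⟨hac, ha⟩), ← pow_add, ← pow_add, ← neg_one_mul ((-1) ^ _),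
    ← pow_succ']
  refine neg_one_pow_eq_of_even ?_
  have h1 := ltC_derE (a := a) hc
  have h2 := ltC_derE (a := c) ha
  rcases lt_or_gt_of_ne hac with h | h
  · rw [if_neg h.not_gt] at h1
    rw [if_pos h] at h2
    exact ⟨ltC a g + ltC c g, by omega⟩
  · rw [if_neg h.not_gt] at h2
    rw [if_pos h] at h1
    exact ⟨ltC a g + ltC c g, by omega⟩

end Leibniz
end

noncomputable section

variable {m n : ℕ} {b : Bool}

section TensorOps

/-- Parity of a direction. -/
def pD : Dir m n b → ℕ
  | .di _ => 0
  | .pa _ => 1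
  | .d0 => 0

lemma neg_one_pow_pd (s : GExp n) (D : Dir m n b) :
    (-1 : ℂ) ^ pd (s, D) = (-1) ^ (gdeg s + pD D) := by
  cases D <;> simp only [pd, par, pD, add_zero] <;> exact (neg_one_pow_eq_pow_mod_two _).symm

variable (σ : GlRep m n) (lam : Fin m → ℂ) (lam0 : ℂ)

/-- Left multiplication by the monomial `t^s ξ^f`. -/
def Lop (s : LExp m) (f : GExp n) : Module.End ℂ (TModule σ) :=
  Finsupp.lsum ℂ fun rc => mulSgn f rc.2 • Finsupp.lsingle (rc.1 + s, xorE f rc.2)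

/-- The operator `1 ⊗ e` for `e` of parity `p`. -/
def Top (p : ℕ) (e : Module.End ℂ σ.V) : Module.End ℂ (TModule σ) :=
  Finsupp.lsum ℂ fun rc => (-1 : ℂ) ^ (gdeg rc.2 * p) • (Finsupp.lsingle rc ∘ₗ e)

/-- The scalar of a direction acting on a monomial of the (twisted) tensor module. -/
def cD : Dir m n b → LExp m → GExp n → ℂ
  | .di j, r, _ => r j + lam j
  | .pa β, _, g => derC β g
  | .d0, _, _ => lam0

/-- The derivation attached to a direction. -/
def Dp (D : Dir m n b) : Module.End ℂ (TModule σ) :=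
  Finsupp.lsum ℂ fun rc => cD lam lam0 D rc.1 rc.2 • Finsupp.lsingle (rc.1, DE D rc.2)

/-- The action of `e_{xy}`, with `y` the index of a direction. -/
def rD (x : GlIdx m n) : Dir m n b → Module.End ℂ σ.V
  | .di j => σ.ρ x (.inl j)
  | .pa β => σ.ρ x (.inr β)
  | .d0 => 0

/-- The part of the tensor module action that multiplies by the monomial itself. -/
def Yop (s : LExp m) (D : Dir m n b) : Module.End ℂ (TModule σ) :=
  Dp σ lam lam0 D + ∑ i, (s i : ℂ) • Top σ (pD D) (rD σ (.inl i) D)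

/-- The action on the tensor module as a composition of elementary operators. -/
def tmL (x : WBasis m n b) : Module.End ℂ (TModule σ) :=
  Lop σ x.1 x.2.1 * Yop σ lam lam0 x.1 x.2.2 +
  ∑ α, ((-1) ^ (gdeg x.2.1 + 1) * derC α x.2.1) •
    (Lop σ x.1 (derE α x.2.1) * Top σ (1 + pD x.2.2) (rD σ (.inr α) x.2.2))

variable {σ lam lam0}

lemma Lop_single (s : LExp m) (f : GExp n) (r : LExp m) (g : GExp n) (v : σ.V) :
    Lop σ s f (Finsupp.single (r, g) v) = mulSgn f g • Finsupp.single (r + s, xorE f g) v := by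
  simp [Lop]

lemma Top_single (p : ℕ) (e : Module.End ℂ σ.V) (r : LExp m) (g : GExp n) (v : σ.V) :
    Top σ p e (Finsupp.single (r, g) v) = (-1 : ℂ) ^ (gdeg g * p) • Finsupp.single (r, g) (e v) := by
  simp [Top]

lemma Dp_single (D : Dir m n b) (r : LExp m) (g : GExp n) (v : σ.V) :
    Dp σ lam lam0 D (Finsupp.single (r, g) v) =
      cD lam lam0 D r g • Finsupp.single (r, DE D g) v := by
  simp [Dp]

lemma tm_ext {M' : Type} [AddCommGroup M'] [Module ℂ M'] {A B : TModule σ →ₗ[ℂ] M'}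
    (h : ∀ r g v, A (Finsupp.single (r, g) v) = B (Finsupp.single (r, g) v)) : A = B := by
  refine Finsupp.lhom_ext' fun rc => LinearMap.ext fun v => ?_
  exact h rc.1 rc.2 v

lemma d_Lop (β : Fin n) (s : LExp m) (f : GExp n) :
    Dp σ lam lam0 (.pa β : Dir m n b) * Lop σ s f = derC β f • Lop σ s (derE β f) +
      (-1 : ℂ) ^ gdeg f • (Lop σ s f * Dp σ lam lam0 (.pa β : Dir m n b)) := by
  refine tm_ext fun r g v => ?_
  simp only [Module.End.mul_apply, LinearMap.add_apply, LinearMap.smul_apply, Lop_single, map_smul,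
    Dp_single, cD, smul_smul, DE_pa]
  have := leibniz_mono β f g (fun e => (Finsupp.single (r + s, e) v : TModule σ))
  rw [this, ← mul_assoc]

lemma d_Top (β : Fin n) (p : ℕ) (e : Module.End ℂ σ.V) :
    Dp σ lam lam0 (.pa β : Dir m n b) * Top σ p e =
      (-1 : ℂ) ^ p • (Top σ p e * Dp σ lam lam0 (.pa β : Dir m n b)) := by
  refine tm_ext fun r g v => ?_
  simp only [Module.End.mul_apply, LinearMap.smul_apply, Top_single, map_smul,
    Dp_single, cD, smul_smul, DE_pa]
  by_cases h : derC β g = 0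
  · simp [h]
  congr 1
  rw [← gdeg_derE h]; ring

lemma d_Dp (β : Fin n) (D : Dir m n b) :
    Dp σ lam lam0 (.pa β : Dir m n b) * Dp σ lam lam0 D =
      (-1 : ℂ) ^ pD D • (Dp σ lam lam0 D * Dp σ lam lam0 (.pa β : Dir m n b)) := by
  refine tm_ext fun r g v => ?_
  simp only [Module.End.mul_apply, LinearMap.smul_apply, map_smul, Dp_single, smul_smul]
  cases D with
  | di j => simp [cD, DE, pD, mul_comm]
  | pa γ =>
    simp only [cD, DE, pD, pow_one, neg_one_mul]
    rw [derC_derE_anti, derE_comm]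
  | d0 => simp [cD, DE, pD, mul_comm]

lemma d_Yop (β : Fin n) (s : LExp m) (D : Dir m n b) :
    Dp σ lam lam0 (.pa β : Dir m n b) * Yop σ lam lam0 s D =
      (-1 : ℂ) ^ pD D • (Yop σ lam lam0 s D * Dp σ lam lam0 (.pa β : Dir m n b)) := by
  rw [Yop, mul_add, add_mul, d_Dp, smul_add, Finset.mul_sum, Finset.sum_mul, Finset.smul_sum]
  congr 1
  refine Finset.sum_congr rfl fun i _ => ?_
  rw [mul_smul_comm, d_Top, smul_mul_assoc, smul_comm]

/-- The commutation relation of `∂_β` with the tensor module action. -/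
lemma d_tmL (β : Fin n) (s : LExp m) (f : GExp n) (D : Dir m n b) :
    Dp σ lam lam0 (.pa β : Dir m n b) * tmL σ lam lam0 (s, f, D) =
      (-1 : ℂ) ^ pd (f, D) • (tmL σ lam lam0 (s, f, D) * Dp σ lam lam0 (.pa β : Dir m n b)) +
      derC β f • tmL σ lam lam0 (s, derE β f, D) := by
  rw [neg_one_pow_pd]
  simp only [tmL]
  rw [mul_add, add_mul, ← mul_assoc, d_Lop, add_mul, smul_mul_assoc, smul_mul_assoc, mul_assoc,
    d_Yop, mul_smul_comm, smul_smul, ← pow_add, Finset.mul_sum, Finset.sum_mul, smul_add, smul_add,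
    Finset.smul_sum, Finset.smul_sum, ← mul_assoc]
  have key : ∀ α, Dp σ lam lam0 (.pa β : Dir m n b) * (((-1) ^ (gdeg f + 1) * derC α f) •
      (Lop σ s (derE α f) * Top σ (1 + pD D) (rD σ (.inr α) D))) =
      (-1 : ℂ) ^ (gdeg f + pD D) • (((-1) ^ (gdeg f + 1) * derC α f) •
        (Lop σ s (derE α f) * Top σ (1 + pD D) (rD σ (.inr α) D)) *
          Dp σ lam lam0 (.pa β : Dir m n b)) +
      derC β f • (((-1) ^ (gdeg (derE β f) + 1) * derC α (derE β f)) •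
        (Lop σ s (derE α (derE β f)) * Top σ (1 + pD D) (rD σ (.inr α) D))) := by
    intro α
    rw [mul_smul_comm, ← mul_assoc, d_Lop, add_mul, smul_mul_assoc, smul_mul_assoc,
      mul_assoc (Lop σ s (derE α f)), d_Top, mul_smul_comm, smul_add, smul_mul_assoc,
      add_comm (_ • _ • _) (_ • _ • _ • _)]
    simp only [smul_smul, mul_assoc]
    congr 1
    · by_cases h : derC α f = 0
      · simp [h]
      congr 1
      rw [← gdeg_derE h]
      ring
    · rw [derE_comm]
      congr 1
      by_cases h : derC β f = 0
      · have := derC_derE_anti α β f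
        rw [h, zero_mul, neg_zero] at this
        rw [this, h]; simp
      · rw [derC_derE_anti, ← gdeg_derE h]; ring
  rw [Finset.sum_congr rfl fun α _ => key α, Finset.sum_add_distrib]
  abel

lemma tmAct_single (x : WBasis m n b) (r : LExp m) (g : GExp n) (v : σ.V) :
    tmAct σ lam lam0 x (Finsupp.single (r, g) v) =
      tmL σ lam lam0 x (Finsupp.single (r, g) v) := by
  obtain ⟨s, f, D⟩ := x
  simp only [tmL, Yop, LinearMap.add_apply, Module.End.mul_apply, Dp_single, map_add, map_smul,
    LinearMap.sum_apply, LinearMap.smul_apply, map_sum, Top_single, Lop_single]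
  cases D with
  | di j =>
    rw [tmAct, Finsupp.sum_single_index (by simp)]
    simp only [cD, DE, pD, rD, smul_smul]
    congr 1
    · congr 1
      exact Finset.sum_congr rfl fun i _ => by simp
    · exact Finset.sum_congr rfl fun i _ => by congr 1; ring
  | pa β =>
    rw [tmAct, Finsupp.sum_single_index (by simp)]
    simp only [cD, DE, pD, rD, smul_smul]
    congr 1
    · congr 1
      exact Finset.sum_congr rfl fun i _ => by congr 1; ring
    · exact Finset.sum_congr rfl fun i _ => by
        congr 1; rw [mul_comm (gdeg g), pow_mul]; norm_num
  | d0 =>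
    rw [tmAct, Finsupp.sum_single_index (by simp)]
    simp [cD, DE, rD, smul_smul]

lemma tmAct_eq (x : WBasis m n b) (u : TModule σ) :
    tmAct σ lam lam0 x u = tmL σ lam lam0 x u := by
  have h1 : tmAct σ lam lam0 x u = u.sum fun rc v => tmAct σ lam lam0 x (Finsupp.single rc v) := by
    obtain ⟨s, f, D⟩ := x
    cases D <;> simp only [tmAct] <;> refine Finsupp.sum_congr fun rc _ => ?_ <;>
      rw [Finsupp.sum_single_index (by simp)]
  rw [h1]
  conv_rhs => rw [← Finsupp.sum_single u, map_finsuppSum]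
  exact Finsupp.sum_congr fun rc _ => tmAct_single x rc.1 rc.2 _

end TensorOps
end

noncomputable section

variable {m n : ℕ} {b : Bool}

section TensorHom

/-- The ordered product of the odd derivations whose variable is absent from the monomial. -/
def Gop {M : Type} [AddCommGroup M] [Module ℂ M] :
    (k : ℕ) → (Fin k → Module.End ℂ M) → GExp k → Module.End ℂ M
  | 0, _, _ => 1
  | k + 1, d, g => (if g 0 = true then 1 else d 0) * Gop k (fun i => -d i.succ) fun i => g i.succ

lemma Gop_top {M : Type} [AddCommGroup M] [Module ℂ M] (k : ℕ) (d : Fin k → Module.End ℂ M) :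
    Gop k d (fun _ => true) = 1 := by
  induction k with
  | zero => rfl
  | succ k ih => rw [Gop, if_pos rfl, ih, one_mul]

lemma derC_succ {k : ℕ} (β : Fin k) (g : GExp (k + 1)) :
    derC β.succ g = (if g 0 = true then -1 else 1) * derC β fun i => g i.succ := by
  rw [derC, derC, Fin.card_filter_univ_succ]
  by_cases h : g β.succ = true
  · rw [if_pos h, if_pos h]
    by_cases h0 : g 0 = true
    · simp [h0, pow_succ]
    · simp [h0]
  · simp [h]

lemma derC_zero {k : ℕ} (g : GExp (k + 1)) : derC 0 g = if g 0 = true then 1 else 0 := by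
  simp [derC]

lemma Gop_der {M : Type} [AddCommGroup M] [Module ℂ M] (k : ℕ) (d : Fin k → Module.End ℂ M)
    (hd : ∀ i j, d i * d j = -(d j * d i)) (β : Fin k) (g : GExp k) :
    d β * Gop k d g = derC β g • Gop k d (derE β g) := by
  induction k with
  | zero => exact β.elim0
  | succ k ih =>
    have hd' : ∀ i j : Fin k, (-d i.succ) * (-d j.succ) = -((-d j.succ) * (-d i.succ)) := by
      intro i j; rw [neg_mul_neg, neg_mul_neg, hd]
    refine Fin.cases ?_ (fun β => ?_) β
    · have hs : d 0 * d 0 = 0 := by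
        have h2 : (2 : ℂ) • (d 0 * d 0) = 0 := by
          rw [two_smul]; exact add_eq_zero_iff_eq_neg.mpr (hd 0 0)
        simpa using h2
      have e : (fun i : Fin k => derE 0 g i.succ) = fun i => g i.succ :=
        funext fun i => derE_ne (Fin.succ_ne_zero i) g
      rw [Gop, Gop, e, derE_same, derC_zero, ← mul_assoc]
      by_cases h : g 0 = true
      · simp [h]
      · simp [h, hs]
    · have e : (fun i : Fin k => derE β.succ g i.succ) = derE β fun i => g i.succ := by
        funext i
        by_cases hi : i = β
        · subst hi; rw [derE_same, derE_same]
        · rw [derE_ne hi, derE_ne (by simpa using hi)]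
      have h1 := ih (fun i => -d i.succ) hd' β (fun i => g i.succ)
      simp only [neg_mul] at h1
      have h2 : d β.succ * Gop k (fun i => -d i.succ) (fun i => g i.succ) =
          -(derC β (fun i => g i.succ) •
            Gop k (fun i => -d i.succ) (derE β fun i => g i.succ)) := by
        rw [← h1, neg_neg]
      rw [Gop, Gop, e, derC_succ, derE_ne (Fin.succ_ne_zero β).symm, ← mul_assoc]
      by_cases h : g 0 = true
      · simp only [h, if_true, mul_one, one_mul]
        rw [h2, neg_one_mul, neg_smul]
      · simp only [h]
        simp only [Bool.false_eq_true, if_false]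
        rw [hd, neg_mul, mul_assoc, h2, one_mul, mul_neg, neg_neg, mul_smul_comm]

variable (ρ : WRep m n b)

/-- The action of `∂_β`. -/
def dOp (β : Fin n) : Module.End ℂ ρ.M := ρ.g ⟨0, gz n, .pa β⟩

variable {ρ}

lemma dOp_g (β : Fin n) (s : LExp m) (f : GExp n) (D : Dir m n b) :
    dOp ρ β * ρ.g (s, f, D) = (-1 : ℂ) ^ pd (f, D) • (ρ.g (s, f, D) * dOp ρ β) +
      derC β f • ρ.g (s, derE β f, D) := by
  ext v
  have h := ρ.comm ⟨0, gz n, .pa β⟩ (s, f, D) v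
  rw [brB_eq, par_eq_pd, par_eq_pd] at h
  have h0 : dD D 0 * bC (f, D) ((gz n, .pa β) : GExp n × Dir m n b) = 0 := by
    cases D <;> simp [dD, bC, DC]
  have h1 : pd ((gz n, .pa β) : GExp n × Dir m n b) = 1 := by simp [pd, par]
  rw [h0, h1] at h
  simp only [mul_zero, zero_smul, sub_zero, zero_add, map_smul, LinearMap.smul_apply, bC, bE, DC,
    DE, dD, one_mul, mulSgn_gz_left, mul_one, xorE_gz_left, WRep.act_sng] at h
  simp only [Module.End.mul_apply, LinearMap.add_apply, LinearMap.smul_apply, dOp]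
  rw [h]; abel

lemma dOp_anti (α β : Fin n) : dOp ρ α * dOp ρ β = -(dOp ρ β * dOp ρ α) := by
  have := dOp_g (ρ := ρ) α 0 (gz n) (.pa β)
  rw [derC_gz, zero_smul, add_zero, neg_one_pow_pd] at this
  simpa [pD, dOp] using this

variable {σ : GlRep m n}

/-- The linear map from a tensor module attached to a space of families. -/
def tmHom (ι : σ.V →ₗ[ℂ] LExp m → ρ.M) : TModule σ →ₗ[ℂ] ρ.M :=
  Finsupp.lsum ℂ fun rc => Gop n (dOp ρ) rc.2 ∘ₗ LinearMap.proj rc.1 ∘ₗ ι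

lemma tmHom_single (ι : σ.V →ₗ[ℂ] LExp m → ρ.M) (r : LExp m) (g : GExp n) (v : σ.V) :
    tmHom ι (Finsupp.single (r, g) v) = Gop n (dOp ρ) g (ι v r) := by
  simp [tmHom]

lemma tmHom_d (ι : σ.V →ₗ[ℂ] LExp m → ρ.M) {lam : Fin m → ℂ} {lam0 : ℂ} (β : Fin n)
    (u : TModule σ) :
    tmHom ι (Dp σ lam lam0 (.pa β : Dir m n b) u) = dOp ρ β (tmHom ι u) := by
  have : tmHom ι ∘ₗ Dp σ lam lam0 (.pa β : Dir m n b) = dOp ρ β ∘ₗ tmHom ι := by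
    refine tm_ext fun r g v => ?_
    have := LinearMap.congr_fun (Gop_der n (dOp ρ) dOp_anti β g) (ι v r)
    simp only [LinearMap.comp_apply, Dp_single, map_smul, tmHom_single]
    exact this.symm
  exact LinearMap.congr_fun this u

lemma derC_ne_zero {β : Fin n} {g : GExp n} (h : g β = true) : derC β g ≠ 0 := by
  rw [derC_true h]; exact pow_ne_zero _ (by norm_num)

theorem tmHom_tmL (ι : σ.V →ₗ[ℂ] LExp m → ρ.M) {lam : Fin m → ℂ} {lam0 : ℂ}
    (hbase : ∀ (x : WBasis m n b) r v,
      tmHom ι (tmL σ lam lam0 x (Finsupp.single (r, fun _ => true) v)) = ρ.g x (ι v r))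
    (x : WBasis m n b) (u : TModule σ) : tmHom ι (tmL σ lam lam0 x u) = ρ.g x (tmHom ι u) := by
  suffices h : ∀ (k : ℕ) (g : GExp n), n - gdeg g = k → ∀ (x : WBasis m n b) r (v : σ.V),
      tmHom ι (tmL σ lam lam0 x (Finsupp.single (r, g) v)) =
        ρ.g x (tmHom ι (Finsupp.single (r, g) v)) by
    have h' : tmHom ι ∘ₗ tmL σ lam lam0 x = ρ.g x ∘ₗ tmHom ι :=
      tm_ext fun r g v => h _ g rfl x r v
    exact LinearMap.congr_fun h' u
  intro k
  induction k using Nat.strong_induction_on with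
  | _ k ih =>
    intro g hg x r v
    by_cases htop : ∀ β, g β = true
    · obtain rfl : g = fun _ => true := funext htop
      rw [hbase, tmHom_single, Gop_top]; rfl
    push Not at htop
    obtain ⟨β, hβ⟩ := htop
    have hβ : g β = false := by simpa using hβ
    set g' : GExp n := Function.update g β true with hg'
    have hβ' : g' β = true := by simp [hg']
    have hE : derE β g' = g := by
      ext y
      by_cases hy : y = β
      · subst hy; rw [derE_same, hβ]
      · rw [derE_ne hy]; simp [hg', hy]
    have hc := derC_ne_zero hβ'
    have hdeg := gdeg_derE hc
    rw [hE] at hdeg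
    have hle : gdeg g' ≤ n := by
      rw [gdeg]; exact (Finset.card_filter_le _ _).trans (by simp)
    have hw : (Finsupp.single (r, g) v : TModule σ) =
        Dp σ lam lam0 (.pa β : Dir m n b) (Finsupp.single (r, g') ((derC β g')⁻¹ • v)) := by
      rw [Dp_single, DE_pa, hE, cD, Finsupp.smul_single, smul_inv_smul₀ hc]
    obtain ⟨s, f, D⟩ := x
    set w : TModule σ := Finsupp.single (r, g') ((derC β g')⁻¹ • v) with hw'
    have i1 : ∀ x, tmHom ι (tmL σ lam lam0 x w) = ρ.g x (tmHom ι w) := fun x =>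
      ih (n - gdeg g') (by omega) g' rfl x r _
    have e1 := congrArg (tmHom ι) (LinearMap.congr_fun
      (d_tmL (σ := σ) (lam := lam) (lam0 := lam0) β s f D) w)
    have e2 := LinearMap.congr_fun (dOp_g (ρ := ρ) β s f D) (tmHom ι w)
    simp only [Module.End.mul_apply, LinearMap.add_apply, LinearMap.smul_apply, map_add,
      map_smul, tmHom_d, i1] at e1 e2
    rw [e2, add_left_inj] at e1
    have hε : (-1 : ℂ) ^ pd (f, D) ≠ 0 := pow_ne_zero _ (by norm_num)
    rw [hw, tmHom_d]
    exact (smul_right_injective _ hε e1).symm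

end TensorHom
end

noncomputable section

variable {m n : ℕ} {b : Bool}

section BoundedCase

/-- The scalar by which `d_0` acts. -/
def lamZero : {b : Bool} → (HIdx m b → ℂ) → ℂ
  | true, l => l (.inr (0 : Fin 1))
  | false, _ => 0

lemma Op_one_d0' {ρ : WRep m n b} {lam : HIdx m b → ℂ} {v : LExp m → ρ.M}
    (hv : v ∈ GF ρ lam) (D : Dir m n b) (hD : wD D = 0) :
    Op ρ (gz n, D) 1 v = lamZero lam • v := by
  cases D with
  | d0 => exact Op_one_d0 (0 : Fin 1) hv
  | _ => simp [wD] at hD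

lemma mulSgn_top {f : GExp n} (h : f ≠ gz n) : mulSgn f (fun _ => true) = 0 := by
  obtain ⟨a, ha⟩ := Function.ne_iff.mp h
  exact mulSgn_zero (a := a) (by simpa using ha) rfl

lemma gdeg_top : gdeg (fun _ : Fin n => true) = n := by simp [gdeg]

variable {ρ : WRep m n b} {lam : HIdx m b → ℂ} {V : Submodule ℂ (LExp m → ρ.M)}

lemma rD_gD (σ : GlRep m n) (x y : GlIdx m n) : rD σ x (gD y : Dir m n b) = σ.ρ x y := by
  cases y <;> rfl

lemma pD_gD (y : GlIdx m n) : pD (gD y : Dir m n b) = gpar y := by cases y <;> rfl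

/-- The inclusion of a minimal stable space, as a map on the underlying `gl(m,n)`-module. -/
def MinFam.incl (h : MinFam ρ lam V) : h.gl.V →ₗ[ℂ] LExp m → ρ.M := V.subtype

lemma MinFam.incl_gl (h : MinFam ρ lam V) (x y : GlIdx m n) (v : h.gl.V) :
    h.incl (h.gl.ρ x y v) = gc x y • EO ρ x y (h.incl v) + gstr x y • h.incl v := rfl

lemma MinFam.Lop_top (h : MinFam ρ lam V) (s : LExp m) {f : GExp n} (hf : f ≠ gz n)
    (r : LExp m) (v : h.gl.V) :
    Lop h.gl s f (Finsupp.single (r, fun _ => true) v) = 0 := by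
  rw [Lop_single, mulSgn_top hf, zero_smul]

lemma MinFam.Lop_gz (h : MinFam ρ lam V) (s : LExp m) (r : LExp m) (g : GExp n) (v : h.gl.V) :
    Lop h.gl s (gz n) (Finsupp.single (r, g) v) = Finsupp.single (r + s, g) v := by
  rw [Lop_single]; simp

lemma gc_gpar (x y : GlIdx m n) : (-1 : ℂ) ^ (n * (gpar x + gpar y)) * gc x y = 1 := by
  rw [gc, ← mul_pow]; simp

lemma MinFam.base (h : MinFam ρ lam V) (x : WBasis m n b) (r : LExp m) (v : h.gl.V) :
    tmHom h.incl (tmL h.gl (fun i => lam (.inl i)) (lamZero lam) x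
      (Finsupp.single (r, fun _ => true) v)) = ρ.g x (h.incl v r) := by
  obtain ⟨s, f, D⟩ := x
  have hvJ : h.incl v ∈ JM ρ 1 := h.le_JM v.2
  have hvG : h.incl v ∈ GF ρ lam := h.le_GF v.2
  have hR : ρ.g (s, f, D) (h.incl v r) = Op ρ (f, D) (sg s) (h.incl v) (r + s) := by
    rw [Op_sg, Tx_apply, add_sub_cancel_right]
  rw [hR]
  simp only [tmL, Yop, LinearMap.add_apply, Module.End.mul_apply, Dp_single, map_add, map_smul,
    LinearMap.sum_apply, LinearMap.smul_apply, map_sum, Top_single, gdeg_top]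
  by_cases hf : f = gz n
  · subst hf
    simp only [derC_gz, mul_zero, zero_smul, Finset.sum_const_zero, add_zero, h.Lop_gz,
      tmHom_single, Gop_top]
    rcases dir_cases D with hD | ⟨y, rfl⟩
    · have e : Op ρ (gz n, D) (sg s) (h.incl v) = Op ρ (gz n, D) 1 (h.incl v) := by
        refine Op_congr_JM ?_ hvJ
        rw [Jx]
        simpa [hD] using sg_sub_mem s
      rw [e, Op_one_d0' hvG D hD]
      cases D with
      | d0 => simp [cD, DE, rD, Gop_top]
      | _ => simp [wD] at hD
    · have e : Op ρ (gz n, gD y) (sg s) (h.incl v) =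
          Op ρ (gz n, gD y) 1 (h.incl v) + ∑ i, (s i : ℂ) • EO ρ (.inl i) y (h.incl v) := by
        have := Op_congr_JM (ρ := ρ) (k := 1) (a := (gz n, (gD y : Dir m n b))) (P := sg s)
          (Q := 1 + ∑ i, (s i : ℂ) • tm1 i) (v := h.incl v) (by
            rw [Jx, wD_gD, gdeg_gz, ← sub_sub]; exact sg_first_order s) hvJ
        rw [this]
        simp only [map_add, map_sum, map_smul, LinearMap.add_apply, LinearMap.sum_apply,
          LinearMap.smul_apply]
        rfl
      rw [e]
      have e2 : ∀ i, (s i : ℂ) • (-1 : ℂ) ^ (n * pD (gD y : Dir m n b)) •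
          (h.incl (rD h.gl (.inl i) (gD y : Dir m n b) v) (r + s)) =
          (s i : ℂ) • EO ρ (.inl i) y (h.incl v) (r + s) +
          ((s i : ℂ) * gstr (.inl i) y * (-1 : ℂ) ^ (n * gpar y)) • h.incl v (r + s) := by
        intro i
        have hg := gc_gpar (n := n) (.inl i : GlIdx m n) y
        rw [show gpar (.inl i : GlIdx m n) = 0 from rfl, zero_add] at hg
        rw [rD_gD, pD_gD, h.incl_gl, Pi.add_apply, Pi.smul_apply, Pi.smul_apply, smul_add,
          smul_smul, hg, one_smul, smul_add]
        simp only [smul_smul]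
        congr 2; ring
      simp only [Module.End.one_apply, Pi.add_apply, Finset.sum_apply, Pi.smul_apply]
      rw [Finset.sum_congr rfl fun i _ => e2 i, Finset.sum_add_distrib, ← Finset.sum_smul,
        add_comm (∑ i, _), ← add_assoc]
      congr 1
      have hvr := mem_GF.mp hvG (r + s)
      cases y with
      | inl j =>
        have h1 : Op ρ (gz n, gD (.inl j)) 1 (h.incl v) (r + s) =
            (lam (.inl j) + (r + s : LExp m) j) • h.incl v (r + s) := by
          rw [← sg_zero, Op_sg, Tx_apply, sub_zero]
          exact ρ.Gr_di hvr j
        rw [h1]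
        simp only [gD_l, cD, DE, Gop_top, Module.End.one_apply, ← add_smul]
        congr 1
        simp [gstr, gpar]
        ring
      | inr β =>
        have h1 : Op ρ (gz n, gD (.inr β)) 1 (h.incl v) (r + s) =
            dOp ρ β (h.incl v (r + s)) := by
          rw [← sg_zero, Op_sg, Tx_apply, sub_zero]; rfl
        rw [h1]
        have h2 := LinearMap.congr_fun (Gop_der n (dOp ρ) dOp_anti β (fun _ => true))
          (h.incl v (r + s))
        rw [Gop_top, mul_one] at h2
        rw [h2]
        simp [gD_r, cD, DE, gstr]
  · simp only [h.Lop_top s hf, map_zero, smul_zero, Finset.sum_const_zero, add_zero]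
    by_cases hdeg : 1 + wD D ≤ gdeg f
    · rw [Op_eq_zero_of_gdeg hdeg _ hvJ]
      have hdeg1 : gdeg f ≠ 0 := fun h0 => hf (eq_gz h0)
      have e1 : cD (fun i => lam (.inl i)) (lamZero lam) D r (fun _ => true) •
          tmHom h.incl (Lop h.gl s f (Finsupp.single (r, DE D fun _ => true) v)) = 0 := by
        cases D with
        | di j => rw [DE, h.Lop_top s hf]; simp
        | d0 => rw [DE, h.Lop_top s hf]; simp
        | pa β =>
          rw [Lop_single, mulSgn, if_pos, zero_smul, map_zero, smul_zero]
          by_contra! hc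
          have : ∀ a, f a = true → a = β := fun a ha => by
            by_contra hne
            refine hc a ha ?_
            rw [DE_pa, derE_ne hne]
          have hle : gdeg f ≤ 1 := by
            rw [gdeg, Finset.card_le_one]
            intro a ha a' ha'
            rw [this a (by simpa using ha), this a' (by simpa using ha')]
          simp [wD] at hdeg
          omega
      rw [e1, zero_add]
      refine Finset.sum_eq_zero fun α _ => ?_
      by_cases hα : derC α f = 0
      · simp [hα]
      by_cases hz : derE α f = gz n
      · have := gdeg_derE hα
        rw [hz, gdeg_gz] at this
        have hw : wD D = 0 := by omega
        cases D with
        | d0 => simp [rD]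
        | _ => simp [wD] at hw
      · rw [h.Lop_top s hz]; simp
    · have hdeg1 : gdeg f ≠ 0 := fun h0 => hf (eq_gz h0)
      rcases dir_cases D with hD | ⟨y, rfl⟩
      · omega
      rw [wD_gD] at hdeg
      obtain ⟨α, rfl⟩ := eq_gx (s := f) (by omega)
      have e : Op ρ (gx α, gD y) (sg s) (h.incl v) = EO ρ (.inr α) y (h.incl v) := by
        refine Op_congr_JM ?_ hvJ
        rw [Jx, wD_gD, gdeg_gx]
        simpa [gP_r] using sg_sub_mem s
      rw [e, Finset.sum_eq_single α]
      · have hg := gc_gpar (n := n) (.inr α : GlIdx m n) y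
        rw [derE_gx, h.Lop_gz, tmHom_single, Gop_top, Module.End.one_apply, derC_gx, if_pos rfl,
          gdeg_gx, rD_gD, pD_gD, h.incl_gl, Pi.add_apply, Pi.smul_apply, Pi.smul_apply, smul_add,
          smul_smul, show (1 : ℕ) + gpar y = gpar (.inr α : GlIdx m n) + gpar y from rfl, hg]
        simp only [one_smul, smul_smul, smul_add]
        norm_num
        cases y with
        | inl j => rw [gD_l, DE, h.Lop_top s hf]; simp [gstr]
        | inr β =>
          rw [gD_r, cD, Lop_single, map_smul, smul_smul, DE_pa]
          by_cases hαβ : α = β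
          · subst hαβ
            rw [derC_mulSgn_gx, if_pos rfl, xorE_gx_derE rfl, tmHom_single, Gop_top]
            simp [gstr, gpar, ← two_mul, mul_comm n, pow_mul]
          · rw [mulSgn_gx_eq_zero (by rw [derE_ne hαβ])]
            simp [gstr, hαβ]
      · intro α' _ hne
        rw [derC_gx, if_neg hne]; simp
      · simp

/-- A simple bounded module is a quotient of a tensor module. -/
theorem bounded_case (ρ : WRep m n b) (hs : IsSimpleG ρ.g) (hw : IsStrongHCG ρ.g) {C : ℕ}
    (hC : ∀ lam, Module.finrank ℂ (wtG ρ.g lam) ≤ C) :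
    ∃ σ : GlRep m n, FiniteDimensional ℂ σ.V ∧ σ.IsSimple ∧
      ∃ (lam : Fin m → ℂ) (lam0 : ℂ) (φ : TModule σ →ₗ[ℂ] ρ.M), (b = false → lam0 = 0) ∧
        Function.Surjective φ ∧
        ∀ (x : WBasis m n b) (u : TModule σ), φ (tmAct σ lam lam0 x u) = ρ.g x (φ u) := by
  obtain ⟨lam, hl⟩ := exists_wt_ne hs hw
  have hl0 : ρ.Gr lam 0 ≠ ⊥ := by rwa [WRep.Gr, wsh_zero]
  obtain ⟨V, h, hV⟩ := exists_MinFam (iSup_Gr_eq_top hs hl0) (fun r => hw.2 _) (fun r => hC _)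
    ⟨0, hl0⟩
  have hφ : ∀ (x : WBasis m n b) (u : TModule h.gl),
      tmHom h.incl (tmAct h.gl (fun i => lam (.inl i)) (lamZero lam) x u) =
        ρ.g x (tmHom h.incl u) := fun x u => by
    rw [tmAct_eq, tmHom_tmL h.incl h.base]
  refine ⟨h.gl, hV, h.isSimple, _, lamZero lam, tmHom h.incl, ?_, ?_, hφ⟩
  · rintro rfl; rfl
  · rw [← LinearMap.range_eq_top]
    refine (hs.2 _ ?_).resolve_left fun h0 => ?_
    · rintro x _ ⟨u, rfl⟩
      exact ⟨_, hφ x u⟩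
    · obtain ⟨v, hv, hv0⟩ := Submodule.exists_mem_ne_zero_of_ne_bot h.ne_bot
      refine hv0 (funext fun r => ?_)
      have : tmHom h.incl (Finsupp.single (r, fun _ => true) (⟨v, hv⟩ : V)) = 0 :=
        (LinearMap.mem_range_self _ _ : _ ∈ LinearMap.range (tmHom h.incl)) |> fun hm => by
          rw [h0] at hm; exact (Submodule.mem_bot ℂ).mp hm
      erw [tmHom_single, Gop_top] at this
      exact this

end BoundedCase
end

noncomputable section

section Triangular
variable {M M' : Type} [AddCommGroup M] [Module ℂ M] [AddCommGroup M'] [Module ℂ M']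

/-- Vectors which are separated triangularly by a family of operators are independent. -/
lemma le_finrank_of_triangular {G : Submodule ℂ M} [FiniteDimensional ℂ G] {L : ℕ} {w : ℕ → M}
    (hw : ∀ i < L, w i ∈ G) (X : ℕ → M →ₗ[ℂ] M') (h0 : ∀ I < L, ∀ i < I, X I (w i) = 0)
    (h1 : ∀ I < L, X I (w I) ≠ 0) : L ≤ Module.finrank ℂ G := by
  have hli : LinearIndependent ℂ (fun i : Fin L => (⟨w i, hw i i.2⟩ : G)) := by
    rw [Fintype.linearIndependent_iff]
    intro g hg
    by_contra! hne
    obtain ⟨I, hI, hmax⟩ := Finset.exists_max_image (Finset.univ.filter fun i => g i ≠ 0) id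
      (by obtain ⟨i, hi⟩ := hne; exact ⟨i, by simpa using hi⟩)
    have hgI : g I ≠ 0 := by simpa using hI
    have hs : ∑ i, g i • w i = 0 := by
      have := congrArg G.subtype hg
      simpa using this
    have hX := congrArg (X I) hs
    rw [map_zero, map_sum, Finset.sum_eq_single I] at hX
    · rw [map_smul] at hX
      exact (smul_ne_zero hgI (h1 I I.2)) hX
    · intro i _ hi
      rw [map_smul]
      by_cases hg : g i = 0
      · rw [hg, zero_smul]
      · have := hmax i (by simpa using hg)
        rw [h0 I I.2 i (Fin.lt_def.1 (lt_of_le_of_ne this hi)), smul_zero]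
    · simp
  simpa using hli.fintype_card_le_finrank

end Triangular

section WittVanish
variable {M : Type} [AddCommGroup M] [Module ℂ M]
variable {e : ℤ → Module.End ℂ M} {a : ℂ} {G : ℤ → Submodule ℂ M}

lemma WittFam.exists_singular (h : WittFam e a G)
    (hk : ∀ k, ∀ v ∈ G k, ∃ p : ℕ, ∀ j : ℤ, p < j → e j v = 0) {K : ℤ} (hK : ∃ k ≥ K, G k ≠ ⊥) :
    ∃ k ≥ K, ∃ v ∈ G k, v ≠ 0 ∧ ∀ j : ℤ, 0 < j → e j v = 0 := by
  classical
  have hex : ∃ p : ℕ, ∃ k ≥ K, ∃ v ∈ G k, v ≠ 0 ∧ ∀ j : ℤ, p < j → e j v = 0 := by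
    obtain ⟨k, hk1, hk2⟩ := hK
    obtain ⟨v, hv, hv0⟩ := Submodule.exists_mem_ne_zero_of_ne_bot hk2
    obtain ⟨p, hp⟩ := hk k v hv
    exact ⟨p, k, hk1, v, hv, hv0, hp⟩
  obtain ⟨k, hk1, u, hu, hu0, hp⟩ := Nat.find_spec hex
  have hmin := fun q => Nat.find_min hex (m := q)
  generalize Nat.find hex = p at hp hmin
  rcases Nat.eq_zero_or_pos p with rfl | hpos
  · exact ⟨k, hk1, u, hu, hu0, by simpa using hp⟩
  exfalso
  have hw : ∀ i : ℕ, (e p ^ i) u ∈ G (k + p * i) ∧ (e p ^ i) u ≠ 0 ∧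
      ∀ j : ℤ, p < j → e j ((e p ^ i) u) = 0 := by
    intro i
    induction i with
    | zero => exact ⟨by simpa using hu, by simpa using hu0, by simpa using hp⟩
    | succ i ih =>
      obtain ⟨h1, h2, h3⟩ := ih
      rw [pow_succ', Module.End.mul_apply]
      refine ⟨?_, fun h0 => ?_, fun j hj => ?_⟩
      · have := h.maps p _ _ h1
        convert this using 2
        push_cast; ring
      · refine hmin (p - 1) (by omega) ⟨k + p * i, by nlinarith, _, h1, h2, fun j hj => ?_⟩
        rcases eq_or_lt_of_le (show (p : ℤ) ≤ j by omega) with rfl | hj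
        · exact h0
        · exact h3 j hj
      · rw [h.swap, h3 j hj, map_zero, h3 _ (by omega), smul_zero, add_zero]
  have := h.fd k
  have hle := le_finrank_of_triangular (G := G k) (L := Module.finrank ℂ (G k) + 1)
    (w := fun i => e (-(p * (i + 1) : ℤ)) ((e p ^ (i + 1)) u)) (X := fun I => e (p * (I + 2))) ?_ ?_ ?_
  · omega
  · intro i _
    have := h.maps (-(p * (i + 1) : ℤ)) _ _ (hw (i + 1)).1
    convert this using 2
    push_cast; ring
  · intro I _ i hi
    have hpi : (p : ℤ) < p * (I + 2) + -(p * (i + 1)) := by nlinarith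
    rw [h.swap, (hw (i + 1)).2.2 _ (by nlinarith), map_zero, (hw (i + 1)).2.2 _ hpi, smul_zero,
      add_zero]
  · intro I _
    have hpi : (p * (I + 2) + -(p * (I + 1)) : ℤ) = p := by ring
    have h2 := (hw (I + 2)).2.1
    rw [pow_succ', Module.End.mul_apply] at h2
    rw [h.swap, (hw (I + 1)).2.2 _ (by nlinarith), map_zero, zero_add, hpi]
    refine smul_ne_zero ?_ h2
    have : (-(p * (I + 1)) - p * (I + 2) : ℤ) ≠ 0 := by nlinarith
    exact_mod_cast this

/-- If all vectors are killed by `e_j` for `j` large, the support is bounded above. -/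
lemma WittFam.eventually_bot (h : WittFam e a G)
    (hk : ∀ k, ∀ v ∈ G k, ∃ p : ℕ, ∀ j : ℤ, p < j → e j v = 0) : ∃ K, ∀ k ≥ K, G k = ⊥ := by
  by_contra! hcon
  obtain ⟨K, hK⟩ : ∃ K : ℤ, ∀ k > K, a + (k : ℂ) ≠ 0 := by
    by_cases ha : ∃ k : ℤ, a + (k : ℂ) = 0
    · obtain ⟨k, hk⟩ := ha
      refine ⟨k, fun l hl h0 => ?_⟩
      have : (k : ℂ) = l := by linear_combination hk - h0
      rw [Int.cast_inj] at this
      omega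
    · push Not at ha
      exact ⟨0, fun k _ => ha k⟩
  have hfr : ∃ᶠ k : ℕ in Filter.atTop, ∃ v ∈ G (K + k), v ≠ 0 ∧ ∀ j : ℤ, 0 < j → e j v = 0 := by
    rw [Filter.frequently_atTop]
    intro N
    obtain ⟨k, hk1, hv⟩ := h.exists_singular hk (hcon (K + N))
    refine ⟨(k - K).toNat, by omega, ?_⟩
    rwa [show K + ((k - K).toNat : ℤ) = k by omega]
  obtain ⟨φ, hφ, hv⟩ := Filter.extraction_of_frequently_atTop hfr
  choose v hv1 hv2 hv3 using hv
  have := h.fd K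
  have hpos : ∀ i, 0 < φ (i + 1) := fun i => (Nat.zero_le _).trans_lt (hφ (Nat.succ_pos i))
  have hle := le_finrank_of_triangular (G := G K) (L := Module.finrank ℂ (G K) + 1)
    (w := fun i => e (-(φ (i + 1) : ℤ)) (v (i + 1))) (X := fun I => e (φ (I + 1))) ?_ ?_ ?_
  · omega
  · intro i _
    have := h.maps (-(φ (i + 1) : ℤ)) _ _ (hv1 (i + 1))
    convert this using 2
    ring
  · intro I _ i hi
    have hlt := hφ (Nat.succ_lt_succ hi)
    simp only [Nat.succ_eq_add_one] at hlt
    rw [h.swap, hv3 _ _ (by have := hpos I; omega), map_zero, hv3 _ _ (by omega), smul_zero,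
      add_zero]
  · intro I _
    have hp := hpos I
    rw [h.swap, hv3 _ _ (by omega), map_zero, zero_add, add_neg_cancel, h.zero _ _ (hv1 _)]
    refine smul_ne_zero ?_ (smul_ne_zero (hK _ (by omega)) (hv2 _))
    have : (-(φ (I + 1)) - φ (I + 1) : ℤ) ≠ 0 := by omega
    exact_mod_cast this

end WittVanish
end

noncomputable section

variable {m n : ℕ} {b : Bool}

section Kill

/-- The value of the direction `D` on the exponent `r`. -/
def dirV (r : LExp m) : Dir m n b → ℂ
  | .di j => r j
  | _ => 0

lemma brB_di_left (r s : LExp m) (i : Fin m) (q : GExp n) (D : Dir m n b) :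
    brB ⟨r, gz n, .di i⟩ ⟨s, q, D⟩
      = (s i : ℂ) • sng ⟨r + s, q, D⟩ - dirV r D • sng ⟨r + s, q, .di i⟩ := by
  cases D <;> simp [brB, dirV]

lemma brB_di_right (r s : LExp m) (i : Fin m) (q : GExp n) (D : Dir m n b) :
    brB ⟨r, q, D⟩ ⟨s, gz n, .di i⟩
      = dirV s D • sng ⟨r + s, q, .di i⟩ - (r i : ℂ) • sng ⟨r + s, q, D⟩ := by
  cases D <;> simp [brB, dirV]

/-- All elements of degree `r` annihilate `v`. -/
def WRep.Kil (ρ : WRep m n b) (v : ρ.M) (r : LExp m) : Prop :=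
  ∀ a : GExp n × Dir m n b, ρ.g ⟨r, a⟩ v = 0

lemma WRep.act_eq_zero {ρ : WRep m n b} {w : W m n b} {v : ρ.M}
    (h : ∀ x ∈ w.support, ρ.g x v = 0) : ρ.act w v = 0 := by
  rw [← Finsupp.sum_single w, Finsupp.sum, map_sum, LinearMap.sum_apply]
  refine Finset.sum_eq_zero fun x hx => ?_
  have : (Finsupp.single x (w x) : W m n b) = w x • sng x := by simp [sng]
  rw [this, map_smul, LinearMap.smul_apply, ρ.act_sng, h x hx, smul_zero]

lemma sng_support {x y : WBasis m n b} {c : ℂ} (h : y ∈ (c • sng x : W m n b).support) : y = x := by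
  have := Finsupp.support_smul h
  simpa [sng] using Finsupp.support_single_subset this

lemma brB_support {x y z : WBasis m n b} (h : z ∈ (brB x y).support) : z.1 = x.1 + y.1 := by
  obtain ⟨r, a⟩ := x
  obtain ⟨s, a'⟩ := y
  rw [brB_eq] at h
  classical
  rcases Finset.mem_union.1 (Finsupp.support_sub h) with h | h <;> rw [sng_support h]

lemma WRep.Kil.act {ρ : WRep m n b} {v : ρ.M} {x y : WBasis m n b} (h : ρ.Kil v (x.1 + y.1)) :
    ρ.act (brB x y) v = 0 :=
  WRep.act_eq_zero fun z hz => by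
    have := h z.2
    rwa [← brB_support hz] at this

lemma WRep.Kil.g {ρ : WRep m n b} {v : ρ.M} {r : LExp m} (h : ρ.Kil v r) (y : WBasis m n b)
    (hy : ρ.Kil v (r + y.1)) : ρ.Kil (ρ.g y v) r := fun a => by
  have := ρ.comm ⟨r, a⟩ y v
  rw [WRep.Kil.act hy, h a, map_zero, smul_zero, sub_zero] at this
  exact this.symm

lemma WRep.Kil.add_vec {ρ : WRep m n b} {v w : ρ.M} {r : LExp m} (h : ρ.Kil v r)
    (h' : ρ.Kil w r) : ρ.Kil (v + w) r := fun a => by rw [map_add, h a, h' a, add_zero]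

lemma WRep.Kil.smul {ρ : WRep m n b} {v : ρ.M} {r : LExp m} (h : ρ.Kil v r) (c : ℂ) :
    ρ.Kil (c • v) r := fun a => by rw [map_smul, h a, smul_zero]

lemma WRep.kil_zero (ρ : WRep m n b) (r : LExp m) : ρ.Kil 0 r := fun _ => map_zero _

/-- Elements of distinct degrees `r, s` generate all elements of degree `r + s`. -/
lemma WRep.Kil.add {ρ : WRep m n false} {v : ρ.M} {r s : LExp m} (hr : ρ.Kil v r)
    (hs : ρ.Kil v s) (hne : r ≠ s) : ρ.Kil v (r + s) := by
  obtain ⟨i, hi⟩ : ∃ i, r i ≠ s i := by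
    by_contra! h
    exact hne (funext h)
  have hi' : (s i : ℂ) - r i ≠ 0 := by
    rw [sub_ne_zero]
    exact_mod_cast hi.symm
  have key : ∀ q (D : Dir m n false),
      (s i : ℂ) • ρ.g ⟨r + s, q, D⟩ v = dirV r D • ρ.g ⟨r + s, q, .di i⟩ v ∧
      dirV s D • ρ.g ⟨r + s, q, .di i⟩ v = (r i : ℂ) • ρ.g ⟨r + s, q, D⟩ v := by
    intro q D
    have h1 := ρ.comm ⟨r, gz n, .di i⟩ ⟨s, q, D⟩ v
    have h2 := ρ.comm ⟨r, q, D⟩ ⟨s, gz n, .di i⟩ v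
    rw [hr, hs, map_zero, map_zero, smul_zero, sub_zero] at h1 h2
    rw [brB_di_left, map_sub, map_smul, map_smul, LinearMap.sub_apply, LinearMap.smul_apply,
      LinearMap.smul_apply, sub_eq_zero] at h1
    rw [brB_di_right, map_sub, map_smul, map_smul, LinearMap.sub_apply, LinearMap.smul_apply,
      LinearMap.smul_apply, sub_eq_zero] at h2
    exact ⟨h1, h2⟩
  have h1 : ∀ q, ρ.g ⟨r + s, q, .di i⟩ v = 0 := fun q => by
    have := (key q (.di i)).1
    rw [← sub_eq_zero, dirV, ← sub_smul] at this
    exact (smul_eq_zero.1 this).resolve_left hi'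
  rintro ⟨q, D⟩
  obtain ⟨h2, h3⟩ := key q D
  rw [h1, smul_zero] at h2 h3
  rcases smul_eq_zero.1 h2 with h | h
  · refine (smul_eq_zero.1 h3.symm).resolve_left fun h' => hi' ?_
    rw [h, h', sub_zero]
  · exact h

/-- Splitting a degree in two ways avoids coincidences. -/
lemma WRep.Kil.add_shift {ρ : WRep m n false} {v : ρ.M} {r s c : LExp m} (hc : c ≠ 0)
    (hr : ρ.Kil v r) (hs : ρ.Kil v s) (hr' : ρ.Kil v (r + c)) (hs' : ρ.Kil v (s - c)) :
    ρ.Kil v (r + s) := by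
  by_cases h : r = s
  · have := hr'.add hs' (fun h' => hc ?_)
    · rwa [show r + c + (s - c) = r + s by abel] at this
    · subst h
      funext i
      have := congrFun h' i
      simp only [Pi.add_apply, Pi.sub_apply] at this
      simp only [Pi.zero_apply]
      omega
  · exact hr.add hs h

lemma IsSimpleG.eq_top {ρ : WRep m n b} (hs : IsSimpleG ρ.g) {N : Submodule ℂ ρ.M}
    (hN : InvariantG ρ.g N) {u : ρ.M} (hu : u ∈ N) (hu0 : u ≠ 0) : N = ⊤ :=
  (hs.2 N hN).resolve_left fun h => hu0 (by rw [h] at hu; exact (Submodule.mem_bot ℂ).1 hu)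

/-- Degrees `r` such that every vector is eventually annihilated along every line of
direction `r`. -/
def WRep.cone (ρ : WRep m n b) : Set (LExp m) :=
  {r | ∀ u : ρ.M, ∀ g : LExp m, ∃ k0 : ℕ, ∀ k ≥ k0, ρ.Kil u (g + k • r)}

lemma WRep.mem_cone {ρ : WRep m n b} (hs : IsSimpleG ρ.g) {r : LExp m} {u : ρ.M} (hu : u ≠ 0)
    (h : ∀ g : LExp m, ∃ k0 : ℕ, ∀ k ≥ k0, ρ.Kil u (g + k • r)) : r ∈ ρ.cone := by
  let N : Submodule ℂ ρ.M :=
    { carrier := {u | ∀ g : LExp m, ∃ k0 : ℕ, ∀ k ≥ k0, ρ.Kil u (g + k • r)}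
      zero_mem' := fun g => ⟨0, fun k _ => ρ.kil_zero _⟩
      add_mem' := fun {v w} hv hw g => by
        obtain ⟨k1, h1⟩ := hv g
        obtain ⟨k2, h2⟩ := hw g
        exact ⟨max k1 k2, fun k hk =>
          (h1 k (le_of_max_le_left hk)).add_vec (h2 k (le_of_max_le_right hk))⟩
      smul_mem' := fun c v hv g => by
        obtain ⟨k1, h1⟩ := hv g
        exact ⟨k1, fun k hk => (h1 k hk).smul c⟩ }
  have hN : N = ⊤ := by
    refine hs.eq_top (fun y v hv g => ?_) (u := u) h hu
    obtain ⟨k1, h1⟩ := hv g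
    obtain ⟨k2, h2⟩ := hv (g + y.1)
    refine ⟨max k1 k2, fun k hk => (h1 k (le_of_max_le_left hk)).g y ?_⟩
    have := h2 k (le_of_max_le_right hk)
    rwa [add_right_comm] at this
  intro u g
  have : u ∈ N := hN ▸ Submodule.mem_top
  exact this g

lemma WRep.cone_add {ρ : WRep m n false} {r s : LExp m} (hm : 0 < m) (hr : r ∈ ρ.cone)
    (hs : s ∈ ρ.cone) : r + s ∈ ρ.cone := by
  intro u g
  have hc : ep ⟨0, hm⟩ 1 ≠ 0 := by simp [ep]
  obtain ⟨k1, h1⟩ := hr u 0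
  obtain ⟨k2, h2⟩ := hr u (ep ⟨0, hm⟩ 1)
  obtain ⟨k3, h3⟩ := hs u g
  obtain ⟨k4, h4⟩ := hs u (g - ep ⟨0, hm⟩ 1)
  refine ⟨k1 + k2 + k3 + k4, fun k hk => ?_⟩
  have := (h1 k (by omega)).add_shift hc (h3 k (by omega))
    (by have := h2 k (by omega); rwa [zero_add, add_comm]; )
    (by have := h4 k (by omega); rwa [sub_add_eq_add_sub] at this)
  rwa [zero_add, show k • r + (g + k • s) = g + k • (r + s) by rw [smul_add]; abel] at this

lemma WRep.cone_of_smul {ρ : WRep m n b} {r : LExp m} {q : ℕ} (hq : 0 < q) (hr : q • r ∈ ρ.cone) :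
    r ∈ ρ.cone := by
  intro u g
  choose f hf using fun t : ℕ => hr u (g + t • r)
  refine ⟨q * ((Finset.range q).sup f), fun k hk => ?_⟩
  have h1 : (Finset.range q).sup f ≤ k / q := by
    rw [Nat.le_div_iff_mul_le hq, mul_comm]; exact hk
  have h2 : f (k % q) ≤ (Finset.range q).sup f :=
    Finset.le_sup (Finset.mem_range.2 (Nat.mod_lt _ hq))
  have := hf (k % q) (k / q) (h2.trans h1)
  rwa [add_assoc, smul_smul, ← add_smul, mul_comm, Nat.mod_add_div] at this

lemma WRep.cone_smul {ρ : WRep m n b} {r : LExp m} {q : ℕ} (hq : 0 < q) (hr : r ∈ ρ.cone) :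
    q • r ∈ ρ.cone := by
  intro u g
  obtain ⟨k0, h⟩ := hr u g
  refine ⟨k0, fun k hk => ?_⟩
  rw [smul_smul]
  exact h _ (hk.trans (Nat.le_mul_of_pos_right _ hq))

/-- The cone is open. -/
lemma WRep.cone_open {ρ : WRep m n false} (hs : IsSimpleG ρ.g) {r : LExp m} (hr : r ∈ ρ.cone)
    (hr0 : r ≠ 0) (h : LExp m) : ∃ j0 : ℕ, ∀ j ≥ j0, j • r + h ∈ ρ.cone := by
  obtain ⟨u, hu⟩ := hs.1
  obtain ⟨I, hI⟩ := hr u h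
  have key : ∀ K : ℕ, ∀ q ≥ (K + 1) * (I + 1), ρ.Kil u ((K + 1) • h + q • r) := by
    intro K
    induction K with
    | zero =>
      intro q hq
      have := hI q (by omega)
      simpa using this
    | succ K ih =>
      intro q hq
      have hq' : (K + 1) * (I + 1) + (I + 1) ≤ q := by nlinarith
      obtain ⟨t, rfl⟩ := Nat.exists_eq_add_of_le hq'
      have := (ih ((K + 1) * (I + 1)) le_rfl).add_shift hr0 (hI (I + 1 + t) (by omega))
        (by
          have := ih ((K + 1) * (I + 1) + 1) (by omega)
          rwa [succ_nsmul r, ← add_assoc] at this)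
        (by
          have := hI (I + t) (by omega)
          rwa [show I + 1 + t = I + t + 1 by ring, succ_nsmul r, ← add_assoc, add_sub_cancel_right])
      rwa [show (K + 1) • h + ((K + 1) * (I + 1)) • r + (h + (I + 1 + t) • r) =
        (K + 1 + 1) • h + ((K + 1) * (I + 1) + (I + 1) + t) • r by module] at this
  refine ⟨I + 2, fun j hj => WRep.mem_cone hs hu fun g => ?_⟩
  obtain ⟨k0, hk0⟩ := hr u g
  refine ⟨k0 + 1, fun k hk => ?_⟩
  obtain ⟨K, rfl⟩ : ∃ K, k = K + 1 := ⟨k - 1, by omega⟩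
  obtain ⟨t, rfl⟩ := Nat.exists_eq_add_of_le hj
  have := (key K ((K + 1) * (I + 1)) le_rfl).add_shift hr0
    (hk0 ((K + 1) * (t + 1)) (by nlinarith))
    (by
      have := key K ((K + 1) * (I + 1) + 1) (by omega)
      rwa [succ_nsmul r, ← add_assoc] at this)
    (by
      have := hk0 ((K + 1) * t + K) (by nlinarith)
      rwa [show (K + 1) * (t + 1) = (K + 1) * t + K + 1 by ring, succ_nsmul r, ← add_assoc,
        add_sub_cancel_right])
  rwa [show (K + 1) • h + ((K + 1) * (I + 1)) • r + (g + ((K + 1) * (t + 1)) • r) =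
    g + (K + 1) • ((I + 2 + t) • r + h) by module] at this

end Kill
end

noncomputable section

variable {m n : ℕ} {b : Bool}

section Unbounded

instance : Finite (Dir m n false) :=
  Finite.of_surjective (Sum.elim (fun i : Fin m => Dir.di i) (fun a : Fin n => Dir.pa a))
    fun D => by
      cases D with
      | di i => exact ⟨.inl i, rfl⟩
      | pa a => exact ⟨.inr a, rfl⟩

instance : Fintype (Dir m n false) := Fintype.ofFinite _

lemma WRep.exists_killed (ρ : WRep m n b) {lam : HIdx m b → ℂ}
    (hfd : ∀ r, FiniteDimensional ℂ (ρ.Gr lam r)) {ι : Type} [Fintype ι] (x : ι → WBasis m n b)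
    {r : LExp m} (h : ∑ i, Module.finrank ℂ (ρ.Gr lam (r + (x i).1)) <
      Module.finrank ℂ (ρ.Gr lam r)) :
    ∃ v ∈ ρ.Gr lam r, v ≠ 0 ∧ ∀ i, ρ.g (x i) v = 0 := by
  have := hfd r
  have := fun i => hfd (r + (x i).1)
  let f : ρ.Gr lam r →ₗ[ℂ] ∀ i, ρ.Gr lam (r + (x i).1) :=
    LinearMap.pi fun i => (ρ.g (x i)).restrict fun v hv => ρ.Gr_maps (x i) v hv
  have hf : LinearMap.ker f ≠ ⊥ :=
    LinearMap.ker_ne_bot_of_finrank_lt (by rwa [Module.finrank_pi_fintype])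
  obtain ⟨v, hv, hv0⟩ := Submodule.exists_mem_ne_zero_of_ne_bot hf
  refine ⟨v, v.2, fun h0 => hv0 (Subtype.ext h0), fun i => ?_⟩
  have := congrFun (LinearMap.mem_ker.1 hv) i
  exact congrArg Subtype.val this

/-- A simple weight module with unbounded finite weight multiplicities. -/
structure WRep.Unb (ρ : WRep m n false) (lam : HIdx m false → ℂ) : Prop where
  simple : IsSimpleG ρ.g
  fd : ∀ r, FiniteDimensional ℂ (ρ.Gr lam r)
  unb : ∀ B : ℕ, ∃ r, B < Module.finrank ℂ (ρ.Gr lam r)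

variable {ρ : WRep m n false} {lam : HIdx m false → ℂ}

/-- The generators `x` and `x + ε_i`. -/
def stepGen (x : LExp m) (o : Option (Fin m)) : LExp m := x + o.elim 0 fun i => ep i 1

lemma exists_stepGen_eq (x h : LExp m) : ∃ z : Option (Fin m) → ℤ, h = ∑ o, z o • stepGen x o := by
  refine ⟨fun o => o.elim (-∑ i, h i) h, ?_⟩
  have : ∀ i : Fin m, h i • ep i (1 : ℤ) = Pi.single i (h i) := fun i => by
    simp [ep, ← Pi.single_smul]
  simp only [Fintype.sum_option, stepGen, Option.elim, smul_add, Finset.sum_add_distrib,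
    ← Finset.sum_smul, this, Finset.univ_sum_single, smul_zero]
  simp

lemma WRep.Kil.walk {v : ρ.M} (hm : 0 < m) {x : LExp m} (hx : ∀ o, ρ.Kil v (stepGen x o))
    (f : LExp m →+ ℤ) (h3 : 3 ≤ f x) (h1 : ∀ i, |f (ep i 1)| ≤ 1) (g : LExp m) :
    ∃ k0 : ℕ, ∀ k ≥ k0, ρ.Kil v (g + k • ∑ o, stepGen x o) := by
  have hf : ∀ o, |f (stepGen x o) - f x| ≤ 1 := by
    rintro (_ | i)
    · simp [stepGen]
    · simpa [stepGen] using h1 i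
  set c0 := stepGen x none + stepGen x (some ⟨0, hm⟩) with hc0
  have hcl : ∀ y ∈ AddSubmonoid.closure (Set.range (stepGen x)), ρ.Kil v (c0 + y) ∧ 0 ≤ f y := by
    intro y hy
    induction hy using AddSubmonoid.closure_induction_right with
    | zero =>
      refine ⟨?_, by simp⟩
      rw [add_zero]
      refine (hx _).add (hx _) fun h => ?_
      simp [stepGen] at h
    | add_right y _ z hz ih =>
      obtain ⟨o, rfl⟩ := hz
      have ho := abs_le.1 (hf o)
      have h0 : f (stepGen x none) = f x := by simp [stepGen]
      have h1 := abs_le.1 (hf (some ⟨0, hm⟩))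
      refine ⟨?_, by rw [map_add]; omega⟩
      rw [← add_assoc]
      refine ih.1.add (hx o) fun h => ?_
      have := congrArg f h
      rw [map_add, hc0, map_add] at this
      have := ih.2
      omega
  obtain ⟨z, hz⟩ := exists_stepGen_eq x (g - c0)
  refine ⟨∑ o, (z o).natAbs, fun k hk => ?_⟩
  have : ∑ o, (k + z o).toNat • stepGen x o ∈ AddSubmonoid.closure (Set.range (stepGen x)) :=
    sum_mem fun o _ => nsmul_mem (AddSubmonoid.subset_closure (Set.mem_range_self o)) _
  have h2 := (hcl _ this).1
  have h4 : ∀ o, (k + z o).toNat • stepGen x o = k • stepGen x o + z o • stepGen x o := by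
    intro o
    have : (z o).natAbs ≤ k :=
      (Finset.single_le_sum (fun _ _ => Nat.zero_le _) (Finset.mem_univ o)).trans hk
    rw [← natCast_zsmul, Int.toNat_of_nonneg (by omega), add_smul, natCast_zsmul]
  rw [Finset.sum_congr rfl fun o _ => h4 o, Finset.sum_add_distrib, ← hz, ← Finset.smul_sum] at h2
  rwa [show c0 + (k • ∑ o, stepGen x o + (g - c0)) = g + k • ∑ o, stepGen x o by abel] at h2

lemma WRep.Unb.exists_mem_cone (h : ρ.Unb lam) (hm : 0 < m) : ∃ r, r ∈ ρ.cone := by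
  classical
  obtain ⟨r, hr⟩ := h.unb ((∑ p : Option (Fin m) × (GExp n × Dir m n false),
    Module.finrank ℂ (ρ.Gr lam (stepGen 0 p.1))) +
      ∑ s ∈ Finset.Icc (-2 : LExp m) 2, Module.finrank ℂ (ρ.Gr lam s))
  obtain ⟨v, -, hv0, hv⟩ := ρ.exists_killed h.fd
    (fun p : Option (Fin m) × (GExp n × Dir m n false) => ⟨stepGen (-r) p.1, p.2⟩) (r := r) (by
      refine lt_of_le_of_lt (le_of_eq (Finset.sum_congr rfl fun p _ => ?_))
        (lt_of_le_of_lt (Nat.le_add_right _ _) hr)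
      exact congrArg (fun s => Module.finrank ℂ (ρ.Gr lam s)) (by simp [stepGen]))
  have hK : ∀ o, ρ.Kil v (stepGen (-r) o) := fun o a => hv (o, a)
  have hbox : r ∉ Finset.Icc (-2 : LExp m) 2 := fun hmem => by
    have := Finset.single_le_sum (f := fun s => Module.finrank ℂ (ρ.Gr lam s))
      (fun _ _ => Nat.zero_le _) hmem
    omega
  obtain ⟨i, hi⟩ : ∃ i, r i < -2 ∨ 2 < r i := by
    by_contra! hcon
    exact hbox (Finset.mem_Icc.2 ⟨fun i => (hcon i).1, fun i => (hcon i).2⟩)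
  have h1 : ∀ j, |Pi.evalAddMonoidHom (fun _ : Fin m => ℤ) i (ep j 1)| ≤ 1 := fun j => by
    simp only [Pi.evalAddMonoidHom_apply, ep, Pi.single_apply]
    split_ifs <;> simp
  rcases hi with hi | hi
  · exact ⟨_, WRep.mem_cone h.simple hv0 fun g => WRep.Kil.walk hm hK
      (Pi.evalAddMonoidHom _ i) (by simp; omega) h1 g⟩
  · exact ⟨_, WRep.mem_cone h.simple hv0 fun g => WRep.Kil.walk hm hK
      (-Pi.evalAddMonoidHom _ i) (by simp; omega) (fun j => by simpa using h1 j) g⟩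

lemma WRep.Unb.zero_not_mem (h : ρ.Unb lam) : (0 : LExp m) ∉ ρ.cone := by
  intro h0
  have hz : ∀ x u, ρ.g x u = 0 := fun x u => by
    obtain ⟨k, hk⟩ := h0 u x.1
    have := hk k le_rfl x.2
    rwa [smul_zero, add_zero] at this
  obtain ⟨r, hr⟩ := h.unb 1
  obtain ⟨u, hu⟩ := h.simple.1
  have htop := h.simple.eq_top (N := Submodule.span ℂ {u}) (fun x v _ => by simp [hz])
    (Submodule.mem_span_singleton_self u) hu
  have := Submodule.finrank_mono (show ρ.Gr lam r ≤ Submodule.span ℂ {u} from htop ▸ le_top)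
  rw [finrank_span_singleton hu] at this
  omega

lemma WRep.dd_comm (ρ : WRep m n b) (r s : LExp m) (i j : Fin m) (v : ρ.M) :
    ρ.g ⟨r, gz n, .di i⟩ (ρ.g ⟨s, gz n, .di j⟩ v) = ρ.g ⟨s, gz n, .di j⟩ (ρ.g ⟨r, gz n, .di i⟩ v)
      + ((s i : ℂ) • ρ.g ⟨r + s, gz n, .di j⟩ v - (r j : ℂ) • ρ.g ⟨r + s, gz n, .di i⟩ v) := by
  have := ρ.comm ⟨r, gz n, .di i⟩ ⟨s, gz n, .di j⟩ v
  rw [brB_di_left, par_di_gz, zero_mul, pow_zero, one_smul, map_sub, map_smul, map_smul] at this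
  rw [← sub_eq_iff_eq_add', ← this]
  rfl

lemma WRep.Unb.eventually_bot (h : ρ.Unb lam) {r : LExp m} (hr : r ∈ ρ.cone) (μ : LExp m) :
    ∃ k0 : ℕ, ∀ k ≥ k0, ρ.Gr lam (μ + k • r) = ⊥ := by
  have hr0 : r ≠ 0 := fun h0 => h.zero_not_mem (h0 ▸ hr)
  obtain ⟨i, hi⟩ := Function.ne_iff.1 hr0
  have hi : (r i : ℂ) ≠ 0 := by exact_mod_cast hi
  have hW : WittFam (fun x : ℤ => (r i : ℂ)⁻¹ • ρ.g ⟨x • r, gz n, .di i⟩)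
      ((r i : ℂ)⁻¹ * (lam (.inl i) + μ i)) (fun k => ρ.Gr lam (μ + k • r)) := by
    refine ⟨fun x y => ?_, fun x k v hv => ?_, fun k v hv => ?_, fun k => h.fd _⟩
    · refine LinearMap.ext fun v => ?_
      have := ρ.dd_comm (x • r) (y • r) i i v
      rw [← add_smul] at this
      simp only [LinearMap.sub_apply, Module.End.mul_apply, LinearMap.smul_apply, map_smul]
      rw [this]
      simp only [Pi.smul_apply, smul_eq_mul, Int.cast_mul]
      match_scalars <;> field_simp <;> ring
    · have := ρ.Gr_maps ⟨x • r, gz n, .di i⟩ v hv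
      simp only [add_assoc, ← add_smul] at this
      exact Submodule.smul_mem _ _ this
    · have := ρ.Gr_di hv i
      rw [zero_smul, LinearMap.smul_apply, this]
      simp only [Pi.add_apply, Pi.smul_apply, smul_eq_mul, Int.cast_add, Int.cast_mul, smul_smul]
      congr 1
      field_simp
      ring
  obtain ⟨K, hK⟩ := hW.eventually_bot fun k v _ => by
    obtain ⟨p, hp⟩ := hr v 0
    refine ⟨p, fun j hj => ?_⟩
    have := hp j.toNat (by omega) (gz n, .di i)
    rw [zero_add, ← natCast_zsmul, Int.toNat_of_nonneg (by omega)] at this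
    rw [LinearMap.smul_apply, this, smul_zero]
  refine ⟨K.toNat, fun k hk => ?_⟩
  have := hK k (by omega)
  rwa [natCast_zsmul] at this

end Unbounded
end

noncomputable section

variable {m n : ℕ} {b : Bool}

section Order

variable {ρ : WRep m n false} {lam : HIdx m false → ℂ}

/-- The additive closure of the cone. -/
def WRep.cbar (ρ : WRep m n false) : AddSubmonoid (LExp m) where
  carrier := {s | ∀ r ∈ ρ.cone, r + s ∈ ρ.cone}
  zero_mem' := fun r hr => by rwa [add_zero]
  add_mem' := fun {s t} hs ht r hr => by
    rw [← add_assoc]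
    exact ht _ (hs r hr)

lemma WRep.Kil.mem_cbar (hs : IsSimpleG ρ.g) (hm : 2 ≤ m) {u : ρ.M} (hu : u ≠ 0) {s : LExp m}
    (hk : ρ.Kil u s) : s ∈ ρ.cbar := by
  by_cases hs0 : s = 0
  · rw [hs0]
    exact zero_mem _
  intro r hr
  refine WRep.mem_cone hs hu fun g => ?_
  obtain ⟨i, hi⟩ := Function.ne_iff.1 hs0
  rw [Pi.zero_apply] at hi
  obtain ⟨j, hj⟩ : ∃ j, j ≠ i := by
    have : Nontrivial (Fin m) := Fin.nontrivial_iff_two_le.2 hm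
    exact exists_ne i
  let f : LExp m →+ ℤ :=
    { toFun := fun y => y i * s j - y j * s i
      map_zero' := by simp
      map_add' := fun x y => by simp only [Pi.add_apply]; ring }
  have hfs : f s = 0 := by simp only [f, AddMonoidHom.coe_mk, ZeroHom.coe_mk]; ring
  have hfe : f (ep j 1) = -s i := by simp [f, ep, hj.symm]
  choose p hp using fun c : ℕ => hr u (c • ep j 1)
  choose q hq using fun c : ℕ => hr u (g - c • ep j 1)
  refine ⟨2 * (p 1 + p 2 + p 3 + q 1 + q 2 + q 3), fun k hk' => ?_⟩
  obtain ⟨c, hcK, hc0, hc1⟩ : ∃ c : ℕ, (c = 1 ∨ c = 2 ∨ c = 3) ∧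
      ((k / 2 : ℕ) : ℤ) * f r - c * s i ≠ 0 ∧
      ((k / 2 : ℕ) : ℤ) * f r - c * s i ≠ f g + ((k - k / 2 : ℕ) : ℤ) * f r + c * s i := by
    generalize ((k / 2 : ℕ) : ℤ) * f r = X
    generalize f g + ((k - k / 2 : ℕ) : ℤ) * f r = Y
    by_contra! hcon
    have h1 := hcon 1 (by simp)
    have h2 := hcon 2 (by simp)
    have h3 := hcon 3 (by simp)
    push_cast at h1 h2 h3
    omega
  have hA : ρ.Kil u (c • ep j 1 + (k / 2) • r) := hp c _ (by
    rcases hcK with rfl | rfl | rfl <;> omega)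
  have hB : ρ.Kil u (g - c • ep j 1 + (k - k / 2) • r) := hq c _ (by
    rcases hcK with rfl | rfl | rfl <;> omega)
  have hfA : f (c • ep j 1 + (k / 2) • r) = ((k / 2 : ℕ) : ℤ) * f r - c * s i := by
    rw [map_add, map_nsmul, map_nsmul, hfe]
    simp only [nsmul_eq_mul]
    ring
  have hfB : f (g - c • ep j 1 + (k - k / 2) • r) =
      f g + ((k - k / 2 : ℕ) : ℤ) * f r + c * s i := by
    rw [map_add, map_sub, map_nsmul, map_nsmul, hfe]
    simp only [nsmul_eq_mul]
    ring
  have hI : ∀ t : ℕ, ρ.Kil u (c • ep j 1 + (k / 2) • r + t • s) := by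
    intro t
    induction t with
    | zero => simpa using hA
    | succ t ih =>
      have := ih.add hk fun h => hc0 (by
        have := congrArg f h
        rw [map_add, map_nsmul, hfs, smul_zero, add_zero, hfA] at this
        exact this)
      rwa [add_assoc, ← succ_nsmul] at this
  have := (hI k).add hB fun h => hc1 (by
    have := congrArg f h
    rw [map_add, map_nsmul, hfs, smul_zero, add_zero, hfA, hfB] at this
    exact this)
  have hkk : (k / 2) • r + (k - k / 2) • r = k • r := by
    rw [← add_smul, Nat.add_sub_cancel' (Nat.div_le_self k 2)]
  rwa [show c • ep j 1 + (k / 2) • r + k • s + (g - c • ep j 1 + (k - k / 2) • r) =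
    g + ((k / 2) • r + (k - k / 2) • r + k • s) by abel, hkk, ← smul_add] at this

namespace WRep.Unb

lemma mem_cbar (h : ρ.Unb lam) (hm : 2 ≤ m) {μ s : LExp m} (h1 : ρ.Gr lam μ ≠ ⊥)
    (h2 : ρ.Gr lam (μ + s) = ⊥) : s ∈ ρ.cbar := by
  obtain ⟨u, hu, hu0⟩ := Submodule.exists_mem_ne_zero_of_ne_bot h1
  refine WRep.Kil.mem_cbar h.simple hm hu0 fun a => ?_
  have := ρ.Gr_maps ⟨s, a⟩ u hu
  rwa [h2, Submodule.mem_bot] at this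

lemma ne_zero (h : ρ.Unb lam) {r : LExp m} (hr : r ∈ ρ.cone) : r ≠ 0 :=
  fun h0 => h.zero_not_mem (h0 ▸ hr)

lemma mem_cbar_of_frequently (h : ρ.Unb lam) {r s : LExp m}
    (hj : ∀ j1 : ℕ, ∃ j ≥ j1, j • s + r ∈ ρ.cbar) : s ∈ ρ.cbar := by
  intro r' hr'
  obtain ⟨j0, hj0⟩ := WRep.cone_open h.simple hr' (h.ne_zero hr') (-r)
  obtain ⟨j, hj1, hj2⟩ := hj (max j0 1)
  refine WRep.cone_of_smul (q := j) (by omega) ?_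
  have := hj2 _ (hj0 j (le_of_max_le_left hj1))
  rwa [show j • r' + -r + (j • s + r) = j • (r' + s) by rw [smul_add]; abel] at this

lemma exists_ne_bot (h : ρ.Unb lam) : ∃ μ, ρ.Gr lam μ ≠ ⊥ := by
  obtain ⟨μ, hμ⟩ := h.unb 0
  refine ⟨μ, fun h0 => ?_⟩
  rw [h0, finrank_bot] at hμ
  omega

lemma total (h : ρ.Unb lam) (hm : 2 ≤ m) (s : LExp m) : s ∈ ρ.cbar ∨ -s ∈ ρ.cbar := by
  by_contra! hcon
  obtain ⟨hs, hs'⟩ := hcon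
  obtain ⟨r, hr⟩ := h.exists_mem_cone (by omega)
  have hshift : ∀ t, t ∉ ρ.cbar → ∀ μ, ρ.Gr lam μ ≠ ⊥ → ρ.Gr lam (μ + t) ≠ ⊥ :=
    fun t ht μ hμ h0 => ht (h.mem_cbar hm hμ h0)
  have hshift' : ∀ t, t ∉ ρ.cbar → ∀ (k : ℕ) μ, ρ.Gr lam μ ≠ ⊥ → ρ.Gr lam (μ + k • t) ≠ ⊥ := by
    intro t ht k μ hμ
    induction k with
    | zero => simpa using hμ
    | succ k ih =>
      rw [succ_nsmul, ← add_assoc]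
      exact hshift t ht _ ih
  obtain ⟨j1, hj1⟩ : ∃ j1 : ℕ, ∀ j ≥ j1, j • s + r ∉ ρ.cbar := by
    by_contra! hcon
    exact hs (h.mem_cbar_of_frequently hcon)
  have key : ∀ μ, ρ.Gr lam μ ≠ ⊥ → ρ.Gr lam (μ + r) ≠ ⊥ := fun μ hμ => by
    have := hshift' (-s) hs' j1 _ (hshift _ (hj1 j1 le_rfl) μ hμ)
    rwa [show μ + (j1 • s + r) + j1 • -s = μ + r by rw [smul_neg]; abel] at this
  obtain ⟨μ, hμ⟩ := h.exists_ne_bot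
  obtain ⟨k0, hk0⟩ := h.eventually_bot hr μ
  have : ∀ k : ℕ, ρ.Gr lam (μ + k • r) ≠ ⊥ := fun k => by
    induction k with
    | zero => simpa using hμ
    | succ k ih =>
      rw [succ_nsmul, ← add_assoc]
      exact key _ ih
  exact this k0 (hk0 k0 le_rfl)

lemma mem_cone_of_cbar (h : ρ.Unb lam) (hm : 2 ≤ m) {s : LExp m}
    (hs' : -s ∉ ρ.cbar) : s ∈ ρ.cone := by
  obtain ⟨r, hr⟩ := h.exists_mem_cone (by omega)
  by_cases hj : ∃ j : ℕ, 0 < j ∧ j • s + -r ∈ ρ.cbar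
  · obtain ⟨j, hj, hj'⟩ := hj
    refine WRep.cone_of_smul hj ?_
    have := hj' r hr
    rwa [show r + (j • s + -r) = j • s by abel] at this
  · push Not at hj
    refine absurd (h.mem_cbar_of_frequently (r := r) fun j1 => ⟨j1 + 1, by omega, ?_⟩) hs'
    have := (h.total hm ((j1 + 1) • s + -r)).resolve_left (hj (j1 + 1) (by omega))
    rwa [neg_add, neg_neg, ← smul_neg] at this

lemma neg_not_mem (h : ρ.Unb lam) {r : LExp m} (hr : r ∈ ρ.cone) : -r ∉ ρ.cbar := fun hr' =>
  h.zero_not_mem (by simpa using hr' r hr)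

lemma cone_le_cbar (hm : 0 < m) {r : LExp m} (hr : r ∈ ρ.cone) : r ∈ ρ.cbar :=
  fun _ hs => WRep.cone_add hm hs hr

lemma sub_ne_bot (h : ρ.Unb lam) (hm : 2 ≤ m) {μ x : LExp m} (hμ : ρ.Gr lam μ ≠ ⊥)
    (hx : x ∈ ρ.cone) : ρ.Gr lam (μ - x) ≠ ⊥ := fun h0 =>
  h.neg_not_mem hx (h.mem_cbar hm hμ (by rwa [← sub_eq_add_neg]))

end WRep.Unb

end Order
end

noncomputable section

variable {m n : ℕ} {b : Bool}

section Line

/-- `d_i` along the line spanned by `r`. -/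
def WRep.lineE (ρ : WRep m n b) (r : LExp m) (i : Fin m) (x : ℤ) : ρ.M →ₗ[ℂ] ρ.M :=
  ρ.g ⟨x • r, gz n, .di i⟩

/-- The vector field `r_j d_i - r_i d_j` along the line spanned by `r`. -/
def WRep.lineA (ρ : WRep m n b) (r : LExp m) (i j : Fin m) (x : ℤ) : ρ.M →ₗ[ℂ] ρ.M :=
  (r j : ℂ) • ρ.lineE r i x - (r i : ℂ) • ρ.lineE r j x

lemma WRep.lineE_comm (ρ : WRep m n b) (r : LExp m) (i j : Fin m) (x y : ℤ) (v : ρ.M) :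
    ρ.lineE r i x (ρ.lineE r j y v) = ρ.lineE r j y (ρ.lineE r i x v)
      + ((y * r i : ℂ) • ρ.lineE r j (x + y) v - (x * r j : ℂ) • ρ.lineE r i (x + y) v) := by
  have := ρ.dd_comm (x • r) (y • r) i j v
  rw [← add_smul] at this
  simp only [Pi.smul_apply, smul_eq_mul, Int.cast_mul] at this
  exact this

lemma WRep.lineE_lineA (ρ : WRep m n b) (r : LExp m) (i j : Fin m) (x y : ℤ) (v : ρ.M) :
    ρ.lineE r i x (ρ.lineA r i j y v) = ρ.lineA r i j y (ρ.lineE r i x v)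
      + (y * r i : ℂ) • ρ.lineA r i j (x + y) v := by
  simp only [lineA, LinearMap.sub_apply, LinearMap.smul_apply, map_sub, map_smul]
  rw [ρ.lineE_comm r i i x y, ρ.lineE_comm r i j x y]
  module

lemma WRep.lineE_lineA' (ρ : WRep m n b) (r : LExp m) (i j : Fin m) (x y : ℤ) (v : ρ.M) :
    ρ.lineE r j x (ρ.lineA r i j y v) = ρ.lineA r i j y (ρ.lineE r j x v)
      + (y * r j : ℂ) • ρ.lineA r i j (x + y) v := by
  simp only [lineA, LinearMap.sub_apply, LinearMap.smul_apply, map_sub, map_smul]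
  rw [ρ.lineE_comm r j j x y, ρ.lineE_comm r j i x y]
  module

lemma WRep.lineA_comm (ρ : WRep m n b) (r : LExp m) (i j : Fin m) (x y : ℤ) (v : ρ.M) :
    ρ.lineA r i j x (ρ.lineA r i j y v) = ρ.lineA r i j y (ρ.lineA r i j x v) := by
  conv_lhs => rw [lineA, LinearMap.sub_apply, LinearMap.smul_apply, LinearMap.smul_apply,
    ρ.lineE_lineA, ρ.lineE_lineA']
  conv_rhs => rw [lineA, LinearMap.sub_apply, LinearMap.smul_apply, LinearMap.smul_apply]
  simp only [lineA, LinearMap.sub_apply, LinearMap.smul_apply, map_sub, map_smul]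
  module

variable {ρ : WRep m n b} {lam : HIdx m b → ℂ}

lemma WRep.lineE_maps {r ν : LExp m} {i : Fin m} {x y : ℤ} {v : ρ.M}
    (hv : v ∈ ρ.Gr lam (ν + y • r)) : ρ.lineE r i x v ∈ ρ.Gr lam (ν + (x + y) • r) := by
  have := ρ.Gr_maps ⟨x • r, gz n, .di i⟩ v hv
  rwa [add_assoc, ← add_smul, add_comm y x] at this

lemma WRep.lineA_maps {r ν : LExp m} {i j : Fin m} {x y : ℤ} {v : ρ.M}
    (hv : v ∈ ρ.Gr lam (ν + y • r)) : ρ.lineA r i j x v ∈ ρ.Gr lam (ν + (x + y) • r) :=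
  Submodule.sub_mem _ (Submodule.smul_mem _ _ (ρ.lineE_maps hv))
    (Submodule.smul_mem _ _ (ρ.lineE_maps hv))

/-- A long string above `ν` ending in a highest vector forces a large multiplicity at `ν`. -/
lemma WRep.line_bound {r ν : LExp m} [FiniteDimensional ℂ (ρ.Gr lam ν)] {K : ℕ} {u : ρ.M}
    (hu : u ∈ ρ.Gr lam (ν + (K : ℤ) • r)) (hu0 : u ≠ 0)
    (htop : ∀ k : ℤ, K < k → ρ.Gr lam (ν + k • r) = ⊥) {i j : Fin m} (hi : r i ≠ 0)
    (hc : (r j : ℂ) * (lam (.inl i) + ν i) - r i * (lam (.inl j) + ν j) ≠ 0) {L : ℕ}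
    (hL : 2 * L < K) : L ≤ Module.finrank ℂ (ρ.Gr lam ν) := by
  have hE : ∀ x > 0, ρ.lineE r i x u = 0 := fun x hx => by
    have := ρ.lineE_maps (i := i) (x := x) hu
    rwa [htop _ (by omega), Submodule.mem_bot] at this
  have hA : ∀ x > 0, ρ.lineA r i j x u = 0 := fun x hx => by
    have := ρ.lineA_maps (i := i) (j := j) (x := x) hu
    rwa [htop _ (by omega), Submodule.mem_bot] at this
  set c := (r j : ℂ) * (lam (.inl i) + ν i) - r i * (lam (.inl j) + ν j) with hcdef
  have hA0 : ρ.lineA r i j 0 u = c • u := by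
    have h1 := ρ.Gr_di hu i
    have h2 := ρ.Gr_di hu j
    simp only [lineA, lineE, zero_smul, LinearMap.sub_apply, LinearMap.smul_apply, h1, h2,
      smul_smul, ← sub_smul, hcdef]
    congr 1
    simp only [Pi.add_apply, Pi.smul_apply, smul_eq_mul, Int.cast_add, Int.cast_mul,
      Int.cast_natCast]
    ring
  let y : ℕ → ℤ := fun t => (L : ℤ) - t
  refine le_finrank_of_triangular (G := ρ.Gr lam ν)
    (w := fun t => ρ.lineA r i j (-(y t)) (ρ.lineA r i j (-(K - y t)) u)) (fun t _ => ?_)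
    (fun t => ρ.lineE r i (y t) ∘ₗ ρ.lineE r i (K - y t)) (fun I hI t ht => ?_) (fun I hI => ?_)
  · have := ρ.lineA_maps (i := i) (j := j) (x := -(y t))
      (ρ.lineA_maps (i := i) (j := j) (x := -(K - y t)) hu)
    rwa [show -(y t) + (-(K - y t) + (K : ℤ)) = 0 by ring, zero_smul, add_zero] at this
  · rw [LinearMap.comp_apply, ρ.lineE_lineA, ρ.lineE_lineA, hE _ (by simp only [y]; omega),
      hA _ (by simp only [y]; omega), ρ.lineA_comm, hA _ (by simp only [y]; omega)]
    simp
  · rw [LinearMap.comp_apply, ρ.lineE_lineA, ρ.lineE_lineA, hE _ (by simp only [y]; omega),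
      ρ.lineA_comm r i j (K - y I + -(y I)) _ u, hA (K - y I + -(y I)) (by simp only [y]; omega), map_zero, zero_add,
      add_neg_cancel, hA0, smul_zero, add_zero, map_smul, map_smul, map_smul, map_smul,
      ρ.lineE_lineA, hE _ (by simp only [y]; omega), map_zero, zero_add, add_neg_cancel, hA0,
      smul_smul, smul_smul, smul_smul]
    have h1 : ((-(K - y I) : ℤ) : ℂ) ≠ 0 := by
      rw [Int.cast_ne_zero]; simp only [y]; omega
    have h2 : ((-(y I) : ℤ) : ℂ) ≠ 0 := by
      rw [Int.cast_ne_zero]; simp only [y]; omega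
    have h3 : (r i : ℂ) ≠ 0 := Int.cast_ne_zero.2 hi
    refine smul_ne_zero ?_ hu0
    simp only [mul_ne_zero_iff]
    tauto

end Line
end

noncomputable section

variable {m n : ℕ} {b : Bool}

section Height

variable {ρ : WRep m n false} {lam : HIdx m false → ℂ}

namespace WRep.Unb

lemma exists_top (h : ρ.Unb lam) {r ν : LExp m} (hr : r ∈ ρ.cone) {K : ℕ}
    (hK : ρ.Gr lam (ν + K • r) ≠ ⊥) : ∃ K' : ℕ, K ≤ K' ∧ ρ.Gr lam (ν + (K' : ℤ) • r) ≠ ⊥ ∧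
      ∀ k : ℤ, K' < k → ρ.Gr lam (ν + k • r) = ⊥ := by
  classical
  obtain ⟨k0, hk0⟩ := h.eventually_bot hr ν
  have hKk : K ≤ k0 := by
    by_contra! hlt
    exact hK (hk0 K hlt.le)
  refine ⟨Nat.findGreatest (fun k => ρ.Gr lam (ν + k • r) ≠ ⊥) k0,
    Nat.le_findGreatest hKk hK, ?_, fun k hk => ?_⟩
  · have := Nat.findGreatest_spec (P := fun k => ρ.Gr lam (ν + k • r) ≠ ⊥) hKk hK
    rwa [natCast_zsmul]
  · obtain ⟨k, rfl⟩ := Int.eq_ofNat_of_zero_le (a := k) (by omega)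
    rw [natCast_zsmul]
    by_cases hk' : k0 ≤ k
    · exact hk0 k hk'
    · by_contra hne
      exact Nat.findGreatest_is_greatest (P := fun k => ρ.Gr lam (ν + k • r) ≠ ⊥)
        (by exact_mod_cast hk) (by omega) hne

lemma exists_halving (h : ρ.Unb lam) (hm : 2 ≤ m)
    (hmin : ∀ r ∈ ρ.cone, ∃ x ∈ ρ.cone, r - x ∈ ρ.cone) {r : LExp m} (hr : r ∈ ρ.cone) (p : ℕ) :
    ∃ x ∈ ρ.cone, r - 2 ^ p • x ∈ ρ.cbar := by
  induction p with
  | zero => exact ⟨r, hr, by simp⟩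
  | succ p ih =>
    obtain ⟨x, hx, hrx⟩ := ih
    obtain ⟨y, hy, hxy⟩ := hmin x hx
    obtain ⟨z, hz, hxz⟩ : ∃ z ∈ ρ.cone, x - 2 • z ∈ ρ.cbar := by
      rcases h.total hm (x - 2 • y) with h1 | h1
      · exact ⟨y, hy, h1⟩
      · refine ⟨x - y, hxy, ?_⟩
        rwa [show x - 2 • (x - y) = -(x - 2 • y) by rw [smul_sub, two_smul ℕ x]; abel]
    refine ⟨z, hz, ?_⟩
    have := add_mem hrx (nsmul_mem hxz (2 ^ p))
    rwa [show r - 2 ^ p • x + 2 ^ p • (x - 2 • z) = r - 2 ^ (p + 1) • z by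
      rw [smul_sub, smul_smul, pow_succ]; abel] at this

lemma exists_minimal (h : ρ.Unb lam) (hm : 2 ≤ m) :
    ∃ x ∈ ρ.cone, ∀ y ∈ ρ.cone, x - y ∉ ρ.cone := by
  by_contra! hmin
  obtain ⟨μ, hμ⟩ := h.exists_ne_bot
  obtain ⟨r, hr⟩ := h.exists_mem_cone (by omega)
  choose j0 hj0 using fun i : Fin m => WRep.cone_open h.simple hr (h.ne_zero hr) (ep i 1)
  set j := Finset.univ.sup j0 + 1 with hj
  have hjr : j • r ∈ ρ.cone := WRep.cone_smul (by omega) hr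
  have hje : ∀ i, j • r + ep i 1 ∈ ρ.cone := fun i =>
    hj0 i j ((Finset.le_sup (f := j0) (Finset.mem_univ i)).trans (Nat.le_succ _))
  clear_value j
  set q := μ - (j + 1) • r with hq
  set B := Module.finrank ℂ (ρ.Gr lam q) + ∑ i, Module.finrank ℂ (ρ.Gr lam (q - ep i 1)) with hB
  obtain ⟨x, hx, hrx⟩ := h.exists_halving hm hmin hr (2 * (B + 1))
  obtain ⟨i, hi⟩ := Function.ne_iff.1 (h.ne_zero hx)
  rw [Pi.zero_apply] at hi
  obtain ⟨i', hi'⟩ : ∃ i', i' ≠ i := by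
    have : Nontrivial (Fin m) := Fin.nontrivial_iff_two_le.2 hm
    exact exists_ne i
  have key : ∀ e, j • r + e ∈ ρ.cone → Module.finrank ℂ (ρ.Gr lam (q - e)) ≤ B →
      (x i' : ℂ) * (lam (.inl i) + (q - e) i) - x i * (lam (.inl i') + (q - e) i') = 0 := by
    intro e he hBe
    have := h.fd (q - e)
    have h1 : ρ.Gr lam (q - e + 2 ^ (2 * (B + 1)) • x) ≠ ⊥ := by
      have := h.sub_ne_bot hm hμ (hrx _ he)
      rwa [show μ - (j • r + e + (r - 2 ^ (2 * (B + 1)) • x)) =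
        q - e + 2 ^ (2 * (B + 1)) • x by rw [hq, succ_nsmul]; abel] at this
    obtain ⟨K, hK, hne, htop⟩ := h.exists_top hx h1
    obtain ⟨u, hu, hu0⟩ := Submodule.exists_mem_ne_zero_of_ne_bot hne
    by_contra hc
    have h2 := WRep.line_bound hu hu0 htop hi hc (L := B + 1)
      (lt_of_lt_of_le Nat.lt_two_pow_self hK)
    omega
  have h1 := key 0 (by rwa [add_zero]) (by rw [sub_zero]; omega)
  have h2 := key (ep i' 1) (hje i') ((Finset.single_le_sum
    (f := fun i => Module.finrank ℂ (ρ.Gr lam (q - ep i 1))) (fun _ _ => Nat.zero_le _)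
    (Finset.mem_univ i')).trans (Nat.le_add_left _ _))
  have e1 : (q - ep i' 1) i = q i := by simp [ep, hi'.symm]
  have e2 : (q - ep i' 1) i' = q i' - 1 := by simp [ep]
  rw [sub_zero] at h1
  rw [e1, e2] at h2
  refine hi (Int.cast_injective (α := ℂ) ?_)
  push_cast at h2 ⊢
  linear_combination h2 - h1

lemma exists_height_of_two_le (h : ρ.Unb lam) (hm : 2 ≤ m) :
    ∃ α : LExp m →+ ℤ, ∃ x, α x = 1 ∧ ∃ B, ∀ μ, ρ.Gr lam μ ≠ ⊥ → α μ ≤ B := by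
  obtain ⟨x, hx, hmin⟩ := h.exists_minimal hm
  have hex : ∀ y, ∃ k : ℤ, y - k • x ∈ ρ.cbar ∧ -(y - k • x) ∈ ρ.cbar := by
    intro y
    obtain ⟨j1, hj1⟩ := WRep.cone_open h.simple hx (h.ne_zero hx) y
    obtain ⟨j2, hj2⟩ := WRep.cone_open h.simple hx (h.ne_zero hx) (-y)
    obtain ⟨k, hk, hk'⟩ := Int.exists_greatest_of_bdd (P := fun k => y - k • x ∈ ρ.cbar)
      ⟨j2, fun z hz => by
        by_contra! hlt
        obtain ⟨z, rfl⟩ := Int.eq_ofNat_of_zero_le (a := z) (by omega)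
        refine h.neg_not_mem (hj2 z (by omega)) ?_
        rw [natCast_zsmul] at hz
        rwa [neg_add, neg_neg, add_comm, ← sub_eq_add_neg]⟩
      ⟨-j1, by
        have := cone_le_cbar (by omega) (hj1 j1 le_rfl)
        rwa [neg_smul, natCast_zsmul, sub_neg_eq_add, add_comm]⟩
    refine ⟨k, hk, ?_⟩
    have h1 : y - (k + 1) • x ∉ ρ.cbar := fun h1 => by
      have := hk' _ h1
      omega
    by_contra h2
    refine hmin _ (h.mem_cone_of_cbar hm h2) (h.mem_cone_of_cbar hm ?_)
    rwa [show -(x - (y - k • x)) = y - (k + 1) • x by rw [add_smul, one_smul]; abel]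
  have huniq : ∀ k : ℤ, k • x ∈ ρ.cbar → -(k • x) ∈ ρ.cbar → k = 0 := by
    intro k h1 h2
    obtain ⟨k, rfl | rfl⟩ := Int.eq_nat_or_neg k
    · by_contra hk
      rw [natCast_zsmul] at h1 h2
      exact h.neg_not_mem (WRep.cone_smul (q := k) (by omega) hx) h2
    · by_contra hk
      rw [neg_smul, natCast_zsmul] at h1 h2
      exact h.neg_not_mem (WRep.cone_smul (q := k) (by omega) hx) h1
  choose a ha ha' using hex
  have hau : ∀ y (k : ℤ), y - k • x ∈ ρ.cbar → -(y - k • x) ∈ ρ.cbar → a y = k := by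
    intro y k h1 h2
    refine sub_eq_zero.1 (huniq _ ?_ ?_)
    · have := add_mem h1 (ha' y)
      rwa [show y - k • x + -(y - a y • x) = (a y - k) • x by rw [sub_smul]; abel] at this
    · have := add_mem h2 (ha y)
      rwa [show -(y - k • x) + (y - a y • x) = -((a y - k) • x) by rw [sub_smul]; abel] at this
  let α : LExp m →+ ℤ := AddMonoidHom.mk' a fun y z => by
    refine hau _ _ ?_ ?_
    · have := add_mem (ha y) (ha z)
      rwa [show y - a y • x + (z - a z • x) = y + z - (a y + a z) • x by
        rw [add_smul]; abel] at this
    · have := add_mem (ha' y) (ha' z)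
      rwa [show -(y - a y • x) + -(z - a z • x) = -(y + z - (a y + a z) • x) by
        rw [add_smul]; abel] at this
  refine ⟨α, x, hau _ _ (by simp) (by simp), ?_⟩
  obtain ⟨μ, hμ⟩ := h.exists_ne_bot
  obtain ⟨k0, hk0⟩ := h.eventually_bot hx μ
  refine ⟨α (μ + k0 • x), fun ν hν => ?_⟩
  by_contra! hlt
  have hpos : 0 < a (ν - (μ + k0 • x)) := by
    have : α (ν - (μ + k0 • x)) = α ν - α (μ + k0 • x) := map_sub _ _ _
    change a (ν - (μ + k0 • x)) = _ at this
    omega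
  have hc : ν - (μ + k0 • x) ∈ ρ.cone := by
    obtain ⟨k, hk⟩ := Int.eq_ofNat_of_zero_le hpos.le
    have h1 := ha (ν - (μ + k0 • x))
    rw [hk, natCast_zsmul] at h1
    have := h1 _ (WRep.cone_smul (q := k) (by omega) hx)
    rwa [add_sub_cancel] at this
  have := h.sub_ne_bot hm hν hc
  rw [sub_sub_cancel] at this
  exact this (hk0 k0 le_rfl)

/-- The support of an unbounded simple module is bounded above in some primitive direction. -/
lemma exists_height (h : ρ.Unb lam) (hm : 0 < m) :
    ∃ α : LExp m →+ ℤ, ∃ x, α x = 1 ∧ ∃ B, ∀ μ, ρ.Gr lam μ ≠ ⊥ → α μ ≤ B := by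
  by_cases hm2 : 2 ≤ m
  · exact h.exists_height_of_two_le hm2
  obtain rfl : m = 1 := by omega
  obtain ⟨r, hr⟩ := h.exists_mem_cone hm
  have hr0 : r 0 ≠ 0 := fun h0 => h.ne_zero hr (funext fun i => by
    rw [Subsingleton.elim i 0, h0]; rfl)
  obtain ⟨s, hs, hs'⟩ : ∃ s : ℤ, (s = 1 ∨ s = -1) ∧ (fun _ => s : LExp 1) ∈ ρ.cone := by
    rcases lt_or_gt_of_ne hr0 with h1 | h1
    · refine ⟨-1, Or.inr rfl, WRep.cone_of_smul (q := (r 0).natAbs) (by omega) ?_⟩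
      convert hr using 1
      funext i
      rw [Subsingleton.elim i 0]
      simp only [Pi.smul_apply, nsmul_eq_mul]
      omega
    · refine ⟨1, Or.inl rfl, WRep.cone_of_smul (q := (r 0).natAbs) (by omega) ?_⟩
      convert hr using 1
      funext i
      rw [Subsingleton.elim i 0]
      simp only [Pi.smul_apply, nsmul_eq_mul]
      omega
  obtain ⟨k0, hk0⟩ := h.eventually_bot hs' 0
  refine ⟨s • Pi.evalAddMonoidHom (fun _ => ℤ) 0, fun _ => s, ?_, k0, fun μ hμ => ?_⟩
  · rcases hs with rfl | rfl <;> simp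
  · by_contra! hlt
    have hlt : (k0 : ℤ) < s * μ 0 := by simpa using hlt
    refine hμ ?_
    have := hk0 (s * μ 0).toNat (by omega)
    rwa [zero_add, show (s * μ 0).toNat • (fun _ => s : LExp 1) = μ from ?_] at this
    funext i
    rw [Subsingleton.elim i 0, Pi.smul_apply, nsmul_eq_mul, Int.toNat_of_nonneg (by omega)]
    rcases hs with rfl | rfl <;> ring

end WRep.Unb

end Height
end

noncomputable section

variable {m n : ℕ} {b : Bool}

section WeightSums

variable {M : Type} [AddCommGroup M] [Module ℂ M] {F : GAct m n b M}

lemma mem_wtG {mu : HIdx m b → ℂ} {v : M} :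
    v ∈ wtG F mu ↔ ∀ h, F (hB m n b h) v = mu h • v := by
  simp [wtG, Submodule.mem_iInf, sub_eq_zero]

/-- A subspace stable under the Cartan subalgebra contains the weight components of its
elements. -/
lemma mem_of_sum_mem {N : Submodule ℂ M} (hN : ∀ h, ∀ v ∈ N, F (hB m n b h) v ∈ N)
    (s : Finset (HIdx m b → ℂ)) : ∀ v : (HIdx m b → ℂ) → M, (∀ mu ∈ s, v mu ∈ wtG F mu) →
      ∑ mu ∈ s, v mu ∈ N → ∀ mu ∈ s, v mu ∈ N := by
  classical
  induction s using Finset.induction_on with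
  | empty => simp
  | insert a s ha ih =>
    intro v hv hsum
    have h1 : ∀ mu ∈ s, v mu ∈ N := fun mu hmu => by
      have hne : mu ≠ a := fun h => ha (h ▸ hmu)
      obtain ⟨h, hh⟩ := Function.ne_iff.1 hne
      have := ih (fun mu => (mu h - a h) • v mu)
        (fun mu hmu => Submodule.smul_mem _ _ (hv mu (Finset.mem_insert_of_mem hmu))) (by
          have h2 := N.sub_mem (hN h _ hsum) (N.smul_mem (a h) hsum)
          rw [map_sum, Finset.smul_sum, ← Finset.sum_sub_distrib, Finset.sum_insert ha] at h2
          rw [mem_wtG.1 (hv a (Finset.mem_insert_self _ _)) h, sub_self, zero_add] at h2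
          have h3 : ∑ nu ∈ s, (F (hB m n b h) (v nu) - a h • v nu) =
              ∑ nu ∈ s, (nu h - a h) • v nu := Finset.sum_congr rfl fun nu hnu => by
            rw [mem_wtG.1 (hv nu (Finset.mem_insert_of_mem hnu)) h, sub_smul]
          rwa [h3] at h2) mu hmu
      exact (Submodule.smul_mem_iff _ (sub_ne_zero.2 hh)).1 this
    rw [Finset.sum_insert ha] at hsum
    have h2 : v a ∈ N := (N.add_mem_iff_left (N.sum_mem h1)).1 hsum
    intro mu hmu
    rcases Finset.mem_insert.1 hmu with rfl | hmu
    · exact h2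
    · exact h1 mu hmu

/-- A subspace stable under the Cartan subalgebra of a weight module is a weight module. -/
lemma mem_iSup_inf_wt (hF : ⨆ mu, wtG F mu = ⊤) {N : Submodule ℂ M}
    (hN : ∀ h, ∀ v ∈ N, F (hB m n b h) v ∈ N) {v : M} (hv : v ∈ N) :
    v ∈ ⨆ mu, N ⊓ wtG F mu := by
  have : v ∈ ⨆ mu, wtG F mu := hF ▸ Submodule.mem_top
  obtain ⟨f, hf, rfl⟩ := (Submodule.mem_iSup_iff_exists_finsupp _ _).1 this
  have := mem_of_sum_mem hN f.support f (fun mu _ => hf mu) hv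
  exact Submodule.sum_mem _ fun mu hmu => Submodule.mem_iSup_of_mem mu ⟨this mu hmu, hf mu⟩

lemma wtG_eq_bot_of_iSup {P : (HIdx m b → ℂ) → Prop} (hP : ⨆ mu, ⨆ _ : P mu, wtG F mu = ⊤)
    {nu : HIdx m b → ℂ} (hnu : ¬ P nu) : wtG F nu = ⊥ := by
  classical
  rw [eq_bot_iff]
  intro v hv
  have : v ∈ ⨆ mu : {mu // P mu}, wtG F mu := by
    rw [iSup_subtype, hP]; trivial
  obtain ⟨f, hf, hfv⟩ := (Submodule.mem_iSup_iff_exists_finsupp _ _).1 this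
  have key := mem_of_sum_mem (F := F) (N := ⊥) (fun h v hv => by
      rw [(Submodule.mem_bot ℂ).1 hv, map_zero]; exact zero_mem _)
    (insert nu (f.support.map (Function.Embedding.subtype P)))
    (fun mu => if h : P mu then f ⟨mu, h⟩ else -v) (fun mu hmu => by
      by_cases h : P mu
      · simpa [h] using hf ⟨mu, h⟩
      · have hmu : mu = nu := by
          rcases Finset.mem_insert.1 hmu with h' | h'
          · exact h'
          · obtain ⟨x, -, rfl⟩ := Finset.mem_map.1 h'
            exact absurd x.2 h
        subst hmu
        simpa [h] using hv) (by
      rw [Finset.sum_insert (by simp [hnu]), dif_neg hnu, Finset.sum_map]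
      simp only [Function.Embedding.coe_subtype, Subtype.prop, dif_pos, Subtype.coe_eta]
      rw [Submodule.mem_bot, neg_add_eq_zero]
      exact hfv.symm) nu (Finset.mem_insert_self _ _)
  rw [dif_neg hnu, Submodule.neg_mem_iff] at key
  exact key

end WeightSums

section Singular

/-- A simple module with unbounded multiplicities, in terms of one weight coset. -/
lemma exists_unb {ρ : WRep m n false} (hs : IsSimpleG ρ.g) (hw : IsStrongHCG ρ.g)
    (hC : ¬ ∃ C : ℕ, ∀ lam, Module.finrank ℂ (wtG ρ.g lam) ≤ C) : ∃ lam, ρ.Unb lam := by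
  obtain ⟨lam, hl⟩ := exists_wt_ne hs hw
  refine ⟨lam, hs, fun r => hw.2 _, fun B => ?_⟩
  push Not at hC
  obtain ⟨nu, hnu⟩ := hC B
  have htop := iSup_Gr_eq_top hs (lam := lam) (r := 0) (by rwa [WRep.Gr, wsh_zero])
  by_contra! hcon
  have : wtG ρ.g nu = ⊥ := by
    refine wtG_eq_bot_of_iSup (P := fun mu => ∃ r, wsh lam r = mu) ?_ fun ⟨r, hr⟩ => ?_
    · rw [eq_top_iff, ← htop]
      exact iSup_le fun r => le_iSup₂_of_le (wsh lam r) ⟨r, rfl⟩ le_rfl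
    · have := hcon r
      rw [WRep.Gr, hr] at this
      omega
  rw [this, finrank_bot] at hnu
  omega

/-- A primitive additive functional becomes the zeroth coordinate after a change of basis. -/
lemma exists_GL_of_hom (α : LExp (m + 1) →+ ℤ) {x : LExp (m + 1)} (hx : α x = 1) :
    ∃ θ : Matrix.GeneralLinearGroup (Fin (m + 1)) ℤ,
      ∀ y, α ((θ : Matrix (Fin (m + 1)) (Fin (m + 1)) ℤ).mulVec y) = y 0 := by
  let N := LinearMap.ker α.toIntLinearMap
  obtain ⟨k, ⟨c⟩⟩ := Submodule.nonempty_basis_of_pid (Pi.basisFun ℤ (Fin (m + 1))) N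
  have hN : ∀ y, y ∈ N ↔ α y = 0 := fun y => LinearMap.mem_ker
  let v := Module.Basis.mkFinCons x c (fun z y hy h => by
    have := congrArg α h
    rwa [map_add, map_zsmul, hx, (hN y).1 hy, map_zero, smul_eq_mul, mul_one, add_zero] at this)
    (fun z => ⟨-α z, by rw [hN, map_add, map_zsmul, hx]; simp⟩)
  have hv : (v : Fin (k + 1) → LExp (m + 1)) = Fin.cons x ((↑) ∘ c) :=
    Module.Basis.coe_mkFinCons _ _ _ _
  obtain rfl : k = m := by
    have h1 := Module.finrank_eq_card_basis v
    have h2 := Module.finrank_eq_card_basis (Pi.basisFun ℤ (Fin (m + 1)))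
    rw [h2] at h1
    simpa using h1.symm
  let e := Pi.basisFun ℤ (Fin (k + 1))
  refine ⟨⟨e.toMatrix v, v.toMatrix e, e.toMatrix_mul_toMatrix_flip v,
    v.toMatrix_mul_toMatrix_flip e⟩, fun y => ?_⟩
  have h1 : (e.toMatrix v).mulVec y = ∑ j, y j • v j := by
    funext i
    simp [Matrix.mulVec, dotProduct, Module.Basis.toMatrix_apply, e, mul_comm]
  change α ((e.toMatrix v).mulVec y) = y 0
  rw [h1, map_sum, Fin.sum_univ_succ]
  simp only [map_zsmul, hv, Fin.cons_zero, Fin.cons_succ, hx, Function.comp_apply,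
    (hN _).1 (c _).2, smul_eq_mul, mul_one,
    mul_zero, Finset.sum_const_zero, add_zero]

lemma WRep.act_twB_eq_zero {ρ : WRep m n false} {v : ρ.M}
    {θ : Matrix.GeneralLinearGroup (Fin m) ℤ} {x : WBasis m n false}
    (h : ρ.Kil v ((θ : Matrix (Fin m) (Fin m) ℤ).mulVec x.1)) : ρ.act (twB θ x) v = 0 := by
  obtain ⟨r, s, D⟩ := x
  cases D with
  | di i =>
    rw [twB, map_sum, LinearMap.sum_apply]
    refine Finset.sum_eq_zero fun j _ => ?_
    rw [map_smul, LinearMap.smul_apply, ρ.act_sng, h, smul_zero]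
  | pa a => exact h _

lemma WRep.Unb.exists_singularSp_ne_bot {ρ : WRep (m + 1) n false} {lam : HIdx (m + 1) false → ℂ}
    (h : ρ.Unb lam) : ∃ θ, singularSp ρ θ ≠ ⊥ := by
  obtain ⟨α, x, hx, B, hB⟩ := h.exists_height (Nat.succ_pos m)
  obtain ⟨θ, hθ⟩ := exists_GL_of_hom α hx
  obtain ⟨μ0, hμ0⟩ := h.exists_ne_bot
  obtain ⟨k, ⟨μ, hμ, rfl⟩, hk⟩ := Int.exists_greatest_of_bdd
    (P := fun k => ∃ μ, ρ.Gr lam μ ≠ ⊥ ∧ α μ = k)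
    ⟨B, by rintro _ ⟨μ, hμ, rfl⟩; exact hB μ hμ⟩ ⟨_, μ0, hμ0, rfl⟩
  obtain ⟨u, hu, hu0⟩ := Submodule.exists_mem_ne_zero_of_ne_bot hμ
  refine ⟨θ, (Submodule.ne_bot_iff _).2 ⟨u, ?_, hu0⟩⟩
  simp only [singularSp, Submodule.mem_iInf, LinearMap.mem_ker, Set.mem_ofPred_eq]
  intro y hy
  refine WRep.act_twB_eq_zero fun a => ?_
  by_contra hne
  have hmem := ρ.Gr_maps ⟨(θ : Matrix (Fin (m + 1)) (Fin (m + 1)) ℤ).mulVec y.1, a⟩ u hu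
  have := hk _ ⟨_, (Submodule.ne_bot_iff _).2 ⟨_, hmem, hne⟩, rfl⟩
  rw [map_add, hθ] at this
  omega

end Singular
end

noncomputable section

variable {m n : ℕ} {b : Bool}

section Twist

/-- The integral matrix underlying an element of `GL_m(ℤ)`. -/
abbrev glm (θ : Matrix.GeneralLinearGroup (Fin m) ℤ) : Matrix (Fin m) (Fin m) ℤ := θ

lemma glm_inv_mulVec (θ : Matrix.GeneralLinearGroup (Fin m) ℤ) (p : LExp m) :
    (glm θ⁻¹).mulVec ((glm θ).mulVec p) = p := by
  rw [Matrix.mulVec_mulVec, ← Units.val_mul, inv_mul_cancel, Units.val_one, Matrix.one_mulVec]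

lemma glm_mulVec_inv (θ : Matrix.GeneralLinearGroup (Fin m) ℤ) (p : LExp m) :
    (glm θ).mulVec ((glm θ⁻¹).mulVec p) = p := by
  rw [Matrix.mulVec_mulVec, ← Units.val_mul, mul_inv_cancel, Units.val_one, Matrix.one_mulVec]

lemma sum_inv_mul_mulVec (θ : Matrix.GeneralLinearGroup (Fin m) ℤ) (p : LExp m) (i : Fin m) :
    ∑ j, (glm θ⁻¹ i j : ℂ) * ((glm θ).mulVec p j : ℂ) = p i := by
  have := congrFun (glm_inv_mulVec θ p) i
  rw [Matrix.mulVec, dotProduct] at this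
  exact_mod_cast this

lemma sum_mul_inv (θ : Matrix.GeneralLinearGroup (Fin m) ℤ) (i j : Fin m) :
    ∑ k, (glm θ i k : ℂ) * (glm θ⁻¹ k j : ℂ) = if i = j then 1 else 0 := by
  have h : glm θ * glm θ⁻¹ = 1 := by rw [← Units.val_mul, mul_inv_cancel, Units.val_one]
  have := congrFun (congrFun h i) j
  rw [Matrix.mul_apply, Matrix.one_apply] at this
  exact_mod_cast this

variable (ρ : WRep m n false) (θ : Matrix.GeneralLinearGroup (Fin m) ℤ)

lemma WRep.act_twB_di (r : LExp m) (s : GExp n) (i : Fin m) (v : ρ.M) :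
    ρ.act (twB θ ⟨r, s, .di i⟩) v
      = ∑ j, (glm θ⁻¹ i j : ℂ) • ρ.g ⟨(glm θ).mulVec r, s, .di j⟩ v := by
  rw [twB, map_sum, LinearMap.sum_apply]
  refine Finset.sum_congr rfl fun j _ => ?_
  rw [map_smul, LinearMap.smul_apply]
  rfl

lemma WRep.act_twB_pa (r : LExp m) (s : GExp n) (a : Fin n) (v : ρ.M) :
    ρ.act (twB θ ⟨r, s, .pa a⟩) v = ρ.g ⟨(glm θ).mulVec r, s, .pa a⟩ v := rfl

/-- The linear extension of the twist. -/
def twLin : W m n false →ₗ[ℂ] W m n false := Finsupp.linearCombination ℂ (twB θ)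

lemma twLin_sng (x : WBasis m n false) : twLin θ (sng x) = twB θ x := by
  simp [twLin, sng]

lemma WRep.comm_sum_di_di (r p : LExp m) (s q : GExp n) (c d : Fin m → ℂ) (v : ρ.M) :
    ∑ j, c j • ρ.g ⟨r, s, .di j⟩ (∑ l, d l • ρ.g ⟨p, q, .di l⟩ v)
      - ((-1 : ℂ) ^ (gdeg s % 2 * (gdeg q % 2))) •
        ∑ l, d l • ρ.g ⟨p, q, .di l⟩ (∑ j, c j • ρ.g ⟨r, s, .di j⟩ v)
    = ((∑ j, c j * p j) * mulSgn s q) • ∑ l, d l • ρ.g ⟨r + p, xorE s q, .di l⟩ v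
      - ((∑ l, d l * r l) * mulSgn s q) • ∑ j, c j • ρ.g ⟨r + p, xorE s q, .di j⟩ v := by
  have h : ∀ j l, ρ.g ⟨r, s, .di j⟩ (ρ.g ⟨p, q, .di l⟩ v)
      = ((-1 : ℂ) ^ (gdeg s % 2 * (gdeg q % 2))) • ρ.g ⟨p, q, .di l⟩ (ρ.g ⟨r, s, .di j⟩ v)
        + ((p j * mulSgn s q) • ρ.g ⟨r + p, xorE s q, .di l⟩ v
          - (r l * mulSgn s q) • ρ.g ⟨r + p, xorE s q, .di j⟩ v) := fun j l => by
    have := ρ.comm ⟨r, s, .di j⟩ ⟨p, q, .di l⟩ v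
    simp only [brB, map_sub, map_smul, LinearMap.sub_apply, LinearMap.smul_apply, ρ.act_sng,
      par] at this
    rw [this]; abel
  rw [sub_eq_iff_eq_add]
  simp only [map_sum, map_smul, Finset.smul_sum, h, smul_add, smul_sub, Finset.sum_add_distrib,
    Finset.sum_sub_distrib, smul_smul, Finset.sum_mul, Finset.sum_smul]
  rw [add_comm]
  congr 1
  · congr 1
    · rw [Finset.sum_comm]
      refine Finset.sum_congr rfl fun _ _ => Finset.sum_congr rfl fun _ _ => ?_
      congr 1; ring
    · refine Finset.sum_congr rfl fun _ _ => Finset.sum_congr rfl fun _ _ => ?_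
      congr 1; ring
  · rw [Finset.sum_comm]
    refine Finset.sum_congr rfl fun _ _ => Finset.sum_congr rfl fun _ _ => ?_
    congr 1; ring

lemma WRep.comm_sum_di (r p : LExp m) (s q : GExp n) (c : Fin m → ℂ) (a : Fin n) (v : ρ.M) :
    ∑ j, c j • ρ.g ⟨r, s, .di j⟩ (ρ.g ⟨p, q, .pa a⟩ v)
      - ((-1 : ℂ) ^ (gdeg s % 2 * ((gdeg q + 1) % 2))) •
        ρ.g ⟨p, q, .pa a⟩ (∑ j, c j • ρ.g ⟨r, s, .di j⟩ v)
    = ((∑ j, c j * p j) * mulSgn s q) • ρ.g ⟨r + p, xorE s q, .pa a⟩ v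
      - ((-1 : ℂ) ^ (gdeg s * (gdeg q + 1)) * derC a s * mulSgn q (derE a s)) •
        ∑ j, c j • ρ.g ⟨r + p, xorE q (derE a s), .di j⟩ v := by
  have h : ∀ j, ρ.g ⟨r, s, .di j⟩ (ρ.g ⟨p, q, .pa a⟩ v)
      = ((-1 : ℂ) ^ (gdeg s % 2 * ((gdeg q + 1) % 2))) •
          ρ.g ⟨p, q, .pa a⟩ (ρ.g ⟨r, s, .di j⟩ v)
        + ((p j * mulSgn s q) • ρ.g ⟨r + p, xorE s q, .pa a⟩ v
          - ((-1 : ℂ) ^ (gdeg s * (gdeg q + 1)) * derC a s * mulSgn q (derE a s)) •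
            ρ.g ⟨r + p, xorE q (derE a s), .di j⟩ v) := fun j => by
    have := ρ.comm ⟨r, s, .di j⟩ ⟨p, q, .pa a⟩ v
    simp only [brB, map_sub, map_smul, LinearMap.sub_apply, LinearMap.smul_apply, ρ.act_sng,
      par] at this
    rw [this]; abel
  rw [sub_eq_iff_eq_add]
  simp only [map_sum, map_smul, Finset.smul_sum, h, smul_add, smul_sub, Finset.sum_add_distrib,
    Finset.sum_sub_distrib, smul_smul, Finset.sum_mul, Finset.sum_smul]
  rw [add_comm]
  simp only [mul_comm, mul_assoc]

lemma WRep.comm_sum_pa (r p : LExp m) (s q : GExp n) (d : Fin m → ℂ) (a : Fin n) (v : ρ.M) :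
    ρ.g ⟨r, s, .pa a⟩ (∑ l, d l • ρ.g ⟨p, q, .di l⟩ v)
      - ((-1 : ℂ) ^ ((gdeg s + 1) % 2 * (gdeg q % 2))) •
        ∑ l, d l • ρ.g ⟨p, q, .di l⟩ (ρ.g ⟨r, s, .pa a⟩ v)
    = (derC a q * mulSgn s (derE a q)) • ∑ l, d l • ρ.g ⟨r + p, xorE s (derE a q), .di l⟩ v
      - ((-1 : ℂ) ^ ((gdeg s + 1) * gdeg q) * (∑ l, d l * r l) * mulSgn q s) •
        ρ.g ⟨r + p, xorE q s, .pa a⟩ v := by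
  have h : ∀ l, ρ.g ⟨r, s, .pa a⟩ (ρ.g ⟨p, q, .di l⟩ v)
      = ((-1 : ℂ) ^ ((gdeg s + 1) % 2 * (gdeg q % 2))) •
          ρ.g ⟨p, q, .di l⟩ (ρ.g ⟨r, s, .pa a⟩ v)
        + ((derC a q * mulSgn s (derE a q)) • ρ.g ⟨r + p, xorE s (derE a q), .di l⟩ v
          - ((-1 : ℂ) ^ ((gdeg s + 1) * gdeg q) * r l * mulSgn q s) •
            ρ.g ⟨r + p, xorE q s, .pa a⟩ v) := fun l => by
    have := ρ.comm ⟨r, s, .pa a⟩ ⟨p, q, .di l⟩ v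
    simp only [brB, map_sub, map_smul, LinearMap.sub_apply, LinearMap.smul_apply, ρ.act_sng,
      par] at this
    rw [this]; abel
  rw [sub_eq_iff_eq_add]
  simp only [map_sum, map_smul, Finset.smul_sum, h, smul_add, smul_sub, Finset.sum_add_distrib,
    Finset.sum_sub_distrib, smul_smul, Finset.sum_mul, Finset.mul_sum, Finset.sum_smul]
  rw [add_comm]
  simp only [mul_comm, mul_assoc]

lemma WRep.act_twLin_brB (x y : WBasis m n false) (v : ρ.M) :
    ρ.act (twLin θ (brB x y)) v = ρ.act (twB θ x) (ρ.act (twB θ y) v)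
      - ((-1 : ℂ) ^ (par x * par y)) • ρ.act (twB θ y) (ρ.act (twB θ x) v) := by
  obtain ⟨r, s, D⟩ := x
  obtain ⟨p, q, E⟩ := y
  cases D <;> cases E <;>
    simp only [brB, map_sub, map_smul, LinearMap.sub_apply, LinearMap.smul_apply, twLin_sng,
      ρ.act_twB_di, ρ.act_twB_pa, Matrix.mulVec_add, par]
  · rw [ρ.comm_sum_di_di, sum_inv_mul_mulVec, sum_inv_mul_mulVec]
  · rw [ρ.comm_sum_di, sum_inv_mul_mulVec]
  · rw [ρ.comm_sum_pa, sum_inv_mul_mulVec]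
  · rename_i a a'
    have := ρ.comm ⟨(glm θ).mulVec r, s, .pa a⟩ ⟨(glm θ).mulVec p, q, .pa a'⟩ v
    simpa only [brB, map_sub, map_smul, LinearMap.sub_apply, LinearMap.smul_apply, ρ.act_sng,
      par] using this

/-- The twisted module `M^θ`. -/
def WRep.tw : WRep m n false where
  M := ρ.M
  act := ρ.act ∘ₗ twLin θ
  super := fun x y => LinearMap.ext fun v => by
    simp only [LinearMap.comp_apply, LinearMap.sub_apply, LinearMap.smul_apply, twLin_sng]
    exact ρ.act_twLin_brB θ x y v

lemma WRep.tw_g (x : WBasis m n false) : (ρ.tw θ).g x = ρ.act (twB θ x) := by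
  change ρ.act (twLin θ (sng x)) = _
  rw [twLin_sng]

lemma WRep.tw_g_pa (r : LExp m) (s : GExp n) (a : Fin n) (v : ρ.M) :
    (ρ.tw θ).g ⟨r, s, .pa a⟩ v = ρ.g ⟨(glm θ).mulVec r, s, .pa a⟩ v := by
  rw [ρ.tw_g]; rfl

lemma WRep.tw_g_di (r : LExp m) (s : GExp n) (i : Fin m) (v : ρ.M) :
    (ρ.tw θ).g ⟨r, s, .di i⟩ v
      = ∑ j, (glm θ⁻¹ i j : ℂ) • ρ.g ⟨(glm θ).mulVec r, s, .di j⟩ v := by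
  rw [ρ.tw_g]; exact ρ.act_twB_di θ r s i v

lemma sum_smul_inv {M : Type*} [AddCommGroup M] [Module ℂ M] (f : Fin m → M) (i : Fin m) :
    ∑ k, (glm θ i k : ℂ) • ∑ j, (glm θ⁻¹ k j : ℂ) • f j = f i := by
  simp only [Finset.smul_sum, smul_smul]
  rw [Finset.sum_comm]
  simp only [← Finset.sum_smul, sum_mul_inv]
  simp

lemma WRep.g_pa_eq_tw (r : LExp m) (s : GExp n) (a : Fin n) (v : ρ.M) :
    ρ.g ⟨r, s, .pa a⟩ v = (ρ.tw θ).g ⟨(glm θ⁻¹).mulVec r, s, .pa a⟩ v := by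
  rw [ρ.tw_g_pa, glm_mulVec_inv]

lemma WRep.g_di_eq_tw (r : LExp m) (s : GExp n) (i : Fin m) (v : ρ.M) :
    ρ.g ⟨r, s, .di i⟩ v
      = ∑ k, (glm θ i k : ℂ) • ((ρ.tw θ).g ⟨(glm θ⁻¹).mulVec r, s, .di k⟩ v : ρ.M) := by
  simp only [ρ.tw_g_di, glm_mulVec_inv]
  exact (sum_smul_inv θ (fun j => ρ.g ⟨r, s, .di j⟩ v) i).symm

lemma WRep.tw_isSimple {ρ : WRep m n false} (hs : IsSimpleG ρ.g) : IsSimpleG (ρ.tw θ).g := by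
  refine ⟨hs.1, fun N hN => hs.2 N ?_⟩
  rintro ⟨r, s, D⟩ v hv
  cases D with
  | di i =>
    rw [ρ.g_di_eq_tw θ]
    exact Submodule.sum_mem _ fun k _ => Submodule.smul_mem _ _ (hN _ v hv)
  | pa a =>
    rw [ρ.g_pa_eq_tw θ]
    exact hN _ v hv

/-- The linear action of an integral matrix on weights. -/
def mulW (A : Matrix (Fin m) (Fin m) ℤ) (lam : HIdx m false → ℂ) : HIdx m false → ℂ :=
  Sum.elim (fun i => ∑ j, (A i j : ℂ) * lam (.inl j)) fun k => k.elim0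

lemma WRep.mem_tw_wtG {lam : HIdx m false → ℂ} {v : ρ.M} (hv : v ∈ wtG ρ.g lam) :
    v ∈ wtG (M := ρ.M) (ρ.tw θ).g (mulW (glm θ⁻¹) lam) := by
  rw [mem_wtG] at hv
  refine mem_wtG.2 ?_
  rintro (i | i)
  · change (ρ.tw θ).g ⟨0, _, .di i⟩ v = _
    rw [ρ.tw_g_di, Matrix.mulVec_zero, mulW, Sum.elim_inl, Finset.sum_smul]
    refine Finset.sum_congr rfl fun j _ => ?_
    rw [mul_smul, ← hv (.inl j)]
    rfl
  · exact i.elim0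

lemma WRep.mem_wtG_of_tw {lam : HIdx m false → ℂ} {v : ρ.M}
    (hv : v ∈ wtG (M := ρ.M) (ρ.tw θ).g lam) : v ∈ wtG ρ.g (mulW (glm θ) lam) := by
  replace hv := mem_wtG.1 hv
  refine mem_wtG.2 ?_
  rintro (i | i)
  · change ρ.g ⟨0, _, .di i⟩ v = _
    rw [ρ.g_di_eq_tw θ, Matrix.mulVec_zero, mulW, Sum.elim_inl, Finset.sum_smul]
    refine Finset.sum_congr rfl fun j _ => ?_
    rw [mul_smul, ← hv (.inl j)]
    rfl
  · exact i.elim0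

lemma WRep.tw_isStrongHC {ρ : WRep m n false} (hw : IsStrongHCG ρ.g) :
    IsStrongHCG (ρ.tw θ).g := by
  refine ⟨top_unique (hw.1.ge.trans ?_), fun lam => ?_⟩
  · exact iSup_le fun lam v hv =>
      le_iSup (fun lam => wtG (M := ρ.M) (ρ.tw θ).g lam) _ (ρ.mem_tw_wtG θ hv)
  · exact @Submodule.finiteDimensional_of_le ℂ ρ.M _ _ _ _ _ (hw.2 (mulW (glm θ) lam))
      fun v hv => ρ.mem_wtG_of_tw θ hv

end Twist
end

noncomputable section

variable {m n : ℕ} {b : Bool}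

section HighestWeight

/-- The eigenspaces of `d_0`. -/
def WRep.Ez (ρ : WRep (m + 1) n false) (c : ℂ) : Submodule ℂ ρ.M :=
  Module.End.eigenspace (ρ.g ⟨0, gz n, .di 0⟩) c

variable {ρ : WRep (m + 1) n false}

lemma WRep.mem_Ez {c : ℂ} {v : ρ.M} : v ∈ ρ.Ez c ↔ ρ.g ⟨0, gz n, .di 0⟩ v = c • v :=
  Module.End.mem_eigenspace_iff

lemma WRep.Ez_maps {c : ℂ} {v : ρ.M} (hv : v ∈ ρ.Ez c) (x : WBasis (m + 1) n false) :
    ρ.g x v ∈ ρ.Ez (c + x.1 0) := by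
  rw [WRep.mem_Ez] at hv ⊢
  have := ρ.comm ⟨0, gz n, .di 0⟩ x v
  rw [brB_zero_di, map_smul, LinearMap.smul_apply, ρ.act_sng, par_di_gz, hv, map_smul] at this
  rw [zero_mul, pow_zero, one_smul, eq_sub_iff_add_eq] at this
  rw [← this, add_smul, add_comm (c • _)]

lemma WRep.Ez_disjoint {c : ℂ} {P : ℂ → Prop} (hP : ¬ P c) :
    Disjoint (ρ.Ez c) (⨆ c', ⨆ _ : P c', ρ.Ez c') :=
  (Module.End.eigenspaces_iSupIndep (ρ.g ⟨0, gz n, .di 0⟩) c).mono_right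
    (iSup_le fun c' => iSup_le fun hc' =>
      le_iSup₂_of_le c' (show c' ≠ c by rintro rfl; exact hP hc') le_rfl)

/-- A subspace is annihilated by the elements of positive degree. -/
def WRep.PosKill (N : Submodule ℂ ρ.M) : Prop :=
  ∀ v ∈ N, ∀ x : WBasis (m + 1) n false, 0 < x.1 0 → ρ.g x v = 0

/-- A subspace is stable under the elements of degree zero. -/
def WRep.ZeroInv (N : Submodule ℂ ρ.M) : Prop :=
  ∀ v ∈ N, ∀ x : WBasis (m + 1) n false, x.1 0 = 0 → ρ.g x v ∈ N

lemma WRep.act_mem {N : Submodule ℂ ρ.M} {w : W (m + 1) n false} {v : ρ.M}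
    (h : ∀ x ∈ w.support, ρ.g x v ∈ N) : ρ.act w v ∈ N := by
  rw [← Finsupp.sum_single w, Finsupp.sum, map_sum, LinearMap.sum_apply]
  refine Submodule.sum_mem _ fun x hx => ?_
  have : (Finsupp.single x (w x) : W (m + 1) n false) = w x • sng x := by simp [sng]
  rw [this, map_smul, LinearMap.smul_apply, ρ.act_sng]
  exact N.smul_mem _ (h x hx)

/-- The subspace generated from `N` by the elements of negative degree. -/
def WRep.lower (N : Submodule ℂ ρ.M) : Submodule ℂ ρ.M :=
  sInf {S | N ≤ S ∧ ∀ v ∈ S, ∀ x : WBasis (m + 1) n false, x.1 0 < 0 → ρ.g x v ∈ S}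

lemma WRep.le_lower (N : Submodule ℂ ρ.M) : N ≤ WRep.lower N :=
  le_sInf fun _ hS => hS.1

lemma WRep.lower_le {N S : Submodule ℂ ρ.M} (h : N ≤ S)
    (h' : ∀ v ∈ S, ∀ x : WBasis (m + 1) n false, x.1 0 < 0 → ρ.g x v ∈ S) :
    WRep.lower N ≤ S :=
  sInf_le ⟨h, h'⟩

lemma WRep.lower_neg {N : Submodule ℂ ρ.M} {v : ρ.M} (hv : v ∈ WRep.lower N)
    (x : WBasis (m + 1) n false) (hx : x.1 0 < 0) : ρ.g x v ∈ WRep.lower N := by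
  rw [WRep.lower, Submodule.mem_sInf] at hv ⊢
  exact fun S hS => hS.2 v (hv S hS) x hx

lemma WRep.lower_invariant {N : Submodule ℂ ρ.M} (hp : WRep.PosKill N) (hz : WRep.ZeroInv N) :
    InvariantG ρ.g (WRep.lower N) := by
  let Q : Submodule ℂ ρ.M := WRep.lower N ⊓
    ⨅ y : WBasis (m + 1) n false, ⨅ _ : 0 ≤ y.1 0, (WRep.lower N).comap (ρ.g y)
  have hQ : ∀ v, v ∈ Q ↔ v ∈ WRep.lower N ∧ ∀ y : WBasis (m + 1) n false, 0 ≤ y.1 0 →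
      ρ.g y v ∈ WRep.lower N := fun v => by
    simp [Q, Submodule.mem_iInf]
  have hle : WRep.lower N ≤ Q := by
    refine WRep.lower_le (fun v hv => (hQ v).2 ⟨WRep.le_lower N hv, fun y hy => ?_⟩)
      fun v hv x hx => ?_
    · rcases hy.eq_or_lt with hy | hy
      · exact WRep.le_lower N (hz v hv y hy.symm)
      · rw [hp v hv y hy]; exact zero_mem _
    · rw [hQ] at hv ⊢
      refine ⟨WRep.lower_neg hv.1 x hx, fun y hy => ?_⟩
      have := ρ.comm y x v
      rw [eq_sub_iff_add_eq] at this
      rw [← this]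
      refine add_mem (WRep.act_mem fun z _ => ?_)
        (Submodule.smul_mem _ _ (WRep.lower_neg (hv.2 y hy) x hx))
      rcases lt_or_ge (z.1 0) 0 with h | h
      · exact WRep.lower_neg hv.1 z h
      · exact hv.2 z h
  intro x v hv
  rcases lt_or_ge (x.1 0) 0 with h | h
  · exact WRep.lower_neg hv x h
  · exact ((hQ v).1 (hle hv)).2 x h

lemma WRep.sup_eq_top (hs : IsSimpleG ρ.g) {N : Submodule ℂ ρ.M} {c : ℂ}
    (hp : WRep.PosKill N) (hz : WRep.ZeroInv N) (hc : N ≤ ρ.Ez c) (h0 : N ≠ ⊥) :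
    N ⊔ ⨆ c', ⨆ _ : (∃ k : ℕ, c' = c - (k + 1 : ℕ)), ρ.Ez c' = ⊤ := by
  obtain ⟨u, hu, hu0⟩ := Submodule.exists_mem_ne_zero_of_ne_bot h0
  rw [← top_le_iff, ← hs.eq_top (WRep.lower_invariant hp hz) (WRep.le_lower N hu) hu0]
  refine WRep.lower_le le_sup_left fun v hv x hx => ?_
  obtain ⟨l, hl⟩ : ∃ l : ℕ, x.1 0 = -((l + 1 : ℕ) : ℤ) := ⟨(-x.1 0 - 1).toNat, by omega⟩
  have key : ∀ c', (∃ k : ℕ, c' = c - (k : ℕ)) → ρ.Ez c' ≤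
      (N ⊔ ⨆ c', ⨆ _ : (∃ k : ℕ, c' = c - (k + 1 : ℕ)), ρ.Ez c').comap (ρ.g x) := by
    rintro c' ⟨k, rfl⟩ w hw
    refine Submodule.mem_sup_right (Submodule.mem_iSup_of_mem _
      (Submodule.mem_iSup_of_mem ⟨k + l, ?_⟩ (WRep.Ez_maps hw x)))
    rw [hl]; push_cast; ring
  exact sup_le (hc.trans (key c ⟨0, by simp⟩))
    (iSup_le fun c' => iSup_le fun ⟨k, hk⟩ => key c' ⟨k + 1, hk⟩) hv

lemma WRep.Ez_eq (hs : IsSimpleG ρ.g) {N : Submodule ℂ ρ.M} {c : ℂ}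
    (hp : WRep.PosKill N) (hz : WRep.ZeroInv N) (hc : N ≤ ρ.Ez c) (h0 : N ≠ ⊥) :
    ρ.Ez c = N := by
  refine le_antisymm (fun v hv => ?_) hc
  have hv' : v ∈ N ⊔ ⨆ c', ⨆ _ : (∃ k : ℕ, c' = c - (k + 1 : ℕ)), ρ.Ez c' :=
    WRep.sup_eq_top hs hp hz hc h0 ▸ Submodule.mem_top
  obtain ⟨a, ha, w, hw, rfl⟩ := Submodule.mem_sup.1 hv'
  have hw' : w ∈ ρ.Ez c := by simpa using sub_mem hv (hc ha)
  have hd := WRep.Ez_disjoint (ρ := ρ) (c := c) (P := fun c' => ∃ k : ℕ, c' = c - (k + 1 : ℕ)) (by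
    rintro ⟨k, hk⟩
    rw [eq_comm, sub_eq_self] at hk
    exact Nat.cast_add_one_ne_zero (R := ℂ) k (by exact_mod_cast hk))
  rw [Submodule.disjoint_def.1 hd w hw' hw, add_zero]
  exact ha

lemma WRep.eq_sub_of_Ez_ne_bot (hs : IsSimpleG ρ.g) {N : Submodule ℂ ρ.M} {c c' : ℂ}
    (hp : WRep.PosKill N) (hz : WRep.ZeroInv N) (hc : N ≤ ρ.Ez c) (h0 : N ≠ ⊥)
    (h : ρ.Ez c' ≠ ⊥) : ∃ k : ℕ, c' = c - k := by
  by_contra hk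
  refine h ?_
  have hd := WRep.Ez_disjoint (ρ := ρ) (c := c') (P := fun c' => ∃ k : ℕ, c' = c - k) hk
  have htop : ⨆ c', ⨆ _ : (∃ k : ℕ, c' = c - k), ρ.Ez c' = ⊤ := by
    rw [← top_le_iff, ← WRep.sup_eq_top hs hp hz hc h0]
    exact sup_le (hc.trans (le_iSup₂_of_le c ⟨0, by simp⟩ le_rfl))
      (iSup_le fun d => iSup_le fun ⟨k, hd⟩ => le_iSup₂_of_le d ⟨k + 1, hd⟩ le_rfl)
  rwa [htop, disjoint_top] at hd

end HighestWeight
end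

noncomputable section

variable {m n : ℕ} {b : Bool}

section Singular

variable {ρ : WRep (m + 1) n false}

/-- `T` is the space of all vectors annihilated by the elements of positive degree. -/
def WRep.IsSing (T : Submodule ℂ ρ.M) : Prop :=
  ∀ v, v ∈ T ↔ ∀ x : WBasis (m + 1) n false, 0 < x.1 0 → ρ.g x v = 0

lemma WRep.IsSing.posKill {T : Submodule ℂ ρ.M} (hT : WRep.IsSing T) : WRep.PosKill T :=
  fun v hv => (hT v).1 hv

lemma WRep.IsSing.zeroInv {T : Submodule ℂ ρ.M} (hT : WRep.IsSing T) : WRep.ZeroInv T := by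
  intro v hv x hx
  rw [hT] at hv ⊢
  intro y hy
  have := ρ.comm y x v
  rwa [hv y hy, map_zero, smul_zero, sub_zero, WRep.act_eq_zero, eq_comm] at this
  intro z hz
  refine hv z ?_
  rw [brB_support hz, Pi.add_apply, hx, add_zero]
  exact hy

lemma WRep.ZeroInv.hB_mem {N : Submodule ℂ ρ.M} (h : WRep.ZeroInv N) (i : HIdx (m + 1) false)
    (v : ρ.M) (hv : v ∈ N) : ρ.g (hB (m + 1) n false i) v ∈ N := by
  rcases i with i | i
  · exact h v hv _ rfl
  · exact i.elim0

lemma WRep.wtG_le_Ez (mu : HIdx (m + 1) false → ℂ) : wtG ρ.g mu ≤ ρ.Ez (mu (.inl 0)) :=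
  fun _ hv => WRep.mem_Ez.2 (mem_wtG.1 hv (.inl 0))

lemma WRep.ZeroInv.inf_Ez {N : Submodule ℂ ρ.M} (h : WRep.ZeroInv N) (c : ℂ) :
    WRep.ZeroInv (N ⊓ ρ.Ez c) := fun v hv x hx => by
  refine ⟨h v hv.1 x hx, ?_⟩
  simpa [hx] using WRep.Ez_maps hv.2 x

lemma WRep.PosKill.mono {N N' : Submodule ℂ ρ.M} (h : WRep.PosKill N) (hN : N' ≤ N) :
    WRep.PosKill N' := fun v hv => h v (hN hv)

lemma WRep.IsSing.exists_Ez_eq (hs : IsSimpleG ρ.g) (hw : IsStrongHCG ρ.g)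
    {T : Submodule ℂ ρ.M} (hT : WRep.IsSing T) (h0 : T ≠ ⊥) : ∃ c, ρ.Ez c = T := by
  have hle : T ≤ ⨆ mu, T ⊓ wtG ρ.g mu :=
    fun v hv => mem_iSup_inf_wt hw.1 hT.zeroInv.hB_mem hv
  obtain ⟨mu, hmu⟩ : ∃ mu, T ⊓ wtG ρ.g mu ≠ ⊥ := by
    by_contra! h
    simp only [h, iSup_bot, le_bot_iff] at hle
    exact h0 hle
  have hne : ∀ {mu}, T ⊓ wtG ρ.g mu ≠ ⊥ → T ⊓ ρ.Ez (mu (.inl 0)) ≠ ⊥ := fun {mu} h h' =>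
    h (le_bot_iff.1 ((inf_le_inf_left T (WRep.wtG_le_Ez mu)).trans h'.le))
  have hEz : ∀ c, T ⊓ ρ.Ez c ≠ ⊥ → ρ.Ez c ≠ ⊥ := fun c h h' => h (by rw [h', inf_bot_eq])
  have hP : ∀ c, WRep.PosKill (T ⊓ ρ.Ez c) := fun c => hT.posKill.mono inf_le_left
  set c := mu (.inl 0)
  refine ⟨c, le_antisymm ?_ ?_⟩
  · rw [WRep.Ez_eq hs (hP c) (hT.zeroInv.inf_Ez c) inf_le_right (hne hmu)]
    exact inf_le_left
  · refine hle.trans (iSup_le fun nu => ?_)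
    by_cases hnu : T ⊓ wtG ρ.g nu = ⊥
    · rw [hnu]; exact bot_le
    · have h1 := hne hmu
      have h2 := hne hnu
      obtain ⟨k, hk⟩ := WRep.eq_sub_of_Ez_ne_bot hs (hP _) (hT.zeroInv.inf_Ez _) inf_le_right h1
        (hEz _ h2)
      obtain ⟨l, hl⟩ := WRep.eq_sub_of_Ez_ne_bot hs (hP _) (hT.zeroInv.inf_Ez _) inf_le_right h2
        (hEz _ h1)
      have hkl : ((k + l : ℕ) : ℂ) = 0 := by
        push_cast
        linear_combination hk + hl
      have hk0 : k = 0 := by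
        have := Nat.cast_eq_zero.1 hkl
        omega
      rw [hk0, Nat.cast_zero, sub_zero] at hk
      rw [← show nu (.inl 0) = c from hk]
      exact inf_le_right.trans (WRep.wtG_le_Ez nu)

/-- The linear extension of `embB`. -/
def embL : W m n true →ₗ[ℂ] W (m + 1) n false := Finsupp.linearCombination ℂ fun x => sng (embB x)

lemma embL_sng (x : WBasis m n true) : embL (sng x) = sng (embB x) := by
  simp [embL, sng]

lemma cons_zero_add (r p : LExp m) :
    (Fin.cons 0 r + Fin.cons 0 p : LExp (m + 1)) = Fin.cons 0 (r + p) := by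
  funext i
  refine Fin.cases ?_ (fun j => ?_) i <;> simp

lemma embB_zero (x : WBasis m n true) : (embB x).1 0 = 0 := by
  obtain ⟨r, s, D⟩ := x
  cases D <;> rfl

lemma par_embB (x : WBasis m n true) : par (embB x) = par x := by
  obtain ⟨r, s, D⟩ := x
  cases D <;> rfl

lemma embL_brB (x y : WBasis m n true) : embL (brB x y) = brB (embB x) (embB y) := by
  obtain ⟨r, s, D⟩ := x
  obtain ⟨p, q, E⟩ := y
  cases D <;> cases E <;>
    simp [brB, embB, embL_sng, cons_zero_add]

lemma exists_embB (x : WBasis (m + 1) n false) (hx : x.1 0 = 0) : ∃ y, embB y = x := by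
  obtain ⟨r, s, D⟩ := x
  have hr : Fin.cons 0 (fun i => r i.succ) = r := by
    funext i
    refine Fin.cases hx.symm (fun j => rfl) i
  cases D with
  | di i =>
    refine Fin.cases ?_ (fun j => ?_) i
    · exact ⟨⟨_, s, .d0⟩, by rw [embB, hr]⟩
    · exact ⟨⟨_, s, .di j⟩, by rw [embB, hr]⟩
  | pa a => exact ⟨⟨_, s, .pa a⟩, by rw [embB, hr]⟩

lemma linearCombination_sng {M : Type*} [AddCommGroup M] [Module ℂ M] (f : WBasis m n b → M)
    (x : WBasis m n b) : Finsupp.linearCombination ℂ f (sng x) = f x := by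
  simp [sng]

/-- The action of `V_0 = W(m,n) ⋉ A d_0` on a stable subspace. -/
def WRep.subAct (ρ : WRep (m + 1) n false) (T : Submodule ℂ ρ.M)
    (hI : ∀ x : WBasis m n true, ∀ v ∈ T, ρ.g (embB x) v ∈ T) : GAct m n true T :=
  fun x => (ρ.g (embB x)).restrict (hI x)

/-- The restriction of a module to `V_0 = W(m,n) ⋉ A d_0` and a stable subspace. -/
def WRep.sub (ρ : WRep (m + 1) n false) (T : Submodule ℂ ρ.M)
    (hI : ∀ x : WBasis m n true, ∀ v ∈ T, ρ.g (embB x) v ∈ T) : WRep m n true where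
  M := T
  act := Finsupp.linearCombination ℂ (ρ.subAct T hI)
  super := fun x y => by
    have hcoe : ∀ (w : W m n true) (v : T), ((Finsupp.linearCombination ℂ
        (ρ.subAct T hI) w v : T) : ρ.M) = ρ.act (embL w) v := by
      intro w v
      simp [Finsupp.linearCombination_apply, Finsupp.sum, embL, LinearMap.sum_apply, WRep.g,
        WRep.subAct]
    refine LinearMap.ext fun v => Subtype.ext ?_
    rw [hcoe, embL_brB, ρ.comm, par_embB, par_embB]
    simp only [LinearMap.sub_apply, LinearMap.smul_apply, LinearMap.comp_apply,
      Submodule.coe_sub, Submodule.coe_smul, hcoe, embL_sng]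
    rfl

lemma WRep.sub_g (ρ : WRep (m + 1) n false) (T : Submodule ℂ ρ.M)
    (hI : ∀ x : WBasis m n true, ∀ v ∈ T, ρ.g (embB x) v ∈ T) :
    (ρ.sub T hI).g = ρ.subAct T hI :=
  funext fun x => linearCombination_sng (ρ.subAct T hI) x

end Singular
end

noncomputable section

variable {m n : ℕ} {b : Bool}

section DegreeZero

variable {ρ : WRep (m + 1) n false} {T : Submodule ℂ ρ.M}

lemma WRep.IsSing.embB_mem (hT : WRep.IsSing T) (x : WBasis m n true) (v : ρ.M) (hv : v ∈ T) :
    ρ.g (embB x) v ∈ T := hT.zeroInv v hv _ (embB_zero x)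

lemma WRep.sub_isSimple (hs : IsSimpleG ρ.g) (hw : IsStrongHCG ρ.g) (hT : WRep.IsSing T)
    (h0 : T ≠ ⊥) : IsSimpleG (ρ.subAct T hT.embB_mem) := by
  obtain ⟨c, hc⟩ := hT.exists_Ez_eq hs hw h0
  obtain ⟨u, hu, hu0⟩ := Submodule.exists_mem_ne_zero_of_ne_bot h0
  refine ⟨⟨⟨u, hu⟩, fun h => hu0 (congrArg Subtype.val h)⟩, fun N hN => ?_⟩
  by_cases hbot : N = ⊥
  · exact Or.inl hbot
  right
  let N' : Submodule ℂ ρ.M := N.map T.subtype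
  have hle : N' ≤ T := by
    rintro _ ⟨v, _, rfl⟩
    exact v.2
  have hz : WRep.ZeroInv N' := by
    rintro _ ⟨v, hv, rfl⟩ x hx
    obtain ⟨y, rfl⟩ := exists_embB x hx
    exact ⟨_, hN y v hv, rfl⟩
  have hne : N' ≠ ⊥ := by
    intro h
    exact hbot (Submodule.map_injective_of_injective T.injective_subtype
      (h.trans (Submodule.map_bot _).symm))
  have := WRep.Ez_eq hs (hT.posKill.mono hle) hz (hle.trans hc.ge) hne
  rw [hc] at this
  refine eq_top_iff.2 fun v _ => ?_
  have hv : v.1 ∈ N' := this ▸ v.2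
  obtain ⟨w, hw, hwv⟩ := hv
  rwa [← Subtype.ext (a1 := w) (a2 := v) hwv]

/-- The weight of `W(m+1,n)` associated with a weight of `W(m,n) ⋉ A d_0`. -/
def upW (mu : HIdx m true → ℂ) : HIdx (m + 1) false → ℂ :=
  Sum.elim (Fin.cons (mu (.inr (0 : Fin 1))) fun i => mu (.inl i)) fun k => k.elim0

/-- The weight of `W(m,n) ⋉ A d_0` associated with a weight of `W(m+1,n)`. -/
def downW (nu : HIdx (m + 1) false → ℂ) : HIdx m true → ℂ :=
  Sum.elim (fun i => nu (.inl i.succ)) fun _ => nu (.inl 0)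

lemma cons_zero_zero : (Fin.cons 0 (0 : LExp m) : LExp (m + 1)) = 0 := by
  funext i
  refine Fin.cases rfl (fun j => rfl) i

lemma WRep.mem_upW (hI : ∀ x : WBasis m n true, ∀ v ∈ T, ρ.g (embB x) v ∈ T)
    {mu : HIdx m true → ℂ} {v : T} (hv : v ∈ wtG (ρ.subAct T hI) mu) :
    v.1 ∈ wtG ρ.g (upW mu) := by
  refine mem_wtG.2 ?_
  replace hv := mem_wtG.1 hv
  rintro (i | i)
  · refine Fin.cases ?_ (fun j => ?_) i
    · have := congrArg (Subtype.val (p := (· ∈ T))) (hv (.inr (0 : Fin 1)))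
      change ρ.g ⟨Fin.cons 0 0, _, _⟩ _ = _ at this
      rw [cons_zero_zero] at this
      exact this
    · have := congrArg (Subtype.val (p := (· ∈ T))) (hv (.inl j))
      change ρ.g ⟨Fin.cons 0 0, _, _⟩ _ = _ at this
      rw [cons_zero_zero] at this
      exact this
  · exact i.elim0

lemma WRep.mem_downW (hI : ∀ x : WBasis m n true, ∀ v ∈ T, ρ.g (embB x) v ∈ T)
    {nu : HIdx (m + 1) false → ℂ} {v : T} (hv : v.1 ∈ wtG ρ.g nu) :
    v ∈ wtG (ρ.subAct T hI) (downW nu) := by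
  refine mem_wtG.2 ?_
  rw [mem_wtG] at hv
  rintro (i | i)
  · refine Subtype.ext ?_
    change ρ.g ⟨Fin.cons 0 0, _, _⟩ _ = _
    rw [cons_zero_zero]
    exact hv (.inl i.succ)
  · refine Subtype.ext ?_
    change ρ.g ⟨Fin.cons 0 0, _, _⟩ _ = _
    rw [cons_zero_zero]
    exact hv (.inl 0)

lemma WRep.sub_wtG_map_le (hI : ∀ x : WBasis m n true, ∀ v ∈ T, ρ.g (embB x) v ∈ T)
    (mu : HIdx m true → ℂ) :
    (wtG (ρ.subAct T hI) mu).map T.subtype ≤ T ⊓ wtG ρ.g (upW mu) := by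
  rintro _ ⟨v, hv, rfl⟩
  exact ⟨v.2, WRep.mem_upW hI hv⟩

lemma WRep.sub_finiteDimensional (hI : ∀ x : WBasis m n true, ∀ v ∈ T, ρ.g (embB x) v ∈ T)
    (mu : HIdx m true → ℂ) (h : FiniteDimensional ℂ (wtG ρ.g (upW mu))) :
    FiniteDimensional ℂ (wtG (ρ.subAct T hI) mu) := by
  let f : wtG (ρ.subAct T hI) mu →ₗ[ℂ] wtG ρ.g (upW mu) :=
    (T.subtype ∘ₗ (wtG (ρ.subAct T hI) mu).subtype).codRestrict _
      fun v => WRep.mem_upW hI v.2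
  refine Module.Finite.of_injective f fun v w h => Subtype.ext (Subtype.ext ?_)
  exact (congrArg Subtype.val h : (f v).1 = (f w).1)

lemma WRep.sub_finrank_le (hI : ∀ x : WBasis m n true, ∀ v ∈ T, ρ.g (embB x) v ∈ T)
    (mu : HIdx m true → ℂ) (h : FiniteDimensional ℂ (wtG ρ.g (upW mu))) :
    Module.finrank ℂ (wtG (ρ.subAct T hI) mu) ≤
      Module.finrank ℂ (wtG ρ.g (upW mu)) := by
  let f : wtG (ρ.subAct T hI) mu →ₗ[ℂ] wtG ρ.g (upW mu) :=
    (T.subtype ∘ₗ (wtG (ρ.subAct T hI) mu).subtype).codRestrict _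
      fun v => WRep.mem_upW hI v.2
  refine LinearMap.finrank_le_finrank_of_injective (f := f)
    fun v w h => Subtype.ext (Subtype.ext ?_)
  exact (congrArg Subtype.val h : (f v).1 = (f w).1)

lemma WRep.sub_isStrongHC (hw : IsStrongHCG ρ.g) (hT : WRep.IsSing T) :
    IsStrongHCG (ρ.subAct T hT.embB_mem) := by
  refine ⟨top_unique fun v _ => ?_, fun mu => WRep.sub_finiteDimensional _ mu (hw.2 _)⟩
  have h1 : v.1 ∈ ⨆ nu, T ⊓ wtG ρ.g nu :=
    mem_iSup_inf_wt hw.1 hT.zeroInv.hB_mem v.2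
  have h2 : ⨆ nu, T ⊓ wtG ρ.g nu ≤
      (⨆ mu, wtG (ρ.subAct T hT.embB_mem) mu).map T.subtype :=
    iSup_le fun nu w hw => ⟨⟨w, hw.1⟩, Submodule.mem_iSup_of_mem (downW nu)
      (WRep.mem_downW hT.embB_mem hw.2), rfl⟩
  obtain ⟨w, hw, hwv⟩ := h2 h1
  rwa [← Subtype.ext (a1 := w) (a2 := v) hwv]

lemma WRep.finrank_Gr_le (hs : IsSimpleG ρ.g) (hw : IsStrongHCG ρ.g) (hT : WRep.IsSing T)
    {lam : HIdx (m + 1) false → ℂ} (hc : ρ.Ez (lam (.inl 0)) = T)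
    (r : LExp (m + 1)) (hr : r 0 = 0) :
    Module.finrank ℂ (ρ.Gr lam r) ≤ max 1 (Fintype.card (GExp n × Dir (m + 1) n false) *
      Module.finrank ℂ (ρ.Gr lam (-Pi.single 0 1))) := by
  by_contra! hlt
  obtain ⟨h1, h2⟩ := max_lt_iff.1 hlt
  obtain ⟨v, hv, hv0, hk⟩ := ρ.exists_killed (fun r => hw.2 _)
    (fun a : GExp n × Dir (m + 1) n false => (⟨-Pi.single 0 1 - r, a⟩ : WBasis (m + 1) n false))
    (lam := lam) (r := r) (by
      change ∑ _ : GExp n × Dir (m + 1) n false,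
        Module.finrank ℂ (ρ.Gr lam (r + (-Pi.single 0 1 - r))) < _
      rwa [Finset.sum_const, Finset.card_univ, smul_eq_mul, add_sub_cancel])
  have hGr : ρ.Gr lam r ≤ ρ.Ez (lam (.inl 0)) := fun w hw => WRep.mem_Ez.2 (by
    simpa [hr] using ρ.Gr_di hw 0)
  have hpos : ∀ s : LExp (m + 1), 0 < s 0 → ρ.Kil v s :=
    fun s hs a => hT.posKill v (hc ▸ hGr hv) ⟨s, a⟩ hs
  have hzero : ∀ s : LExp (m + 1), s 0 = 0 → ρ.Kil v s := fun s hs => by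
    have := WRep.Kil.add (r := -Pi.single 0 1 - r) (s := s + Pi.single 0 1 + r) hk
      (hpos _ (by simp [hs, hr])) (fun h => by
        have := congrFun h 0
        simp [hs, hr] at this)
    convert this using 1
    abel
  let N : Submodule ℂ ρ.M := Submodule.span ℂ {v}
  have hN : ∀ s : LExp (m + 1), 0 ≤ s 0 → ∀ a, ∀ w ∈ N, ρ.g ⟨s, a⟩ w = 0 := by
    intro s hs a w hw
    obtain ⟨c, rfl⟩ := Submodule.mem_span_singleton.1 hw
    rw [map_smul]
    rcases hs.eq_or_lt with h | h
    · rw [hzero s h.symm a, smul_zero]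
    · rw [hpos s h a, smul_zero]
  have hNle : N ≤ ρ.Gr lam r := (Submodule.span_singleton_le_iff_mem _ _).2 hv
  have hE := WRep.Ez_eq hs (N := N) (fun w hw x hx => hN x.1 hx.le x.2 w hw)
    (fun w hw x hx => by
      have := hN x.1 hx.ge x.2 w hw
      change ρ.g x w = 0 at this
      rw [this]; exact zero_mem _) (hNle.trans hGr)
    (fun h => hv0 (by simpa [N] using h))
  have h3 : ρ.Gr lam r = N := le_antisymm (hE ▸ hGr) hNle
  rw [h3, finrank_span_singleton hv0] at h1
  exact lt_irrefl _ h1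

lemma WRep.sub_bounded (hs : IsSimpleG ρ.g) (hw : IsStrongHCG ρ.g) (hT : WRep.IsSing T)
    (h0 : T ≠ ⊥) : ∃ C, ∀ mu, Module.finrank ℂ (wtG (ρ.subAct T hT.embB_mem) mu) ≤ C := by
  obtain ⟨c, hc⟩ := hT.exists_Ez_eq hs hw h0
  obtain ⟨lam, hlam⟩ : ∃ lam, T ⊓ wtG ρ.g lam ≠ ⊥ := by
    by_contra! h
    refine h0 (le_bot_iff.1 fun v hv => ?_)
    simpa [h] using mem_iSup_inf_wt hw.1 hT.zeroInv.hB_mem hv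
  have hval : ∀ mu, T ⊓ wtG ρ.g mu ≠ ⊥ → mu (.inl 0) = c := fun mu h => by
    obtain ⟨u, hu, hu0⟩ := Submodule.exists_mem_ne_zero_of_ne_bot h
    have h1 := WRep.mem_Ez.1 (WRep.wtG_le_Ez mu hu.2)
    have h2 := WRep.mem_Ez.1 (hc.ge hu.1)
    exact smul_left_injective ℂ hu0 (h1.symm.trans h2)
  have hl : ρ.Gr lam 0 ≠ ⊥ := by
    rw [WRep.Gr, wsh_zero]
    exact fun h => hlam (by rw [h, inf_bot_eq])
  have htop := iSup_Gr_eq_top hs hl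
  refine ⟨max 1 (Fintype.card (GExp n × Dir (m + 1) n false) *
    Module.finrank ℂ (ρ.Gr lam (-Pi.single 0 1))), fun mu => ?_⟩
  by_cases hmu : T ⊓ wtG ρ.g (upW mu) = ⊥
  · have : wtG (ρ.subAct T hT.embB_mem) mu = ⊥ := by
      have := (WRep.sub_wtG_map_le hT.embB_mem mu).trans hmu.le
      exact Submodule.map_injective_of_injective T.injective_subtype
        ((le_bot_iff.1 this).trans (Submodule.map_bot _).symm)
    rw [this, finrank_bot]
    exact Nat.zero_le _
  · refine (WRep.sub_finrank_le hT.embB_mem mu (hw.2 _)).trans ?_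
    obtain ⟨r, hr⟩ : ∃ r, wsh lam r = upW mu := by
      by_contra hr
      have := wtG_eq_bot_of_iSup (F := ρ.g) (P := fun mu => ∃ r, wsh lam r = mu)
        (top_unique (htop.ge.trans (iSup_le fun r => le_iSup₂_of_le (wsh lam r) ⟨r, rfl⟩ le_rfl)))
        hr
      rw [this, inf_bot_eq] at hmu
      exact hmu rfl
    have hr0 : r 0 = 0 := by
      have h1 := hval _ hlam
      have h2 := hval _ hmu
      rw [← hr] at h2
      change lam (.inl 0) + (r 0 : ℂ) = c at h2
      rw [h1, add_eq_left] at h2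
      exact_mod_cast h2
    rw [← hr]
    exact WRep.finrank_Gr_le hs hw hT (by rw [hval _ hlam, hc]) r hr0

end DegreeZero
end

noncomputable section

variable {m n : ℕ} {b : Bool}

section HighestWeightQuotient

lemma restrict_congr {M : Type*} [AddCommGroup M] [Module ℂ M] {T : Submodule ℂ M}
    {f g : M →ₗ[ℂ] M} (h : f = g) (hf : ∀ v ∈ T, f v ∈ T) (hg : ∀ v ∈ T, g v ∈ T) :
    f.restrict hf = g.restrict hg := by
  subst h
  rfl

lemma mem_singularSp {ρ : WRep (m + 1) n false}
    {θ : Matrix.GeneralLinearGroup (Fin (m + 1)) ℤ} {v : ρ.M} :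
    v ∈ singularSp ρ θ ↔
      ∀ x : WBasis (m + 1) n false, 0 < x.1 0 → ρ.act (twB θ x) v = 0 := by
  simp [singularSp, Submodule.mem_iInf]

lemma isSing_singularSp (ρ : WRep (m + 1) n false)
    (θ : Matrix.GeneralLinearGroup (Fin (m + 1)) ℤ) :
    WRep.IsSing (ρ := ρ.tw θ) (singularSp ρ θ) := fun v =>
  ⟨fun h x hx => (LinearMap.congr_fun (ρ.tw_g θ x) v).trans (mem_singularSp.1 h x hx),
    fun h => mem_singularSp.2 fun x hx =>
      (LinearMap.congr_fun (ρ.tw_g θ x) v).symm.trans (h x hx)⟩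

lemma WRep.IsSing.exists_quotient {ρ : WRep (m + 1) n false} (hs : IsSimpleG ρ.g)
    (hw : IsStrongHCG ρ.g) {T : Submodule ℂ ρ.M} (hT : WRep.IsSing T) (h0 : T ≠ ⊥) :
    ∃ σ : GlRep m n, FiniteDimensional ℂ σ.V ∧ σ.IsSimple ∧
      ∃ (lam : Fin m → ℂ) (lam0 : ℂ) (φ : TModule σ →ₗ[ℂ] T), Function.Surjective φ ∧
        ∀ x u, φ (tmAct σ lam lam0 x u) = ρ.subAct T hT.embB_mem x (φ u) := by
  have hg := ρ.sub_g T hT.embB_mem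
  obtain ⟨C, hC⟩ := WRep.sub_bounded hs hw hT h0
  obtain ⟨σ, h1, h2, lam, lam0, φ, _, h4, h5⟩ := bounded_case (ρ.sub T hT.embB_mem)
    (hg ▸ WRep.sub_isSimple hs hw hT h0) (hg ▸ WRep.sub_isStrongHC hw hT)
    (C := C) (hg ▸ hC)
  rw [hg] at h5
  exact ⟨σ, h1, h2, lam, lam0, φ, h4, h5⟩

lemma exists_quotient_of_singularSp_ne_bot {ρ : WRep (m + 1) n false} (hs : IsSimpleG ρ.g)
    (hw : IsStrongHCG ρ.g) {θ : Matrix.GeneralLinearGroup (Fin (m + 1)) ℤ}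
    (h0 : singularSp ρ θ ≠ ⊥) :
    ∃ hInv : ∀ x : WBasis m n true,
        ∀ v ∈ singularSp ρ θ, ρ.act (twB θ (embB x)) v ∈ singularSp ρ θ,
      IsSimpleG (fun x => (ρ.act (twB θ (embB x))).restrict (hInv x)) ∧
      (∃ σ : GlRep m n, FiniteDimensional ℂ σ.V ∧ σ.IsSimple ∧
        ∃ (lam : Fin m → ℂ) (lam0 : ℂ) (φ : TModule σ →ₗ[ℂ] ↥(singularSp ρ θ)),
          Function.Surjective φ ∧
          ∀ (x : WBasis m n true) (u : TModule σ),
            φ (tmAct σ lam lam0 x u)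
              = (ρ.act (twB θ (embB x))).restrict (hInv x) (φ u)) := by
  have hT := isSing_singularSp ρ θ
  have hs' := WRep.tw_isSimple θ hs
  have hw' := WRep.tw_isStrongHC θ hw
  have hInv : ∀ x : WBasis m n true,
      ∀ v ∈ singularSp ρ θ, ρ.act (twB θ (embB x)) v ∈ singularSp ρ θ :=
    fun x v hv => ρ.tw_g θ (embB x) ▸ hT.embB_mem x v hv
  have hF : (ρ.tw θ).subAct (singularSp ρ θ) hT.embB_mem
      = fun x => (ρ.act (twB θ (embB x))).restrict (hInv x) := by
    funext x
    exact restrict_congr (ρ.tw_g θ (embB x)) _ _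
  obtain ⟨σ, h1, h2, lam, lam0, φ, h3, h4⟩ := hT.exists_quotient hs' hw' h0
  refine ⟨hInv, hF ▸ WRep.sub_isSimple hs' hw' hT h0, σ, h1, h2, lam, lam0, φ, h3, fun x u => ?_⟩
  exact (h4 x u).trans <| congrFun (congrArg DFunLike.coe (congrFun hF x)) (φ u)

end HighestWeightQuotient
end

/-- Main theorem.  Let `m, n` be non-negative integers.  Every
simple strong Harish-Chandra `W(m+1,n)`-module is either
(1) a quotient of a tensor module `T(V, λ)` corresponding to a simple
finite-dimensional `gl(m+1,n)`-module `V` and `λ ∈ ℂ^{m+1}`, or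
(2) a module of highest weight type `L(T)^θ`, twisted by an automorphism
`θ ∈ GL_{m+1}(ℤ)`, where `T` is a simple quotient of a tensor module for
`W(m,n) ⋉ A d_0`.  In case (2): since `M` is simple, `M ≅ L(T)^θ` holds exactly
when the subspace `T` of singular vectors of `M^θ` (the vectors annihilated by
the positive part `V_+`) is nonzero and, as a module over the zero component
`V_0 = W(m,n) ⋉ A d_0`, is simple and a quotient of a tensor module for
`W(m,n) ⋉ A d_0` (on whose tensor modules `f d_0` acts as multiplication by a
scalar `λ_0`). -/
theorem main_classification (m n : ℕ) (ρ : WRep (m + 1) n false)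
    (hsimple : IsSimpleG ρ.g) (hstrong : IsStrongHCG ρ.g) :
    -- (1) `M` is a quotient of a tensor module `T(V, λ)` for `W(m+1,n)`
    (∃ σ : GlRep (m + 1) n, FiniteDimensional ℂ σ.V ∧ σ.IsSimple ∧
      ∃ (lam : Fin (m + 1) → ℂ) (φ : TModule σ →ₗ[ℂ] ρ.M),
        Function.Surjective φ ∧
        ∀ (x : WBasis (m + 1) n false) (u : TModule σ),
          φ (tmAct σ lam 0 x u) = ρ.act (sng x) (φ u)) ∨
    -- (2) `M` is a module of highest weight type `L(T)^θ`
    (∃ θ : Matrix.GeneralLinearGroup (Fin (m + 1)) ℤ,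
      singularSp ρ θ ≠ ⊥ ∧
      ∃ hInv : ∀ x : WBasis m n true,
          ∀ v ∈ singularSp ρ θ, ρ.act (twB θ (embB x)) v ∈ singularSp ρ θ,
        -- `T = singularSp ρ θ` is a simple `V_0`-module …
        IsSimpleG (fun x => (ρ.act (twB θ (embB x))).restrict (hInv x)) ∧
        -- … which is a quotient of a tensor module for `W(m,n) ⋉ A d_0`.
        (∃ σ : GlRep m n, FiniteDimensional ℂ σ.V ∧ σ.IsSimple ∧
          ∃ (lam : Fin m → ℂ) (lam0 : ℂ)
            (φ : TModule σ →ₗ[ℂ] ↥(singularSp ρ θ)),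
            Function.Surjective φ ∧
            ∀ (x : WBasis m n true) (u : TModule σ),
              φ (tmAct σ lam lam0 x u)
                = (ρ.act (twB θ (embB x))).restrict (hInv x) (φ u))) := by
  by_cases hC : ∃ C : ℕ, ∀ lam, Module.finrank ℂ (wtG ρ.g lam) ≤ C
  · obtain ⟨C, hC⟩ := hC
    obtain ⟨σ, h1, h2, lam, lam0, φ, h3, h4, h5⟩ := bounded_case ρ hsimple hstrong hC
    rw [h3 rfl] at h5
    exact Or.inl ⟨σ, h1, h2, lam, φ, h4, h5⟩
  · obtain ⟨lam, hlam⟩ := exists_unb hsimple hstrong hC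
    obtain ⟨θ, hθ⟩ := hlam.exists_singularSp_ne_bot
    exact Or.inr ⟨θ, hθ, exists_quotient_of_singularSp_ne_bot hsimple hstrong hθ⟩

end WSuper
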